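/- For every 0<p<1, the vector-valued Hardy space H_p(𝔻,ℓ₂) has a unique unconditional basis: it admits a normalized unconditional basis, and any two normalized unconditional bases of H_p(𝔻,ℓ₂) are permutatively equivalent. -/

import Mathlib

/-!
Statement 0: For every `0 < p < 1`, the vector-valued Hardy space `H_p(𝔻, ℓ₂)` has a unique
unconditional basis: it admits a normalized unconditional basis, and any two normalized
unconditional bases of `H_p(𝔻, ℓ₂)` are permutatively equivalent.

`H_p(𝔻, ℓ₂)` is realized as the pair `(memHpD p, qHpD p)` carving out of the ambient complex
vector space of functions `ℂ → ℓ₂` the analytic functions on the open unit disc with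
`sup_{0≤r<1} (∫_{-1/2}^{1/2} ‖F(r e^{2πit})‖^p dt)^{1/p} < ∞`.
-/

noncomputable section
open Filter Topology MeasureTheory ENNReal

/-- The complex Hilbert sequence space `ℓ₂`. -/
abbrev ELL2 : Type := lp (fun _ : ℕ => ℂ) 2

/-- The unit-length interval `[-1/2, 1/2)` representing the circle. -/
def I₀ : Set ℝ := Set.Ico (-(1 : ℝ)/2) (1/2)

/-- The point `r e^{2πit}` of the disc. -/
def circlePt (r t : ℝ) : ℂ := (r : ℂ) * Complex.exp (2 * Real.pi * t * Complex.I)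

/-- `∫_{-1/2}^{1/2} ‖F(r e^{2πit})‖^p dt`. -/
def hpIntegral (p : ℝ) (F : ℂ → ELL2) (r : ℝ) : ℝ≥0∞ :=
  ∫⁻ t in I₀, (‖F (circlePt r t)‖₊ : ℝ≥0∞) ^ p

/-- Membership in the Hardy space `H_p(𝔻, ℓ₂)`: `F` is analytic on the open unit disc and its
`p`-means over circles are uniformly bounded. -/
def memHpD (p : ℝ) (F : ℂ → ELL2) : Prop :=
  DifferentiableOn ℂ F (Metric.ball 0 1) ∧
  ∃ B : ℝ≥0∞, B < ⊤ ∧ ∀ r : ℝ, 0 ≤ r → r < 1 → hpIntegral p F r ≤ B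

/-- The quasi-norm of `H_p(𝔻, ℓ₂)`:
`‖F‖ = sup_{0 ≤ r < 1} (∫_{-1/2}^{1/2} ‖F(r e^{2πit})‖^p dt)^{1/p}`. -/
def qHpD (p : ℝ) (F : ℂ → ELL2) : ℝ :=
  ⨆ r : Set.Ico (0 : ℝ) 1, ((hpIntegral p F r.1) ^ (1/p)).toReal

/-- Unconditional convergence of `∑ n, v n` to `f` with respect to the quasi-norm `q`. -/
def UncondSum {M ι : Type*} [AddCommGroup M] (q : M → ℝ) (v : ι → M) (f : M) : Prop :=
  ∀ ε : ℝ, 0 < ε → ∃ F : Finset ι, ∀ G : Finset ι, F ⊆ G → q ((∑ n ∈ G, v n) - f) < ε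

/-- `x` is an unconditional basis of the (complex) space `(mem, q)`: every member has a
unique unconditionally convergent expansion `∑_n a_n x_n`. -/
def IsUncondBasis {M ι : Type*} [AddCommGroup M] [Module ℂ M] (mem : M → Prop) (q : M → ℝ)
    (x : ι → M) : Prop :=
  (∀ n, mem (x n)) ∧
  ∀ f, mem f → ∃! a : ι → ℂ, UncondSum q (fun n => a n • x n) f

/-- `x` is normalized. -/
def Normalized {M ι : Type*} (q : M → ℝ) (x : ι → M) : Prop := ∀ n, q (x n) = 1

/-- Permutative equivalence of two families: there is a bijection of the index sets such that
corresponding finitely supported linear combinations have uniformly comparable quasi-norms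
(i.e. the correspondence extends to an isomorphism between closed linear spans). -/
def PermutativelyEquivalent {M M' : Type*} {ι κ : Type*} [AddCommGroup M] [Module ℂ M]
    [AddCommGroup M'] [Module ℂ M'] (q : M → ℝ) (q' : M' → ℝ)
    (x : ι → M) (y : κ → M') : Prop :=
  ∃ (π : ι ≃ κ) (C : ℝ), 0 < C ∧ ∀ a : ι →₀ ℂ,
    C⁻¹ * q (∑ n ∈ a.support, a n • x n) ≤ q' (∑ n ∈ a.support, a n • y (π n)) ∧
    q' (∑ n ∈ a.support, a n • y (π n)) ≤ C * q (∑ n ∈ a.support, a n • x n)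

set_option linter.unusedSectionVars false
open ENNReal (ofReal)
open Finset (sum_congr range mul_sum sum_le_sum mem_filter sum_add_distrib sum_mul sum_singleton sum_image sum_insert card_powerset mem_image_of_mem filter_subset sum_const sum_filter mem_range sum_fiberwise_of_maps_to)
open Set (Ico Icc indicator_of_mem indicator_of_notMem mem_iUnion InjOn Ico_subset_Icc_self)
open Metric (ball isOpen_ball ball_subset_ball)
open Complex (norm_real exp I re_ofReal_mul norm_exp)
open Real (norm_eq_abs sin pi_pos)
local notation "𝕀" => Set.Ico (0 : ℝ) 1
local notation "cp(" x ")" => circlePt (Prod.fst x) (Prod.snd x)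

/-- `p`-normed spaces: the norm is subadditive and `p`-homogeneous. -/
class PNormed (p : outParam ℝ) (V : Type*) [NormedAddCommGroup V] [Module ℂ V] : Prop where
  hp : 0 < p
  norm_smul' : ∀ (c : ℂ) (x : V), ‖c • x‖ = ‖c‖ ^ p * ‖x‖

/-- a `p`-norm with values in `[0,∞]` -/
structure PN (M : Type*) [AddCommGroup M] [Module ℂ M] where
  p : ℝ
  hp : 0 < p
  N : M → ℝ≥0∞
  zero : N 0 = 0
  add : ∀ x y, N (x + y) ≤ N x + N y
  smul : ∀ (c : ℂ) x, N (c • x) = ‖c‖ₑ ^ p * N x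
  eq_zero : ∀ x, N x = 0 → x = 0

namespace PN
variable {M : Type*} [AddCommGroup M] [Module ℂ M] (n : PN M)

lemma neg (x : M) : n.N (-x) = n.N x := by
  have := n.smul (-1) x
  simpa using this

/-- the subspace of finite elements -/
def sub : Submodule ℂ M where
  carrier := {x | n.N x < ∞}
  zero_mem' := by simp [n.zero]
  add_mem' := fun {x y} hx hy => lt_of_le_of_lt (n.add x y) (add_lt_top.2 ⟨hx, hy⟩)
  smul_mem' := fun c x hx => by
    show n.N _ < ∞
    rw [n.smul]
    exact mul_lt_top (rpow_lt_top_of_nonneg n.hp.le (by simp)) hx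

/-- the associated `p`-normed space -/
def Sp : Type _ := ↥n.sub

instance : AddCommGroup n.Sp := inferInstanceAs (AddCommGroup n.sub)

instance : NormedAddCommGroup n.Sp :=
  AddGroupNorm.toNormedAddCommGroup
    { toFun := fun x => (n.N (x : n.sub).1).toReal
      map_zero' := by
        show (n.N 0).toReal = 0
        simp [n.zero]
      add_le' := fun x y => by
        have hx : n.N (x : n.sub).1 < ∞ := (x : n.sub).2
        have hy : n.N (y : n.sub).1 < ∞ := (y : n.sub).2
        show (n.N ((x : n.sub).1 + (y : n.sub).1)).toReal ≤ _
        rw [← toReal_add hx.ne hy.ne]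
        exact toReal_mono (add_lt_top.2 ⟨hx, hy⟩).ne (n.add _ _)
      neg' := fun x => by
        show (n.N (-(x : n.sub).1)).toReal = _
        rw [n.neg]
      eq_zero_of_map_eq_zero' := fun x hx => by
        have hx' : n.N (x : n.sub).1 < ∞ := (x : n.sub).2
        have : n.N (x : n.sub).1 = 0 := by
          rcases (toReal_eq_zero_iff _).1 hx with h | h
          · exact h
          · exact absurd h hx'.ne
        exact Subtype.ext (n.eq_zero _ this) }

instance : Module ℂ n.Sp := inferInstanceAs (Module ℂ n.sub)

/-- underlying element -/
def val (x : n.Sp) : M := (x : n.sub).1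

/-- constructor -/
def mk' (x : M) (h : n.N x < ∞) : n.Sp := (⟨x, h⟩ : n.sub)

/-- underlying element as a linear map -/
def valL : n.Sp →ₗ[ℂ] M := n.sub.subtype

variable {n}
@[simp] lemma val_mk (x : M) (h : n.N x < ∞) : n.val (n.mk' x h) = x := rfl
@[simp] lemma val_sub (x y : n.Sp) : n.val (x - y) = n.val x - n.val y := rfl
@[simp] lemma val_smul (c : ℂ) (x : n.Sp) : n.val (c • x) = c • n.val x := rfl
lemma val_sum {ι : Type*} (s : Finset ι) (f : ι → n.Sp) :
    n.val (∑ i ∈ s, f i) = ∑ i ∈ s, n.val (f i) := map_sum n.valL f s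
lemma val_lt (x : n.Sp) : n.N (n.val x) < ∞ := (x : n.sub).2
lemma norm_def (x : n.Sp) : ‖x‖ = (n.N (n.val x)).toReal := rfl
lemma enorm_def (x : n.Sp) : ‖x‖ₑ = n.N (n.val x) := by rw [← ofReal_norm, norm_def, ofReal_toReal (val_lt x).ne]
lemma val_inj {x y : n.Sp} (h : n.val x = n.val y) : x = y := Subtype.ext h

instance : PNormed n.p n.Sp where
  hp := n.hp
  norm_smul' := fun c x => by
    rw [norm_def, norm_def, val_smul, n.smul, toReal_mul, ← toReal_rpow]
    simp

end PN

section pnormed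
variable {p : ℝ} {V : Type*} [NormedAddCommGroup V] [Module ℂ V] [PNormed p V]

lemma pn_smul (c : ℂ) (x : V) : ‖c • x‖ = ‖c‖ ^ p * ‖x‖ := PNormed.norm_smul' c x

lemma pn_pos (V : Type*) [NormedAddCommGroup V] [Module ℂ V] [PNormed p V] : 0 < p := PNormed.hp V

instance (priority := 50) pnormed_ccs : ContinuousConstSMul ℂ V where
  continuous_const_smul := fun c => by
    refine AddMonoidHomClass.continuous_of_bound (DistribSMul.toAddMonoidHom V c) (‖c‖ ^ p) ?_
    intro x
    exact (pn_smul c x).le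

/-- unconditional bases -/
def UBasis {ι : Type*} (x : ι → V) : Prop :=
  ∀ f : V, ∃! a : ι → ℂ, HasSum (fun n => a n • x n) f

namespace UBasis

/-- coefficients -/
def co {V : Type*} [NormedAddCommGroup V] [Module ℂ V]
    {ι : Type*} {x : ι → V} (hx : UBasis x) (f : V) : ι → ℂ := (hx f).choose
variable {V : Type*} [NormedAddCommGroup V] [Module ℂ V] {ι : Type*} {x : ι → V}
lemma hasSum {p : ℝ} [PNormed p V] (hx : UBasis x) (f : V) : HasSum (fun n => hx.co f n • x n) f := (hx f).choose_spec.1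
lemma co_eq {p : ℝ} [PNormed p V] (hx : UBasis x) {f : V} {a : ι → ℂ} (h : HasSum (fun n => a n • x n) f) : hx.co f = a :=
  ((hx f).choose_spec.2 a h).symm
lemma co_add {p : ℝ} [PNormed p V] (hx : UBasis x) (f g : V) : hx.co (f + g) = hx.co f + hx.co g := by
  apply hx.co_eq
  have := (hx.hasSum f).add (hx.hasSum g)
  simpa [add_smul] using this
lemma co_smul {p : ℝ} [PNormed p V] (hx : UBasis x) (c : ℂ) (f : V) : hx.co (c • f) = c • hx.co f := by
  apply hx.co_eq
  have := (hx.hasSum f).const_smul c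
  simpa [mul_smul] using this
/-- coefficients as a linear map -/
def coL {p : ℝ} [PNormed p V] (hx : UBasis x) : V →ₗ[ℂ] (ι → ℂ) where
  toFun := hx.co
  map_add' := hx.co_add
  map_smul' := hx.co_smul
lemma co_sub {p : ℝ} [PNormed p V] (hx : UBasis x) (f g : V) : hx.co (f - g) = hx.co f - hx.co g := map_sub hx.coL f g
lemma co_sum {p : ℝ} [PNormed p V] (hx : UBasis x) {κ : Type*} (s : Finset κ) (f : κ → V) :
    hx.co (∑ i ∈ s, f i) = ∑ i ∈ s, hx.co (f i) := map_sum hx.coL f s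
lemma co_fin {p : ℝ} [PNormed p V] (hx : UBasis x) [DecidableEq ι] (G : Finset ι) (a : ι → ℂ) :
    hx.co (∑ i ∈ G, a i • x i) = fun i => if i ∈ G then a i else 0 := by
  apply hx.co_eq
  have : ∑ i ∈ G, a i • x i = ∑ i ∈ G, (if i ∈ G then a i else 0) • x i :=
    sum_congr rfl (fun i hi => by simp [hi])
  rw [this]
  apply hasSum_sum_of_ne_finset_zero
  intro b hb
  simp [hb]
lemma co_self {p : ℝ} [PNormed p V] (hx : UBasis x) [DecidableEq ι] (i : ι) : hx.co (x i) = Pi.single i 1 := by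
  apply hx.co_eq
  have := hasSum_single (f := fun n => (Pi.single i (1:ℂ) : ι → ℂ) n • x n) i (by
    intro b hb; simp [hb])
  simpa using this
lemma ne_zero {p : ℝ} [PNormed p V] (hx : UBasis x) (i : ι) : x i ≠ 0 := by
  classical
  intro h
  have h1 := hx.co_self i
  rw [h] at h1
  have h2 : hx.co 0 = 0 := map_zero hx.coL
  rw [h2] at h1
  simpa using congrFun h1 i

lemma bdd {p : ℝ} [PNormed p V] (hx : UBasis x) (f : V) : ∃ B : ℕ, ∀ G : Finset ι, ‖∑ i ∈ G, hx.co f i • x i‖ ≤ B := by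
  classical
  have h := hx.hasSum f
  have h1 := Metric.tendsto_nhds.1 h 1 one_pos
  rw [SummationFilter.unconditional_filter, Filter.eventually_atTop] at h1
  obtain ⟨s, hs⟩ := h1
  obtain ⟨B, hB⟩ := exists_nat_ge (1 + ‖f‖ + ∑ i ∈ s, ‖hx.co f i • x i‖)
  refine ⟨B, fun G => le_trans ?_ hB⟩
  have h2 := hs (G ∪ s) Finset.subset_union_right
  have h3 : ∑ i ∈ G, hx.co f i • x i
      = ((∑ i ∈ G ∪ s, hx.co f i • x i) - f) + f - ∑ i ∈ s \ G, hx.co f i • x i := by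
    rw [← Finset.union_sdiff_self_eq_union, Finset.sum_union Finset.disjoint_sdiff]
    abel
  rw [h3]
  rw [dist_eq_norm] at h2
  calc _ ≤ ‖((∑ i ∈ G ∪ s, hx.co f i • x i) - f) + f‖ + ‖∑ i ∈ s \ G, hx.co f i • x i‖ :=
        norm_sub_le _ _
    _ ≤ (1 + ‖f‖) + ∑ i ∈ s, ‖hx.co f i • x i‖ := by
        gcongr
        · exact (norm_add_le _ _).trans (by gcongr)
        · refine (norm_sum_le _ _).trans ?_
          exact Finset.sum_le_sum_of_subset_of_nonneg Finset.sdiff_subset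
            (fun _ _ _ => norm_nonneg _)

/-- elements with suppression bound `m` -/
def A {V : Type*} [NormedAddCommGroup V] [Module ℂ V]
    {ι : Type*} {x : ι → V} (hx : UBasis x) (m : ℝ) : Set V := {f | ∀ G : Finset ι, ‖∑ i ∈ G, hx.co f i • x i‖ ≤ m}

lemma A_sub {p : ℝ} [PNormed p V] (hx : UBasis x) {f g : V} {m m' : ℝ} (hf : f ∈ hx.A m) (hg : g ∈ hx.A m') :
    f - g ∈ hx.A (m + m') := fun G => by
  rw [hx.co_sub]
  simp only [Pi.sub_apply, sub_smul, Finset.sum_sub_distrib]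
  exact (norm_sub_le _ _).trans (add_le_add (hf G) (hg G))

lemma A_smul {p : ℝ} [PNormed p V] (hx : UBasis x) {f : V} {m : ℝ} (c : ℂ) (hf : f ∈ hx.A m) : c • f ∈ hx.A (‖c‖ ^ p * m) := by
  intro G
  rw [hx.co_smul]
  simp only [Pi.smul_apply, smul_assoc, ← Finset.smul_sum]
  rw [pn_smul]
  gcongr
  exact hf G

lemma exists_scal {p : ℝ} (hp : 0 < p) {s : ℝ} (hs : 0 < s) : ∃ c : ℂ, c ≠ 0 ∧ ‖c‖ ^ p = s := by
  refine ⟨((s ^ (1 / p) : ℝ) : ℂ), ?_, ?_⟩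
  · have : 0 < s ^ (1 / p) := Real.rpow_pos_of_pos hs _
    exact_mod_cast this.ne'
  · rw [norm_real, Real.norm_of_nonneg (by positivity), ← Real.rpow_mul hs.le]
    field_simp
    simp

lemma step {p : ℝ} [PNormed p V] (hx : UBasis x) [CompleteSpace V] : ∃ r > 0, ∃ m ≥ 0, ∀ s > 0, ∀ f : V, ‖f‖ < s * r →
    ∀ ε > 0, ∃ g ∈ hx.A (s * m), ‖f - g‖ < ε := by
  have hU : (⋃ m : ℕ, closure (hx.A m)) = Set.univ := by
    rw [Set.eq_univ_iff_forall]
    intro f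
    obtain ⟨B, hB⟩ := hx.bdd f
    exact mem_iUnion.2 ⟨B, subset_closure hB⟩
  obtain ⟨m, f0, hf0⟩ := nonempty_interior_of_iUnion_of_closed (fun m => isClosed_closure) hU
  obtain ⟨r, hr, hball⟩ := Metric.isOpen_iff.1 isOpen_interior f0 hf0
  refine ⟨r, hr, (m : ℝ) + m, by positivity, ?_⟩
  intro s hs f hf ε hε
  have hp : 0 < p := pn_pos V
  obtain ⟨c, hc0, hc⟩ := exists_scal hp hs
  have hcf : ‖c⁻¹ • f‖ < r := by
    rw [pn_smul, norm_inv, Real.inv_rpow (norm_nonneg _), hc, inv_mul_lt_iff₀ hs]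
    exact hf
  have h1 : f0 + c⁻¹ • f ∈ closure (hx.A m) :=
    interior_subset (hball (by simpa [Metric.mem_ball, dist_eq_norm] using hcf))
  have h2 : f0 ∈ closure (hx.A m) := interior_subset hf0
  obtain ⟨g1, hg1, hd1⟩ := Metric.mem_closure_iff.1 h1 (ε / s / 2) (by positivity)
  obtain ⟨g2, hg2, hd2⟩ := Metric.mem_closure_iff.1 h2 (ε / s / 2) (by positivity)
  refine ⟨c • (g1 - g2), ?_, ?_⟩
  · have := hx.A_smul c (hx.A_sub hg1 hg2)
    rwa [hc] at this
  · have e : f - c • (g1 - g2) = c • ((f0 + c⁻¹ • f - g1) - (f0 - g2)) := by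
      simp only [smul_sub, smul_add, smul_smul, mul_inv_cancel₀ hc0, one_smul]
      abel
    rw [e, pn_smul, hc]
    rw [dist_eq_norm] at hd1 hd2
    have := norm_sub_le (f0 + c⁻¹ • f - g1) (f0 - g2)
    calc s * ‖(f0 + c⁻¹ • f - g1) - (f0 - g2)‖ < s * (ε / s) := by gcongr; linarith
      _ = ε := by field_simp

theorem const {p : ℝ} [PNormed p V] (hx : UBasis x) [CompleteSpace V] : ∃ C : ℝ, 0 < C ∧
    ∀ f (G : Finset ι), ‖∑ i ∈ G, hx.co f i • x i‖ ≤ C * ‖f‖ := by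
  classical
  obtain ⟨r, hr, m, hm, hstep⟩ := hx.step
  have hp : 0 < p := pn_pos V
  have key : ∀ f : V, ‖f‖ < r → f ∈ hx.A (2 * m) := fun f hf => by
    have hst : ∀ (k : ℕ) (f : V), ∃ g : V, ‖f‖ < (1/2)^k * r →
        g ∈ hx.A ((1/2)^k * m) ∧ ‖f - g‖ < (1/2)^(k+1) * r := fun k f => by
      by_cases h : ‖f‖ < (1/2)^k * r
      · obtain ⟨g, hg, hg'⟩ := hstep ((1/2)^k) (by positivity) f h ((1/2)^(k+1) * r) (by positivity)
        exact ⟨g, fun _ => ⟨hg, hg'⟩⟩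
      · exact ⟨0, fun h' => absurd h' h⟩
    choose T hT using hst
    let R : ℕ → V := fun k => Nat.rec f (fun k y => y - T k y) k
    have hR : ∀ k, ‖R k‖ < (1/2)^k * r := fun k => by
      induction k with
      | zero => simpa [R] using hf
      | succ k ih => exact (hT k _ ih).2
    let g : ℕ → V := fun k => T k (R k)
    have hgA : ∀ k, g k ∈ hx.A ((1/2)^k * m) := fun k => (hT k _ (hR k)).1
    have hgsum : ∀ n, ∑ k ∈ range n, g k = f - R n := fun n => by
      induction n with
      | zero => simp [R]
      | succ n ih =>
        rw [Finset.sum_range_succ, ih]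
        show f - R n + T n (R n) = f - (R n - T n (R n))
        abel
    have hgn : ∀ k, ‖g k‖ ≤ (1/2)^k * m := fun k => by
      exact le_of_tendsto' (Filter.Tendsto.norm (hx.hasSum (g k))) (fun G => hgA k G)
    have hgeo : Summable (fun k : ℕ => ((1:ℝ)/2)^k * m) :=
      (summable_geometric_of_lt_one (by norm_num) (by norm_num)).mul_right m
    have hgS : HasSum g f := by
      have hs : Summable g := Summable.of_norm_bounded hgeo hgn
      have h1 := hs.hasSum.tendsto_sum_nat
      have hR0 : Tendsto R atTop (𝓝 0) := by
        refine squeeze_zero_norm (fun k => (hR k).le) ?_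
        have := (tendsto_pow_atTop_nhds_zero_of_lt_one (r := (1/2:ℝ)) (by norm_num)
          (by norm_num)).mul_const r
        simpa using this
      have h2 : Tendsto (fun n => ∑ k ∈ range n, g k) atTop (𝓝 f) := by
        simp_rw [hgsum]
        simpa using tendsto_const_nhds.sub hR0
      have := tendsto_nhds_unique h1 h2
      rw [← this]
      exact hs.hasSum
    -- coefficient convergence
    have hco : ∀ i, Summable (fun k => hx.co (g k) i) := fun i => by
      have hxi : 0 < ‖x i‖ := norm_pos_iff.2 (hx.ne_zero i)
      have hb : ∀ k, ‖hx.co (g k) i‖ ≤ (((1:ℝ)/2)^(1/p))^k * (m / ‖x i‖)^(1/p) := fun k => by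
        have h := hgA k {i}
        simp only [sum_singleton] at h
        rw [pn_smul, ← le_div_iff₀ hxi] at h
        have h2 := Real.rpow_le_rpow (by positivity) h (by positivity : 0 ≤ 1/p)
        rw [← Real.rpow_mul (norm_nonneg _), mul_one_div_cancel hp.ne', Real.rpow_one] at h2
        refine h2.trans_eq ?_
        rw [mul_div_assoc, Real.mul_rpow (by positivity) (by positivity),
          ← Real.rpow_natCast, ← Real.rpow_natCast, ← Real.rpow_mul (by norm_num),
          ← Real.rpow_mul (by norm_num), mul_comm (k:ℝ)]
      refine Summable.of_norm_bounded ?_ hb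
      refine Summable.mul_right _ (summable_geometric_of_lt_one (by positivity) ?_)
      exact Real.rpow_lt_one (by norm_num) (by norm_num) (by positivity)
    let a : ι → ℂ := fun i => ∑' k, hx.co (g k) i
    have hsmul : ∀ i, HasSum (fun k => hx.co (g k) i • x i) (a i • x i) := fun i => by
      have h1 : Summable (fun k => hx.co (g k) i • x i) := by
        refine Summable.of_norm_bounded hgeo (fun k => ?_)
        simpa using hgA k {i}
      have h2 := h1.hasSum
      have h3 : Continuous (fun c : ℂ => c • x i) := by
        let φ : ℂ →+ V := AddMonoidHom.mk' (fun c : ℂ => c • x i) (fun a b => add_smul a b (x i))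
        have : Continuous φ := by
          apply continuous_of_continuousAt_zero φ
          show Tendsto _ _ _
          rw [map_zero, tendsto_zero_iff_norm_tendsto_zero]
          have h4 : ∀ c : ℂ, ‖φ c‖ = ‖c‖ ^ p * ‖x i‖ := fun c => pn_smul c (x i)
          simp_rw [h4]
          have h5 : Tendsto (fun c : ℂ => ‖c‖) (𝓝 0) (𝓝 0) := by simpa using (tendsto_norm (E := ℂ) (x := 0))
          have h6 := (h5.rpow_const (p := p) (Or.inr hp.le)).mul_const ‖x i‖
          simpa [Real.zero_rpow hp.ne'] using h6
        exact this
      exact (hco i).hasSum.map (AddMonoidHom.mk' (fun c : ℂ => c • x i)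
        (fun a b => add_smul a b (x i))) h3
    have hG : ∀ G : Finset ι, HasSum (fun k => ∑ i ∈ G, hx.co (g k) i • x i)
        (∑ i ∈ G, a i • x i) := fun G => hasSum_sum (fun i _ => hsmul i)
    have hfin : HasSum (fun i => a i • x i) f := by
      show Tendsto _ _ _
      have h1 : Tendsto (fun G : Finset ι => ∑' k, ((∑ i ∈ G, hx.co (g k) i • x i))) atTop
          (𝓝 (∑' k, g k)) := by
        refine tendsto_tsum_of_dominated_convergence hgeo ?_ ?_
        · intro k
          exact (hx.hasSum (g k))
        · exact Filter.Eventually.of_forall (fun G k => hgA k G)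
      rw [hgS.tsum_eq] at h1
      simp_rw [(hG _).tsum_eq] at h1
      exact h1
    intro G
    rw [hx.co_eq hfin, ← (hG G).tsum_eq]
    have h7 : Summable (fun k => ‖∑ i ∈ G, hx.co (g k) i • x i‖) :=
      Summable.of_nonneg_of_le (fun _ => norm_nonneg _) (fun k => hgA k G) hgeo
    refine (norm_tsum_le_tsum_norm h7).trans ?_
    refine (h7.tsum_le_tsum (fun k => hgA k G) hgeo).trans_eq ?_
    rw [tsum_mul_right, tsum_geometric_two]
  refine ⟨(2 * m + 1) / (r / 2), by positivity, ?_⟩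
  intro f G
  by_cases hf : f = 0
  · have h2 : hx.co 0 = 0 := map_zero hx.coL
    subst hf
    rw [h2]; simp
  · have hf' : 0 < ‖f‖ := norm_pos_iff.2 hf
    obtain ⟨c, hc0, hc⟩ := exists_scal hp (s := r / 2 / ‖f‖) (by positivity)
    have h1 := key (c • f) (by rw [pn_smul, hc, div_mul_cancel₀ _ hf'.ne']; linarith) G
    rw [hx.co_smul] at h1
    simp only [Pi.smul_apply, smul_assoc, ← Finset.smul_sum] at h1
    rw [pn_smul, hc] at h1
    rw [div_mul_eq_mul_div, div_mul_eq_mul_div, div_le_iff₀ hf'] at h1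
    rw [div_mul_eq_mul_div, le_div_iff₀ (by positivity)]
    nlinarith [norm_nonneg (∑ i ∈ G, hx.co f i • x i)]

end UBasis

/-- transport along isomorphisms -/
lemma UBasis.map {p : ℝ} {V : Type*} [NormedAddCommGroup V] [Module ℂ V] [PNormed p V] {W : Type*} [NormedAddCommGroup W] [Module ℂ W]
    {ι : Type*} {x : ι → V} (hx : UBasis x) (e : V ≃L[ℂ] W) : UBasis (fun i => e (x i)) := fun f => by
  refine ⟨hx.co (e.symm f), ?_, ?_⟩
  · have := (hx.hasSum (e.symm f)).mapL (e : V →L[ℂ] W)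
    simpa using this
  · intro a ha
    have := ha.mapL (e.symm : W →L[ℂ] V)
    simp only [map_smul, ContinuousLinearEquiv.coe_coe, ContinuousLinearEquiv.symm_apply_apply]
      at this
    exact (hx.co_eq this).symm

end pnormed

lemma PN.complete {M : Type*} [AddCommGroup M] [Module ℂ M] (n : PN M)
    (h : ∀ f : ℕ → n.Sp, CauchySeq f → ∃ x : M, ∀ k, ∀ B : ℝ≥0∞,
      (∀ᶠ m in atTop, n.N (n.val (f m) - n.val (f k)) ≤ B) → n.N (x - n.val (f k)) ≤ B) :
    CompleteSpace n.Sp := by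
  refine Metric.complete_of_cauchySeq_tendsto (fun f hf => ?_)
  obtain ⟨x, hx⟩ := h f hf
  have key : ∀ ε : ℝ, 0 < ε → ∃ N, ∀ k ≥ N, n.N (x - n.val (f k)) ≤ ofReal ε := fun ε hε => by
    obtain ⟨N, hN⟩ := Metric.cauchySeq_iff.1 hf ε hε
    refine ⟨N, fun k hk => hx k _ ?_⟩
    filter_upwards [eventually_ge_atTop N] with m hm
    have := hN m hm k hk
    rw [dist_eq_norm, PN.norm_def, PN.val_sub] at this
    rw [← PN.val_sub, ← ofReal_toReal (PN.val_lt (f m - f k)).ne]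
    exact ofReal_le_ofReal this.le
  have hxf : n.N x < ∞ := by
    obtain ⟨N, hN⟩ := key 1 one_pos
    have h1 := hN N le_rfl
    have h2 := n.add (x - n.val (f N)) (n.val (f N))
    rw [sub_add_cancel] at h2
    exact h2.trans_lt (add_lt_top.2 ⟨h1.trans_lt ofReal_lt_top, PN.val_lt _⟩)
  refine ⟨n.mk' x hxf, ?_⟩
  rw [Metric.tendsto_atTop]
  intro ε hε
  obtain ⟨N, hN⟩ := key (ε / 2) (by positivity)
  refine ⟨N, fun k hk => ?_⟩
  rw [dist_comm, dist_eq_norm, PN.norm_def, PN.val_sub, PN.val_mk]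
  have := toReal_mono (by simp) (hN k hk)
  rw [toReal_ofReal (by positivity)] at this
  linarith

/-- weighted square-function data -/
structure WS (Ω K : Type*) [MeasurableSpace Ω] where
  μ : Measure Ω
  p : ℝ
  hp : 0 < p
  hp1 : p ≤ 1
  g : K → Ω → ℝ≥0∞
  gfin : ∀ k θ, g k θ ≠ ∞
  gm : ∀ k, Measurable (g k)
  g1 : ∀ k, ∫⁻ θ, (g k θ) ^ (p / 2) ∂μ = 1

namespace WS
variable {Ω K : Type*} [MeasurableSpace Ω] (W : WS Ω K)

/-- pointwise square sum -/
def sq (u : K → ℝ≥0∞) (θ : Ω) : ℝ≥0∞ := ∑' k, u k ^ 2 * W.g k θ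

/-- the functional -/
def Ph (u : K → ℝ≥0∞) : ℝ≥0∞ := ∫⁻ θ, (W.sq u θ) ^ (W.p / 2) ∂W.μ

lemma hp2 : 0 < W.p / 2 := by have := W.hp; positivity

lemma sq_meas [Countable K] (u : K → ℝ≥0∞) : Measurable (W.sq u) :=
  Measurable.tsum (fun k => (W.gm k).const_mul _)

lemma Ph_mono {u v : K → ℝ≥0∞} (h : ∀ k, u k ≤ v k) : W.Ph u ≤ W.Ph v := by
  refine lintegral_mono (fun θ => rpow_le_rpow ?_ W.hp2.le)
  exact ENNReal.tsum_le_tsum (fun k => by gcongr; exact h k)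

lemma Ph_smul [Countable K] (a : ℝ≥0∞) (u : K → ℝ≥0∞) :
    W.Ph (fun k => a * u k) = a ^ W.p * W.Ph u := by
  unfold Ph
  rw [← lintegral_const_mul _ ((W.sq_meas u).pow_const _)]
  congr 1
  ext θ
  have : W.sq (fun k => a * u k) θ = a ^ 2 * W.sq u θ := by
    unfold sq
    rw [← ENNReal.tsum_mul_left]
    congr 1; ext k; ring
  rw [this, mul_rpow_of_nonneg _ _ W.hp2.le, ← rpow_natCast, ← rpow_mul]
  congr 2
  push_cast; ring

lemma sq_add [Countable K] (u v : K → ℝ≥0∞) (θ : Ω) :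
    (W.sq (fun k => u k + v k) θ) ^ (1 / 2 : ℝ) ≤
      (W.sq u θ) ^ (1 / 2 : ℝ) + (W.sq v θ) ^ (1 / 2 : ℝ) := by
  let _ : MeasurableSpace K := ⊤
  have h := lintegral_Lp_add_le (μ := Measure.count) (p := 2)
    (f := fun k => u k * (W.g k θ) ^ (1 / 2 : ℝ)) (g := fun k => v k * (W.g k θ) ^ (1 / 2 : ℝ))
    (Measurable.of_discrete.aemeasurable) (Measurable.of_discrete.aemeasurable) (by norm_num)
  simp only [Pi.add_apply, lintegral_count] at h
  have e : ∀ (a b : ℝ≥0∞), (a * b ^ (1 / 2 : ℝ)) ^ (2 : ℝ) = a ^ 2 * b := fun a b => by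
    rw [mul_rpow_of_nonneg _ _ (by norm_num), ← rpow_mul]
    norm_num
  simp only [← add_mul, e] at h
  exact h

lemma Ph_add [Countable K] (u v : K → ℝ≥0∞) :
    W.Ph (fun k => u k + v k) ≤ W.Ph u + W.Ph v := by
  unfold Ph
  rw [← lintegral_add_left ((W.sq_meas u).pow_const _)]
  refine lintegral_mono (fun θ => ?_)
  have e : ∀ a : ℝ≥0∞, a ^ (W.p / 2) = (a ^ (1 / 2 : ℝ)) ^ W.p := by intro a; rw [← rpow_mul]; congr 1; ring
  simp only [e]
  refine (rpow_le_rpow (W.sq_add u v θ) W.hp.le).trans ?_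
  exact rpow_add_le_add_rpow _ _ W.hp.le W.hp1

lemma Ph_single [DecidableEq K] (k : K) (a : ℝ≥0∞) :
    W.Ph (fun j => if j = k then a else 0) = a ^ W.p := by
  unfold Ph
  have : ∀ θ, W.sq (fun j => if j = k then a else 0) θ = a ^ 2 * W.g k θ := fun θ => by
    unfold sq
    rw [tsum_eq_single k]
    · simp
    · intro j hj; simp [hj]
  simp only [this, mul_rpow_of_nonneg _ _ W.hp2.le]
  rw [lintegral_const_mul _ ((W.gm k).pow_const _), W.g1, mul_one,
    ← rpow_natCast, ← rpow_mul]
  congr 1; push_cast; ring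

lemma le_Ph (u : K → ℝ≥0∞) (k : K) : (u k) ^ W.p ≤ W.Ph u := by
  classical
  rw [← W.Ph_single k]
  refine W.Ph_mono (fun j => ?_)
  split_ifs with h
  · rw [h]
  · exact zero_le

lemma Ph_zero : W.Ph (fun _ => 0) = 0 := by simp [Ph, sq, W.hp2]

lemma Ph_fatou [Countable K] {u : ℕ → K → ℝ≥0∞} {v : K → ℝ≥0∞} {B : ℝ≥0∞}
    (h : ∀ᶠ m in atTop, W.Ph (u m) ≤ B) (hv : ∀ k, Tendsto (fun m => u m k) atTop (𝓝 (v k))) :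
    W.Ph v ≤ B := by
  let _ : MeasurableSpace K := ⊤
  have h1 : ∀ θ, W.sq v θ ≤ liminf (fun m => W.sq (u m) θ) atTop := fun θ => by
    have := lintegral_liminf_le (μ := (Measure.count : Measure K)) (u := atTop)
      (f := fun m k => (u m k) ^ 2 * W.g k θ) (fun m => Measurable.of_discrete)
    simp only [lintegral_count] at this
    refine le_trans (ENNReal.tsum_le_tsum (fun k => ?_)) this
    rw [Filter.Tendsto.liminf_eq]
    exact ENNReal.Tendsto.mul_const ((ENNReal.continuous_pow 2).tendsto _ |>.comp (hv k))
      (Or.inr (W.gfin k θ))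
  calc W.Ph v ≤ ∫⁻ θ, liminf (fun m => (W.sq (u m) θ) ^ (W.p / 2)) atTop ∂W.μ := by
        refine lintegral_mono (fun θ => ?_)
        refine (rpow_le_rpow (h1 θ) W.hp2.le).trans ?_
        have := Monotone.map_liminf_of_continuousAt (F := atTop)
          (monotone_rpow_of_nonneg W.hp2.le) (fun m => W.sq (u m) θ)
          (continuous_rpow_const.continuousAt)
        exact this.le
    _ ≤ liminf (fun m => W.Ph (u m)) atTop :=
        lintegral_liminf_le (fun m => (W.sq_meas (u m)).pow_const _)
    _ ≤ B := by refine Filter.liminf_le_of_frequently_le' h.frequently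

lemma Ph_tail [Countable K] [DecidableEq K] {u : K → ℝ≥0∞} (hu : W.Ph u ≠ ∞) :
    Tendsto (fun G : Finset K => W.Ph (fun k => if k ∈ G then 0 else u k)) atTop (𝓝 0) := by
  have h0 : ∫⁻ θ, (0 : ℝ≥0∞) ∂W.μ = 0 := by simp
  suffices hmain : Tendsto (fun G : Finset K => W.Ph (fun k => if k ∈ G then 0 else u k)) atTop
      (𝓝 (∫⁻ θ, (0 : ℝ≥0∞) ∂W.μ)) by rwa [h0] at hmain
  have hm : ∀ v : K → ℝ≥0∞, Measurable (fun θ => (W.sq v θ) ^ (W.p / 2)) :=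
    fun v => (W.sq_meas v).pow_const _
  refine tendsto_lintegral_filter_of_dominated_convergence (fun θ => (W.sq u θ) ^ (W.p / 2))
    (Eventually.of_forall (fun G => hm _)) (Eventually.of_forall (fun G =>
      Eventually.of_forall (fun θ => ?_))) hu ?_
  · refine rpow_le_rpow (ENNReal.tsum_le_tsum (fun k => ?_)) W.hp2.le
    dsimp only
    split_ifs
    · simp
    · exact le_rfl
  · filter_upwards [ae_lt_top (hm u) hu] with θ hθ
    have hfin : W.sq u θ ≠ ∞ := fun h => by
      rw [h, top_rpow_of_pos W.hp2] at hθ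
      exact absurd hθ (lt_irrefl _)
    have h1 := ENNReal.tendsto_tsum_compl_atTop_zero hfin
    have h2 : ∀ G : Finset K, W.sq (fun k => if k ∈ G then 0 else u k) θ
        = ∑' b : { x // x ∉ G }, u b ^ 2 * W.g b θ := fun G => by
      have := tsum_subtype {x | x ∉ G} (fun b => u b ^ 2 * W.g b θ)
      refine Eq.trans ?_ this.symm
      unfold sq
      congr 1; ext k
      by_cases h : k ∈ G <;> simp [h]
    have h3 := ((continuous_rpow_const (y := W.p / 2)).tendsto 0).comp h1
    rw [zero_rpow_of_pos W.hp2] at h3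
    refine h3.congr (fun G => ?_)
    simp only [Function.comp]
    rw [h2 G]

/-- the `p`-norm -/
def pn [Countable K] : PN (K → ℂ) where
  p := W.p
  hp := W.hp
  N := fun c => W.Ph (fun k => ‖c k‖ₑ)
  zero := by simpa using W.Ph_zero
  add := fun x y => (W.Ph_mono (fun k => enorm_add_le _ _)).trans (W.Ph_add _ _)
  smul := fun c x => by
    rw [← W.Ph_smul]
    congr 1; ext k; simp [enorm_mul]
  eq_zero := fun x hx => by
    ext k
    have := W.le_Ph (fun k => ‖x k‖ₑ) k
    rw [hx] at this
    simpa [W.hp, W.hp.le, W.hp.not_gt] using this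

/-- the sequence space -/
abbrev F [Countable K] : Type _ := W.pn.Sp

variable [Countable K]

/-- coordinates -/
def cd (c : W.F) (k : K) : ℂ := W.pn.val c k

lemma enorm_F (c : W.F) : ‖c‖ₑ = W.Ph (fun k => ‖W.cd c k‖ₑ) := PN.enorm_def c

lemma norm_F (c : W.F) : ‖c‖ = (W.Ph (fun k => ‖W.cd c k‖ₑ)).toReal := rfl

lemma cd_le (c : W.F) (k : K) : ‖W.cd c k‖ ^ W.p ≤ ‖c‖ := by
  have h := W.le_Ph (fun k => ‖W.cd c k‖ₑ) k
  rw [← enorm_F] at h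
  have h2 := toReal_mono (by simp) h
  rw [← toReal_rpow] at h2
  simpa using h2

/-- coordinates as continuous linear maps -/
def cdL (k : K) : W.F →L[ℂ] ℂ where
  toFun := fun c => W.cd c k
  map_add' := fun _ _ => rfl
  map_smul' := fun _ _ => rfl
  cont := by
    let φ : W.F →+ ℂ := ⟨⟨fun c => W.cd c k, rfl⟩, fun _ _ => rfl⟩
    apply continuous_of_continuousAt_zero φ
    show Tendsto _ _ _
    rw [map_zero, tendsto_zero_iff_norm_tendsto_zero]
    have h1 : Tendsto (fun c : W.F => ‖c‖ ^ (1 / W.p)) (𝓝 0) (𝓝 0) := by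
      have h5 : Tendsto (fun c : W.F => ‖c‖) (𝓝 0) (𝓝 0) := by simpa using (tendsto_norm (E := W.F) (x := 0))
      have hp : 0 < 1 / W.p := by have := W.hp; positivity
      have := h5.rpow_const (p := 1 / W.p) (Or.inr hp.le)
      rwa [Real.zero_rpow hp.ne'] at this
    refine squeeze_zero (fun _ => norm_nonneg _) (fun c => ?_) h1
    have := Real.rpow_le_rpow (by positivity) (W.cd_le c k)
      (by have := W.hp; positivity : 0 ≤ 1 / W.p)
    rwa [← Real.rpow_mul (norm_nonneg _), mul_one_div_cancel W.hp.ne', Real.rpow_one] at this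

@[simp] lemma cdL_apply (k : K) (c : W.F) : W.cdL k c = W.cd c k := rfl

instance complete : CompleteSpace W.F := by
  apply PN.complete
  intro f hf
  have hc : ∀ k, CauchySeq (fun m => W.cd (f m) k) := fun k =>
    (W.cdL k).uniformContinuous.comp_cauchySeq hf
  choose x hx using fun k => cauchySeq_tendsto_of_complete (hc k)
  refine ⟨x, fun k B hB => ?_⟩
  refine W.Ph_fatou hB (fun j => ?_)
  exact ((hx j).sub_const _).enorm

/-- unit vectors -/
def e [DecidableEq K] (k : K) : W.F := W.pn.mk' (Pi.single k 1) (by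
  show W.Ph _ < ∞
  have := W.Ph_single k 1
  have h : (fun j => ‖(Pi.single k (1:ℂ) : K → ℂ) j‖ₑ) = fun j => if j = k then 1 else 0 := by
    ext j
    by_cases h : j = k
    · subst h; simp
    · simp [h]
  rw [h, this]; simp)

lemma cd_e [DecidableEq K] (k j : K) : W.cd (W.e k) j = if j = k then 1 else 0 := by
  show (Pi.single k (1:ℂ) : K → ℂ) j = _
  rw [Pi.single_apply]

lemma norm_e [DecidableEq K] (k : K) : ‖W.e k‖ = 1 := by
  rw [norm_F]
  have h : (fun j => ‖W.cd (W.e k) j‖ₑ) = fun j => if j = k then 1 else 0 := by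
    ext j
    rw [cd_e]
    split_ifs <;> simp
  rw [h, W.Ph_single]; simp

lemma cd_sum {ι : Type*} (s : Finset ι) (f : ι → W.F) (k : K) :
    W.cd (∑ i ∈ s, f i) k = ∑ i ∈ s, W.cd (f i) k := map_sum (W.cdL k) f s
lemma cd_smul (c : ℂ) (f : W.F) (k : K) : W.cd (c • f) k = c * W.cd f k := rfl
lemma cd_sub (f g : W.F) (k : K) : W.cd (f - g) k = W.cd f k - W.cd g k := rfl
lemma cd_add (f g : W.F) (k : K) : W.cd (f + g) k = W.cd f k + W.cd g k := rfl

lemma cd_fin [DecidableEq K] (G : Finset K) (a : K → ℂ) (k : K) :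
    W.cd (∑ i ∈ G, a i • W.e i) k = if k ∈ G then a k else 0 := by
  rw [cd_sum]
  simp [cd_smul, cd_e]

lemma hasSum_e [DecidableEq K] (c : W.F) : HasSum (fun k => W.cd c k • W.e k) c := by
  show Tendsto _ _ _
  rw [SummationFilter.unconditional_filter, tendsto_iff_norm_sub_tendsto_zero]
  have h := W.Ph_tail (u := fun k => ‖W.cd c k‖ₑ) (PN.val_lt c).ne
  have h2 := (tendsto_toReal (by simp : (0:ℝ≥0∞) ≠ ∞)).comp h
  simp only [toReal_zero] at h2
  refine h2.congr (fun G => ?_)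
  rw [norm_F]
  simp only [Function.comp]
  congr 2
  ext k
  rw [cd_sub, cd_fin]
  split_ifs <;> simp

lemma ubasis_e [DecidableEq K] : UBasis W.e := by
  intro f
  refine ⟨W.cd f, W.hasSum_e f, fun a ha => ?_⟩
  ext k
  have h1 := ha.mapL (W.cdL k)
  simp only [map_smul, cdL_apply, cd_e, smul_eq_mul] at h1
  have h2 := hasSum_single (f := fun n => a n * (if k = n then (1:ℂ) else 0)) k (by
    intro b hb; simp [Ne.symm hb])
  simpa using h2.unique h1

/-- extension lemma -/
theorem extend [DecidableEq K] {V : Type*} [NormedAddCommGroup V] [Module ℂ V] [CompleteSpace V]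
    [ContinuousConstSMul ℂ V]
    (τ : K → V) (C : ℝ≥0∞) (hC : C ≠ ∞)
    (h : ∀ (c : K → ℂ) (G : Finset K), ‖∑ k ∈ G, c k • τ k‖ₑ ≤
      C * W.Ph (fun k => if k ∈ G then ‖c k‖ₑ else 0)) :
    ∃ T : W.F →L[ℂ] V, ∀ c, HasSum (fun k => W.cd c k • τ k) (T c) := by
  have hs : ∀ c : W.F, Summable (fun k => W.cd c k • τ k) := fun c => by
    rw [summable_iff_vanishing_norm]
    intro ε hε
    have h1 := W.Ph_tail (u := fun k => ‖W.cd c k‖ₑ) (PN.val_lt c).ne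
    have h2 := ENNReal.Tendsto.const_mul h1 (Or.inr hC)
    rw [mul_zero] at h2
    have h3 := h2.eventually (gt_mem_nhds (ofReal_pos.2 hε))
    rw [Filter.eventually_atTop] at h3
    obtain ⟨s, hs⟩ := h3
    refine ⟨s, fun t ht => ?_⟩
    have h4 := (h (W.cd c) t).trans_lt ((mul_le_mul_right (W.Ph_mono (fun k => ?_)) C).trans_lt
      (hs s le_rfl))
    · rw [← ofReal_norm] at h4
      exact (ofReal_lt_ofReal_iff hε).1 h4
    · by_cases hk : k ∈ t
      · have : k ∉ s := Finset.disjoint_left.1 ht hk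
        simp [hk, this]
      · simp [hk]
  let T : W.F →+ V := AddMonoidHom.mk' (fun c => ∑' k, W.cd c k • τ k) (fun a b => by
    rw [← (hs a).tsum_add (hs b)]
    congr 1; ext k; rw [cd_add, add_smul])
  have hb : ∀ c, ‖T c‖ ≤ C.toReal * ‖c‖ := fun c => by
    refine le_of_tendsto' (Filter.Tendsto.norm (hs c).hasSum) (fun G => ?_)
    have h1 := (h (W.cd c) G).trans (mul_le_mul_right (W.Ph_mono
      (v := fun k => ‖W.cd c k‖ₑ) (fun k => by split_ifs <;> simp)) C)
    rw [← enorm_F] at h1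
    have h2 := toReal_mono (mul_ne_top hC (by simp)) h1
    rw [toReal_mul] at h2
    simpa using h2
  refine ⟨⟨⟨⟨T, fun a b => map_add T a b⟩, fun m c => ?_⟩,
    AddMonoidHomClass.continuous_of_bound T C.toReal hb⟩, fun c => (hs c).hasSum⟩
  show ∑' k, W.cd (m • c) k • τ k = m • ∑' k, W.cd c k • τ k
  rw [← (hs c).tsum_const_smul m]
  congr 1; ext k; rw [cd_smul, mul_smul]

/-- pull back of the data along a map of index sets -/
def comap {J : Type*} (W : WS Ω K) (ι : J → K) : WS Ω J where
  μ := W.μ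
  p := W.p
  hp := W.hp
  hp1 := W.hp1
  g := fun j => W.g (ι j)
  gfin := fun j => W.gfin (ι j)
  gm := fun _ => W.gm _
  g1 := fun _ => W.g1 _

end WS

/-- signs -/
def sg {ι : Type*} [DecidableEq ι] (A : Finset ι) (i : ι) : ℂ := if i ∈ A then 1 else -1

section khin
variable {ι : Type*} [DecidableEq ι]

lemma sg_mul_self (A : Finset ι) (i : ι) : sg A i * sg A i = 1 := by unfold sg; split_ifs <;> simp

section inner
variable {H : Type*} [NormedAddCommGroup H] [InnerProductSpace ℂ H]

lemma sum_sg_insert {s : Finset ι} {a : ι} (ha : a ∉ s) (h : ι → H) {β : Type*}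
    [AddCommMonoid β] (f : H → β) :
    ∑ A ∈ (insert a s).powerset, f (∑ i ∈ insert a s, sg A i • h i)
      = ∑ A ∈ s.powerset, (f ((∑ i ∈ s, sg A i • h i) - h a)
          + f ((∑ i ∈ s, sg A i • h i) + h a)) := by
  rw [Finset.sum_powerset_insert ha, ← sum_add_distrib]
  refine sum_congr rfl (fun A hA => ?_)
  have haA : a ∉ A := fun h => ha (Finset.mem_powerset.1 hA h)
  congr 2
  · rw [sum_insert ha]
    simp only [sg, haA, if_false]
    simp only [neg_smul, one_smul]
    abel
  · rw [sum_insert ha, add_comm]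
    congr 1
    · refine sum_congr rfl (fun i hi => ?_)
      have : i ≠ a := fun h => ha (h ▸ hi)
      simp [sg, this]
    · simp [sg]

lemma avg2 (s : Finset ι) (h : ι → H) :
    ∑ A ∈ s.powerset, ‖∑ i ∈ s, sg A i • h i‖ ^ 2 = 2 ^ s.card * ∑ i ∈ s, ‖h i‖ ^ 2 := by
  induction s using Finset.induction_on with
  | empty => simp
  | insert a s ha ih =>
    rw [sum_sg_insert ha h (fun v => ‖v‖ ^ 2)]
    have : ∀ v : H, ‖v - h a‖ ^ 2 + ‖v + h a‖ ^ 2 = 2 * ‖v‖ ^ 2 + 2 * ‖h a‖ ^ 2 := fun v => by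
      have := parallelogram_law_with_norm ℂ v (h a)
      nlinarith
    simp_rw [this]
    rw [sum_add_distrib, ← mul_sum, ih, sum_insert ha,
      Finset.card_insert_of_notMem ha]
    simp only [sum_const, card_powerset, nsmul_eq_mul]
    push_cast
    ring

lemma avg4 (s : Finset ι) (h : ι → H) :
    ∑ A ∈ s.powerset, ‖∑ i ∈ s, sg A i • h i‖ ^ 4 ≤
      2 ^ s.card * (3 * (∑ i ∈ s, ‖h i‖ ^ 2) ^ 2) := by
  induction s using Finset.induction_on with
  | empty => simp
  | insert a s ha ih =>
    rw [sum_sg_insert ha h (fun v => ‖v‖ ^ 4)]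
    have key : ∀ v : H, ‖v - h a‖ ^ 4 + ‖v + h a‖ ^ 4 ≤
        2 * ‖v‖ ^ 4 + 12 * ‖h a‖ ^ 2 * ‖v‖ ^ 2 + 2 * ‖h a‖ ^ 4 := fun v => by
      have h1 := norm_sub_sq (𝕜 := ℂ) v (h a)
      have h2 := norm_add_sq (𝕜 := ℂ) v (h a)
      have h3 := abs_le.1 ((RCLike.abs_re_le_norm (inner ℂ v (h a))).trans
        (norm_inner_le_norm (𝕜 := ℂ) v (h a)))
      set r := RCLike.re (inner ℂ v (h a))
      have e : ∀ y : ℝ, y ^ 4 = (y ^ 2) ^ 2 := fun y => by ring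
      rw [e ‖v - h a‖, e ‖v + h a‖, h1, h2]
      have h4 : r ^ 2 ≤ (‖v‖ * ‖h a‖) ^ 2 := sq_le_sq' h3.1 h3.2
      nlinarith
    refine (sum_le_sum (fun A _ => key _)).trans ?_
    rw [sum_add_distrib, sum_add_distrib, ← mul_sum, ← mul_sum, avg2,
      sum_insert ha, Finset.card_insert_of_notMem ha]
    simp only [sum_const, card_powerset, nsmul_eq_mul]
    push_cast
    have h5 : (0:ℝ) < 2 ^ s.card := by positivity
    have h6 : (0:ℝ) ≤ ∑ i ∈ s, ‖h i‖ ^ 2 := by positivity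
    set σ := ∑ i ∈ s, ‖h i‖ ^ 2
    set T := ∑ A ∈ s.powerset, ‖∑ i ∈ s, sg A i • h i‖ ^ 4
    have : 2 * T ≤ 2 * (2 ^ s.card * (3 * σ ^ 2)) := by linarith
    have h7 : 0 ≤ (2:ℝ) ^ s.card * ‖h a‖ ^ 4 := by positivity
    have e9 : (2:ℝ) ^ (s.card + 1) = 2 * 2 ^ s.card := by ring
    rw [e9]
    nlinarith

lemma khin_real {p : ℝ} (hp : 0 < p) (hp2 : p ≤ 2) (s : Finset ι) (h : ι → H) :
    2 ^ s.card * (∑ i ∈ s, ‖h i‖ ^ 2) ^ (p / 2) ≤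
      12 * ∑ A ∈ s.powerset, ‖∑ i ∈ s, sg A i • h i‖ ^ p := by
  have h6 : (0:ℝ) ≤ ∑ i ∈ s, ‖h i‖ ^ 2 := by positivity
  rcases h6.eq_or_lt with h0 | hpos
  · rw [← h0, Real.zero_rpow (by positivity), mul_zero]
    positivity
  set σ := ∑ i ∈ s, ‖h i‖ ^ 2 with hσ
  -- threshold
  set K2 := 6 * σ with hK2
  have hK2p : 0 < K2 := by positivity
  have pt : ∀ y : ℝ, 0 ≤ y → y ^ 2 ≤ K2 ^ (1 - p / 2) * y ^ p + y ^ 4 / K2 := fun y hy => by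
    rcases hy.eq_or_lt with h | hy0
    · rw [← h, Real.zero_rpow hp.ne']; simp
    by_cases hle : y ^ 2 ≤ K2
    · have e : y ^ 2 = (y ^ 2) ^ (1 - p / 2) * y ^ p := by
        rw [← Real.rpow_natCast, ← Real.rpow_mul hy, ← Real.rpow_add hy0]
        congr 1; push_cast; ring
      have : (y ^ 2) ^ (1 - p / 2) ≤ K2 ^ (1 - p / 2) :=
        Real.rpow_le_rpow (by positivity) hle (by linarith)
      calc y ^ 2 = (y ^ 2) ^ (1 - p / 2) * y ^ p := e
        _ ≤ K2 ^ (1 - p / 2) * y ^ p := by gcongr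
        _ ≤ _ := by have : 0 ≤ y ^ 4 / K2 := by positivity
                    linarith
    · have : y ^ 2 ≤ y ^ 4 / K2 := by
        rw [le_div_iff₀ hK2p]
        nlinarith [sq_nonneg y]
      have : 0 ≤ K2 ^ (1 - p / 2) * y ^ p := by positivity
      linarith
  have h1 := sum_le_sum (s := s.powerset) (fun A _ => pt _ (norm_nonneg (∑ i ∈ s, sg A i • h i)))
  rw [avg2, sum_add_distrib, ← mul_sum, ← Finset.sum_div] at h1
  have h2 := avg4 s h
  rw [← hσ] at h2 h1
  set P := ∑ A ∈ s.powerset, ‖∑ i ∈ s, sg A i • h i‖ ^ p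
  set n2 : ℝ := 2 ^ s.card
  have h3 : (∑ A ∈ s.powerset, ‖∑ i ∈ s, sg A i • h i‖ ^ 4) / K2 ≤ n2 * σ / 2 := by rw [div_le_iff₀ hK2p, hK2]; nlinarith
  have h4 : n2 * σ ≤ 2 * (K2 ^ (1 - p / 2) * P) := by linarith
  have h5 : K2 ^ (1 - p / 2) ≤ 6 * σ ^ (1 - p / 2) := by
    rw [hK2, Real.mul_rpow (by norm_num) hpos.le]
    gcongr
    calc (6:ℝ) ^ (1 - p / 2) ≤ 6 ^ (1:ℝ) :=
          Real.rpow_le_rpow_of_exponent_le (by norm_num) (by linarith)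
      _ = 6 := by simp
  have hP : 0 ≤ P := by positivity
  have h7 : n2 * σ ≤ 12 * P * σ ^ (1 - p / 2) := by nlinarith
  have e2 : σ = σ ^ (p / 2) * σ ^ (1 - p / 2) := by rw [← Real.rpow_add hpos]; simp
  have h8 : n2 * σ ^ (p / 2) * σ ^ (1 - p / 2) ≤ 12 * P * σ ^ (1 - p / 2) := by rw [mul_assoc, ← e2]; exact h7
  exact le_of_mul_le_mul_right h8 (by positivity)
end inner

/-- pointwise second moment identity in `ℝ≥0∞` -/
lemma avg2_enn (s : Finset ι) (a : ι → ℂ) :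
    ∑ A ∈ s.powerset, ‖∑ i ∈ s, sg A i * a i‖ₑ ^ 2 = 2 ^ s.card * ∑ i ∈ s, ‖a i‖ₑ ^ 2 := by
  have := avg2 s a
  simp only [smul_eq_mul] at this
  have e : ∀ z : ℂ, ‖z‖ₑ ^ 2 = ofReal (‖z‖ ^ 2) := by intro z; rw [← ofReal_norm, ofReal_pow (norm_nonneg _)]
  simp_rw [e]
  rw [← ofReal_sum_of_nonneg (by intros; positivity),
    ← ofReal_sum_of_nonneg (by intros; positivity), this,
    ofReal_mul (by positivity), ofReal_pow (by norm_num)]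
  norm_num

variable {X : Type*} [MeasurableSpace X] (ν : Measure X)

lemma avg2_lint (s : Finset ι) (a : ι → X → ℂ) (ha : ∀ i ∈ s, AEStronglyMeasurable (a i) ν) :
    ∑ A ∈ s.powerset, ∫⁻ x, ‖∑ i ∈ s, sg A i * a i x‖ₑ ^ 2 ∂ν
      = 2 ^ s.card * ∑ i ∈ s, ∫⁻ x, ‖a i x‖ₑ ^ 2 ∂ν := by
  rw [← lintegral_finsetSum', ← lintegral_finsetSum', ← lintegral_const_mul'']
  · exact lintegral_congr (fun x => avg2_enn s (fun i => a i x))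
  · exact Finset.aemeasurable_fun_sum _ (fun i hi => ((ha i hi).enorm.pow_const 2))
  · exact fun i hi => ((ha i hi).enorm.pow_const 2)
  · intro A _
    refine AEMeasurable.pow_const (AEStronglyMeasurable.enorm ?_) 2
    exact Finset.aestronglyMeasurable_fun_sum _ (fun i hi => (ha i hi).const_mul _)

/-- lower Khintchine -/
theorem khin_lower {p : ℝ} (hp : 0 < p) (hp2 : p ≤ 2) (s : Finset ι) (a : ι → X → ℂ)
    (ha : ∀ i ∈ s, AEStronglyMeasurable (a i) ν) :
    2 ^ s.card * (∑ i ∈ s, ∫⁻ x, ‖a i x‖ₑ ^ 2 ∂ν) ^ (p / 2) ≤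
      12 * ∑ A ∈ s.powerset, (∫⁻ x, ‖∑ i ∈ s, sg A i * a i x‖ₑ ^ 2 ∂ν) ^ (p / 2) := by
  have hp2' : 0 < p / 2 := by positivity
  by_cases hfin : ∀ i ∈ s, ∫⁻ x, ‖a i x‖ₑ ^ 2 ∂ν ≠ ∞
  · have e0 : ∀ f : X → ℂ, eLpNorm f 2 ν = (∫⁻ x, ‖f x‖ₑ ^ 2 ∂ν) ^ (1 / 2 : ℝ) := fun f => by
      rw [eLpNorm_eq_lintegral_rpow_enorm_toReal (by norm_num) (by norm_num)]
      norm_num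
    have hL : ∀ i ∈ s, MemLp (a i) 2 ν := fun i hi => by
      refine ⟨ha i hi, ?_⟩
      rw [e0]
      exact rpow_lt_top_of_nonneg (by norm_num) (hfin i hi)
    let b : ι → X → ℂ := fun i => if i ∈ s then a i else 0
    have hb : ∀ i, MemLp (b i) 2 ν := fun i => by
      by_cases hi : i ∈ s
      · simpa [b, hi] using hL i hi
      · simp [b, hi]
    let h : ι → Lp ℂ 2 ν := fun i => (hb i).toLp (b i)
    have e1 : ∀ (f : X → ℂ) (hf : MemLp f 2 ν), ∀ q : ℝ, 0 ≤ q → ofReal (‖hf.toLp f‖ ^ q)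
        = (∫⁻ x, ‖f x‖ₑ ^ 2 ∂ν) ^ (q / 2) := fun f hf q hq => by
      rw [← ofReal_rpow_of_nonneg (norm_nonneg _) hq, ofReal_norm, Lp.enorm_toLp, e0,
        ← rpow_mul]
      congr 1; ring
    have e2 : ∀ A : Finset ι, ∀ q : ℝ, 0 ≤ q → ofReal (‖∑ i ∈ s, sg A i • h i‖ ^ q)
        = (∫⁻ x, ‖∑ i ∈ s, sg A i * a i x‖ₑ ^ 2 ∂ν) ^ (q / 2) := fun A q hq => by
      have hm : MemLp (fun x => ∑ i ∈ s, sg A i * a i x) 2 ν :=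
        memLp_finsetSum _ (fun i hi => (hL i hi).const_mul _)
      rw [← e1 _ hm q hq]
      congr 3
      apply Lp.ext
      refine (Lp.coeFn_finsetSum _ _).trans ?_
      refine EventuallyEq.trans ?_ hm.coeFn_toLp.symm
      have h3 : ∀ i ∈ s, (fun x => (sg A i • h i : Lp ℂ 2 ν) x) =ᵐ[ν] fun x => sg A i * a i x := fun i hi => by
        filter_upwards [Lp.coeFn_smul (sg A i) (h i), (hb i).coeFn_toLp] with x h1 h2
        rw [h1, Pi.smul_apply, h2]
        simp [b, hi]
      have h4 : ∀ᵐ x ∂ν, ∀ i ∈ s, (sg A i • h i : Lp ℂ 2 ν) x = sg A i * a i x := by rw [Finset.eventually_all]; exact h3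
      filter_upwards [h4] with x hx
      simp only [Finset.sum_apply]
      exact sum_congr rfl hx
    have key := khin_real hp hp2 s h
    have key2 := ofReal_le_ofReal key
    rw [ofReal_mul (by positivity), ofReal_mul (by norm_num),
      ofReal_sum_of_nonneg (by intros; positivity), ofReal_pow (by norm_num),
      ← ofReal_rpow_of_nonneg (by positivity) hp2'.le,
      ofReal_sum_of_nonneg (by intros; positivity)] at key2
    simp_rw [e2 _ p hp.le] at key2
    have e3 : ∀ i ∈ s, ofReal (‖h i‖ ^ 2) = ∫⁻ x, ‖a i x‖ₑ ^ 2 ∂ν := fun i hi => by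
      have := e1 (b i) (hb i) 2 (by norm_num)
      rw [Real.rpow_two, div_self two_ne_zero, rpow_one] at this
      refine this.trans ?_
      simp [b, hi]
    rw [sum_congr rfl e3] at key2
    simpa using key2
  · push Not at hfin
    obtain ⟨i, hi, hinf⟩ := hfin
    have h1 := avg2_lint ν s a ha
    have h2 : ∑ i ∈ s, ∫⁻ x, ‖a i x‖ₑ ^ 2 ∂ν = ∞ := sum_eq_top.2 ⟨i, hi, hinf⟩
    rw [h2, mul_top (by positivity)] at h1
    obtain ⟨A, hA, hAinf⟩ := sum_eq_top.1 h1
    have : ∑ A ∈ s.powerset, (∫⁻ x, ‖∑ i ∈ s, sg A i * a i x‖ₑ ^ 2 ∂ν) ^ (p / 2) = ∞ := by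
      refine sum_eq_top.2 ⟨A, hA, ?_⟩
      rw [hAinf, top_rpow_of_pos hp2']
    rw [this, mul_top (by norm_num)]
    exact le_top

/-- upper Khintchine -/
theorem khin_upper {p : ℝ} (hp : 0 < p) (hp2 : p ≤ 2) (s : Finset ι) (a : ι → X → ℂ)
    (ha : ∀ i ∈ s, AEStronglyMeasurable (a i) ν) :
    ∑ A ∈ s.powerset, (∫⁻ x, ‖∑ i ∈ s, sg A i * a i x‖ₑ ^ 2 ∂ν) ^ (p / 2) ≤
    2 ^ s.card * (∑ i ∈ s, ∫⁻ x, ‖a i x‖ₑ ^ 2 ∂ν) ^ (p / 2) := by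
  have h1 := avg2_lint ν s a ha
  set f : Finset ι → ℝ≥0∞ := fun A => ∫⁻ x, ‖∑ i ∈ s, sg A i * a i x‖ₑ ^ 2 ∂ν with hf
  have hq : 1 ≤ 2 / p := by rw [le_div_iff₀ hp]; linarith
  have h2 := inner_le_weight_mul_Lp_of_nonneg s.powerset hq (fun _ => 1)
    (fun A => (f A) ^ (p / 2))
  have e : ∀ y : ℝ≥0∞, (y ^ (p / 2)) ^ (2 / p) = y := by
    intro y; rw [← rpow_mul]
    have : p / 2 * (2 / p) = 1 := by field_simp
    rw [this, rpow_one]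
  simp only [one_mul, e, sum_const, card_powerset, nsmul_eq_mul, mul_one] at h2
  refine h2.trans_eq ?_
  rw [h1]
  push_cast
  have e4 : (2 / p)⁻¹ = p / 2 := by field_simp
  rw [e4, mul_rpow_of_nonneg _ _ (by positivity), ← mul_assoc,
    ← rpow_add _ _ (by positivity) (by simp)]
  simp

/-- discrete measure with weights -/
lemma exists_wt {κ : Type*} (w : κ → ℝ≥0∞) : ∃ ν : @Measure κ ⊤, ∀ f : κ → ℝ≥0∞,
    @lintegral κ ⊤ ν f = ∑' k, f k * w k := by
  let _ : MeasurableSpace κ := ⊤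
  refine ⟨Measure.sum (fun k => w k • Measure.dirac k), fun f => ?_⟩
  rw [lintegral_sum_measure]
  congr 1; ext k
  rw [lintegral_smul_measure, lintegral_dirac, smul_eq_mul, mul_comm]

theorem khin_lower_tsum {κ : Type*} (w : κ → ℝ≥0∞) {p : ℝ} (hp : 0 < p) (hp2 : p ≤ 2)
    (s : Finset ι) (a : ι → κ → ℂ) :
    2 ^ s.card * (∑ i ∈ s, ∑' k, ‖a i k‖ₑ ^ 2 * w k) ^ (p / 2) ≤
      12 * ∑ A ∈ s.powerset, (∑' k, ‖∑ i ∈ s, sg A i * a i k‖ₑ ^ 2 * w k) ^ (p / 2) := by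
  let _ : MeasurableSpace κ := ⊤
  obtain ⟨ν, hν⟩ := exists_wt w
  have := khin_lower ν hp hp2 s a (fun i _ => (Measurable.of_discrete).aestronglyMeasurable)
  simpa only [hν] using this

theorem khin_upper_tsum {κ : Type*} (w : κ → ℝ≥0∞) {p : ℝ} (hp : 0 < p) (hp2 : p ≤ 2)
    (s : Finset ι) (a : ι → κ → ℂ) :
    ∑ A ∈ s.powerset, (∑' k, ‖∑ i ∈ s, sg A i * a i k‖ₑ ^ 2 * w k) ^ (p / 2) ≤
    2 ^ s.card * (∑ i ∈ s, ∑' k, ‖a i k‖ₑ ^ 2 * w k) ^ (p / 2) := by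
  let _ : MeasurableSpace κ := ⊤
  obtain ⟨ν, hν⟩ := exists_wt w
  have := khin_upper ν hp hp2 s a (fun i _ => (Measurable.of_discrete).aestronglyMeasurable)
  simpa only [hν] using this

end khin

/-- embedding hypothesis -/
def WS.Emb {Ω 𝒯 : Type*} [MeasurableSpace Ω] (B : WS Ω 𝒯) : Prop :=
  ∃ (q : ℝ) (C : ℝ≥0∞), 0 < q ∧ q < 1 ∧ C ≠ ∞ ∧ ∀ s : 𝒯 → ℝ≥0∞,
    ∑' T, (s T) ^ q ≤ C * (B.Ph s) ^ (q / B.p)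

section signs
variable {p : ℝ} {V : Type*} [NormedAddCommGroup V] [Module ℂ V]

/-- unconditional constant -/
def UC {J : Type*} (x : J → V) (hx : UBasis x) (C : ℝ≥0∞) : Prop :=
  ∀ f (G : Finset J), ‖∑ i ∈ G, hx.co f i • x i‖ₑ ≤ C * ‖f‖ₑ

lemma exists_UC [PNormed p V] [CompleteSpace V] {J : Type*} {x : J → V} (hx : UBasis x) :
    ∃ C : ℝ≥0∞, C ≠ ∞ ∧ UC x hx C := by
  obtain ⟨C, hC, h⟩ := hx.const
  refine ⟨ofReal C, by simp, fun f G => ?_⟩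
  rw [← ofReal_norm, ← ofReal_norm, ← ofReal_mul hC.le]
  exact ofReal_le_ofReal (h f G)

lemma UC.sign [PNormed p V] {J : Type*} [DecidableEq J] {x : J → V} {hx : UBasis x} {C : ℝ≥0∞}
    (h : UC x hx C) (f : V) (G A : Finset J) :
    ‖∑ i ∈ G, (sg A i * hx.co f i) • x i‖ₑ ≤ 2 * C * ‖f‖ₑ := by
  have e : ∑ i ∈ G, (sg A i * hx.co f i) • x i
      = (∑ i ∈ G with i ∈ A, hx.co f i • x i) - ∑ i ∈ G with i ∉ A, hx.co f i • x i := by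
    rw [← Finset.sum_filter_add_sum_filter_not G (fun i => i ∈ A), sub_eq_add_neg]
    congr 1
    · refine sum_congr rfl (fun i hi => ?_)
      simp [sg, (mem_filter.1 hi).2]
    · rw [← Finset.sum_neg_distrib]
      refine sum_congr rfl (fun i hi => ?_)
      simp [sg, (mem_filter.1 hi).2]
  rw [e, two_mul, add_mul]
  exact enorm_sub_le.trans (add_le_add (h _ _) (h _ _))

lemma UC.sign' [PNormed p V] {J : Type*} [DecidableEq J] {x : J → V} {hx : UBasis x} {C : ℝ≥0∞}
    (h : UC x hx C) (c : J → ℂ) (G A : Finset J) :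
    ‖∑ i ∈ G, (sg A i * c i) • x i‖ₑ ≤ 2 * C * ‖∑ i ∈ G, c i • x i‖ₑ := by
  have := h.sign (∑ i ∈ G, c i • x i) G A
  rw [hx.co_fin] at this
  refine le_trans (le_of_eq ?_) this
  congr 1
  refine sum_congr rfl (fun i hi => ?_)
  simp [hi]

lemma UC.sign'' [PNormed p V] {J : Type*} [DecidableEq J] {x : J → V} {hx : UBasis x} {C : ℝ≥0∞}
    (h : UC x hx C) (c : J → ℂ) (G A : Finset J) :
    ‖∑ i ∈ G, c i • x i‖ₑ ≤ 2 * C * ‖∑ i ∈ G, (sg A i * c i) • x i‖ₑ := by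
  have := h.sign' (fun i => sg A i * c i) G A
  simpa only [← mul_assoc, sg_mul_self, one_mul] using this

lemma UC.coef [PNormed p V] {J : Type*} [DecidableEq J] {x : J → V} {hx : UBasis x} {C : ℝ≥0∞}
    (h : UC x hx C) (f : V) (j : J) : ‖hx.co f j‖ₑ ^ p * ‖x j‖ₑ ≤ C * ‖f‖ₑ := by
  have := h f {j}
  rw [sum_singleton] at this
  refine le_trans (le_of_eq ?_) this
  rw [← ofReal_norm, ← ofReal_norm, ← ofReal_norm, pn_smul,
    ofReal_mul (by positivity), ofReal_rpow_of_nonneg (by positivity) (pn_pos V).le]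

lemma UC.coef_le [PNormed p V] {J : Type*} [DecidableEq J] {x : J → V} {hx : UBasis x} {C : ℝ≥0∞}
    (h : UC x hx C) {c1 : ℝ≥0∞} (hc1 : ∀ j, c1 ≤ ‖x j‖ₑ) (h0 : c1 ≠ 0) (f : V) (j : J) :
    ‖hx.co f j‖ₑ ^ p ≤ C / c1 * ‖f‖ₑ := by
  have h1 := h.coef f j
  have h2 : ‖hx.co f j‖ₑ ^ p * c1 ≤ C * ‖f‖ₑ := (mul_le_mul_right (hc1 j) _).trans h1
  have h3 : c1 ≠ ∞ := ne_top_of_le_ne_top (by simp) (hc1 j)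
  rw [ENNReal.div_eq_inv_mul, mul_assoc, ← ENNReal.div_eq_inv_mul]
  rwa [ENNReal.le_div_iff_mul_le (Or.inl h0) (Or.inl h3)]

/-- bounded coefficient functionals are continuous -/
def UBasis.coCL [PNormed p V] [CompleteSpace V] {J : Type*} {x : J → V} (hx : UBasis x) (j : J) :
    V →L[ℂ] ℂ where
  toFun := fun f => hx.co f j
  map_add' := fun f g => by rw [hx.co_add]; rfl
  map_smul' := fun c f => by rw [hx.co_smul]; rfl
  cont := by
    classical
    let φ : V →+ ℂ := AddMonoidHom.mk' (fun f => hx.co f j) (fun f g => by rw [hx.co_add]; rfl)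
    apply continuous_of_continuousAt_zero φ
    show Tendsto _ _ _
    rw [map_zero, tendsto_zero_iff_norm_tendsto_zero]
    obtain ⟨C, hC, h⟩ := hx.const
    have hp : 0 < p := pn_pos V
    have hxj : 0 < ‖x j‖ := norm_pos_iff.2 (hx.ne_zero j)
    have h1 : Tendsto (fun f : V => (C / ‖x j‖ * ‖f‖) ^ (1 / p)) (𝓝 0) (𝓝 0) := by
      have h5 : Tendsto (fun f : V => C / ‖x j‖ * ‖f‖) (𝓝 0) (𝓝 0) := by
        simpa using (tendsto_norm (E := V) (x := 0)).const_mul (C / ‖x j‖)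
      have hp' : 0 < 1 / p := by positivity
      have := h5.rpow_const (p := 1 / p) (Or.inr hp'.le)
      rwa [Real.zero_rpow hp'.ne'] at this
    refine squeeze_zero (fun _ => norm_nonneg _) (fun f => ?_) h1
    have h2 := h f {j}
    rw [sum_singleton, pn_smul] at h2
    have h3 : ‖hx.co f j‖ ^ p ≤ C / ‖x j‖ * ‖f‖ := by rw [div_mul_eq_mul_div, le_div_iff₀ hxj]; exact h2
    have := Real.rpow_le_rpow (by positivity) h3 (by positivity : 0 ≤ 1 / p)
    rwa [← Real.rpow_mul (norm_nonneg _), mul_one_div_cancel hp.ne', Real.rpow_one] at this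

lemma UBasis.coCL_apply [PNormed p V] [CompleteSpace V] {J : Type*} {x : J → V} (hx : UBasis x)
    (j : J) (f : V) : hx.coCL j f = hx.co f j := rfl
end signs

namespace WS
variable {Ω 𝒯 K J : Type*} [MeasurableSpace Ω] [Countable K] [Countable 𝒯] [Countable J]

/-- square of the block norm -/
def blk (ι : K → 𝒯) (u : K → ℝ≥0∞) (T : 𝒯) : ℝ≥0∞ := ∑' k, (ι ⁻¹' {T}).indicator (fun k => u k ^ 2) k

lemma sq_comap (B : WS Ω 𝒯) (ι : K → 𝒯) (u : K → ℝ≥0∞) (θ : Ω) :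
    (B.comap ι).sq u θ = ∑' T, blk ι u T * B.g T θ := by
  unfold blk
  simp_rw [← ENNReal.tsum_mul_right]
  rw [ENNReal.tsum_comm]
  unfold sq
  congr 1; ext k
  rw [tsum_eq_single (ι k)]
  · simp [comap]
  · intro T hT
    have : k ∉ ι ⁻¹' {T} := fun h => hT (by simpa using h.symm)
    simp [this]

lemma half_sq (a : ℝ≥0∞) : (a ^ (1 / 2 : ℝ)) ^ 2 = a := by rw [← rpow_natCast, ← rpow_mul]; norm_num

lemma Ph_comap (B : WS Ω 𝒯) (ι : K → 𝒯) (u : K → ℝ≥0∞) :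
    (B.comap ι).Ph u = B.Ph (fun T => (blk ι u T) ^ (1 / 2 : ℝ)) := by
  unfold Ph
  simp_rw [sq_comap]
  unfold sq
  simp_rw [half_sq]
  rfl

lemma Ph_block (B : WS Ω 𝒯) (ι : K → 𝒯) (u : K → ℝ≥0∞) (T : 𝒯) :
    (B.comap ι).Ph ((ι ⁻¹' {T}).indicator u) = (blk ι u T) ^ (B.p / 2) := by
  classical
  have h : ∀ T', blk ι ((ι ⁻¹' {T}).indicator u) T' = if T' = T then blk ι u T else 0 := fun T' => by
    unfold blk
    split_ifs with h
    · subst h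
      congr 1; ext k
      by_cases hk : k ∈ ι ⁻¹' {T'} <;> simp [hk]
    · rw [ENNReal.tsum_eq_zero]
      intro k
      by_cases hk : k ∈ ι ⁻¹' {T'}
      · have : k ∉ ι ⁻¹' {T} := fun h2 => by
          simp only [Set.mem_preimage, Set.mem_singleton_iff] at hk h2
          exact h (hk ▸ h2)
        simp [this]
      · simp [hk]
  rw [Ph_comap]
  have h2 : (fun T' => (blk ι ((ι ⁻¹' {T}).indicator u) T') ^ (1 / 2 : ℝ))
      = fun T' => if T' = T then (blk ι u T) ^ (1 / 2 : ℝ) else 0 := by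
    ext T'
    rw [h]
    split_ifs <;> simp
  rw [h2, Ph_single, ← rpow_mul]
  congr 1; ring

/-- restriction to a set of coordinates -/
def res (W : WS Ω K) (S : Set K) (c : W.F) : W.F := W.pn.mk' (S.indicator (W.cd c)) (by
  refine lt_of_le_of_lt (W.Ph_mono (fun k => ?_)) (PN.val_lt c)
  by_cases h : k ∈ S
  · simp [h, cd]
  · simp [h])

lemma cd_res (W : WS Ω K) (S : Set K) (c : W.F) (k : K) :
    W.cd (W.res S c) k = S.indicator (W.cd c) k := rfl

/-- square functional of a finite family -/
def SQ (W : WS Ω K) {J : Type*} (G : Finset J) (y : J → W.F) : ℝ≥0∞ :=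
  ∫⁻ θ, (∑ j ∈ G, W.sq (fun k => ‖W.cd (y j) k‖ₑ) θ) ^ (W.p / 2) ∂W.μ

lemma SQ_low [DecidableEq J] (W : WS Ω K) (G : Finset J) (y : J → W.F) :
    2 ^ G.card * W.SQ G y ≤ 12 * ∑ A ∈ G.powerset, ‖∑ j ∈ G, sg A j • y j‖ₑ := by
  simp_rw [enorm_F]
  unfold SQ Ph
  have hm : ∀ u : K → ℝ≥0∞, Measurable (fun θ => (W.sq u θ) ^ (W.p / 2)) :=
    fun v => (W.sq_meas v).pow_const _
  rw [← lintegral_finsetSum _ (fun A _ => hm _), ← lintegral_const_mul _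
    (Finset.measurable_fun_sum _ (fun A _ => hm _)), ← lintegral_const_mul]
  · refine lintegral_mono (fun θ => ?_)
    have := khin_lower_tsum (fun k => W.g k θ) W.hp (by linarith [W.hp1]) G (fun j k => W.cd (y j) k)
    simpa only [sq, cd_sum, cd_smul] using this
  · exact (Finset.measurable_fun_sum _ (fun A _ => W.sq_meas _)).pow_const _

lemma SQ_up [DecidableEq J] (W : WS Ω K) (G : Finset J) (y : J → W.F) :
    ∑ A ∈ G.powerset, ‖∑ j ∈ G, sg A j • y j‖ₑ ≤ 2 ^ G.card * W.SQ G y := by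
  simp_rw [enorm_F]
  unfold SQ Ph
  have hm : ∀ u : K → ℝ≥0∞, Measurable (fun θ => (W.sq u θ) ^ (W.p / 2)) :=
    fun v => (W.sq_meas v).pow_const _
  rw [← lintegral_finsetSum _ (fun A _ => hm _), ← lintegral_const_mul]
  · refine lintegral_mono (fun θ => ?_)
    have := khin_upper_tsum (fun k => W.g k θ) W.hp (by linarith [W.hp1]) G (fun j k => W.cd (y j) k)
    simpa only [sq, cd_sum, cd_smul] using this
  · exact (Finset.measurable_fun_sum _ (fun A _ => W.sq_meas _)).pow_const _

/-- model for a basis -/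
def Mod (B : WS Ω 𝒯) {V J : Type*} [NormedAddCommGroup V] [Module ℂ V] [DecidableEq J]
    (x : J → V) (I : J → 𝒯) (C : ℝ≥0∞) : Prop :=
  ∀ (c : J → ℂ) (G : Finset J),
    ‖∑ j ∈ G, c j • x j‖ₑ ≤ C * (B.comap I).Ph (fun j => if j ∈ G then ‖c j‖ₑ else 0) ∧
    (B.comap I).Ph (fun j => if j ∈ G then ‖c j‖ₑ else 0) ≤ C * ‖∑ j ∈ G, c j • x j‖ₑ

end WS

namespace WS
variable {Ω 𝒯 K J : Type*} [MeasurableSpace Ω] [Countable K] [Countable 𝒯] [Countable J]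

lemma enorm_res (B : WS Ω 𝒯) (ι : K → 𝒯) (c : (B.comap ι).F) (T : 𝒯) :
    ‖(B.comap ι).res (ι ⁻¹' {T}) c‖ₑ = (blk ι (fun k => ‖(B.comap ι).cd c k‖ₑ) T) ^ (B.p / 2) := by
  rw [enorm_F, ← Ph_block]
  congr 1; ext k
  rw [cd_res]
  by_cases h : k ∈ ι ⁻¹' {T} <;> simp [h]

lemma big_block [DecidableEq J] (B : WS Ω 𝒯) (hE : B.Emb) (ι : K → 𝒯) (x : J → (B.comap ι).F)
    (hx : UBasis x) {C c1 C1 : ℝ≥0∞} (hC : C ≠ ∞) (hU : UC x hx C) (hc1 : c1 ≠ 0)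
    (hC1 : C1 ≠ ∞) (hlow : ∀ j, c1 ≤ ‖x j‖ₑ) (hup : ∀ j, ‖x j‖ₑ ≤ C1) :
    ∃ δ : ℝ≥0∞, δ ≠ 0 ∧ ∀ j, ∃ T, δ ≤ ‖hx.co ((B.comap ι).res (ι ⁻¹' {T}) (x j)) j‖ₑ := by
  classical
  obtain ⟨q, CE, hq0, hq1, hCE, hEmb⟩ := hE
  have hp := B.hp
  set D : ℝ≥0∞ := (C / c1) ^ (1 / B.p) with hD
  have hDf : D ≠ ∞ := (rpow_lt_top_of_nonneg (by positivity)
    (div_ne_top hC hc1)).ne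
  set M : ℝ≥0∞ := D ^ q * (CE * C1 ^ (q / B.p)) with hM
  have hMf : M ≠ ∞ := by
    refine mul_ne_top (rpow_lt_top_of_nonneg hq0.le hDf).ne
      (mul_ne_top hCE (rpow_lt_top_of_nonneg (by positivity) hC1).ne)
  set δ : ℝ≥0∞ := ((M + 1)⁻¹) ^ (1 / (1 - q)) with hδ
  have h1q : 0 < 1 - q := by linarith
  have hδ0 : δ ≠ 0 := by
    have : 0 < (M + 1)⁻¹ := ENNReal.inv_pos.2 (by simp [hMf])
    exact (rpow_pos this (by simp)).ne'
  have hδq : δ ^ (1 - q) * M < 1 := by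
    rw [hδ, ← rpow_mul, one_div_mul_cancel h1q.ne', rpow_one, mul_comm,
      ← div_eq_mul_inv]
    rw [ENNReal.div_lt_iff (by simp) (by simp [hMf])]
    rw [one_mul]
    exact lt_add_right hMf one_ne_zero
  refine ⟨δ, hδ0, fun j => ?_⟩
  by_contra hcon
  push Not at hcon
  set t : 𝒯 → ℂ := fun T => hx.co ((B.comap ι).res (ι ⁻¹' {T}) (x j)) j with ht
  have hsum : ∀ f : (B.comap ι).F, HasSum (fun k => (B.comap ι).cd f k * hx.co ((B.comap ι).e k) j) (hx.co f j) := fun f => by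
    have := ((B.comap ι).hasSum_e f).mapL (hx.coCL j)
    simpa only [map_smul, smul_eq_mul, UBasis.coCL_apply] using this
  have ht1 : HasSum t 1 := by
    have h1 := (hsum (x j)).tsum_fiberwise ι
    rw [hx.co_self j, Pi.single_eq_same] at h1
    have hT : t = fun T => ∑' b : ι ⁻¹' {T}, (B.comap ι).cd (x j) b * hx.co ((B.comap ι).e b) j := by
     ext T
     rw [tsum_subtype (ι ⁻¹' {T}) (fun k => (B.comap ι).cd (x j) k * hx.co ((B.comap ι).e k) j),
      ht]
     simp only
     rw [← (hsum ((B.comap ι).res (ι ⁻¹' {T}) (x j))).tsum_eq]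
     congr 1; ext k
     rw [cd_res]
     by_cases h : k ∈ ι ⁻¹' {T} <;> simp [h]
    rw [hT]; exact h1
  have hle : (1 : ℝ≥0∞) ≤ ∑' T, ‖t T‖ₑ := by
    have h1 := ht1.tsum_eq
    have : ‖∑' T, t T‖ₑ ≤ ∑' T, ‖t T‖ₑ := enorm_tsum_le_tsum_enorm
    rw [h1] at this
    simpa using this
  set s : 𝒯 → ℝ≥0∞ := fun T => (blk ι (fun k => ‖(B.comap ι).cd (x j) k‖ₑ) T) ^ (1 / 2 : ℝ) with hs
  have hts : ∀ T, ‖t T‖ₑ ≤ D * s T := fun T => by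
    have h1 := hU.coef_le hlow hc1 ((B.comap ι).res (ι ⁻¹' {T}) (x j)) j
    rw [enorm_res] at h1
    have h2 := rpow_le_rpow h1 (by positivity : 0 ≤ 1 / B.p)
    rw [← rpow_mul, mul_rpow_of_nonneg _ _ (by positivity), ← rpow_mul] at h2
    have e1 : (B.comap ι).pn.p * (1 / B.p) = 1 := mul_one_div_cancel hp.ne'
    have e2 : B.p / 2 * (1 / B.p) = 1 / 2 := by field_simp
    rw [e1, e2, rpow_one] at h2
    exact h2
  have hsq : ∑' T, s T ^ q ≤ CE * C1 ^ (q / B.p) := by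
    refine (hEmb s).trans ?_
    rw [hs, ← Ph_comap, ← enorm_F]
    gcongr
    exact hup j
  have : ∑' T, ‖t T‖ₑ ≤ δ ^ (1 - q) * M := by
    have hpt : ∀ T, ‖t T‖ₑ ≤ δ ^ (1 - q) * (D ^ q * s T ^ q) := fun T => by
      have e : ‖t T‖ₑ = ‖t T‖ₑ ^ (1 - q) * ‖t T‖ₑ ^ q := by rw [← rpow_add_of_nonneg _ _ h1q.le hq0.le]; simp
      rw [e, ← mul_rpow_of_nonneg _ _ hq0.le]
      gcongr
      · exact (hcon T).le
      · exact hts T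
    refine (ENNReal.tsum_le_tsum hpt).trans ?_
    rw [ENNReal.tsum_mul_left, ENNReal.tsum_mul_left]
    rw [hM]
    gcongr
  exact absurd (hle.trans this) (not_le.2 hδq)

/-- Lemma A -/
theorem lemmaA [DecidableEq J] (B : WS Ω 𝒯) (ι : K → 𝒯) (x : J → (B.comap ι).F)
    (hx : UBasis x) {C c1 C1 δ : ℝ≥0∞} (hC : C ≠ ∞) (hU : UC x hx C) (hc1 : c1 ≠ 0)
    (hC1 : C1 ≠ ∞) (hlow : ∀ j, c1 ≤ ‖x j‖ₑ) (hup : ∀ j, ‖x j‖ₑ ≤ C1)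
    (hδ : δ ≠ 0) (I : J → 𝒯)
    (hI : ∀ j, δ ≤ ‖hx.co ((B.comap ι).res (ι ⁻¹' {I j}) (x j)) j‖ₑ) :
    ∃ C' : ℝ≥0∞, C' ≠ ∞ ∧ B.Mod x I C' := by
  classical
  have hp := B.hp
  have hp2 : 0 < (B.comap ι).p / 2 := (B.comap ι).hp2
  have h2n : ∀ G : Finset J, (2 : ℝ≥0∞) ^ G.card ≠ 0 ∧ (2 : ℝ≥0∞) ^ G.card ≠ ∞ := fun G => by constructor <;> simp
  set y : J → (B.comap ι).F := fun j => (B.comap ι).res (ι ⁻¹' {I j}) (x j) with hy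
  -- block norm bounds
  have hyn : ∀ j, ‖y j‖ₑ = (blk ι (fun k => ‖(B.comap ι).cd (x j) k‖ₑ) (I j)) ^ (B.p / 2) :=
    fun j => enorm_res B ι (x j) (I j)
  set b : J → ℝ≥0∞ := fun j => blk ι (fun k => ‖(B.comap ι).cd (x j) k‖ₑ) (I j) with hb
  have hyup : ∀ j, ‖y j‖ₑ ≤ C1 := fun j => by
    refine le_trans ?_ (hup j)
    rw [enorm_F, enorm_F]
    refine (B.comap ι).Ph_mono (fun k => ?_)
    simp only [hy]; rw [cd_res]
    by_cases h : k ∈ ι ⁻¹' {I j} <;> simp [h]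
  have hylow : ∀ j, δ ^ B.p / (C / c1) ≤ ‖y j‖ₑ := fun j => by
    have h1 := (rpow_le_rpow (hI j) hp.le).trans (hU.coef_le hlow hc1 (y j) j)
    exact div_le_of_le_mul' h1
  set η := δ ^ B.p / (C / c1) with hη
  have hη0 : η ≠ 0 := by
    rw [hη]
    refine (ENNReal.div_pos ?_ (div_ne_top hC hc1)).ne'
    intro h
    rw [rpow_eq_zero_iff] at h
    rcases h with h | h
    · exact hδ h.1
    · linarith [h.2]
  have hsqy : ∀ j θ, (B.comap ι).sq (fun k => ‖(B.comap ι).cd (y j) k‖ₑ) θ = b j * B.g (I j) θ := fun j θ => by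
    unfold sq
    rw [hb]
    simp only [blk]
    rw [← ENNReal.tsum_mul_right]
    congr 1; ext k
    simp only [hy]; rw [cd_res]
    by_cases h : k ∈ ι ⁻¹' {I j}
    · have : ι k = I j := h
      simp [h, comap, this]
    · simp [h]
  have hsqle : ∀ j θ, (B.comap ι).sq (fun k => ‖(B.comap ι).cd (y j) k‖ₑ) θ ≤ (B.comap ι).sq (fun k => ‖(B.comap ι).cd (x j) k‖ₑ) θ := fun j θ => by
    refine ENNReal.tsum_le_tsum (fun k => ?_)
    simp only [hy]; rw [cd_res]
    by_cases h : k ∈ ι ⁻¹' {I j} <;> simp [h]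
  have hsqs : ∀ (a : ℂ) (f : (B.comap ι).F) θ, (B.comap ι).sq (fun k => ‖(B.comap ι).cd (a • f) k‖ₑ) θ
      = ‖a‖ₑ ^ 2 * (B.comap ι).sq (fun k => ‖(B.comap ι).cd f k‖ₑ) θ := fun a f θ => by
    unfold sq
    rw [← ENNReal.tsum_mul_left]
    congr 1; ext k
    simp only [cd_smul, enorm_mul]; ring
  -- SQ of c_j y_j compared with the model
  have hmod : ∀ (c : J → ℂ) (G : Finset J) θ,
      (B.comap I).sq (fun j => if j ∈ G then ‖c j‖ₑ else 0) θ = ∑ j ∈ G, ‖c j‖ₑ ^ 2 * B.g (I j) θ := fun c G θ => by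
    unfold sq
    rw [tsum_eq_sum (s := G)]
    · refine sum_congr rfl (fun j hj => ?_)
      simp [hj, comap]
    · intro j hj; simp [hj]
  have hSy1 : ∀ (c : J → ℂ) (G : Finset J), (B.comap ι).SQ G (fun j => c j • y j) ≤
      C1 * (B.comap I).Ph (fun j => if j ∈ G then ‖c j‖ₑ else 0) := fun c G => by
    unfold SQ Ph
    rw [← lintegral_const_mul' _ _ hC1]
    refine lintegral_mono (fun θ => ?_)
    rw [hmod]
    simp_rw [hsqs, hsqy]
    have hbC : ∀ j, b j ≤ C1 ^ (2 / B.p) := fun j => by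
      have h1 := hyup j
      rw [hyn] at h1
      have h2 := rpow_le_rpow h1 (by positivity : 0 ≤ 2 / B.p)
      rw [← rpow_mul] at h2
      have : B.p / 2 * (2 / B.p) = 1 := by field_simp
      rwa [this, rpow_one] at h2
    calc (∑ j ∈ G, ‖c j‖ₑ ^ 2 * (b j * B.g (I j) θ)) ^ ((B.comap ι).p / 2)
        ≤ (∑ j ∈ G, C1 ^ (2 / B.p) * (‖c j‖ₑ ^ 2 * B.g (I j) θ)) ^ ((B.comap ι).p / 2) := by
          refine rpow_le_rpow (sum_le_sum (fun j _ => ?_)) hp2.le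
          rw [mul_left_comm]
          gcongr
          exact hbC j
      _ = C1 * (∑ j ∈ G, ‖c j‖ₑ ^ 2 * B.g (I j) θ) ^ (B.p / 2) := by
          rw [← mul_sum, mul_rpow_of_nonneg _ _ hp2.le, ← rpow_mul]
          have : 2 / B.p * ((B.comap ι).p / 2) = 1 := by
            show 2 / B.p * (B.p / 2) = 1
            field_simp
          rw [this, rpow_one]; rfl
  have hSy2 : ∀ (c : J → ℂ) (G : Finset J),
      η * (B.comap I).Ph (fun j => if j ∈ G then ‖c j‖ₑ else 0) ≤ (B.comap ι).SQ G (fun j => c j • x j) := fun c G => by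
    by_cases hG : G = ∅
    · subst hG
      simp [Ph_zero]
    obtain ⟨j0, -⟩ := Finset.nonempty_iff_ne_empty.2 hG
    have hηf : η ≠ ∞ := ne_top_of_le_ne_top (by simp) (hylow j0)
    unfold SQ Ph
    rw [← lintegral_const_mul' _ _ hηf]
    refine lintegral_mono (fun θ => ?_)
    rw [hmod]
    have hbC : ∀ j, η ^ (2 / B.p) ≤ b j := fun j => by
      have h1 := hylow j
      rw [hyn] at h1
      have h2 := rpow_le_rpow h1 (by positivity : 0 ≤ 2 / B.p)
      rw [← rpow_mul] at h2
      have : B.p / 2 * (2 / B.p) = 1 := by field_simp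
      rwa [this, rpow_one] at h2
    calc η * (∑ j ∈ G, ‖c j‖ₑ ^ 2 * B.g (I j) θ) ^ (B.p / 2)
        = (∑ j ∈ G, η ^ (2 / B.p) * (‖c j‖ₑ ^ 2 * B.g (I j) θ)) ^ ((B.comap ι).p / 2) := by
          rw [← mul_sum, mul_rpow_of_nonneg _ _ hp2.le, ← rpow_mul]
          have : 2 / B.p * ((B.comap ι).p / 2) = 1 := by
            show 2 / B.p * (B.p / 2) = 1
            field_simp
          rw [this, rpow_one]; rfl
      _ ≤ _ := by
          refine rpow_le_rpow (sum_le_sum (fun j _ => ?_)) hp2.le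
          rw [hsqs, mul_left_comm]
          gcongr
          refine le_trans ?_ (hsqle j θ)
          rw [hsqy]
          gcongr
          exact hbC j
  -- key estimate
  have hkey : ∀ (c : J → ℂ) (G : Finset J), δ ^ B.p * (B.comap ι).SQ G (fun j => c j • x j) ≤
      (144 * (2 * C) * C1) * (B.comap I).Ph (fun j => if j ∈ G then ‖c j‖ₑ else 0) := fun c G => by
    by_cases hG : G = ∅
    · subst hG
      simp [SQ, hp2]
    obtain ⟨j0, -⟩ := Finset.nonempty_iff_ne_empty.2 hG
    have hδf : δ ≠ ∞ := ne_top_of_le_ne_top (by simp) (hI j0)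
    have hδpf : δ ^ B.p ≠ ∞ := (rpow_lt_top_of_nonneg hp.le hδf).ne
    set v : Finset J → (B.comap ι).F := fun A => ∑ j ∈ G, sg A j • (c j • y j) with hv
    have hv1 : ∑ A ∈ G.powerset, ‖v A‖ₑ ≤ 2 ^ G.card *
        (C1 * (B.comap I).Ph (fun j => if j ∈ G then ‖c j‖ₑ else 0)) :=
      ((B.comap ι).SQ_up G (fun j => c j • y j)).trans (mul_le_mul_right (hSy1 c G) _)
    have hv2 : ∀ A, (B.comap ι).SQ G (fun i => hx.co (v A) i • x i) ≤ 12 * (2 * C * ‖v A‖ₑ) := fun A => by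
      have h1 := (B.comap ι).SQ_low G (fun i => hx.co (v A) i • x i)
      have h2 : ∑ D ∈ G.powerset, ‖∑ j ∈ G, sg D j • (hx.co (v A) j • x j)‖ₑ ≤
          2 ^ G.card * (2 * C * ‖v A‖ₑ) := by
        refine (Finset.sum_le_card_nsmul _ _ (2 * C * ‖v A‖ₑ) (fun D _ => ?_)).trans_eq ?_
        · simp_rw [smul_smul]
          exact hU.sign (v A) G D
        · rw [card_powerset, nsmul_eq_mul]; push_cast; rfl
      have h3 := h1.trans (mul_le_mul_right h2 12)
      rw [mul_left_comm] at h3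
      exact (ENNReal.mul_le_mul_iff_right (h2n G).1 (h2n G).2).1 h3
    have hv3 : 2 ^ G.card * (δ ^ B.p * (B.comap ι).SQ G (fun j => c j • x j)) ≤
        12 * ∑ A ∈ G.powerset, (B.comap ι).SQ G (fun i => hx.co (v A) i • x i) := by
      have hmm : ∀ f : J → (B.comap ι).F, Measurable
          (fun θ => (∑ j ∈ G, (B.comap ι).sq (fun k => ‖(B.comap ι).cd (f j) k‖ₑ) θ) ^ ((B.comap ι).p / 2)) := fun f =>
        (Finset.measurable_fun_sum _ (fun A _ => (B.comap ι).sq_meas _)).pow_const _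
      unfold SQ
      rw [← lintegral_finsetSum _ (fun A _ => hmm _), ← lintegral_const_mul' _ _ (by simp : (12:ℝ≥0∞) ≠ ∞),
        ← lintegral_const_mul' _ _ hδpf, ← lintegral_const_mul' _ _ (h2n G).2]
      refine lintegral_mono (fun θ => ?_)
      set w : J → ℝ≥0∞ := fun i => if i ∈ G then (B.comap ι).sq (fun k => ‖(B.comap ι).cd (x i) k‖ₑ) θ else 0 with hw
      have h1 := khin_lower_tsum w (B.comap ι).hp (by linarith [(B.comap ι).hp1]) G (fun j i => c j * hx.co (y j) i)
      have e1 : ∀ A, ∑' i, ‖∑ j ∈ G, sg A j * (c j * hx.co (y j) i)‖ₑ ^ 2 * w i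
          = ∑ i ∈ G, (B.comap ι).sq (fun k => ‖(B.comap ι).cd (hx.co (v A) i • x i) k‖ₑ) θ := fun A => by
        rw [tsum_eq_sum (s := G) (by intro i hi; simp [hw, hi])]
        refine sum_congr rfl (fun i hi => ?_)
        rw [hsqs, hw]
        simp only [hi, if_true]
        congr 3
        rw [hv, hx.co_sum]
        simp only [hx.co_smul, Finset.sum_apply, Pi.smul_apply, smul_eq_mul]
      simp_rw [e1] at h1
      refine le_trans ?_ h1
      rw [← mul_assoc, mul_assoc]
      refine mul_le_mul_right ?_ _
      calc δ ^ B.p * (∑ j ∈ G, (B.comap ι).sq (fun k => ‖(B.comap ι).cd (c j • x j) k‖ₑ) θ) ^ ((B.comap ι).p / 2)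
          = (∑ j ∈ G, δ ^ 2 * (B.comap ι).sq (fun k => ‖(B.comap ι).cd (c j • x j) k‖ₑ) θ) ^ ((B.comap ι).p / 2) := by
            rw [← mul_sum, mul_rpow_of_nonneg _ _ hp2.le, ← rpow_natCast,
              ← rpow_mul]
            congr 2
            show B.p = ((2:ℕ):ℝ) * (B.p / 2)
            push_cast; ring
        _ ≤ _ := by
            refine rpow_le_rpow (sum_le_sum (fun j hj => ?_)) hp2.le
            refine le_trans ?_ (ENNReal.le_tsum j)
            simp only [hw, hj, if_true]
            rw [hsqs, enorm_mul, mul_pow, ← mul_assoc]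
            gcongr ?_ * _
            rw [mul_comm]
            gcongr
            exact hI j
    have h4 := hv3.trans (mul_le_mul_right (sum_le_sum (fun A _ => hv2 A)) 12)
    rw [← mul_sum, ← mul_sum] at h4
    have h5 := h4.trans (mul_le_mul_right (mul_le_mul_right (mul_le_mul_right hv1 _) _) _)
    refine (ENNReal.mul_le_mul_iff_right (h2n G).1 (h2n G).2).1 (h5.trans_eq ?_)
    have : (144 : ℝ≥0∞) = 12 * 12 := by norm_num
    rw [this]
    ring
  have havg1 : ∀ (c : J → ℂ) (G : Finset J), ‖∑ j ∈ G, c j • x j‖ₑ ≤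
      2 * C * (B.comap ι).SQ G (fun j => c j • x j) := fun c G => by
    have h1 : (2:ℝ≥0∞) ^ G.card * ‖∑ j ∈ G, c j • x j‖ₑ ≤
        ∑ A ∈ G.powerset, 2 * C * ‖∑ j ∈ G, sg A j • (c j • x j)‖ₑ := by
      have := Finset.card_nsmul_le_sum G.powerset
        (fun A => 2 * C * ‖∑ j ∈ G, sg A j • (c j • x j)‖ₑ) ‖∑ j ∈ G, c j • x j‖ₑ (fun A _ => by
          simp_rw [smul_smul]
          exact hU.sign'' c G A)
      rw [card_powerset, nsmul_eq_mul] at this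
      push_cast at this
      exact this
    rw [← mul_sum] at h1
    have h2 := h1.trans (mul_le_mul_right ((B.comap ι).SQ_up G (fun j => c j • x j)) _)
    rw [mul_left_comm] at h2
    exact (ENNReal.mul_le_mul_iff_right (h2n G).1 (h2n G).2).1 h2
  have havg2 : ∀ (c : J → ℂ) (G : Finset J), (B.comap ι).SQ G (fun j => c j • x j) ≤
      12 * (2 * C * ‖∑ j ∈ G, c j • x j‖ₑ) := fun c G => by
    have h1 := (B.comap ι).SQ_low G (fun i => c i • x i)
    have h2 : ∑ D ∈ G.powerset, ‖∑ j ∈ G, sg D j • (c j • x j)‖ₑ ≤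
        2 ^ G.card * (2 * C * ‖∑ j ∈ G, c j • x j‖ₑ) := by
      refine (Finset.sum_le_card_nsmul _ _ (2 * C * ‖∑ j ∈ G, c j • x j‖ₑ) (fun D _ => ?_)).trans_eq ?_
      · simp_rw [smul_smul]
        exact hU.sign' c G D
      · rw [card_powerset, nsmul_eq_mul]; push_cast; rfl
    have h3 := h1.trans (mul_le_mul_right h2 12)
    rw [mul_left_comm] at h3
    exact (ENNReal.mul_le_mul_iff_right (h2n G).1 (h2n G).2).1 h3
  have hδp0 : δ ^ B.p ≠ 0 := fun h => by
    rw [rpow_eq_zero_iff] at h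
    rcases h with h | h
    · exact hδ h.1
    · linarith [h.2]
  refine ⟨max (2 * C * ((144 * (2 * C) * C1) / δ ^ B.p)) (12 * (2 * C) / η), ?_, ?_⟩
  · rw [← lt_top_iff_ne_top]
    refine max_lt ?_ ?_
    · refine mul_lt_top (mul_lt_top (by simp) hC.lt_top) (div_lt_top ?_ hδp0)
      exact mul_ne_top (mul_ne_top (by simp) (mul_ne_top (by simp) hC)) hC1
    · exact div_lt_top (mul_ne_top (by simp) (mul_ne_top (by simp) hC)) hη0
  intro c G
  by_cases hG : G = ∅
  · subst hG
    simp [Ph_zero]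
  obtain ⟨j0, -⟩ := Finset.nonempty_iff_ne_empty.2 hG
  have hδf : δ ≠ ∞ := ne_top_of_le_ne_top (by simp) (hI j0)
  have hδpf : δ ^ B.p ≠ ∞ := (rpow_lt_top_of_nonneg hp.le hδf).ne
  have hηf : η ≠ ∞ := ne_top_of_le_ne_top (by simp) (hylow j0)
  constructor
  · refine (havg1 c G).trans ?_
    refine le_trans ?_ (mul_le_mul_left (le_max_left _ _) _)
    rw [mul_assoc (2 * C)]
    refine mul_le_mul_right ?_ _
    rw [ENNReal.div_eq_inv_mul, mul_assoc, ← ENNReal.div_eq_inv_mul]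
    rw [ENNReal.le_div_iff_mul_le (Or.inl hδp0) (Or.inl hδpf), mul_comm]
    exact hkey c G
  · refine le_trans ?_ (mul_le_mul_left (le_max_right _ _) _)
    rw [ENNReal.div_eq_inv_mul, mul_assoc, ← ENNReal.div_eq_inv_mul]
    rw [ENNReal.le_div_iff_mul_le (Or.inl hη0) (Or.inl hηf), mul_comm, mul_assoc]
    exact (hSy2 c G).trans (havg2 c G)

end WS

namespace WS
variable {Ω 𝒯 K J : Type*} [MeasurableSpace Ω] [Countable K] [Countable 𝒯] [Countable J]

/-- finite version of the functional for an index map -/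
def Pf (B : WS Ω 𝒯) (I : J → 𝒯) (c : J → ℂ) (G : Finset J) : ℝ≥0∞ :=
  ∫⁻ θ, (∑ j ∈ G, ‖c j‖ₑ ^ 2 * B.g (I j) θ) ^ (B.p / 2) ∂B.μ

lemma Ph_fin [DecidableEq J] (B : WS Ω 𝒯) (I : J → 𝒯) (c : J → ℂ) (G : Finset J) :
    (B.comap I).Ph (fun j => if j ∈ G then ‖c j‖ₑ else 0) = B.Pf I c G := by
  unfold Ph Pf
  refine lintegral_congr (fun θ => ?_)
  congr 1
  unfold sq
  rw [tsum_eq_sum (s := G)]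
  · refine sum_congr rfl (fun j hj => ?_)
    simp [hj, comap]
  · intro j hj; simp [hj]

lemma enorm_fin [DecidableEq J] (B : WS Ω 𝒯) (I : J → 𝒯) (c : J → ℂ) (G : Finset J) :
    ‖∑ j ∈ G, c j • (B.comap I).e j‖ₑ = B.Pf I c G := by
  rw [enorm_F, ← Ph_fin]
  congr 1; ext k
  rw [cd_fin]
  split_ifs <;> simp

lemma iso [DecidableEq J] (B : WS Ω 𝒯) (I : J → 𝒯) {p : ℝ} {V : Type*} [NormedAddCommGroup V]
    [Module ℂ V] [PNormed p V] [CompleteSpace V] {x : J → V} (hx : UBasis x) {C : ℝ≥0∞}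
    (hC : C ≠ ∞) (hM : B.Mod x I C) :
    ∃ Θ : (B.comap I).F ≃L[ℂ] V, (∀ j, Θ ((B.comap I).e j) = x j) ∧
      (∀ c, ‖Θ c‖ₑ ≤ C * ‖c‖ₑ) ∧ (∀ c, ‖c‖ₑ ≤ C * ‖Θ c‖ₑ) := by
  obtain ⟨T, hT⟩ := (B.comap I).extend x C hC (fun c G => (hM c G).1)
  have hTe : ∀ j, T ((B.comap I).e j) = x j := fun j => by
    refine (hT _).unique ?_
    have := hasSum_single (f := fun k => (B.comap I).cd ((B.comap I).e j) k • x k) j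
      (fun k hk => by simp [cd_e, hk])
    simpa [cd_e] using this
  have hup : ∀ c, ‖T c‖ₑ ≤ C * ‖c‖ₑ := fun c => by
    have h1 : Tendsto (fun G : Finset J => ‖∑ j ∈ G, (B.comap I).cd c j • x j‖ₑ) atTop (𝓝 ‖T c‖ₑ) :=
      (continuous_enorm.tendsto _).comp (hT c)
    refine le_of_tendsto' h1 (fun G => ((hM _ G).1).trans (mul_le_mul_right ?_ _))
    rw [enorm_F]
    exact Ph_mono _ (fun k => by split_ifs <;> simp)
  have hlow : ∀ c, ‖c‖ₑ ≤ C * ‖T c‖ₑ := fun c => by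
    have h1 : Tendsto (fun G : Finset J => C * ‖∑ j ∈ G, (B.comap I).cd c j • x j‖ₑ) atTop
        (𝓝 (C * ‖T c‖ₑ)) :=
      ENNReal.Tendsto.const_mul ((continuous_enorm.tendsto _).comp (hT c)) (Or.inr hC)
    have h2 : Tendsto (fun G : Finset J => ‖∑ j ∈ G, (B.comap I).cd c j • (B.comap I).e j‖ₑ) atTop
        (𝓝 ‖c‖ₑ) := (continuous_enorm.tendsto _).comp ((B.comap I).hasSum_e c)
    refine le_of_tendsto_of_tendsto' h2 h1 (fun G => ?_)
    rw [enorm_fin, ← Ph_fin]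
    exact (hM _ G).2
  have hinj : Function.Injective T := by
    rw [injective_iff_map_eq_zero]
    intro c hc
    have := hlow c
    rw [hc] at this
    simpa using this
  have hsurj : Function.Surjective T := fun f => by
    have hs : Summable (fun j => hx.co f j • (B.comap I).e j) := by
      rw [summable_iff_vanishing_norm]
      intro ε hε
      have h0 := (hx.hasSum f).summable
      rw [summable_iff_vanishing_norm] at h0
      obtain ⟨s, hs⟩ := h0 (ε / (C.toReal + 1)) (by positivity)
      refine ⟨s, fun t ht => ?_⟩
      have h1 := hs t ht
      have h2 := (hM (hx.co f) t).2
      rw [Ph_fin, ← enorm_fin] at h2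
      have h3 := toReal_mono (mul_ne_top hC (by simp)) h2
      rw [toReal_mul] at h3
      simp only [toReal_enorm] at h3
      refine h3.trans_lt ?_
      rw [lt_div_iff₀ (by positivity)] at h1
      nlinarith [norm_nonneg (∑ j ∈ t, hx.co f j • x j), toReal_nonneg (a := C)]
    refine ⟨∑' j, hx.co f j • (B.comap I).e j, ?_⟩
    have h1 := hs.hasSum.mapL T
    simp only [map_smul, hTe] at h1
    exact h1.unique (hx.hasSum f)
  let e : (B.comap I).F ≃ₗ[ℂ] V := LinearEquiv.ofBijective T.toLinearMap ⟨hinj, hsurj⟩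
  refine ⟨⟨e, T.continuous, ?_⟩, hTe, hup, hlow⟩
  refine AddMonoidHomClass.continuous_of_bound e.symm C.toReal (fun f => ?_)
  have h2 := hlow (e.symm f)
  have h4 : T (e.symm f) = f := e.apply_symm_apply f
  rw [h4] at h2
  have h3 := toReal_mono (mul_ne_top hC (by simp)) h2
  rw [toReal_mul] at h3
  simpa only [toReal_enorm] using h3

lemma Pf_map (B : WS Ω 𝒯) (I : J → 𝒯) (h : K ↪ J) (c : J → ℂ) (G : Finset K) :
    B.Pf I c (G.map h) = B.Pf (I ∘ h) (c ∘ h) G := by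
  unfold Pf
  simp

lemma Pf_mono (B : WS Ω 𝒯) (I : J → 𝒯) (c : J → ℂ) {G G' : Finset J} (h : G ⊆ G') :
    B.Pf I c G ≤ B.Pf I c G' := by
  have := B.hp
  unfold Pf
  gcongr

lemma Pf_congr (B : WS Ω 𝒯) {I I' : J → 𝒯} {c c' : J → ℂ} {G : Finset J}
    (h : ∀ j ∈ G, I j = I' j) (h' : ∀ j ∈ G, c j = c' j) : B.Pf I c G = B.Pf I' c' G := by
  unfold Pf
  refine lintegral_congr (fun θ => ?_)
  congr 1
  exact sum_congr rfl (fun j hj => by rw [h j hj, h' j hj])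

lemma Pf_split (B : WS Ω 𝒯) (I : J → 𝒯) (c : J → ℂ) (G : Finset J) (P : J → Prop)
    [DecidablePred P] :
    B.Pf I c G ≤ B.Pf I c (G.filter P) + B.Pf I c (G.filter (fun j => ¬ P j)) := by
  have := B.hp
  have := B.hp1
  unfold Pf
  rw [← lintegral_add_left]
  · refine lintegral_mono (fun θ => ?_)
    rw [← Finset.sum_filter_add_sum_filter_not G P]
    exact rpow_add_le_add_rpow _ _ (by positivity) (by linarith)
  · exact (Finset.measurable_fun_sum _ (fun j _ => (B.gm _).const_mul _)).pow_const _

/-- equivalence of index maps -/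
def Eqv (B : WS Ω 𝒯) (I I' : J → 𝒯) (C : ℝ≥0∞) : Prop :=
  ∀ c G, B.Pf I c G ≤ C * B.Pf I' c G ∧ B.Pf I' c G ≤ C * B.Pf I c G

lemma Eqv.comp {B : WS Ω 𝒯} {I I' : J → 𝒯} {C : ℝ≥0∞} (h : B.Eqv I I' C) (f : K ↪ J) :
    B.Eqv (I ∘ f) (I' ∘ f) C := fun c G => by
  classical
  have := h (Function.extend f c 0) (G.map f)
  rw [Pf_map, Pf_map] at this
  have e : Function.extend f c 0 ∘ f = c := by ext k; simp [f.injective.extend_apply]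
  rwa [e] at this

/-- finitely many blocks -/
lemma fin_values (B : WS Ω 𝒯) (hE : B.Emb) {N' : Type*} {C : ℝ≥0∞} (hC : C ≠ ∞)
    [Countable N'] (I : 𝒯 × N' → 𝒯) (h : B.Eqv I Prod.fst C) (T : 𝒯) :
    (Set.range (fun n => I (T, n))).Finite := by
  classical
  rcases isEmpty_or_nonempty N' with hN' | hN'
  · exact Set.toFinite _
  by_contra hinf
  obtain ⟨q, CE, hq0, hq1, hCE, hEmb⟩ := hE
  have hp := B.hp
  have key : ∀ N : ℕ, (N : ℝ≥0∞) ≤ CE * (C ^ (q / B.p) * (N : ℝ≥0∞) ^ (q / 2)) := fun N => by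
    obtain ⟨S, hS, hcard⟩ := Set.Infinite.exists_subset_card_eq hinf N
    choose! r hr using (fun s (hs : s ∈ S) => hS hs)
    have hrinj : InjOn r S := fun a ha b hb hab => by rw [← hr a ha, ← hr b hb, hab]
    set G : Finset (𝒯 × N') := S.image (fun s => (T, r s)) with hG
    have hinj : InjOn (fun s => (T, r s)) (S : Set 𝒯) := fun a ha b hb hab =>
      hrinj ha hb (Prod.ext_iff.1 hab).2
    have h1 := (h (fun _ => 1) G).1
    have e1 : B.Pf I (fun _ => 1) G = B.Ph (fun s => if s ∈ S then 1 else 0) := by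
      unfold Pf Ph
      refine lintegral_congr (fun θ => ?_)
      congr 1
      unfold sq
      rw [hG, sum_image hinj, tsum_eq_sum (s := S) (by intro s hs; simp [hs])]
      refine sum_congr rfl (fun s hs => ?_)
      have : I (T, r s) = s := hr s hs
      simp [hs, this]
    have e2 : B.Pf Prod.fst (fun _ => (1:ℂ)) G = (N : ℝ≥0∞) ^ (B.p / 2) := by
      unfold Pf
      rw [hG]
      simp_rw [sum_image hinj]
      simp only [enorm_one, one_pow, one_mul, sum_const, hcard, nsmul_eq_mul]
      simp_rw [mul_rpow_of_nonneg _ _ B.hp2.le]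
      rw [lintegral_const_mul _ ((B.gm T).pow_const _), B.g1, mul_one]
    have h2 := hEmb (fun s => if s ∈ S then 1 else 0)
    rw [← e1] at h2
    have e3 : ∑' s, (if s ∈ S then (1:ℝ≥0∞) else 0) ^ q = N := by
      rw [tsum_eq_sum (s := S) (by intro s hs; simp [hs, hq0])]
      rw [sum_congr rfl (g := fun _ => 1) (by intro s hs; simp [hs])]
      simp [hcard]
    rw [e3] at h2
    refine h2.trans ?_
    gcongr
    rw [e2] at h1
    have h3 := rpow_le_rpow h1 (by positivity : 0 ≤ q / B.p)
    rw [mul_rpow_of_nonneg _ _ (by positivity), ← rpow_mul] at h3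
    have e4 : B.p / 2 * (q / B.p) = q / 2 := by field_simp
    rwa [e4] at h3
  set A := CE * C ^ (q / B.p) with hA
  have hAf : A ≠ ∞ := mul_ne_top hCE (rpow_lt_top_of_nonneg (by positivity) hC).ne
  have key2 : ∀ N : ℕ, 0 < N → (N : ℝ≥0∞) ^ (1 - q / 2) ≤ A := fun N hN => by
    have h1 := key N
    rw [← mul_assoc] at h1
    have hN0 : (N : ℝ≥0∞) ≠ 0 := by exact_mod_cast hN.ne'
    have : (N : ℝ≥0∞) = (N : ℝ≥0∞) ^ (1 - q / 2) * (N : ℝ≥0∞) ^ (q / 2) := by rw [← rpow_add _ _ hN0 (by simp)]; simp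
    nth_rewrite 1 [this] at h1
    refine (ENNReal.mul_le_mul_iff_left ?_ ?_).1 h1
    · exact (rpow_pos (pos_iff_ne_zero.2 hN0) (by simp)).ne'
    · exact (rpow_lt_top_of_nonneg (by positivity) (by simp)).ne
  have ht : Tendsto (fun N : ℕ => (N : ℝ≥0∞) ^ (1 - q / 2)) atTop (𝓝 ∞) := by
    have h1 := (tendsto_rpow_at_top (show 0 < 1 - q / 2 by linarith)).comp
      tendsto_nat_nhds_top
    exact h1
  have := ge_of_tendsto ht (b := A) |> fun _ => le_of_tendsto ht
    ((eventually_gt_atTop 0).mono (fun N hN => key2 N hN))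
  exact hAf (top_le_iff.1 this)

lemma mod_of_iso [DecidableEq J] (B : WS Ω 𝒯) {V : Type*} [NormedAddCommGroup V] [Module ℂ V]
    {x : J → V} {I : J → 𝒯} {C : ℝ≥0∞} :
    B.Mod x I C ↔ ∀ (c : J → ℂ) (G : Finset J),
      ‖∑ j ∈ G, c j • x j‖ₑ ≤ C * B.Pf I c G ∧ B.Pf I c G ≤ C * ‖∑ j ∈ G, c j • x j‖ₑ := by
  unfold Mod
  simp_rw [Ph_fin]

/-- choice of an injection respecting blocks -/
lemma exists_sigma {Λ : Type*} [Countable Λ] (I : J → 𝒯) (τ : Λ → 𝒯)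
    (h : ∀ a, (I ⁻¹' {τ a}).Infinite) : ∃ σ : Λ → J, Function.Injective σ ∧ ∀ a, I (σ a) = τ a := by
  classical
  rcases isEmpty_or_nonempty Λ with hΛ | ⟨⟨a⟩⟩
  · exact ⟨fun a => hΛ.elim a, fun a => hΛ.elim a, fun a => hΛ.elim a⟩
  obtain ⟨enc, henc⟩ := Countable.exists_injective_nat Λ
  have h2 : ∀ S : 𝒯, (I ⁻¹' {S}).Infinite → ∃ f : ℕ → J, Function.Injective f ∧ ∀ n, I (f n) = S := fun S hS => by
    have := hS.to_subtype
    let f := Infinite.natEmbedding (I ⁻¹' {S})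
    exact ⟨fun n => (f n : J), fun a b hab => f.injective (Subtype.ext hab), fun n => (f n).2⟩
  have h3 : ∀ S : 𝒯, ∃ f : ℕ → J, (I ⁻¹' {S}).Infinite → (Function.Injective f ∧ ∀ n, I (f n) = S) := fun S => by
    by_cases hS : (I ⁻¹' {S}).Infinite
    · obtain ⟨f, hf⟩ := h2 S hS
      exact ⟨f, fun _ => hf⟩
    · exact ⟨fun _ => (h a).nonempty.some, fun h => absurd h hS⟩
  choose f hf using h3
  refine ⟨fun a => f (τ a) (enc a), fun a b hab => ?_, fun a => (hf _ (h a)).2 _⟩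
  have h4 : τ a = τ b := by
    rw [← (hf _ (h a)).2 (enc a), ← (hf _ (h b)).2 (enc b)]
    exact congrArg I hab
  simp only [← h4] at hab
  exact henc ((hf _ (h a)).1 hab)

theorem lemmaB [DecidableEq J] [DecidableEq 𝒯] {N' : Type*} [Countable N'] [Infinite N']
    [DecidableEq N'] (B : WS Ω 𝒯) (hE : B.Emb)
    (x : J → (B.comap (Prod.fst : 𝒯 × N' → 𝒯)).F)
    (hx : UBasis x) {c1 C1 : ℝ≥0∞} (hc1 : c1 ≠ 0)
    (hC1 : C1 ≠ ∞) (hlow : ∀ j, c1 ≤ ‖x j‖ₑ) (hup : ∀ j, ‖x j‖ₑ ≤ C1) :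
    ∃ h : 𝒯 × N' ≃ J, ∃ C : ℝ≥0∞, C ≠ ∞ ∧ ∀ (c : 𝒯 × N' → ℂ) (G : Finset (𝒯 × N')),
      ‖∑ j ∈ G, c j • x (h j)‖ₑ ≤ C * B.Pf Prod.fst c G ∧
      B.Pf Prod.fst c G ≤ C * ‖∑ j ∈ G, c j • x (h j)‖ₑ := by
  obtain ⟨CU, hCU, hU⟩ := exists_UC hx
  obtain ⟨δ, hδ, hbig⟩ := big_block B hE Prod.fst x hx hCU hU hc1 hC1 hlow hup
  choose I hI using hbig
  obtain ⟨CM, hCM, hM⟩ := lemmaA B Prod.fst x hx hCU hU hc1 hC1 hlow hup hδ I hI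
  obtain ⟨Θ, hΘe, hΘ1, hΘ2⟩ := B.iso I hx hCM hM
  have hΘs1 : ∀ f, ‖Θ.symm f‖ₑ ≤ CM * ‖f‖ₑ := fun f => by simpa using hΘ2 (Θ.symm f)
  have hΘs2 : ∀ f, ‖f‖ₑ ≤ CM * ‖Θ.symm f‖ₑ := fun f => by simpa using hΘ1 (Θ.symm f)
  have hee : ∀ l, ‖(B.comap (Prod.fst : 𝒯 × N' → 𝒯)).e l‖ₑ = 1 := fun l => by rw [← ofReal_norm, norm_e]; simp
  set y : 𝒯 × N' → (B.comap I).F := fun l => Θ.symm ((B.comap (Prod.fst : 𝒯 × N' → 𝒯)).e l) with hy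
  have hyb : UBasis y := (B.comap (Prod.fst : 𝒯 × N' → 𝒯)).ubasis_e.map Θ.symm
  obtain ⟨CV, hCV, hV⟩ := exists_UC hyb
  have hylow : ∀ l, (CM)⁻¹ ≤ ‖y l‖ₑ := fun l => by
    have := hΘs2 ((B.comap (Prod.fst : 𝒯 × N' → 𝒯)).e l)
    rw [hee] at this
    rw [inv_le_iff_le_mul (fun h => absurd h (by simp)) (fun h => absurd h hCM)]
    exact this
  have hyup : ∀ l, ‖y l‖ₑ ≤ CM := fun l => by simpa [hee] using hΘs1 ((B.comap (Prod.fst : 𝒯 × N' → 𝒯)).e l)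
  have hci : (CM)⁻¹ ≠ 0 := by simpa using hCM
  obtain ⟨δ', hδ', hbig'⟩ := big_block B hE I y hyb hCV hV hci hCM hylow hyup
  choose I' hI' using hbig'
  obtain ⟨CN, hCN, hN⟩ := lemmaA B I y hyb hCV hV hci hCM hylow hyup hδ' I' hI'
  rw [mod_of_iso] at hM hN
  -- comparison of I' with fst
  have hEq : B.Eqv I' Prod.fst (CN * CM) := fun c G => by
    have h1 : ∑ l ∈ G, c l • y l = Θ.symm (∑ l ∈ G, c l • (B.comap (Prod.fst : 𝒯 × N' → 𝒯)).e l) := by simp [hy, map_sum]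
    have h2 : ‖∑ l ∈ G, c l • (B.comap (Prod.fst : 𝒯 × N' → 𝒯)).e l‖ₑ = B.Pf Prod.fst c G := enorm_fin B _ c G
    have h3 := hN c G
    rw [h1] at h3
    constructor
    · refine h3.2.trans ?_
      rw [mul_assoc, ← h2]
      gcongr
      exact hΘs1 _
    · rw [← h2]
      refine (hΘs2 _).trans ?_
      rw [mul_comm CN, mul_assoc]
      gcongr
      exact h3.1
  have hτ : ∀ T : 𝒯, ∃ S : 𝒯, {n : N' | I' (T, n) = S}.Infinite := fun T => by
    have hf := fin_values B hE (mul_ne_top hCN hCM) I' hEq T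
    have := hf.to_subtype
    obtain ⟨S, hS⟩ := Finite.exists_infinite_fiber
      (Set.rangeFactorization (fun n => I' (T, n)))
    refine ⟨S, ?_⟩
    have := Set.infinite_coe_iff.1 hS
    refine this.mono ?_
    intro n hn
    have h1 : Set.rangeFactorization (fun n => I' (T, n)) n = S := hn
    show I' (T, n) = S
    rw [← h1]; rfl
  choose τ hτ using hτ
  -- the block of τ T is infinite
  have hinf : ∀ T, (I ⁻¹' {τ T}).Infinite := fun T hfin => by
    set Z := hfin.toFinset with hZ
    have hval : ∀ n, I' (T, n) = τ T → δ' ≤ ∑ j ∈ Z, CM ^ (1 / B.p) * ‖hyb.co ((B.comap I).e j) (T, n)‖ₑ := fun n hn => by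
      refine (hI' (T, n)).trans ?_
      rw [hn]
      have h1 : (B.comap I).res (I ⁻¹' {τ T}) (y (T, n))
          = ∑ j ∈ Z, (B.comap I).cd (y (T, n)) j • (B.comap I).e j := by
        apply PN.val_inj
        ext k
        show (B.comap I).cd _ k = (B.comap I).cd _ k
        rw [cd_res, cd_fin]
        by_cases hk : k ∈ I ⁻¹' {τ T}
        · have : k ∈ Z := by simpa [hZ] using hk
          simp [hk, this]
        · have : k ∉ Z := by simpa [hZ] using hk
          simp [hk, this]
      rw [h1, hyb.co_sum]
      simp only [Finset.sum_apply, hyb.co_smul, Pi.smul_apply, smul_eq_mul]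
      refine (enorm_sum_le _ _).trans (sum_le_sum (fun j _ => ?_))
      rw [enorm_mul]
      gcongr
      have h2 := (B.comap I).le_Ph (fun k => ‖(B.comap I).cd (y (T, n)) k‖ₑ) j
      rw [← enorm_F] at h2
      have h3 := rpow_le_rpow (h2.trans (hyup (T, n))) (by have := B.hp; positivity : 0 ≤ 1 / B.p)
      rw [← rpow_mul] at h3
      have e1 : (B.comap I).p * (1 / B.p) = 1 := mul_one_div_cancel B.hp.ne'
      rwa [e1, rpow_one] at h3
    have hten : Tendsto (fun l => ∑ j ∈ Z, CM ^ (1 / B.p) * ‖hyb.co ((B.comap I).e j) l‖ₑ) cofinite (𝓝 0) := by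
      have hCp : CM ^ (1 / B.p) ≠ ∞ :=
        (rpow_lt_top_of_nonneg (by have := B.hp; positivity) hCM).ne
      rw [show (0:ℝ≥0∞) = ∑ j ∈ Z, CM ^ (1 / B.p) * 0 by simp]
      refine tendsto_finsetSum _ (fun j _ => ENNReal.Tendsto.const_mul ?_ (Or.inr hCp))
      have h1 := (hyb.hasSum ((B.comap I).e j)).summable.tendsto_cofinite_zero
      have h2 : Tendsto (fun l => ‖hyb.co ((B.comap I).e j) l • y l‖ₑ) cofinite (𝓝 0) := by
        have := (continuous_enorm.tendsto _).comp h1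
        rw [enorm_zero] at this
        exact this
      have h3 : ∀ l, ‖hyb.co ((B.comap I).e j) l‖ₑ ^ B.p ≤ CM * ‖hyb.co ((B.comap I).e j) l • y l‖ₑ := fun l => by
        have e1 : ‖hyb.co ((B.comap I).e j) l • y l‖ₑ = ‖hyb.co ((B.comap I).e j) l‖ₑ ^ B.p * ‖y l‖ₑ := by
          rw [← ofReal_norm, ← ofReal_norm, ← ofReal_norm, pn_smul,
            ofReal_mul (by positivity), ofReal_rpow_of_nonneg (by positivity) B.hp.le]
          rfl
        have h4 := hΘs2 ((B.comap (Prod.fst : 𝒯 × N' → 𝒯)).e l)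
        rw [hee] at h4
        rw [e1, mul_left_comm]
        calc _ = ‖hyb.co ((B.comap I).e j) l‖ₑ ^ B.p * 1 := by rw [mul_one]
          _ ≤ _ := by gcongr
      have h5 : Tendsto (fun l => ‖hyb.co ((B.comap I).e j) l‖ₑ ^ B.p) cofinite (𝓝 0) := by
        refine tendsto_of_tendsto_of_tendsto_of_le_of_le tendsto_const_nhds ?_ (fun _ => zero_le) h3
        have := ENNReal.Tendsto.const_mul h2 (Or.inr hCM)
        simpa using this
      have h6 := (continuous_rpow_const (y := 1 / B.p)).tendsto 0 |>.comp h5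
      have h7 : 0 < 1 / B.p := by have := B.hp; positivity
      have e2 : B.p * (1 / B.p) = 1 := mul_one_div_cancel B.hp.ne'
      rw [zero_rpow_of_pos h7] at h6
      refine h6.congr (fun l => ?_)
      simp only [Function.comp]
      rw [← rpow_mul, e2, rpow_one]
    have hev := hten.eventually (gt_mem_nhds (pos_iff_ne_zero.2 hδ'))
    rw [Filter.eventually_cofinite] at hev
    refine hτ T (Set.Finite.subset (hev.preimage (f := fun n => (T, n)) (by
      intro a _ b _ hab; exact (Prod.ext_iff.1 hab).2)) ?_)
    intro n hn
    exact not_lt.2 (hval n hn)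
  -- fst and τ ∘ fst are equivalent
  have hEq2 : B.Eqv (fun l : 𝒯 × N' => τ l.1) Prod.fst (CN * CM) := by
    have : ∀ T, ∃ f : N' → N', Function.Injective f ∧ ∀ n, I' (T, f n) = τ T := fun T => by
      have := (hτ T).to_subtype
      obtain ⟨enc, henc⟩ := Countable.exists_injective_nat N'
      let f := Infinite.natEmbedding {n : N' | I' (T, n) = τ T}
      exact ⟨fun n => (f (enc n)).1, fun a b hab => henc (f.injective (Subtype.ext hab)),
        fun n => (f (enc n)).2⟩
    choose ν hν1 hν2 using this
    let emb : 𝒯 × N' ↪ 𝒯 × N' := ⟨fun l => (l.1, ν l.1 l.2), fun a b hab => by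
      obtain ⟨a1, a2⟩ := a
      obtain ⟨b1, b2⟩ := b
      simp only [Prod.mk.injEq] at hab
      obtain ⟨rfl, h⟩ := hab
      rw [hν1 a1 h]⟩
    have := hEq.comp emb
    have e1 : I' ∘ emb = fun l : 𝒯 × N' => τ l.1 := by ext l; exact hν2 l.1 l.2
    have e2 : Prod.fst ∘ emb = (Prod.fst : 𝒯 × N' → 𝒯) := by ext l; rfl
    rwa [e1, e2] at this
  obtain ⟨σ, hσ, hσI⟩ := exists_sigma I (fun l : 𝒯 × N' => τ l.1) (fun l => hinf l.1)
  obtain ⟨enc, henc⟩ : ∃ f : J → N', Function.Injective f := by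
    obtain ⟨f, hf⟩ := Countable.exists_injective_nat J
    exact ⟨fun j => Infinite.natEmbedding N' (f j), (Infinite.natEmbedding N').injective.comp hf⟩
  obtain ⟨h, hbij, hR⟩ := Function.Embedding.schroeder_bernstein_of_rel hσ
    (g := fun j => (I j, enc j)) (fun a b hab => henc (Prod.ext_iff.1 hab).2)
    (fun l j => I j = τ l.1 ∨ I j = l.1) (fun l => Or.inl (hσI l)) (fun j => Or.inr rfl)
  have hEq3 : B.Eqv (I ∘ h) Prod.fst (CN * CM + 1) := fun c G => by
    classical
    set P : 𝒯 × N' → Prop := fun l => I (h l) = τ l.1 with hP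
    set G1 := G.filter P
    set G2 := G.filter (fun l => ¬ P l)
    have a1 : B.Pf (I ∘ h) c G1 = B.Pf (fun l : 𝒯 × N' => τ l.1) c G1 :=
      B.Pf_congr (fun l hl => (mem_filter.1 hl).2) (fun _ _ => rfl)
    have a2 : B.Pf (I ∘ h) c G2 = B.Pf Prod.fst c G2 :=
      B.Pf_congr (fun l hl => (hR l).resolve_left (mem_filter.1 hl).2) (fun _ _ => rfl)
    have s1 : G1 ⊆ G := filter_subset _ _
    have s2 : G2 ⊆ G := filter_subset _ _
    constructor
    · refine (B.Pf_split (I ∘ h) c G P).trans ?_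
      rw [add_mul, one_mul]
      refine add_le_add ?_ ?_
      · show B.Pf (I ∘ h) c G1 ≤ _
        rw [a1]
        exact (hEq2 c G1).1.trans (mul_le_mul_right (B.Pf_mono _ _ s1) _)
      · show B.Pf (I ∘ h) c G2 ≤ _
        rw [a2]
        exact B.Pf_mono _ _ s2
    · refine (B.Pf_split Prod.fst c G P).trans ?_
      rw [add_mul, one_mul]
      refine add_le_add ?_ ?_
      · refine (hEq2 c G1).2.trans (mul_le_mul_right ?_ _)
        rw [← a1]
        exact B.Pf_mono _ _ s1
      · show B.Pf Prod.fst c G2 ≤ _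
        rw [← a2]
        exact B.Pf_mono _ _ s2
  let h' : 𝒯 × N' ≃ J := Equiv.ofBijective h hbij
  refine ⟨h', CM * (CN * CM + 1), mul_ne_top hCM
    (by simp [mul_ne_top hCN hCM]), fun c G => ?_⟩
  have h1 := hM (c ∘ h'.symm) (G.map h'.toEmbedding)
  rw [Pf_map, Finset.sum_map] at h1
  have e1 : (c ∘ h'.symm) ∘ h'.toEmbedding = c := by ext l; simp
  rw [e1] at h1
  simp only [Function.comp, Equiv.coe_toEmbedding, Equiv.symm_apply_apply] at h1
  have h2 := hEq3 c G
  constructor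
  · refine h1.1.trans ?_
    rw [mul_assoc]
    exact mul_le_mul_right h2.1 _
  · refine h2.2.trans ?_
    rw [mul_comm CM, mul_assoc]
    exact mul_le_mul_right h1.2 _

end WS

/-- index set of dyadic intervals -/
abbrev Dy : Type := Σ i : ℕ, Fin (2 ^ i)

namespace Dy
/-- left endpoint -/
def lf (I : Dy) : ℝ := (I.2 : ℝ) / 2 ^ I.1
/-- length -/
def len (I : Dy) : ℝ := (2 ^ I.1)⁻¹
/-- dyadic interval -/
def A (I : Dy) : Set ℝ := Ico I.lf (I.lf + I.len)

lemma len_pos (I : Dy) : 0 < I.len := by unfold len; positivity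
lemma lf_nonneg (I : Dy) : 0 ≤ I.lf := by unfold lf; positivity
lemma lf_add_len (I : Dy) : I.lf + I.len = ((I.2 : ℝ) + 1) / 2 ^ I.1 := by unfold lf len; field_simp
lemma rt_le (I : Dy) : I.lf + I.len ≤ 1 := by
  rw [lf_add_len, div_le_one (by positivity)]
  have := I.2.2
  have h : ((I.2 : ℕ) : ℝ) + 1 ≤ ((2 ^ I.1 : ℕ) : ℝ) := by exact_mod_cast this
  simpa using h

lemma measA (I : Dy) : MeasurableSet I.A := measurableSet_Ico
lemma A_sub (I : Dy) : I.A ⊆ Ico 0 1 := by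
  intro t ht
  exact ⟨I.lf_nonneg.trans ht.1, ht.2.trans_le I.rt_le⟩
lemma volA (I : Dy) : volume I.A = (2 ^ I.1)⁻¹ := by
  unfold A
  rw [Real.volume_Ico]
  simp only [add_sub_cancel_left, len]
  rw [ofReal_inv_of_pos (by positivity), ofReal_pow (by norm_num)]
  simp

/-- level function -/
def lv (i : ℕ) (t : ℝ) : Dy := ⟨i, ⟨⌊2 ^ i * t⌋₊ % 2 ^ i, Nat.mod_lt _ (by positivity)⟩⟩

lemma mem_A_iff (I : Dy) (t : ℝ) : t ∈ I.A ↔ 0 ≤ t ∧ ⌊2 ^ I.1 * t⌋₊ = I.2.1 := by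
  unfold A
  rw [Set.mem_Ico, lf_add_len]
  unfold lf
  rw [div_le_iff₀ (by positivity), lt_div_iff₀ (by positivity)]
  constructor
  · rintro ⟨h1, h2⟩
    have h0 : 0 ≤ t * 2 ^ I.1 := (Nat.cast_nonneg _).trans h1
    refine ⟨?_, ?_⟩
    · exact nonneg_of_mul_nonneg_left h0 (by positivity)
    · rw [mul_comm]
      exact (Nat.floor_eq_iff h0).2 ⟨h1, h2⟩
  · rintro ⟨h1, h2⟩
    rw [mul_comm] at h2
    exact (Nat.floor_eq_iff (by positivity)).1 h2

lemma mem_lv {t : ℝ} (ht : t ∈ Ico (0:ℝ) 1) (i : ℕ) : t ∈ (lv i t).A := by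
  rw [mem_A_iff]
  refine ⟨ht.1, ?_⟩
  simp only [lv]
  rw [Nat.mod_eq_of_lt]
  rw [Nat.floor_lt (by have := ht.1; positivity)]
  push_cast
  nlinarith [ht.2, pow_pos (two_pos (α := ℝ)) i]

lemma eq_lv {I : Dy} {t : ℝ} (h : t ∈ I.A) : I = lv I.1 t := by
  rw [mem_A_iff] at h
  obtain ⟨i, j⟩ := I
  simp only [lv]
  congr 1
  ext
  simp only at h ⊢
  rw [h.2, Nat.mod_eq_of_lt j.2]

@[simp] lemma lv_fst (i : ℕ) (t : ℝ) : (lv i t).1 = i := rfl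

lemma tsum_lv {F : Dy → ℝ≥0∞} {t : ℝ} (hF : ∀ I : Dy, t ∉ I.A → F I = 0) :
    ∑' I, F I = ∑' i, F (lv i t) := by
  rw [ENNReal.tsum_sigma']
  congr 1; ext i
  refine (tsum_eq_single (f := fun b : Fin (2 ^ i) => F ⟨i, b⟩) (lv i t).2 ?_).trans ?_
  rotate_left
  · rfl
  · intro j hj
    apply hF
    intro h
    have := eq_lv h
    simp only at this
    apply hj
    have h2 : (⟨i, j⟩ : Dy) = ⟨i, (lv i t).2⟩ := this
    exact eq_of_heq (Sigma.mk.inj h2).2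

end Dy

lemma two_rpow_pos (x : ℝ) : (0:ℝ≥0∞) < 2 ^ x := rpow_pos (by simp) (by simp)
lemma tsum_two_rpow {ε : ℝ} (hε : 0 < ε) : ∑' n : ℕ, (2:ℝ≥0∞) ^ (-(n * ε)) ≠ ∞ := by
  have : ∀ n : ℕ, (2:ℝ≥0∞) ^ (-(n * ε)) = ((2:ℝ≥0∞) ^ (-ε)) ^ n := fun n => by
    rw [← rpow_natCast, ← rpow_mul]
    congr 1; ring
  simp_rw [this]
  rw [tsum_geometric]
  apply inv_ne_top.2
  rw [Ne, tsub_eq_zero_iff_le, not_le]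
  exact rpow_lt_one_of_one_lt_of_neg (by norm_num) (by linarith)

/-- two sided geometric sum -/
lemma tsum_int_geom {ε : ℝ} (hε : 0 < ε) :
    ∑' j : ℤ, min ((2:ℝ≥0∞) ^ (j:ℝ)) (2 ^ (-((j - 1) * ε))) ≠ ∞ := by
  rw [tsum_of_nat_of_neg_add_one ENNReal.summable ENNReal.summable]
  refine add_ne_top.2 ⟨?_, ?_⟩
  · refine ne_top_of_le_ne_top (b := 2 ^ ε * ∑' n : ℕ, (2:ℝ≥0∞) ^ (-(n * ε))) ?_ ?_
    · exact mul_ne_top (by simp) (tsum_two_rpow hε)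
    · rw [← ENNReal.tsum_mul_left]
      refine ENNReal.tsum_le_tsum (fun n => (min_le_right _ _).trans (le_of_eq ?_))
      rw [← rpow_add _ _ (by simp) (by simp)]
      congr 1; push_cast; ring
  · refine ne_top_of_le_ne_top (tsum_two_rpow (ε := 1) one_pos) ?_
    refine ENNReal.tsum_le_tsum (fun n => (min_le_left _ _).trans ?_)
    refine rpow_le_rpow_of_exponent_le (by norm_num) ?_
    push_cast; linarith

lemma scale_sum {p q : ℝ} (hp : 0 < p) (hpq : p < q) : ∃ C : ℝ≥0∞, C ≠ ∞ ∧
    ∀ (a g : ℝ≥0∞) (s : ℕ → ℝ≥0∞), a ≠ 0 → a ≠ ∞ → (∀ i, s i ≤ a) →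
      (∀ i, s i ≤ 2 ^ (-(i / p) : ℝ) * g) →
      ∑' i, 2 ^ i * s i ^ q ≤ C * (a ^ (q - p) * g ^ p) := by
  set ε := q / p - 1 with hε
  have hε0 : 0 < ε := by rw [hε, sub_pos, one_lt_div hp]; exact hpq
  refine ⟨_, tsum_int_geom hε0, fun a g s ha0 haf h1 h2 => ?_⟩
  have hq : 0 < q := hp.trans hpq
  have hC0 : ∑' j : ℤ, min ((2:ℝ≥0∞) ^ (j:ℝ)) (2 ^ (-((j - 1) * ε))) ≠ 0 := fun h => by
    rw [ENNReal.tsum_eq_zero] at h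
    have := h 0
    rw [min_eq_iff] at this
    rcases this with h | h
    · exact (two_rpow_pos _).ne' h.1
    · exact (two_rpow_pos _).ne' h.1
  have haq0 : a ^ (q - p) ≠ 0 := by simp [ha0, haf, rpow_eq_zero_iff]
  have haqf : a ^ (q - p) ≠ ∞ := by simp [ha0, haf, rpow_eq_top_iff]
  by_cases hg0 : g = 0
  · have : ∀ i, s i = 0 := fun i => by simpa [hg0] using h2 i
    simp [this, hq]
  by_cases hgt : g = ∞
  · rw [hgt, top_rpow_of_pos hp, mul_top haq0, mul_top hC0]
    exact le_top
  have hap0 : a ^ p ≠ 0 := by simp [ha0, haf, rpow_eq_zero_iff]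
  have hapf : a ^ p ≠ ∞ := by simp [ha0, haf, rpow_eq_top_iff]
  have hgp0 : g ^ p ≠ 0 := by simp [hg0, hgt, rpow_eq_zero_iff]
  have hgpf : g ^ p ≠ ∞ := by simp [hg0, hgt, rpow_eq_top_iff]
  obtain ⟨m, hm1, hm2⟩ := ENNReal.exists_mem_Ico_zpow (x := g ^ p / a ^ p) (y := 2)
    (ENNReal.div_pos hgp0 hapf).ne' (div_ne_top hgpf hap0) (by norm_num) (by simp)
  have b1 : (2:ℝ≥0∞) ^ (m : ℝ) * a ^ p ≤ g ^ p := by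
    rw [ENNReal.le_div_iff_mul_le (Or.inl hap0) (Or.inl hapf)] at hm1
    rwa [rpow_intCast]
  have b2 : g ^ p ≤ (2:ℝ≥0∞) ^ ((m : ℝ) + 1) * a ^ p := by
    rw [ENNReal.div_lt_iff (Or.inl hap0) (Or.inl hapf)] at hm2
    have := hm2.le
    rw [← rpow_intCast] at this
    exact_mod_cast this
  have key : ∀ i : ℕ, 2 ^ i * s i ^ q ≤ min ((2:ℝ≥0∞) ^ (((i:ℤ) - m : ℤ):ℝ))
      (2 ^ (-(((((i:ℤ) - m : ℤ):ℝ) - 1) * ε))) * (a ^ (q - p) * g ^ p) := fun i => by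
    rw [min_mul]
    refine le_min ?_ ?_
    · have e1 : s i ^ q ≤ a ^ (q - p) * a ^ p := by
        rw [← rpow_add _ _ ha0 haf, sub_add_cancel]
        exact rpow_le_rpow (h1 i) hq.le
      have e2 : a ^ p ≤ 2 ^ (-(m:ℝ)) * g ^ p := by
        calc a ^ p = 2 ^ (-(m:ℝ)) * (2 ^ (m:ℝ) * a ^ p) := by rw [← mul_assoc, ← rpow_add _ _ (by simp) (by simp)]; simp
          _ ≤ _ := by gcongr
      calc 2 ^ i * s i ^ q ≤ 2 ^ i * (a ^ (q - p) * (2 ^ (-(m:ℝ)) * g ^ p)) := by gcongr; exact e1.trans (by gcongr)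
        _ = (2 ^ i * 2 ^ (-(m:ℝ))) * (a ^ (q - p) * g ^ p) := by ring
        _ = _ := by
            rw [← rpow_natCast, ← rpow_add _ _ (by simp) (by simp)]
            congr 2
            push_cast; ring
    · have e1 : s i ^ q ≤ 2 ^ (-(i * (q / p))) * (g ^ p * (g ^ p) ^ ε) := by
        have : (g ^ p * (g ^ p) ^ ε) = g ^ q := by
          rw [← rpow_mul, ← rpow_add _ _ hg0 hgt]
          congr 1; rw [hε]; field_simp; ring
        rw [this]
        refine (rpow_le_rpow (h2 i) hq.le).trans (le_of_eq ?_)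
        rw [mul_rpow_of_nonneg _ _ hq.le, ← rpow_mul]
        congr 2; ring
      have e2 : (g ^ p) ^ ε ≤ 2 ^ (((m:ℝ) + 1) * ε) * a ^ (q - p) := by
        refine (rpow_le_rpow b2 hε0.le).trans (le_of_eq ?_)
        rw [mul_rpow_of_nonneg _ _ hε0.le, ← rpow_mul, ← rpow_mul]
        congr 2; rw [hε]; field_simp
      calc 2 ^ i * s i ^ q ≤ 2 ^ i * (2 ^ (-(i * (q / p))) * (g ^ p *
            (2 ^ (((m:ℝ) + 1) * ε) * a ^ (q - p)))) := by
            gcongr; exact e1.trans (by gcongr)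
        _ = (2 ^ i * 2 ^ (-(i * (q / p))) * 2 ^ (((m:ℝ) + 1) * ε)) * (a ^ (q - p) * g ^ p) := by ring
        _ = _ := by
            rw [← rpow_natCast, ← rpow_add _ _ (by simp) (by simp),
              ← rpow_add _ _ (by simp) (by simp)]
            congr 2
            rw [hε]; push_cast; ring
  refine (ENNReal.tsum_le_tsum key).trans ?_
  rw [ENNReal.tsum_mul_right]
  gcongr
  exact tsum_comp_le_tsum_of_injective (f := fun i : ℕ => (i:ℤ) - m)
    (fun a b hab => by simpa using hab) (fun j : ℤ => min ((2:ℝ≥0∞) ^ (j:ℝ)) (2 ^ (-((j - 1) * ε))))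

/-- the Hardy sequence space data -/
def dyW (p : ℝ) (hp : 0 < p) (hp1 : p ≤ 1) : WS ℝ Dy where
  μ := volume
  p := p
  hp := hp
  hp1 := hp1
  g := fun I => I.A.indicator (fun _ => (2:ℝ≥0∞) ^ (2 * I.1 / p))
  gfin := fun I t => by by_cases h : t ∈ I.A <;> simp [h]
  gm := fun I => measurable_const.indicator I.measA
  g1 := fun I => by
    have : ∀ t, (I.A.indicator (fun _ => (2:ℝ≥0∞) ^ (2 * I.1 / p)) t) ^ (p / 2)
        = I.A.indicator (fun _ => (2:ℝ≥0∞) ^ I.1) t := fun t => by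
      by_cases h : t ∈ I.A
      · simp only [h, indicator_of_mem]
        rw [← rpow_mul, ← rpow_natCast]
        congr 1; field_simp
      · simp [h, hp]
    simp_rw [this]
    rw [lintegral_indicator I.measA, setLIntegral_const, Dy.volA]
    exact ENNReal.mul_inv_cancel (by simp) (by simp)

lemma dyW_emb (p : ℝ) (hp : 0 < p) (hp1 : p < 1) : (dyW p hp hp1.le).Emb := by
  set q := (p + 1) / 2 with hq
  have hpq : p < q := by rw [hq]; linarith
  have hq1 : q < 1 := by rw [hq]; linarith
  have hq0 : 0 < q := hp.trans hpq
  obtain ⟨C, hC, h⟩ := scale_sum hp hpq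
  refine ⟨q, C + 1, hq0, hq1, by simp [hC], fun s => ?_⟩
  set B := dyW p hp hp1.le with hB
  have hBp : B.p = p := rfl
  rw [hBp]
  have hle : ∀ I, s I ≤ (B.Ph s) ^ (1 / p) := fun I => by
    have h3 := rpow_le_rpow (B.le_Ph s I) (by positivity : 0 ≤ 1 / p)
    rw [← rpow_mul] at h3
    have e1 : B.p * (1 / p) = 1 := mul_one_div_cancel hp.ne'
    rwa [e1, rpow_one] at h3
  by_cases h0 : B.Ph s = 0
  · have : ∀ I, s I = 0 := fun I => by
      have := hle I
      rw [h0, zero_rpow_of_pos (by positivity)] at this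
      simpa using this
    simp [this, hq0]
  by_cases ht : B.Ph s = ∞
  · rw [ht, top_rpow_of_pos (by positivity), mul_top (by simp)]
    exact le_top
  set a := (B.Ph s) ^ (1 / p) with ha
  have ha0 : a ≠ 0 := (rpow_pos (pos_iff_ne_zero.2 h0) ht).ne'
  have haf : a ≠ ∞ := (rpow_lt_top_of_nonneg (by positivity) ht).ne
  have step : ∀ t, ∑' I : Dy, I.A.indicator (fun _ => 2 ^ I.1 * s I ^ q) t ≤
      C * (a ^ (q - p) * (B.sq s t) ^ (p / 2)) := fun t => by
    by_cases htm : t ∈ Ico (0:ℝ) 1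
    · rw [Dy.tsum_lv (t := t) (fun I hI => by simp [hI])]
      simp only [indicator_of_mem (Dy.mem_lv htm _), Dy.lv_fst]
      have := h a ((B.sq s t) ^ (1 / 2 : ℝ)) (fun i => s (Dy.lv i t)) ha0 haf (fun i => hle _) ?_
      · rw [← rpow_mul (B.sq s t)] at this
        rwa [show 1 / 2 * p = p / 2 by ring] at this
      · intro i
        have h5 : (s (Dy.lv i t)) ^ 2 * 2 ^ (2 * i / p : ℝ) ≤ B.sq s t := by
          refine le_trans (le_of_eq ?_) (ENNReal.le_tsum (Dy.lv i t))
          simp [hB, dyW, indicator_of_mem (Dy.mem_lv htm _)]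
        have h6 := rpow_le_rpow h5 (by norm_num : (0:ℝ) ≤ 1 / 2)
        rw [mul_rpow_of_nonneg _ _ (by norm_num), ← rpow_natCast,
          ← rpow_mul, ← rpow_mul] at h6
        have e1 : ((2:ℕ):ℝ) * (1 / 2) = 1 := by norm_num
        have e2 : 2 * (i:ℝ) / p * (1 / 2) = i / p := by ring
        rw [e1, e2, rpow_one] at h6
        calc s (Dy.lv i t) = 2 ^ (-(i / p) : ℝ) * (s (Dy.lv i t) * 2 ^ (i / p : ℝ)) := by
              rw [mul_left_comm, ← rpow_add _ _ (by simp) (by simp)]; simp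
          _ ≤ _ := by gcongr
    · have : ∀ I : Dy, t ∉ I.A := fun I h => htm (I.A_sub h)
      simp [this]
  calc ∑' I, s I ^ q = ∑' I : Dy, ∫⁻ t, I.A.indicator (fun _ => 2 ^ I.1 * s I ^ q) t := by
        congr 1; ext I
        rw [lintegral_indicator I.measA, setLIntegral_const, Dy.volA, mul_right_comm,
          ENNReal.mul_inv_cancel (by simp) (by simp), one_mul]
    _ = ∫⁻ t, ∑' I : Dy, I.A.indicator (fun _ => 2 ^ I.1 * s I ^ q) t := by
        rw [lintegral_tsum]
        intro I
        exact (measurable_const.indicator I.measA).aemeasurable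
    _ ≤ ∫⁻ t, C * (a ^ (q - p) * (B.sq s t) ^ (p / 2)) := lintegral_mono step
    _ = C * (a ^ (q - p) * B.Ph s) := by
        have hm : Measurable (fun t => (B.sq s t) ^ (p / 2)) := (B.sq_meas s).pow_const _
        rw [lintegral_const_mul _ (hm.const_mul _), lintegral_const_mul _ hm]
        rfl
    _ ≤ (C + 1) * B.Ph s ^ (q / p) := by
        gcongr
        · simp
        · rw [ha, ← rpow_mul]
          nth_rewrite 2 [← rpow_one (B.Ph s)]
          rw [← rpow_add _ _ h0 ht]
          apply le_of_eq
          congr 1; field_simp; ring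

/-! ### circle basics -/
/-- the point `e^{2πit}` -/
def Ec (t : ℝ) : ℂ := exp (2 * Real.pi * t * I)

variable {p : ℝ}
local notation "fstDy" => (Prod.fst : Dy × (ℕ × ℕ) → Dy)
local notation "Hol(" f "," R ")" => DifferentiableOn ℂ f (Metric.ball 0 R)

lemma Ec_norm (t : ℝ) : ‖Ec t‖ = 1 := by
  have : Ec t = exp ((2 * Real.pi * t : ℝ) * I) := by unfold Ec; push_cast; rfl
  rw [this, Complex.norm_exp_ofReal_mul_I]
lemma Ec_add (s t : ℝ) : Ec (s + t) = Ec s * Ec t := by unfold Ec; rw [← Complex.exp_add]; congr 1; push_cast; ring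
lemma Ec_neg (t : ℝ) : Ec (-t) = (starRingEnd ℂ) (Ec t) := by
  unfold Ec; rw [← Complex.exp_conj]; congr 1
  simp only [map_mul, Complex.conj_ofReal, Complex.conj_I, map_ofNat]; push_cast; ring
lemma Ec_zero : Ec 0 = 1 := by simp [Ec]
lemma Ec_one : Ec 1 = 1 := by unfold Ec; simpa using Complex.exp_two_pi_mul_I
lemma Ec_cont : Continuous Ec := by unfold Ec; fun_prop
lemma Ec_per (t : ℝ) : Ec (t + 1) = Ec t := by rw [Ec_add, Ec_one, mul_one]
lemma circlePt_eq (r t : ℝ) : circlePt r t = r * Ec t := rfl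
lemma circlePt_norm (r t : ℝ) : ‖circlePt r t‖ = |r| := by rw [circlePt_eq, norm_mul, Ec_norm, mul_one, norm_real, norm_eq_abs]
lemma circlePt_cont : Continuous (fun x : ℝ × ℝ => circlePt x.1 x.2) := by unfold circlePt; fun_prop
lemma Ec_pow (t : ℝ) (n : ℕ) : Ec t ^ n = Ec (n * t) := by unfold Ec; rw [← Complex.exp_nat_mul]; congr 1; push_cast; ring

lemma Ec_int (k : ℤ) (hk : k ≠ 0) : ∫ t in (0 : ℝ)..1, Ec (k * t) = 0 := by
  have hc : (2 * Real.pi * k * I : ℂ) ≠ 0 := by simp [hk, Real.pi_ne_zero]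
  have h1 : ∀ t : ℝ, Ec (k * t) = exp ((2 * Real.pi * k * I : ℂ) * t) := by intro t; unfold Ec; congr 1; push_cast; ring
  simp_rw [h1]
  rw [integral_exp_mul_complex hc]
  have : exp ((2 * Real.pi * k * I : ℂ) * (1 : ℝ)) = 1 := by
    have := Complex.exp_int_mul_two_pi_mul_I k
    rw [← this]; congr 1; push_cast; ring
  rw [this]; simp

lemma Ec_orth (m n : ℕ) : ∫ t in (0 : ℝ)..1, Ec (-t) ^ m * Ec t ^ n = if m = n then 1 else 0 := by
  have h1 : ∀ t : ℝ, Ec (-t) ^ m * Ec t ^ n = Ec (((n : ℤ) - (m : ℤ) : ℤ) * t) := by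
    intro t; rw [Ec_pow, Ec_pow, ← Ec_add]; congr 1; push_cast; ring
  simp_rw [h1]
  split_ifs with h
  · subst h; simp [Ec_zero]
  · exact Ec_int _ (by omega)

/-- bilinear Parseval -/
lemma pars_one (m : ℕ) {b : ℕ → ℂ} (hb : Summable fun n => ‖b n‖) :
    ∫ t in (0 : ℝ)..1, Ec (-t) ^ m * ∑' n, b n * Ec t ^ n = b m := by
  have hs : HasSum (fun n => ∫ t in (0 : ℝ)..1, Ec (-t) ^ m * (b n * Ec t ^ n))
      (∫ t in (0 : ℝ)..1, Ec (-t) ^ m * ∑' n, b n * Ec t ^ n) := by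
    simp_rw [intervalIntegral.integral_of_le (zero_le_one (α := ℝ))]
    simp_rw [← tsum_mul_left]
    apply hasSum_integral_of_summable_integral_norm
    · intro n
      apply Continuous.integrableOn_Ioc
      have := Ec_cont; fun_prop
    · simpa [Ec_norm] using hb
  have h2 : ∀ n, ∫ t in (0 : ℝ)..1, Ec (-t) ^ m * (b n * Ec t ^ n) = if n = m then b m else 0 := fun n => by
    have : ∀ t : ℝ, Ec (-t) ^ m * (b n * Ec t ^ n) = b n * (Ec (-t) ^ m * Ec t ^ n) := by intro t; ring
    simp_rw [this]
    rw [intervalIntegral.integral_const_mul, Ec_orth]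
    by_cases h : m = n
    · subst h; simp
    · simp [h, Ne.symm h]
  simp_rw [h2] at hs
  exact hs.unique (hasSum_ite_eq m (b m))

lemma ser_cont {b : ℕ → ℂ} (hb : Summable fun n => ‖b n‖) :
    Continuous fun t : ℝ => ∑' n, b n * Ec t ^ n := by
  apply continuous_tsum (u := fun n => ‖b n‖) _ hb
  · intro n t; simp [Ec_norm]
  · intro n; have := Ec_cont; fun_prop

lemma pars {a b : ℕ → ℂ} (ha : Summable fun n => ‖a n‖) (hb : Summable fun n => ‖b n‖) :
    HasSum (fun n => a n * b n)
      (∫ t in (0 : ℝ)..1, (∑' n, a n * Ec (-t) ^ n) * ∑' n, b n * Ec t ^ n) := by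
  have hs : HasSum (fun m => ∫ t in (0 : ℝ)..1, a m * Ec (-t) ^ m * ∑' n, b n * Ec t ^ n)
      (∫ t in (0 : ℝ)..1, (∑' n, a n * Ec (-t) ^ n) * ∑' n, b n * Ec t ^ n) := by
    simp_rw [intervalIntegral.integral_of_le (zero_le_one (α := ℝ))]
    simp_rw [← tsum_mul_right]
    apply hasSum_integral_of_summable_integral_norm
    · intro n
      apply Continuous.integrableOn_Ioc
      have := Ec_cont; have := ser_cont hb; fun_prop
    · simp only [norm_mul, norm_pow, Ec_norm, one_pow, mul_one]
      simp_rw [integral_const_mul]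
      exact ha.mul_right _
  convert hs using 2 with m
  simp_rw [mul_assoc]
  rw [intervalIntegral.integral_const_mul, pars_one m hb]

/-- Parseval -/
lemma parseval {b : ℕ → ℂ} (hb : Summable fun n => ‖b n‖) :
    HasSum (fun n => ‖b n‖ ^ 2) (∫ t in (0 : ℝ)..1, ‖∑' n, b n * Ec t ^ n‖ ^ 2) := by
  have h := pars (a := fun n => (starRingEnd ℂ) (b n)) (by simpa using hb) hb
  have h1 : ∀ t, (∑' n, (starRingEnd ℂ) (b n) * Ec (-t) ^ n) = (starRingEnd ℂ) (∑' n, b n * Ec t ^ n) := fun t => by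
    rw [Complex.conj_tsum]
    congr 1; ext n; simp [Ec_neg]
  simp_rw [h1, Complex.conj_mul'] at h
  rw [← Complex.hasSum_ofReal]
  convert h using 1
  · ext n; push_cast; rfl
  · rw [← intervalIntegral.integral_ofReal]; push_cast; rfl

/-! ### Taylor coefficients -/
/-- Taylor coefficients at 0 -/
def tc (f : ℂ → ℂ) (n : ℕ) : ℂ := iteratedDeriv n f 0 / n.factorial

lemma tc_hasSum {f : ℂ → ℂ} {R : ℝ} (hf : Hol(f, R)) {z : ℂ}
    (hz : ‖z‖ < R) : HasSum (fun n => tc f n * z ^ n) (f z) := by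
  have h := Complex.hasSum_taylorSeries_on_ball hf (z := z) (by simpa using hz)
  refine h.congr_fun ?_
  intro n; simp [tc]; ring

lemma tc_summable {f : ℂ → ℂ} {R : ℝ} (hf : Hol(f, R)) {r : ℝ}
    (h0 : 0 ≤ r) (hr : r < R) : Summable (fun n => ‖tc f n‖ * r ^ n) := by
  have h := (tc_hasSum hf (z := (r : ℂ)) (by simpa [abs_of_nonneg h0] using hr)).summable.norm
  simpa [abs_of_nonneg h0] using h

lemma tc_deriv {f : ℂ → ℂ} (n : ℕ) : tc (deriv f) n = (n + 1) * tc f (n + 1) := by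
  simp only [tc, ← iteratedDeriv_succ']
  rw [Nat.factorial_succ]; push_cast
  have : (n.factorial : ℂ) ≠ 0 := by exact_mod_cast n.factorial_ne_zero
  have : (n + 1 : ℂ) ≠ 0 := by exact_mod_cast n.succ_ne_zero
  field_simp

lemma tc_deriv_hasSum {f : ℂ → ℂ} {R : ℝ} (hf : Hol(f, R)) {z : ℂ}
    (hz : ‖z‖ < R) : HasSum (fun n : ℕ => n * tc f n * z ^ n) (z * deriv f z) := by
  have h := (tc_hasSum (hf.deriv isOpen_ball) hz).mul_left z
  rw [← hasSum_nat_add_iff' 1]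
  have e : (z * deriv f z - ∑ i ∈ range 1, (i : ℂ) * tc f i * z ^ i) = z * deriv f z := by simp
  rw [e]
  refine h.congr_fun ?_
  intro n; rw [tc_deriv]; push_cast; ring

/-- the differential operator -/
def Rop (L : ℕ) (f : ℂ → ℂ) (w : ℂ) : ℂ := w * deriv f w + L * f w

lemma Rop_hasSum (L : ℕ) {f : ℂ → ℂ} {R : ℝ} (hf : Hol(f, R)) {z : ℂ}
    (hz : ‖z‖ < R) : HasSum (fun n : ℕ => (n + L) * tc f n * z ^ n) (Rop L f z) := by
  refine ((tc_deriv_hasSum hf hz).add ((tc_hasSum hf hz).mul_left (L : ℂ))).congr_fun ?_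
  intro n; ring

lemma Rop_summable (L : ℕ) {f : ℂ → ℂ} {R : ℝ} (hf : Hol(f, R)) {r : ℝ}
    (h0 : 0 ≤ r) (hr : r < R) : Summable (fun n : ℕ => ‖(n + L) * tc f n‖ * r ^ n) := by
  have h := (Rop_hasSum L hf (z := (r : ℂ)) (by simpa [abs_of_nonneg h0] using hr)).summable.norm
  simpa [abs_of_nonneg h0] using h

lemma Rop_diff (L : ℕ) {f : ℂ → ℂ} {R : ℝ} (hf : Hol(f, R)) :
    DifferentiableOn ℂ (Rop L f) (ball 0 R) := by
  have := hf.deriv isOpen_ball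
  unfold Rop; fun_prop

/-! ### lower bounds of |1 - x e(φ)| -/
lemma one_sub_normSq (x φ : ℝ) :
    ‖1 - (x : ℂ) * Ec φ‖ ^ 2 = (1 - x) ^ 2 + 4 * x * sin (Real.pi * φ) ^ 2 := by
  have h : Ec φ = (Real.cos (2 * (Real.pi * φ)) : ℂ) + sin (2 * (Real.pi * φ)) * I := by
    unfold Ec
    rw [show (2 * Real.pi * φ * I : ℂ) = ((2 * (Real.pi * φ) : ℝ) : ℂ) * I by push_cast; ring, Complex.exp_mul_I]
    push_cast; rfl
  rw [← Complex.normSq_eq_norm_sq, Complex.normSq_apply, h]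
  simp only [Complex.sub_re, Complex.one_re, Complex.mul_re, Complex.ofReal_re, Complex.add_re,
    Complex.I_re, Complex.ofReal_im, Complex.I_im, Complex.sub_im, Complex.one_im, Complex.mul_im,
    Complex.add_im]
  have h1 := Real.sin_sq_add_cos_sq (2 * (Real.pi * φ))
  have h2 := Real.cos_two_mul (Real.pi * φ)
  have h3 := Real.sin_sq_add_cos_sq (Real.pi * φ)
  have h4 : Real.cos (2 * (Real.pi * φ)) = 1 - 2 * sin (Real.pi * φ) ^ 2 := by linarith
  have h5 : 4 * x * sin (Real.pi * φ) ^ 2 = 2 * x * (1 - Real.cos (2 * (Real.pi * φ))) := by linear_combination (2 * x) * h4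
  rw [h5]
  linear_combination x ^ 2 * h1

lemma sin_low {φ : ℝ} (h : |φ| ≤ 3 / 4) : 2 / 3 * |φ| ≤ |sin (Real.pi * φ)| := by
  wlog h0 : 0 ≤ φ generalizing φ
  · have := this (φ := -φ) (by simpa using h) (by linarith)
    simpa using this
  rw [abs_of_nonneg h0] at h ⊢
  refine le_trans ?_ (le_abs_self _)
  by_cases h1 : φ ≤ 1 / 2
  · have := Real.mul_le_sin (x := Real.pi * φ) (by positivity) (by nlinarith [pi_pos])
    have e : 2 / Real.pi * (Real.pi * φ) = 2 * φ := by field_simp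
    linarith
  · push Not at h1
    have e0 : sin (Real.pi * φ) = sin (Real.pi * (1 - φ)) := by rw [← Real.sin_pi_sub]; congr 1; ring
    rw [e0]
    have := Real.mul_le_sin (x := Real.pi * (1 - φ)) (mul_nonneg pi_pos.le (by linarith)) (by nlinarith [pi_pos])
    have e : 2 / Real.pi * (Real.pi * (1 - φ)) = 2 * (1 - φ) := by field_simp
    linarith

lemma one_sub_low {x φ : ℝ} (h0 : 0 ≤ x) (h : |φ| ≤ 3 / 4) :
    |φ| / 2 ≤ ‖1 - (x : ℂ) * Ec φ‖ := by
  apply le_of_sq_le_sq _ (norm_nonneg _)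
  rw [one_sub_normSq]
  have h1 := sin_low h
  have h2 : (2 / 3 * |φ|) ^ 2 ≤ sin (Real.pi * φ) ^ 2 := by rw [← sq_abs (sin _)]; gcongr
  have h3 := abs_nonneg φ
  by_cases hx : 1 / 2 ≤ x
  · nlinarith [sq_nonneg (1 - x), mul_le_mul hx h2 (by positivity) h0]
  · push Not at hx
    have : 0 ≤ 4 * x * sin (Real.pi * φ) ^ 2 := by positivity
    nlinarith

lemma one_sub_low' {x : ℝ} (h0 : 0 ≤ x) (φ : ℝ) : 1 - x ≤ ‖1 - (x : ℂ) * Ec φ‖ := by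
  have := norm_sub_norm_le (1 : ℂ) ((x : ℂ) * Ec φ)
  simpa [Ec_norm, abs_of_nonneg h0] using this

lemma Ec_lip (s t : ℝ) : ‖Ec s - Ec t‖ ≤ 2 * Real.pi * |s - t| := by
  have h : Ec s - Ec t = Ec t * (Ec (s - t) - 1) := by rw [mul_sub, ← Ec_add]; simp
  rw [h, norm_mul, Ec_norm, one_mul]
  have e : Ec (s - t) = exp (I * ((2 * Real.pi * (s - t) : ℝ) : ℂ)) := by unfold Ec; congr 1; push_cast; ring
  rw [e]
  refine (Real.norm_exp_I_mul_ofReal_sub_one_le).trans ?_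
  rw [norm_eq_abs, abs_mul, abs_of_nonneg (by positivity : (0 : ℝ) ≤ 2 * Real.pi)]

/-! ### Beta integrals -/
/-- truncated beta integral -/
def bI (n l : ℕ) (r : ℝ) : ℝ := ∫ ρ in (0 : ℝ)..r, 2 * ρ * (1 - ρ ^ 2) ^ l * ρ ^ (2 * n)

lemma bI_one (n l : ℕ) : bI n l 1 = n.factorial * l.factorial / (n + l + 1).factorial := by
  induction l generalizing n with
  | zero =>
    unfold bI
    have : ∀ ρ : ℝ, 2 * ρ * (1 - ρ ^ 2) ^ 0 * ρ ^ (2 * n) = 2 * ρ ^ (2 * n + 1) := by intro ρ; ring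
    simp_rw [this]
    rw [intervalIntegral.integral_const_mul, integral_pow]
    simp [Nat.factorial_succ]
    field_simp; ring
  | succ l ih =>
    have h : bI n (l + 1) 1 = bI n l 1 - bI (n + 1) l 1 := by
      unfold bI
      rw [← intervalIntegral.integral_sub]
      · congr 1; ext ρ; ring
      · apply Continuous.intervalIntegrable; fun_prop
      · apply Continuous.intervalIntegrable; fun_prop
    rw [h, ih, ih]
    have e1 : n + 1 + l + 1 = (n + l + 1) + 1 := by ring
    have e2 : n + (l + 1) + 1 = (n + l + 1) + 1 := by ring
    rw [e1, e2, Nat.factorial_succ (n + l + 1), Nat.factorial_succ n, Nat.factorial_succ l]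
    have : ((n + l + 1).factorial : ℝ) ≠ 0 := by positivity
    push_cast
    field_simp
    ring

lemma bI_int (n l : ℕ) {r : ℝ} (h0 : 0 ≤ r) (h1 : r ≤ 1) : 0 ≤ bI n l r ∧ bI n l r ≤ bI n l 1 := by
  have hn : ∀ ρ ∈ Icc (0 : ℝ) 1, 0 ≤ 2 * ρ * (1 - ρ ^ 2) ^ l * ρ ^ (2 * n) := by
    intro ρ ⟨a, b⟩
    have : 0 ≤ 1 - ρ ^ 2 := by nlinarith
    positivity
  constructor
  · apply intervalIntegral.integral_nonneg h0
    intro ρ hρ; exact hn ρ ⟨hρ.1, hρ.2.trans h1⟩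
  · unfold bI
    apply intervalIntegral.integral_mono_interval le_rfl h0 h1
    · filter_upwards [ae_restrict_mem measurableSet_Ioc] with ρ hρ
      exact hn ρ ⟨hρ.1.le, hρ.2⟩
    · apply Continuous.intervalIntegrable; fun_prop

lemma bI_tendsto (n l : ℕ) : Tendsto (bI n l) (𝓝 1) (𝓝 (bI n l 1)) := by
  have : Continuous (bI n l) := by
    unfold bI
    apply intervalIntegral.continuous_primitive
    intro a b; apply Continuous.intervalIntegrable; fun_prop
  exact this.tendsto 1

/-- binomial coefficients -/
def bt (l n : ℕ) : ℝ := ((n + l).choose l : ℝ)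
lemma bt_pos (l n : ℕ) : 0 < bt l n := by unfold bt; exact_mod_cast Nat.choose_pos (by omega)
lemma bt_eq (l n : ℕ) : bt l n = (n + l).factorial / (n.factorial * l.factorial) := by
  unfold bt
  rw [Nat.add_choose]
  rw [Nat.cast_div (Nat.factorial_mul_factorial_dvd_factorial_add n l) (by positivity)]
  push_cast; rfl
lemma bt_bI (l n : ℕ) : bt l n * (n + l + 1) * bI n l 1 = 1 := by
  rw [bt_eq, bI_one, Nat.factorial_succ (n + l)]
  have : ((n + l).factorial : ℝ) ≠ 0 := by positivity
  have : (n.factorial : ℝ) ≠ 0 := by positivity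
  have : (l.factorial : ℝ) ≠ 0 := by positivity
  push_cast
  field_simp

/-! ### kernel -/
/-- `(1-w)^{-l-1}` expansion -/
lemma bt_hasSum (l : ℕ) {w : ℂ} (hw : ‖w‖ < 1) :
    HasSum (fun n => (bt l n : ℂ) * w ^ n) ((1 - w)⁻¹ ^ (l + 1)) := by
  have := hasSum_choose_mul_geometric_of_norm_lt_one' l hw
  rw [Ring.inverse_eq_inv'] at this
  simpa [bt] using this

/-- reproducing kernel -/
def kz (l : ℕ) (z : ℂ) (x : ℝ × ℝ) : ℂ :=
  ((2 * x.1 * (1 - x.1 ^ 2) ^ l : ℝ) : ℂ) * (1 - x.1 * Ec (-x.2) * z)⁻¹ ^ (l + 1)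

lemma kz_den {z : ℂ} (hz : ‖z‖ < 1) {x : ℝ × ℝ} (h0 : 0 ≤ x.1) (h1 : x.1 ≤ 1) :
    (1 - ‖z‖) ≤ ‖1 - (x.1 : ℂ) * Ec (-x.2) * z‖ := by
  have := norm_sub_norm_le (1 : ℂ) ((x.1 : ℂ) * Ec (-x.2) * z)
  simp [Ec_norm, abs_of_nonneg h0] at this
  nlinarith [norm_nonneg z]

lemma kz_contOn (l : ℕ) {z : ℂ} (hz : ‖z‖ < 1) :
    ContinuousOn (kz l z) {x | 0 ≤ x.1 ∧ x.1 ≤ 1} := by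
  unfold kz
  have := Ec_cont
  apply ContinuousOn.mul (by fun_prop)
  apply ContinuousOn.pow
  apply ContinuousOn.inv₀ (by fun_prop)
  intro x hx h
  have := kz_den hz hx.1 hx.2
  rw [h] at this; simp at this; linarith

lemma kz_norm_le (l : ℕ) {z : ℂ} (hz : ‖z‖ < 1) {x : ℝ × ℝ} (h0 : 0 ≤ x.1) (h1 : x.1 ≤ 1) :
    ‖kz l z x‖ ≤ 2 ^ (l + 1) * (1 - x.1) ^ l * (1 - ‖z‖)⁻¹ ^ (l + 1) := by
  unfold kz
  rw [norm_mul, norm_pow, norm_inv, norm_real, norm_eq_abs]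
  have hd := kz_den hz h0 h1
  have h2 : 0 ≤ 1 - x.1 ^ 2 := by nlinarith
  have h4 : 0 < 1 - ‖z‖ := by linarith
  rw [abs_of_nonneg (by positivity)]
  have h3 : 2 * x.1 * (1 - x.1 ^ 2) ^ l ≤ 2 ^ (l + 1) * (1 - x.1) ^ l := by
    have : (1 - x.1 ^ 2) ^ l ≤ (2 * (1 - x.1)) ^ l := by apply pow_le_pow_left₀ h2; nlinarith
    rw [mul_pow] at this
    have h5 : 0 ≤ 2 ^ l * (1 - x.1) ^ l := by
      have : 0 ≤ 1 - x.1 := by linarith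
      positivity
    calc 2 * x.1 * (1 - x.1 ^ 2) ^ l ≤ 2 * 1 * (2 ^ l * (1 - x.1) ^ l) := by gcongr
      _ = _ := by ring
  have : 0 ≤ 1 - x.1 := by linarith
  gcongr

lemma repr_circle (l : ℕ) {f : ℂ → ℂ} (hf : Hol(f, 1)) {z : ℂ}
    (hz : ‖z‖ < 1) {ρ : ℝ} (h0 : 0 ≤ ρ) (h1 : ρ < 1) :
    HasSum (fun n : ℕ => (bt l n * (n + l + 1) * (2 * ρ * (1 - ρ ^ 2) ^ l * ρ ^ (2 * n)) : ℝ) *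
        (tc f n * z ^ n))
      (∫ t in (0 : ℝ)..1, kz l z (ρ, t) * Rop (l + 1) f (circlePt ρ t)) := by
  have hρz : ‖(ρ : ℂ) * z‖ < 1 := by
    rw [norm_mul, Complex.norm_of_nonneg h0]
    nlinarith [norm_nonneg z]
  have ha : Summable fun n => ‖(bt l n : ℂ) * (ρ * z) ^ n‖ := (bt_hasSum l hρz).summable.norm
  have hb : Summable fun n : ℕ => ‖((n + (l + 1 : ℕ)) * tc f n) * (ρ : ℂ) ^ n‖ := by
    simpa [abs_of_nonneg h0] using Rop_summable (l + 1) hf h0 h1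
  have h := (pars ha hb).mul_left (((2 * ρ * (1 - ρ ^ 2) ^ l : ℝ)) : ℂ)
  rw [← intervalIntegral.integral_const_mul] at h
  have hInt : (∫ t in (0 : ℝ)..1, kz l z (ρ, t) * Rop (l + 1) f (circlePt ρ t)) =
      ∫ t in (0 : ℝ)..1, ((2 * ρ * (1 - ρ ^ 2) ^ l : ℝ) : ℂ) *
        ((∑' n, (bt l n : ℂ) * (ρ * z) ^ n * Ec (-t) ^ n) *
          ∑' n : ℕ, ((n + (l + 1 : ℕ)) * tc f n) * (ρ : ℂ) ^ n * Ec t ^ n) := by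
    apply intervalIntegral.integral_congr
    intro t _
    have e1 : ∑' n, (bt l n : ℂ) * (ρ * z) ^ n * Ec (-t) ^ n = (1 - ρ * Ec (-t) * z)⁻¹ ^ (l + 1) := by
      rw [← (bt_hasSum l (w := ρ * Ec (-t) * z) _).tsum_eq]
      · congr 1; ext n; ring
      · simpa [Ec_norm] using hρz
    have e2 : ∑' n : ℕ, ((n + (l + 1 : ℕ)) * tc f n) * (ρ : ℂ) ^ n * Ec t ^ n
        = Rop (l + 1) f (circlePt ρ t) := by
      rw [← (Rop_hasSum (l + 1) hf (z := circlePt ρ t) _).tsum_eq]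
      · congr 1; ext n; rw [circlePt_eq]; ring
      · simpa [circlePt_norm, abs_of_nonneg h0] using h1
    simp only [e1, e2, kz]
    ring
  rw [hInt]
  refine h.congr_fun ?_
  intro n; push_cast; ring

lemma repr_disc (l : ℕ) {f : ℂ → ℂ} (hf : Hol(f, 1)) {z : ℂ}
    (hz : ‖z‖ < 1) {r : ℝ} (h0 : 0 ≤ r) (h1 : r < 1) :
    ∫ ρ in (0 : ℝ)..r, ∫ t in (0 : ℝ)..1, kz l z (ρ, t) * Rop (l + 1) f (circlePt ρ t) =
      ∑' n : ℕ, (bt l n * (n + l + 1) * bI n l r : ℝ) * (tc f n * z ^ n) := by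
  have hs : HasSum (fun n : ℕ => ∫ ρ in (0 : ℝ)..r,
      ((bt l n * (n + l + 1) * (2 * ρ * (1 - ρ ^ 2) ^ l * ρ ^ (2 * n)) : ℝ) : ℂ) * (tc f n * z ^ n))
      (∫ ρ in (0 : ℝ)..r, ∑' n : ℕ,
      ((bt l n * (n + l + 1) * (2 * ρ * (1 - ρ ^ 2) ^ l * ρ ^ (2 * n)) : ℝ) : ℂ) * (tc f n * z ^ n)) := by
    simp_rw [intervalIntegral.integral_of_le h0]
    apply hasSum_integral_of_summable_integral_norm
    · intro n
      apply Continuous.integrableOn_Ioc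
      fun_prop
    · refine Summable.of_nonneg_of_le (fun n => integral_nonneg fun _ => norm_nonneg _) ?_
        (tc_hasSum hf hz).summable.norm
      intro n
      have : ∀ ρ ∈ Set.Ioc 0 r, ‖((bt l n * (n + l + 1) * (2 * ρ * (1 - ρ ^ 2) ^ l * ρ ^ (2 * n)) : ℝ) : ℂ) * (tc f n * z ^ n)‖
         = ‖tc f n * z ^ n‖ * (bt l n * (n + l + 1)) * (2 * ρ * (1 - ρ ^ 2) ^ l * ρ ^ (2 * n)) := fun ρ hρ => by
        have : 0 ≤ 1 - ρ ^ 2 := by nlinarith [hρ.1, hρ.2]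
        have := hρ.1.le
        have := (bt_pos l n).le
        rw [norm_mul, Complex.norm_of_nonneg (by positivity)]; ring
      rw [setIntegral_congr_fun measurableSet_Ioc this, integral_const_mul,
        ← intervalIntegral.integral_of_le h0]
      change _ * bI n l r ≤ _
      rw [mul_assoc]
      have h3 := (bI_int n l h0 h1.le).2
      have := (bt_pos l n).le
      calc ‖tc f n * z ^ n‖ * (bt l n * (n + l + 1) * bI n l r) ≤
          ‖tc f n * z ^ n‖ * (bt l n * (n + l + 1) * bI n l 1) := by gcongr
        _ = _ := by rw [bt_bI, mul_one]
  rw [intervalIntegral.integral_congr (g := fun ρ => ∑' n : ℕ,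
      ((bt l n * (n + l + 1) * (2 * ρ * (1 - ρ ^ 2) ^ l * ρ ^ (2 * n)) : ℝ) : ℂ) * (tc f n * z ^ n))]
  · rw [← hs.tsum_eq]
    congr 1; ext n
    rw [intervalIntegral.integral_mul_const]
    congr 1
    rw [intervalIntegral.integral_ofReal, intervalIntegral.integral_const_mul]; rfl
  · intro ρ hρ
    rw [Set.uIcc_of_le h0] at hρ
    exact (repr_circle l hf hz hρ.1 (hρ.2.trans_lt h1)).tsum_eq.symm

lemma repr_lim (l : ℕ) {f : ℂ → ℂ} (hf : Hol(f, 1)) {z : ℂ}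
    (hz : ‖z‖ < 1) {r : ℕ → ℝ} (h0 : ∀ n, 0 ≤ r n) (h1 : ∀ n, r n < 1) (hr : Tendsto r atTop (𝓝 1)) :
    Tendsto (fun N => ∫ ρ in (0 : ℝ)..r N, ∫ t in (0 : ℝ)..1, kz l z (ρ, t) * Rop (l + 1) f (circlePt ρ t))
      atTop (𝓝 (f z)) := by
  simp_rw [fun N => repr_disc l hf hz (h0 N) (h1 N)]
  rw [← (tc_hasSum hf hz).tsum_eq]
  apply tendsto_tsum_of_dominated_convergence (bound := fun n => ‖tc f n * z ^ n‖)
    (tc_hasSum hf hz).summable.norm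
  · intro n
    have h2 : Tendsto (fun N => ((bt l n * (n + l + 1) * bI n l (r N) : ℝ) : ℂ) * (tc f n * z ^ n)) atTop
        (𝓝 (((bt l n * (n + l + 1) * bI n l 1 : ℝ) : ℂ) * (tc f n * z ^ n))) := by
      apply Filter.Tendsto.mul_const
      apply (Complex.continuous_ofReal.tendsto _).comp
      exact (((bI_tendsto n l).comp hr).const_mul _)
    simpa only [bt_bI, Complex.ofReal_one, one_mul] using h2
  · apply Eventually.of_forall
    intro N n
    have h3 := (bI_int n l (h0 N) (h1 N).le)
    have := (bt_pos l n).le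
    have h4 : bt l n * (n + l + 1) * bI n l (r N) ≤ 1 := by
      refine le_trans ?_ (bt_bI l n).le
      apply mul_le_mul_of_nonneg_left h3.2; positivity
    rw [norm_mul, Complex.norm_of_nonneg (mul_nonneg (by positivity) h3.1)]
    nlinarith [norm_nonneg (tc f n * z ^ n)]

/-! ### boxes -/
namespace Dy
/-- Whitney boxes -/
def Q (I : Dy) : Set (ℝ × ℝ) := Ico (1 - I.len) (1 - I.len / 2) ×ˢ I.A

lemma measQ (I : Dy) : MeasurableSet I.Q := measurableSet_Ico.prod I.measA
lemma len_le_one (I : Dy) : I.len ≤ 1 := by unfold len; exact inv_le_one_of_one_le₀ (one_le_pow₀ (by norm_num))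
lemma Q_bd {I : Dy} {x : ℝ × ℝ} (h : x ∈ I.Q) :
    0 ≤ x.1 ∧ x.1 < 1 ∧ I.len / 2 < 1 - x.1 ∧ 1 - x.1 ≤ I.len ∧ 0 ≤ x.2 ∧ x.2 < 1 := by
  obtain ⟨⟨a, b⟩, c⟩ := h
  have := I.len_le_one; have := I.len_pos; have := I.A_sub c
  exact ⟨by linarith, by linarith, by linarith, by linarith, this.1, this.2⟩
lemma volQ (I : Dy) : volume I.Q = ofReal (I.len ^ 2 / 2) := by
  unfold Q A
  rw [Measure.volume_eq_prod, Measure.prod_prod, Real.volume_Ico, Real.volume_Ico,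
    ← ofReal_mul (by have := I.len_pos; linarith)]
  congr 1; ring
lemma Q_inj {I J : Dy} {x : ℝ × ℝ} (hI : x ∈ I.Q) (hJ : x ∈ J.Q) : I = J := by
  have key : ∀ {I J : Dy}, x ∈ I.Q → x ∈ J.Q → ¬ I.1 < J.1 := by
    intro I J hI hJ hlt
    have h1 := (Q_bd hI).2.2.1
    have h2 := (Q_bd hJ).2.2.2.1
    have : J.len ≤ I.len / 2 := by
      unfold len
      have : (2 : ℝ) ^ (I.1 + 1) ≤ 2 ^ J.1 := pow_le_pow_right₀ (by norm_num) hlt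
      rw [div_eq_mul_inv, ← mul_inv, ← pow_succ]
      exact inv_anti₀ (by positivity) this
    linarith
  have e : I.1 = J.1 := le_antisymm (not_lt.1 (key hJ hI)) (not_lt.1 (key hI hJ))
  rw [eq_lv hI.2, eq_lv hJ.2, e]
lemma Q_disj {I J : Dy} (h : I ≠ J) : Disjoint I.Q J.Q :=
  Set.disjoint_left.2 fun _ a b => h (Q_inj a b)
/-- dyadic intervals of levels below N -/
def lev (N : ℕ) : Finset Dy := (range N).sigma fun _ => Finset.univ
lemma mem_lev {N : ℕ} {I : Dy} : I ∈ lev N ↔ I.1 < N := by simp [lev]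
lemma biUnion_Q (N : ℕ) : ⋃ I ∈ lev N, Q I = Ico 0 (1 - (2 ^ N : ℝ)⁻¹) ×ˢ Ico 0 1 := by
  ext x
  simp only [mem_iUnion, mem_lev, exists_prop]
  constructor
  · rintro ⟨I, hN, hx⟩
    have h := Q_bd hx
    refine ⟨⟨h.1, ?_⟩, h.2.2.2.2⟩
    have h1 : x.1 < 1 - I.len / 2 := hx.1.2
    have : (2 ^ N : ℝ)⁻¹ ≤ I.len / 2 := by
      unfold len
      have : (2 : ℝ) ^ (I.1 + 1) ≤ 2 ^ N := pow_le_pow_right₀ (by norm_num) hN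
      rw [div_eq_mul_inv, ← mul_inv, ← pow_succ]
      exact inv_anti₀ (by positivity) this
    linarith
  · rintro ⟨⟨h1, h2⟩, h3⟩
    have hex : ∃ i : ℕ, x.1 < 1 - (2 ^ (i + 1) : ℝ)⁻¹ := by
      refine ⟨N, h2.trans_le ?_⟩
      have : (2 ^ (N + 1) : ℝ)⁻¹ ≤ (2 ^ N : ℝ)⁻¹ :=
        inv_anti₀ (by positivity) (pow_le_pow_right₀ (by norm_num) (by omega))
      linarith
    classical
    refine ⟨lv (Nat.find hex) x.2, ?_, ⟨?_, ?_⟩, mem_lv h3 _⟩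
    · rw [lv_fst]
      rcases N with _ | N
      · simp at h2; linarith
      · exact Nat.lt_succ_of_le (Nat.find_min' hex h2)
    · unfold len; rw [lv_fst]
      rcases h : Nat.find hex with _ | k
      · simpa using h1
      · have := Nat.find_min hex (m := k) (by omega)
        linarith
    · have := Nat.find_spec hex
      unfold len; rw [lv_fst]
      rw [pow_succ, mul_inv] at this
      linarith
end Dy

/-- the reproducing formula over boxes -/
lemma repr_box (l : ℕ) {f : ℂ → ℂ} (hf : Hol(f, 1)) {z : ℂ}
    (hz : ‖z‖ < 1) :
    Tendsto (fun N => ∑ I ∈ Dy.lev N, ∫ x in I.Q, kz l z x * Rop (l + 1) f cp(x))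
      atTop (𝓝 (f z)) := by
  have hco : ContinuousOn (fun x : ℝ × ℝ => kz l z x * Rop (l + 1) f cp(x))
      {x | 0 ≤ x.1 ∧ x.1 < 1} := by
    apply ((kz_contOn l hz).mono fun x hx => ⟨hx.1, hx.2.le⟩).mul
    apply (Rop_diff (l + 1) hf).continuousOn.comp circlePt_cont.continuousOn
    intro x hx
    simpa [circlePt_norm, abs_of_nonneg hx.1] using hx.2
  have hInt : ∀ r : ℝ, r < 1 → IntegrableOn (fun x : ℝ × ℝ => kz l z x * Rop (l + 1) f cp(x))
      (Icc 0 r ×ˢ Icc 0 1) := fun r hr => by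
    apply (hco.mono _).integrableOn_compact (isCompact_Icc.prod isCompact_Icc)
    intro x hx; exact ⟨hx.1.1, hx.1.2.trans_lt hr⟩
  have hr : Tendsto (fun N : ℕ => 1 - (2 ^ N : ℝ)⁻¹) atTop (𝓝 1) := by
    have : Tendsto (fun N : ℕ => ((2 : ℝ)⁻¹) ^ N) atTop (𝓝 0) :=
      tendsto_pow_atTop_nhds_zero_of_lt_one (by norm_num) (by norm_num)
    simpa using this.const_sub 1
  have hr0 : ∀ N : ℕ, 0 ≤ 1 - (2 ^ N : ℝ)⁻¹ := fun N => by
    have : (2 ^ N : ℝ)⁻¹ ≤ 1 := inv_le_one_of_one_le₀ (one_le_pow₀ (by norm_num))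
    linarith
  have hr1 : ∀ N : ℕ, 1 - (2 ^ N : ℝ)⁻¹ < 1 := fun N => by
    have : 0 < (2 ^ N : ℝ)⁻¹ := by positivity
    linarith
  refine (repr_lim l hf hz hr0 hr1 hr).congr fun N => ?_
  have hsub : Ico 0 (1 - (2 ^ N : ℝ)⁻¹) ×ˢ 𝕀 ⊆
      Icc 0 (1 - (2 ^ N : ℝ)⁻¹) ×ˢ Icc 0 1 :=
    Set.prod_mono Ico_subset_Icc_self Ico_subset_Icc_self
  have hI := (hInt _ (hr1 N)).mono_set hsub
  rw [← integral_biUnion_finset _ (fun I _ => I.measQ) (fun I _ J _ h => Dy.Q_disj h), Dy.biUnion_Q,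
    Measure.volume_eq_prod, setIntegral_prod _ (by simpa [Measure.volume_eq_prod] using hI)]
  · rw [intervalIntegral.integral_of_le (hr0 N), integral_Ico_eq_integral_Ioc]
    apply setIntegral_congr_fun measurableSet_Ioc
    intro ρ _
    simp only
    rw [intervalIntegral.integral_of_le zero_le_one, integral_Ico_eq_integral_Ioc]
  · intro I hIN
    apply hI.mono_set
    rw [← Dy.biUnion_Q]
    exact Set.subset_biUnion_of_mem (u := fun I => Dy.Q I) hIN

/-! ### Poisson-type maximal function -/
lemma lint_CS {α : Type*} [MeasurableSpace α] (μ : Measure α) {u v : α → ℝ≥0∞}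
    (hu : AEMeasurable u μ) (hv : AEMeasurable v μ) :
    (∫⁻ x, u x * v x ∂μ) ^ 2 ≤ (∫⁻ x, u x ^ 2 ∂μ) * ∫⁻ x, v x ^ 2 ∂μ := by
  have h := lintegral_mul_le_Lp_mul_Lq μ Real.HolderConjugate.two_two hu hv
  have h2 := pow_le_pow_left' h 2
  refine h2.trans ?_
  simp only [rpow_two]
  rw [mul_pow]
  simp only [← rpow_natCast, ← rpow_mul]
  norm_num

/-- Poisson-type kernel -/
def pk (h x : ℝ) : ℝ≥0∞ := ofReal (h / (h ^ 2 + x ^ 2))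

lemma pk_meas (h : ℝ) : Measurable (pk h) := by unfold pk; fun_prop
lemma pk_neg (h x : ℝ) : pk h (-x) = pk h x := by simp [pk]
lemma pk_comm (h x y : ℝ) : pk h (x - y) = pk h (y - x) := by rw [← pk_neg, neg_sub]

lemma pk_int0 {h : ℝ} (hh : 0 < h) : ∫⁻ s, pk h s = ofReal Real.pi := by
  have e : ∀ s : ℝ, h / (h ^ 2 + s ^ 2) = h⁻¹ * (1 + (h⁻¹ * s) ^ 2)⁻¹ := by intro s; field_simp
  have hi : Integrable (fun s : ℝ => h⁻¹ * (1 + (h⁻¹ * s) ^ 2)⁻¹) :=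
    (integrable_inv_one_add_sq.comp_mul_left' (inv_ne_zero hh.ne')).const_mul _
  unfold pk
  simp_rw [e]
  rw [← ofReal_integral_eq_lintegral_ofReal hi (ae_of_all _ fun s => by positivity)]
  rw [integral_const_mul, Measure.integral_comp_mul_left (fun s : ℝ => (1 + s ^ 2)⁻¹) h⁻¹,
    integral_univ_inv_one_add_sq]
  congr 1
  simp [abs_of_pos hh]
  field_simp

lemma pk_int {h : ℝ} (hh : 0 < h) (x : ℝ) : ∫⁻ s, pk h (x - s) = ofReal Real.pi := by
  rw [lintegral_sub_left_eq_self (fun s => pk h s) x, pk_int0 hh]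

lemma pk_prod {h h' : ℝ} (hh : 0 < h') (hle : h' ≤ h) (x y s : ℝ) :
    pk h (x - s) * pk h' (s - y) ≤ pk h (x - y) * (8 * pk h (x - s) + 4 * pk h' (s - y)) := by
  have h0 : 0 < h := hh.trans_le hle
  have key : (h / (h ^ 2 + (x - s) ^ 2)) * (h' / (h' ^ 2 + (s - y) ^ 2)) ≤
      (h / (h ^ 2 + (x - y) ^ 2)) * (8 * (h / (h ^ 2 + (x - s) ^ 2)) + 4 * (h' / (h' ^ 2 + (s - y) ^ 2))) := by
    have pA : 0 < h / (h ^ 2 + (x - s) ^ 2) := by positivity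
    have pB : 0 < h' / (h' ^ 2 + (s - y) ^ 2) := by positivity
    have pD : 0 < h / (h ^ 2 + (x - y) ^ 2) := by positivity
    -- either first factor ≤ 4 D or second ≤ 8 D
    have alt : h / (h ^ 2 + (x - s) ^ 2) ≤ 4 * (h / (h ^ 2 + (x - y) ^ 2)) ∨
        h' / (h' ^ 2 + (s - y) ^ 2) ≤ 8 * (h / (h ^ 2 + (x - y) ^ 2)) := by
      by_cases hd : (x - y) ^ 2 ≤ h ^ 2
      · left
        rw [← mul_div_assoc, div_le_div_iff₀ (by positivity) (by positivity)]
        nlinarith [mul_nonneg h0.le (sq_nonneg (x - s)), mul_nonneg h0.le (sub_nonneg.2 hd), pow_pos h0 3]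
      · push Not at hd
        by_cases hs : (x - y) ^ 2 ≤ 4 * (x - s) ^ 2
        · left
          rw [← mul_div_assoc, div_le_div_iff₀ (by positivity) (by positivity)]
          nlinarith [pow_pos h0 3]
        · right
          have : (x - y) ^ 2 ≤ 4 * (s - y) ^ 2 := by
            push Not at hs
            have h1 : |x - s| < |x - y| / 2 := by
              apply lt_of_pow_lt_pow_left₀ 2 (by positivity)
              rw [div_pow, sq_abs, sq_abs]; linarith
            have h2 : |x - y| ≤ |x - s| + |s - y| := by have := abs_add_le (x - s) (s - y); simpa using this
            have h3 : |x - y| / 2 ≤ |s - y| := by linarith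
            have h4 : (|x - y| / 2) ^ 2 ≤ |s - y| ^ 2 := by gcongr
            rw [div_pow, sq_abs, sq_abs] at h4; linarith
          rw [← mul_div_assoc, div_le_div_iff₀ (by positivity) (by positivity)]
          nlinarith [mul_le_mul_of_nonneg_left this h0.le, mul_le_mul_of_nonneg_right hle (sq_nonneg (x - y)), mul_le_mul_of_nonneg_right hle (sq_nonneg h), mul_le_mul_of_nonneg_left hd.le hh.le, mul_pos h0 (pow_pos hh 2)]
    rcases alt with a | a
    · nlinarith [mul_le_mul_of_nonneg_right a pB.le, mul_pos pD pA]
    · nlinarith [mul_le_mul_of_nonneg_left a pA.le, mul_pos pD pB]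
  unfold pk
  have e8 : (8 : ℝ≥0∞) = ofReal 8 := by norm_num
  have e4 : (4 : ℝ≥0∞) = ofReal 4 := by norm_num
  rw [e8, e4]
  rw [← ofReal_mul (by positivity), ← ofReal_mul (by positivity),
    ← ofReal_mul (by positivity), ← ofReal_add (by positivity) (by positivity),
    ← ofReal_mul (by positivity)]
  exact ofReal_le_ofReal key

lemma pk_conv' {h h' : ℝ} (hh : 0 < h') (hle : h' ≤ h) (x y : ℝ) :
    ∫⁻ s, pk h (x - s) * pk h' (s - y) ≤ 12 * ofReal Real.pi * pk h (x - y) := by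
  have m1 : Measurable fun s => pk h (x - s) := (pk_meas h).comp (by fun_prop)
  have m2 : Measurable fun s => pk h' (s - y) := (pk_meas h').comp (by fun_prop)
  refine (lintegral_mono fun s => pk_prod hh hle x y s).trans ?_
  rw [lintegral_const_mul _ (by fun_prop), lintegral_add_left (by fun_prop),
    lintegral_const_mul _ m1, lintegral_const_mul _ m2, pk_int (hh.trans_le hle)]
  simp_rw [pk_comm h' _ y]
  rw [pk_int hh, ← add_mul]
  norm_num
  rw [mul_comm]

lemma pk_conv {h h' : ℝ} (h0 : 0 < h) (hh : 0 < h') (x y : ℝ) :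
    ∫⁻ s, pk h (x - s) * pk h' (s - y) ≤
      12 * ofReal Real.pi * (pk h (x - y) + pk h' (x - y)) := by
  rcases le_total h' h with hle | hle
  · exact (pk_conv' hh hle x y).trans (mul_le_mul_right le_self_add _)
  · have := pk_conv' h0 hle y x
    rw [pk_comm h' y x] at this
    refine le_trans (le_of_eq ?_) (this.trans (mul_le_mul_right le_add_self _))
    congr 1; ext s; rw [mul_comm, pk_comm h x s, pk_comm h' s y]

/-- kernel operator -/
def pK (h : ℝ) (f : ℝ → ℝ≥0∞) (x : ℝ) : ℝ≥0∞ := ∫⁻ s, pk h (x - s) * f s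

lemma pK_m2 (h : ℝ) {f : ℝ → ℝ≥0∞} (hf : Measurable f) :
    Measurable fun z : ℝ × ℝ => pk h (z.1 - z.2) * f z.2 :=
  ((pk_meas h).comp (by fun_prop)).mul (hf.comp measurable_snd)

lemma pK_meas (h : ℝ) {f : ℝ → ℝ≥0∞} (hf : Measurable f) : Measurable (pK h f) :=
  (pK_m2 h hf).lintegral_prod_right'

lemma pK_sq {h : ℝ} (hh : 0 < h) {f : ℝ → ℝ≥0∞} (hf : Measurable f) :
    ∫⁻ x, pK h f x ^ 2 ≤ ofReal Real.pi ^ 2 * ∫⁻ s, f s ^ 2 := by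
  have h1 : ∀ x, pK h f x ^ 2 ≤ ofReal Real.pi * pK h (fun s => f s ^ 2) x := fun x => by
    have m1 : Measurable fun s => pk h (x - s) ^ (1 / 2 : ℝ) := ((pk_meas h).comp (by fun_prop)).pow_const _
    have := lint_CS volume m1.aemeasurable (m1.mul hf).aemeasurable
    have e : ∀ s, pk h (x - s) ^ (1 / 2 : ℝ) * pk h (x - s) ^ (1 / 2 : ℝ) = pk h (x - s) := by
      intro s; rw [← rpow_add_of_nonneg _ _ (by norm_num) (by norm_num)]; norm_num
    have e' : ∀ s, (pk h (x - s) ^ (1 / 2 : ℝ)) ^ 2 = pk h (x - s) := by intro s; rw [sq, e]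
    simp only [Pi.mul_apply, ← mul_assoc, mul_pow, e, e'] at this
    rw [pk_int hh] at this
    exact this
  refine (lintegral_mono h1).trans ?_
  rw [lintegral_const_mul _ (pK_meas h (hf.pow_const 2)), sq, mul_assoc]
  gcongr
  unfold pK
  rw [lintegral_lintegral_swap (pK_m2 h (hf.pow_const 2)).aemeasurable]
  have : ∀ y, ∫⁻ x, pk h (x - y) * f y ^ 2 = ofReal Real.pi * f y ^ 2 := fun y => by
    simp_rw [pk_comm h _ y]
    have m1 : Measurable fun s => pk h (y - s) := (pk_meas h).comp (by fun_prop)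
    rw [lintegral_mul_const _ m1, pk_int hh]
  simp_rw [this]
  rw [lintegral_const_mul _ (hf.pow_const 2)]

lemma pK_symm (h : ℝ) {f g : ℝ → ℝ≥0∞} (hf : Measurable f) (hg : Measurable g) :
    ∫⁻ x, g x * pK h f x = ∫⁻ s, f s * pK h g s := by
  unfold pK
  have e1 : ∀ x, g x * ∫⁻ s, pk h (x - s) * f s = ∫⁻ s, g x * (pk h (x - s) * f s) := by
    intro x; rw [lintegral_const_mul]
    exact ((pk_meas h).comp (by fun_prop)).mul hf
  have e2 : ∀ s, f s * ∫⁻ x, pk h (s - x) * g x = ∫⁻ x, f s * (pk h (s - x) * g x) := by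
    intro x; rw [lintegral_const_mul]
    exact ((pk_meas h).comp (by fun_prop)).mul hg
  simp_rw [e1, e2]
  rw [lintegral_lintegral_swap]
  · congr 1; ext s; congr 1; ext x; rw [pk_comm h x s]; ring
  · exact ((hg.comp measurable_fst).mul (pK_m2 h hf)).aemeasurable

lemma pK_mul {h h' : ℝ} (h0 : 0 < h) (hh : 0 < h') {f g : ℝ → ℝ≥0∞} (hf : Measurable f) (hg : Measurable g) :
    ∫⁻ s, pK h f s * pK h' g s ≤ 12 * ofReal Real.pi *
      ((∫⁻ x, f x * pK h g x) + ∫⁻ x, g x * pK h' f x) := by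
  have e0 : ∫⁻ s, pK h f s * pK h' g s = ∫⁻ x, f x * pK h (pK h' g) x := by rw [pK_symm h (pK_meas h' hg) hf]; simp_rw [mul_comm]
  rw [e0]
  have e : ∀ x, pK h (pK h' g) x ≤ 12 * ofReal Real.pi * (pK h g x + pK h' g x) := fun x => by
    unfold pK
    have m0 : Measurable fun y => pk h (x - y) * g y := ((pk_meas h).comp (by fun_prop)).mul hg
    have m1 : Measurable fun y => pk h (x - y) * g y + pk h' (x - y) * g y :=
      m0.add (((pk_meas h').comp (by fun_prop)).mul hg)
    rw [← lintegral_add_left m0, ← lintegral_const_mul _ m1]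
    have e1 : ∀ s, pk h (x - s) * ∫⁻ y, pk h' (s - y) * g y = ∫⁻ y, pk h (x - s) * (pk h' (s - y) * g y) := by
      intro s; rw [lintegral_const_mul]
      exact ((pk_meas h').comp (by fun_prop)).mul hg
    simp_rw [e1]
    rw [lintegral_lintegral_swap]
    · apply lintegral_mono
      intro y
      simp only
      have := pk_conv h0 hh x y
      have m3 : Measurable fun s => pk h (x - s) * pk h' (s - y) :=
        ((pk_meas h).comp (by fun_prop)).mul ((pk_meas h').comp (by fun_prop))
      simp_rw [← mul_assoc]
      rw [lintegral_mul_const _ m3, ← add_mul, ← mul_assoc]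
      gcongr
    · exact (((pk_meas h).comp (by fun_prop)).mul (pK_m2 h' hg)).aemeasurable
  calc ∫⁻ x, f x * pK h (pK h' g) x ≤ ∫⁻ x, 12 * ofReal Real.pi * (f x * pK h g x + f x * pK h' g x) := by
        apply lintegral_mono; intro x
        refine (mul_le_mul_right (e x) _).trans (le_of_eq ?_)
        ring
    _ = _ := by
        rw [lintegral_const_mul _ (by have := pK_meas h hg; have := pK_meas h' hg; fun_prop),
          lintegral_add_left (by have := pK_meas h hg; fun_prop), pK_symm h' hg hf]

/-- truncated maximal function -/
def pM (h : ℕ → ℝ) (N : ℕ) (f : ℝ → ℝ≥0∞) (x : ℝ) : ℝ≥0∞ := (range N).sup fun i => pK (h i) f x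

lemma pM_meas (h : ℕ → ℝ) (N : ℕ) {f : ℝ → ℝ≥0∞} (hf : Measurable f) : Measurable (pM h N f) := by
  unfold pM
  simp_rw [Finset.sup_eq_iSup]
  refine Measurable.iSup fun i => Measurable.iSup fun _ => pK_meas _ hf

lemma le_pM {h : ℕ → ℝ} {N i : ℕ} (hi : i < N) (f : ℝ → ℝ≥0∞) (x : ℝ) : pK (h i) f x ≤ pM h N f x :=
  Finset.le_sup (f := fun i => pK (h i) f x) (mem_range.2 hi)

lemma pM_apriori {h : ℕ → ℝ} (hh : ∀ i, 0 < h i) (N : ℕ) {f : ℝ → ℝ≥0∞} (hf : Measurable f) :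
    ∫⁻ x, pM h N f x ^ 2 ≤ N * ofReal Real.pi ^ 2 * ∫⁻ s, f s ^ 2 := by
  have h1 : ∀ x, pM h N f x ^ 2 ≤ ∑ i ∈ range N, pK (h i) f x ^ 2 := fun x => by
    by_cases hN : N = 0
    · subst hN; simp [pM]
    · obtain ⟨i, hi, e⟩ := Finset.exists_mem_eq_sup (range N) (by simpa using hN) (fun i => pK (h i) f x)
      unfold pM; rw [e]
      exact Finset.single_le_sum (f := fun i => pK (h i) f x ^ 2) (fun _ _ => zero_le) hi
  refine (lintegral_mono h1).trans ?_
  rw [lintegral_finsetSum _ fun i _ => (pK_meas _ hf).pow_const 2]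
  refine (sum_le_sum fun i _ => pK_sq (hh i) hf).trans ?_
  simp [mul_assoc]

lemma pM_improve {h : ℕ → ℝ} (hh : ∀ i, 0 < h i) (N : ℕ) {B : ℝ≥0∞}
    (hB : ∀ f, Measurable f → ∫⁻ s, f s ^ 2 ≠ ∞ → ∫⁻ x, pM h N f x ^ 2 ≤ B * ∫⁻ s, f s ^ 2) {f : ℝ → ℝ≥0∞}
    (hf : Measurable f) (hfin : ∫⁻ x, pM h N f x ^ 2 ≠ ∞) :
    (∫⁻ x, pM h N f x ^ 2) ^ 2 ≤ (24 * ofReal Real.pi * ∫⁻ s, f s ^ 2) ^ 2 * B := by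
  classical
  set m := pM h N f with hm
  have mm : Measurable m := pM_meas h N hf
  set S : ℕ → Set ℝ := fun i => {x | i < N ∧ pK (h i) f x = m x} with hS
  have mS : ∀ i, MeasurableSet (S i) := fun i => by
    by_cases hi : i < N
    · have : S i = {x | pK (h i) f x = m x} := by ext x; simp [hS, hi]
      rw [this]; exact measurableSet_eq_fun (pK_meas _ hf) mm
    · have : S i = ∅ := by ext x; simp [hS, hi]
      rw [this]; exact MeasurableSet.empty
  set D : ℕ → Set ℝ := disjointed S with hD
  have mD : ∀ i, MeasurableSet (D i) := fun i => MeasurableSet.disjointed mS i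
  set mi : ℕ → ℝ → ℝ≥0∞ := fun i => (D i).indicator m with hmi
  have mmi : ∀ i, Measurable (mi i) := fun i => mm.indicator (mD i)
  have hDsub : ∀ i, D i ⊆ S i := fun i => disjointed_subset S i
  by_cases hN : N = 0
  · subst hN; simp [hm, pM]
  have hsum : ∀ x, ∑ i ∈ range N, mi i x = m x := fun x => by
    obtain ⟨i, hi, e⟩ := Finset.exists_mem_eq_sup (range N) (by simpa using hN) (fun i => pK (h i) f x)
    have hx : x ∈ ⋃ i, D i := by rw [hD, iUnion_disjointed]; exact mem_iUnion.2 ⟨i, mem_range.1 hi, e.symm⟩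
    obtain ⟨j, hj⟩ := mem_iUnion.1 hx
    rw [Finset.sum_eq_single_of_mem j (mem_range.2 (hDsub j hj).1)]
    · simp [hmi, hj]
    · intro k _ hk
      have : x ∉ D k := fun hk' => Set.disjoint_left.1 (disjoint_disjointed S hk) hk' hj
      simp [hmi, this]
  set U : ℝ → ℝ≥0∞ := fun s => ∑ i ∈ range N, pK (h i) (mi i) s with hU
  have mU : Measurable U := Finset.measurable_sum _ fun i _ => pK_meas _ (mmi i)
  have s1 : ∫⁻ x, m x ^ 2 = ∫⁻ s, f s * U s := by
    have e1 : ∀ x, m x ^ 2 = ∑ i ∈ range N, mi i x * pK (h i) f x := fun x => by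
      rw [sq]; nth_rewrite 1 [← hsum x]
      rw [sum_mul]
      apply sum_congr rfl
      intro i _
      by_cases hx : x ∈ D i
      · rw [(hDsub i hx).2]
      · simp [hmi, hx]
    simp_rw [e1, hU, mul_sum]
    have mK : ∀ i, Measurable (pK (h i) f) := fun i => pK_meas _ hf
    have mK' : ∀ i, Measurable (pK (h i) (mi i)) := fun i => pK_meas _ (mmi i)
    rw [lintegral_finsetSum _ (fun i _ => by fun_prop), lintegral_finsetSum _ (fun i _ => by fun_prop)]
    exact sum_congr rfl fun i _ => pK_symm _ hf (mmi i)
  have s2 : (∫⁻ x, m x ^ 2) ^ 2 ≤ (∫⁻ s, f s ^ 2) * ∫⁻ s, U s ^ 2 := by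
    rw [s1]; exact lint_CS volume hf.aemeasurable mU.aemeasurable
  have s3 : ∫⁻ s, U s ^ 2 ≤ 24 * ofReal Real.pi * ∫⁻ x, m x * pM h N m x := by
    have e1 : ∀ s, U s ^ 2 = ∑ i ∈ range N, ∑ j ∈ range N, pK (h i) (mi i) s * pK (h j) (mi j) s := by
      intro s; rw [sq, hU, Finset.sum_mul_sum]
    simp_rw [e1]
    have mK' : ∀ i, Measurable (pK (h i) (mi i)) := fun i => pK_meas _ (mmi i)
    rw [lintegral_finsetSum _ (fun i _ => by fun_prop)]
    have e0 : ∀ i, ∫⁻ s, ∑ j ∈ range N, pK (h i) (mi i) s * pK (h j) (mi j) s =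
        ∑ j ∈ range N, ∫⁻ s, pK (h i) (mi i) s * pK (h j) (mi j) s := by
      intro i; rw [lintegral_finsetSum _ (fun i _ => by fun_prop)]
    simp_rw [e0]
    have e2 : ∀ i x, ∑ j ∈ range N, pK (h i) (mi j) x = pK (h i) m x := fun i x => by
      unfold pK
      have m1 : Measurable fun s => pk (h i) (x - s) := (pk_meas _).comp (by fun_prop)
      rw [← lintegral_finsetSum _ (fun j _ => by fun_prop)]
      congr 1; ext s; rw [← mul_sum, hsum]
    have e3 : ∑ i ∈ range N, ∑ j ∈ range N, ∫⁻ x, mi i x * pK (h i) (mi j) x ≤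
        ∫⁻ x, m x * pM h N m x := by
      have : ∀ i, ∑ j ∈ range N, ∫⁻ x, mi i x * pK (h i) (mi j) x = ∫⁻ x, mi i x * pK (h i) m x := fun i => by
        have m1 : ∀ j, Measurable (pK (h i) (mi j)) := fun j => pK_meas _ (mmi j)
        rw [← lintegral_finsetSum _ (fun j _ => by fun_prop)]
        congr 1; ext x; rw [← mul_sum, e2]
      simp_rw [this]
      have m1 : ∀ j, Measurable (pK (h j) m) := fun j => pK_meas _ mm
      rw [← lintegral_finsetSum _ (fun j _ => by fun_prop)]
      apply lintegral_mono
      intro x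
      simp only
      rw [← hsum x, sum_mul]
      exact sum_le_sum fun i hi => mul_le_mul_right (le_pM (mem_range.1 hi) _ _) _
    calc _ ≤ ∑ i ∈ range N, ∑ j ∈ range N, 12 * ofReal Real.pi *
          ((∫⁻ x, mi i x * pK (h i) (mi j) x) + ∫⁻ x, mi j x * pK (h j) (mi i) x) :=
          sum_le_sum fun i _ => sum_le_sum fun j _ => pK_mul (hh i) (hh j) (mmi i) (mmi j)
      _ = 12 * ofReal Real.pi * (2 * ∑ i ∈ range N, ∑ j ∈ range N, ∫⁻ x, mi i x * pK (h i) (mi j) x) := by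
          simp_rw [← mul_sum, sum_add_distrib]
          rw [Finset.sum_comm (f := fun i j => ∫⁻ x, mi j x * pK (h j) (mi i) x), two_mul]
      _ ≤ 12 * ofReal Real.pi * (2 * ∫⁻ x, m x * pM h N m x) := by gcongr
      _ = _ := by ring
  have s4 : (∫⁻ x, m x * pM h N m x) ^ 2 ≤ B * (∫⁻ x, m x ^ 2) ^ 2 := by
    refine (lint_CS volume mm.aemeasurable (pM_meas h N mm).aemeasurable).trans ?_
    refine (mul_le_mul_right (hB m mm hfin) _).trans (le_of_eq ?_)
    ring
  by_cases ha0 : ∫⁻ x, m x ^ 2 = 0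
  · rw [ha0]; simp
  have s5 : (∫⁻ x, m x ^ 2) ^ 2 * (∫⁻ x, m x ^ 2) ^ 2 ≤
      (∫⁻ x, m x ^ 2) ^ 2 * ((24 * ofReal Real.pi * ∫⁻ s, f s ^ 2) ^ 2 * B) := by
    calc (∫⁻ x, m x ^ 2) ^ 2 * (∫⁻ x, m x ^ 2) ^ 2 = ((∫⁻ x, m x ^ 2) ^ 2) ^ 2 := by ring
      _ ≤ ((∫⁻ s, f s ^ 2) * (24 * ofReal Real.pi * ∫⁻ x, m x * pM h N m x)) ^ 2 := by
          gcongr; exact s2.trans (mul_le_mul_right s3 _)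
      _ = (24 * ofReal Real.pi * ∫⁻ s, f s ^ 2) ^ 2 * (∫⁻ x, m x * pM h N m x) ^ 2 := by ring
      _ ≤ (24 * ofReal Real.pi * ∫⁻ s, f s ^ 2) ^ 2 * (B * (∫⁻ x, m x ^ 2) ^ 2) := by gcongr
      _ = _ := by ring
  exact (ENNReal.mul_le_mul_iff_right (pow_ne_zero 2 ha0) (pow_ne_top hfin)).1 s5

lemma pM_bound {h : ℕ → ℝ} (hh : ∀ i, 0 < h i) (N : ℕ) {f : ℝ → ℝ≥0∞} (hf : Measurable f) :
    ∫⁻ x, pM h N f x ^ 2 ≤ (24 * ofReal Real.pi) ^ 2 * ∫⁻ s, f s ^ 2 := by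
  set B : ℝ≥0∞ := ⨆ f : {f : ℝ → ℝ≥0∞ // Measurable f ∧ ∫⁻ s, f s ^ 2 ≠ 0 ∧ ∫⁻ s, f s ^ 2 ≠ ∞},
    (∫⁻ x, pM h N f.1 x ^ 2) / ∫⁻ s, f.1 s ^ 2 with hBdef
  have hBfin : B ≠ ∞ := by
    have : B ≤ N * ofReal Real.pi ^ 2 := by
      apply iSup_le
      rintro ⟨f, h1, h2, h3⟩
      exact div_le_of_le_mul (pM_apriori hh N h1)
    exact ne_top_of_le_ne_top (mul_ne_top (by simp) (by simp)) this
  have hB' : ∀ f, Measurable f → ∫⁻ s, f s ^ 2 ≠ ∞ → ∫⁻ x, pM h N f x ^ 2 ≤ B * ∫⁻ s, f s ^ 2 := fun f hf h3 => by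
    by_cases h2 : ∫⁻ s, f s ^ 2 = 0
    · have := pM_apriori hh N hf
      rw [h2] at this ⊢; simpa using this
    · have := le_iSup (fun f : {f : ℝ → ℝ≥0∞ // Measurable f ∧ ∫⁻ s, f s ^ 2 ≠ 0 ∧ ∫⁻ s, f s ^ 2 ≠ ∞} =>
        (∫⁻ x, pM h N f.1 x ^ 2) / ∫⁻ s, f.1 s ^ 2) ⟨f, hf, h2, h3⟩
      exact (ENNReal.div_le_iff h2 h3).1 this
  have hK : B ≤ (24 * ofReal Real.pi) ^ 2 := by
    have h1 : B ≤ ((24 * ofReal Real.pi) ^ 2 * B) ^ (1 / 2 : ℝ) := by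
      nth_rewrite 1 [hBdef]
      apply iSup_le
      rintro ⟨f, hf, h2, h3⟩
      have hfin : ∫⁻ x, pM h N f x ^ 2 ≠ ∞ :=
        ne_top_of_le_ne_top (mul_ne_top hBfin h3) (hB' f hf h3)
      have h4 := pM_improve hh N hB' hf hfin
      rw [one_div, le_rpow_inv_iff (by norm_num), rpow_two]
      simp only
      rw [div_eq_mul_inv, mul_pow, ENNReal.inv_pow.symm, ← div_eq_mul_inv]
      apply div_le_of_le_mul
      refine h4.trans (le_of_eq ?_)
      ring
    rw [one_div, le_rpow_inv_iff (by norm_num), rpow_two] at h1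
    by_cases hB0 : B = 0
    · rw [hB0]; exact zero_le
    · rw [sq B] at h1
      exact (ENNReal.mul_le_mul_iff_left hB0 hBfin).1 h1
  by_cases h3 : ∫⁻ s, f s ^ 2 = ∞
  · rw [h3, mul_top]
    · exact le_top
    · have := pi_pos
      simp [this]
  · exact (hB' f hf h3).trans (mul_le_mul_left hK _)

/-- full maximal function -/
def pMx (h : ℕ → ℝ) (f : ℝ → ℝ≥0∞) (x : ℝ) : ℝ≥0∞ := ⨆ i, pK (h i) f x

lemma pMx_meas (h : ℕ → ℝ) {f : ℝ → ℝ≥0∞} (hf : Measurable f) : Measurable (pMx h f) :=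
  Measurable.iSup fun i => pK_meas _ hf

lemma pMx_bound {h : ℕ → ℝ} (hh : ∀ i, 0 < h i) {f : ℝ → ℝ≥0∞} (hf : Measurable f) :
    ∫⁻ x, pMx h f x ^ 2 ≤ (24 * ofReal Real.pi) ^ 2 * ∫⁻ s, f s ^ 2 := by
  have e : ∀ x, pMx h f x ^ 2 = ⨆ N, pM h N f x ^ 2 := fun x => by
    have h1 : pMx h f x = ⨆ N, pM h N f x := by
      apply le_antisymm
      · exact iSup_le fun i => (le_pM (Nat.lt_succ_self i) f x).trans (le_iSup (fun N => pM h N f x) _)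
      · exact iSup_le fun N => Finset.sup_le fun i _ => le_iSup (fun i => pK (h i) f x) i
    rw [h1, ← rpow_two]
    have := (orderIsoRpow 2 (by norm_num)).map_iSup (fun N => pM h N f x)
    simp only [orderIsoRpow_apply, rpow_two] at this ⊢
    exact this
  simp_rw [e]
  rw [lintegral_iSup]
  · exact iSup_le fun N => pM_bound hh N hf
  · exact fun N => (pM_meas h N hf).pow_const 2
  · intro a b hab x
    simp only
    gcongr
    exact Finset.sup_mono (Finset.range_mono hab)

/-! ### cones and area functionals -/
/-- dyadic cone -/
def Gm (θ : ℝ) : Set (ℝ × ℝ) := ⋃ I : Dy, ⋃ _ : θ ∈ I.A, I.Q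

lemma Gm_meas (θ : ℝ) : MeasurableSet (Gm θ) :=
  MeasurableSet.iUnion fun I => MeasurableSet.iUnion fun _ => I.measQ

/-- area functional -/
def Ar (v : ℝ × ℝ → ℝ≥0∞) (θ : ℝ) : ℝ≥0∞ := ∫⁻ x in Gm θ, v x

lemma Ar_eq (v : ℝ × ℝ → ℝ≥0∞) (θ : ℝ) :
    Ar v θ = ∑' I : Dy, I.A.indicator (fun _ => ∫⁻ x in I.Q, v x) θ := by
  unfold Ar Gm
  rw [lintegral_iUnion]
  · congr 1; ext I
    by_cases h : θ ∈ I.A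
    · simp [h]
    · simp [h]
  · exact fun I => MeasurableSet.iUnion fun _ => I.measQ
  · intro I J h
    refine Set.disjoint_left.2 fun x a b => ?_
    simp only [mem_iUnion] at a b
    exact h (Dy.Q_inj a.2 b.2)

lemma Ar_meas (v : ℝ × ℝ → ℝ≥0∞) : Measurable (Ar v) := by
  have : Ar v = fun θ => ∑' I : Dy, I.A.indicator (fun _ => ∫⁻ x in I.Q, v x) θ := by ext θ; exact Ar_eq v θ
  rw [this]
  exact Measurable.tsum fun I => measurable_const.indicator I.measA

lemma Dy.volA' (I : Dy) : volume I.A = ofReal I.len := by unfold Dy.A; rw [Real.volume_Ico]; congr 1; ring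

lemma Ar_lint {v : ℝ × ℝ → ℝ≥0∞} (hv : Measurable v) :
    ∫⁻ θ, Ar v θ ≤ 2 * ∫⁻ x in 𝕀 ×ˢ 𝕀, ofReal (1 - x.1) * v x := by
  simp_rw [Ar_eq]
  rw [lintegral_tsum fun I => (measurable_const.indicator I.measA).aemeasurable]
  have h1 : ∀ I : Dy, ∫⁻ θ, I.A.indicator (fun _ => ∫⁻ x in I.Q, v x) θ ≤
      ∫⁻ x in I.Q, 2 * (ofReal (1 - x.1) * v x) := fun I => by
    rw [lintegral_indicator_const I.measA, Dy.volA', mul_comm, ← lintegral_const_mul _ hv]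
    apply setLIntegral_mono' I.measQ
    intro x hx
    rw [← mul_assoc]
    gcongr
    rw [show (2 : ℝ≥0∞) = ofReal 2 by norm_num, ← ofReal_mul (by norm_num)]
    apply ofReal_le_ofReal
    have := Dy.Q_bd hx; linarith
  refine (ENNReal.tsum_le_tsum h1).trans ?_
  rw [← lintegral_iUnion (fun I => Dy.measQ I) (fun I J h => Dy.Q_disj h),
    ← lintegral_const_mul _ (by fun_prop)]
  apply lintegral_mono_set
  apply Set.iUnion_subset
  intro I x hx
  have := Dy.Q_bd hx
  exact ⟨⟨this.1, this.2.1⟩, this.2.2.2.2⟩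

/-! ### Parseval in ENNReal form -/
lemma eparseval {b : ℕ → ℂ} (hb : Summable fun n => ‖b n‖) :
    ∫⁻ t in 𝕀, ‖∑' n, b n * Ec t ^ n‖ₑ ^ 2 = ∑' n, ‖b n‖ₑ ^ 2 := by
  have h := parseval hb
  rw [intervalIntegral.integral_of_le zero_le_one, ← integral_Ico_eq_integral_Ioc] at h
  have hi : IntegrableOn (fun t => ‖∑' n, b n * Ec t ^ n‖ ^ 2) 𝕀 := by
    have := ser_cont hb
    exact (Continuous.integrableOn_Icc (by fun_prop)).mono_set Ico_subset_Icc_self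
  have h1 := ofReal_integral_eq_lintegral_ofReal hi (ae_of_all _ fun t => by positivity)
  have e : ∀ z : ℂ, ofReal (‖z‖ ^ 2) = ‖z‖ₑ ^ 2 := by intro z; rw [ofReal_pow (norm_nonneg _), ofReal_norm]
  simp_rw [e] at h1
  rw [← h1, ← h.tsum_eq, ofReal_tsum_of_nonneg (fun n => by positivity) h.summable]
  simp_rw [e]

lemma rho_int (n : ℕ) : ∫⁻ ρ in 𝕀, ofReal ((1 - ρ) * ρ ^ (2 * n)) ≤
    ofReal (1 / ((2 * n + 1) * (2 * n + 2))) := by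
  rw [← ofReal_integral_eq_lintegral_ofReal]
  · apply ofReal_le_ofReal
    rw [integral_Ico_eq_integral_Ioc, ← intervalIntegral.integral_of_le zero_le_one]
    have : ∀ ρ : ℝ, (1 - ρ) * ρ ^ (2 * n) = ρ ^ (2 * n) - ρ ^ (2 * n + 1) := by intro ρ; ring
    simp_rw [this]
    rw [intervalIntegral.integral_sub, integral_pow, integral_pow]
    · simp; apply le_of_eq; field_simp; ring
    · apply Continuous.intervalIntegrable; fun_prop
    · apply Continuous.intervalIntegrable; fun_prop
  · exact (Continuous.integrableOn_Icc (by fun_prop)).mono_set Ico_subset_Icc_self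
  · filter_upwards [ae_restrict_mem measurableSet_Ico] with ρ hρ
    have := hρ.1; have : 0 ≤ 1 - ρ := by linarith [hρ.2]
    simp only [Pi.zero_apply]; positivity

/-- the density used in the area integral of `G` -/
def vG (G : ℂ → ℂ) (x : ℝ × ℝ) : ℝ≥0∞ :=
  ‖circlePt x.1 x.2 * deriv G cp(x)‖ₑ ^ 2 + ‖G cp(x)‖ₑ ^ 2

lemma vG_bound {G : ℂ → ℂ} {R : ℝ} (hR : 1 < R) (hG : Hol(G, R)) :
    ∫⁻ ρ in 𝕀, ∫⁻ t in 𝕀, ofReal (1 - ρ) * vG G (ρ, t) ≤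
      2 * ∫⁻ t in 𝕀, ‖G (Ec t)‖ₑ ^ 2 := by
  have hE : ∫⁻ t in 𝕀, ‖G (Ec t)‖ₑ ^ 2 = ∑' n, ‖tc G n‖ₑ ^ 2 := by
    rw [← eparseval (by simpa using tc_summable hG zero_le_one hR)]
    congr 1; ext t
    rw [(tc_hasSum hG (z := Ec t) (by simpa [Ec_norm] using hR)).tsum_eq]
  have hin : ∀ ρ ∈ 𝕀, ∫⁻ t in 𝕀, ofReal (1 - ρ) * vG G (ρ, t) =
      ∑' n : ℕ, ofReal ((1 - ρ) * ρ ^ (2 * n)) * (((n : ℝ≥0∞) ^ 2 + 1) * ‖tc G n‖ₑ ^ 2) := fun ρ hρ => by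
    have hz : ∀ t, ‖circlePt ρ t‖ < R := fun t => by rw [circlePt_norm, abs_of_nonneg hρ.1]; linarith [hρ.2]
    have s1 : Summable fun n : ℕ => ‖(n * tc G n) * (ρ : ℂ) ^ n‖ := by
      have := (tc_deriv_hasSum hG (z := (ρ : ℂ)) (by
        rw [Complex.norm_of_nonneg hρ.1]; linarith [hρ.2])).summable.norm
      simpa using this
    have s2 : Summable fun n : ℕ => ‖tc G n * (ρ : ℂ) ^ n‖ := by
      have := (tc_hasSum hG (z := (ρ : ℂ)) (by
        rw [Complex.norm_of_nonneg hρ.1]; linarith [hρ.2])).summable.norm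
      simpa using this
    have e1 : ∀ t, circlePt ρ t * deriv G (circlePt ρ t) = ∑' n : ℕ, (n * tc G n) * (ρ : ℂ) ^ n * Ec t ^ n := by
      intro t; rw [← (tc_deriv_hasSum hG (hz t)).tsum_eq]
      congr 1; ext n; rw [circlePt_eq]; ring
    have e2 : ∀ t, G (circlePt ρ t) = ∑' n : ℕ, tc G n * (ρ : ℂ) ^ n * Ec t ^ n := by
      intro t; rw [← (tc_hasSum hG (hz t)).tsum_eq]
      congr 1; ext n; rw [circlePt_eq]; ring
    have m1 : Measurable fun t : ℝ => ‖∑' n : ℕ, (n * tc G n) * (ρ : ℂ) ^ n * Ec t ^ n‖ₑ ^ 2 := by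
      have := ser_cont s1; exact (this.measurable.enorm).pow_const 2
    have m2 : Measurable fun t : ℝ => ‖∑' n : ℕ, tc G n * (ρ : ℂ) ^ n * Ec t ^ n‖ₑ ^ 2 := by
      have := ser_cont s2; exact (this.measurable.enorm).pow_const 2
    simp only [vG, e1, e2]
    rw [lintegral_const_mul _ (by fun_prop), lintegral_add_left (by fun_prop), eparseval s1, eparseval s2,
      ← ENNReal.tsum_add, ← ENNReal.tsum_mul_left]
    congr 1; ext n
    have e3 : ‖(ρ : ℂ) ^ n‖ₑ ^ 2 = ofReal (ρ ^ (2 * n)) := by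
      rw [← ofReal_norm, ← ofReal_pow (norm_nonneg _)]
      congr 1
      rw [norm_pow, Complex.norm_of_nonneg hρ.1]; ring
    have e4 : ‖(n : ℂ)‖ₑ = (n : ℝ≥0∞) := by rw [← ofReal_norm]; simp
    rw [enorm_mul, enorm_mul, enorm_mul, mul_pow, mul_pow, mul_pow, e3, e4,
      ofReal_mul (by linarith [hρ.2])]
    ring
  rw [setLIntegral_congr_fun measurableSet_Ico hin, lintegral_tsum (fun n => by fun_prop), hE,
    ← ENNReal.tsum_mul_left]
  apply ENNReal.tsum_le_tsum
  intro n
  rw [lintegral_mul_const _ (by fun_prop), ← mul_assoc]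
  gcongr
  refine (mul_le_mul_left (rho_int n) _).trans ?_
  have e5 : ((n : ℝ≥0∞) ^ 2 + 1) = ofReal ((n : ℝ) ^ 2 + 1) := by
    rw [ofReal_add (by positivity) (by norm_num), ofReal_pow (by positivity)]
    simp
  rw [e5, ← ofReal_mul (by positivity), show (2 : ℝ≥0∞) = ofReal 2 by norm_num]
  apply ofReal_le_ofReal
  rw [one_div, inv_mul_le_iff₀ (by positivity)]
  have : (0 : ℝ) ≤ n := by positivity
  nlinarith

/-! ### Poisson domination -/
lemma poisson_repr {G : ℂ → ℂ} {R : ℝ} (hR : 1 < R) (hG : Hol(G, R))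
    {z : ℂ} (hz : ‖z‖ < 1) :
    G z = (1 - ‖z‖ ^ 2 : ℝ) * ∫ s in (0 : ℝ)..1, (1 - z * Ec (-s))⁻¹ * (G (Ec s) * (1 - (starRingEnd ℂ) z * Ec s)⁻¹) := by
  obtain ⟨R', hR1, hR2, hR3⟩ : ∃ R' : ℝ, 1 < R' ∧ R' ≤ R ∧ ∀ w : ℂ, ‖w‖ < R' → (1 - (starRingEnd ℂ) z * w) ≠ 0 := by
    by_cases h0 : z = 0
    · exact ⟨R, hR, le_rfl, fun w _ => by simp [h0]⟩
    have hz0 : 0 < ‖z‖ := norm_pos_iff.2 h0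
    refine ⟨min R ‖z‖⁻¹, lt_min hR ((one_lt_inv₀ hz0).2 hz), min_le_left _ _, fun w hw h => ?_⟩
    have h1 : ‖w‖ < ‖z‖⁻¹ := hw.trans_le (min_le_right _ _)
    have h2 : (starRingEnd ℂ) z * w = 1 := (sub_eq_zero.1 h).symm
    have h3 : ‖z‖ * ‖w‖ = 1 := by have := congrArg norm h2; simpa using this
    have := mul_lt_mul_of_pos_left h1 hz0
    rw [mul_inv_cancel₀ hz0.ne'] at this; linarith
  have hH : DifferentiableOn ℂ (fun w => G w * (1 - (starRingEnd ℂ) z * w)⁻¹) (ball 0 R') := by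
    apply (hG.mono (ball_subset_ball hR2)).mul
    apply DifferentiableOn.inv (by fun_prop)
    intro w hw; exact hR3 w (by simpa using hw)
  have ha : Summable fun n => ‖z ^ n‖ := by simp_rw [norm_pow]; exact summable_geometric_of_lt_one (norm_nonneg _) hz
  have hb := tc_summable hH zero_le_one hR1
  simp only [one_pow, mul_one] at hb
  have hp := pars ha hb
  have e1 : ∀ s, (∑' n, z ^ n * Ec (-s) ^ n) = (1 - z * Ec (-s))⁻¹ := fun s => by
    simp_rw [← mul_pow]
    exact tsum_geometric_of_norm_lt_one (by simpa [Ec_norm] using hz)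
  have e2 : ∀ s, (∑' n, tc (fun w => G w * (1 - (starRingEnd ℂ) z * w)⁻¹) n * Ec s ^ n) =
      G (Ec s) * (1 - (starRingEnd ℂ) z * Ec s)⁻¹ := fun s => by
    exact (tc_hasSum hH (z := Ec s) (by simpa [Ec_norm] using hR1)).tsum_eq
  simp_rw [e1, e2] at hp
  have h3 := tc_hasSum hH (z := z) (hz.trans hR1)
  have h4 := hp.unique (h3.congr_fun fun n => mul_comm _ _)
  rw [h4]
  have h5 : (1 - (starRingEnd ℂ) z * z) = ((1 - ‖z‖ ^ 2 : ℝ) : ℂ) := by rw [Complex.conj_mul']; push_cast; rfl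
  rw [h5]
  have h6 : ((1 - ‖z‖ ^ 2 : ℝ) : ℂ) ≠ 0 := by rw [← h5]; exact hR3 z (hz.trans hR1)
  field_simp

/-- dyadic scales -/
def hsc (i : ℕ) : ℝ := (2 ^ i)⁻¹
lemma hsc_pos (i : ℕ) : 0 < hsc i := by unfold hsc; positivity

/-- boundary values on a window -/
def bvf (G : ℂ → ℂ) : ℝ → ℝ≥0∞ := (Icc (-1 / 2 : ℝ) (3 / 2)).indicator fun s => ‖G (Ec s)‖ₑ

lemma poisson_ker {ρ t θ s h : ℝ} (h0 : 0 ≤ ρ) (h1 : h / 2 < 1 - ρ) (h2 : 1 - ρ ≤ h) (hh : 0 < h)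
    (ht : |t - θ| ≤ h) (hs : |θ - s| ≤ 1 / 2) :
    (1 - ρ ^ 2) * (‖1 - (ρ : ℂ) * Ec (t - s)‖⁻¹) ^ 2 ≤ 3600 * (h / (h ^ 2 + (θ - s) ^ 2)) := by
  set y := ‖1 - (ρ : ℂ) * Ec (t - s)‖ with hy
  have y1 : h / 2 ≤ y := (h1.le).trans (one_sub_low' h0 _)
  have hρ : ρ ≤ 1 := by linarith
  have y0 : 0 < y := by linarith
  have y2 : |θ - s| / 2 ≤ y + 2 * Real.pi * h := by
    refine (one_sub_low h0 (hs.trans (by norm_num))).trans ?_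
    have e : 1 - (ρ : ℂ) * Ec (θ - s) = (1 - (ρ : ℂ) * Ec (t - s)) + ρ * (Ec (t - s) - Ec (θ - s)) := by ring
    rw [e]
    refine (norm_add_le _ _).trans ?_
    gcongr
    rw [norm_mul, Complex.norm_of_nonneg h0]
    have := Ec_lip (t - s) (θ - s)
    have e2 : t - s - (θ - s) = t - θ := by ring
    rw [e2] at this
    have h3 : 2 * Real.pi * |t - θ| ≤ 2 * Real.pi * h := by gcongr
    have := norm_nonneg (Ec (t - s) - Ec (θ - s))
    nlinarith
  have y3 : |θ - s| ≤ 30 * y := by nlinarith [Real.pi_lt_d2, pi_pos]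
  have y4 : (θ - s) ^ 2 ≤ 900 * y ^ 2 := by rw [← sq_abs]; nlinarith [abs_nonneg (θ - s)]
  have y5 : h ^ 2 ≤ 4 * y ^ 2 := by nlinarith
  have y6 : 1 - ρ ^ 2 ≤ 2 * h := by nlinarith
  rw [inv_pow, ← div_eq_mul_inv, ← mul_div_assoc, div_le_div_iff₀ (by positivity) (by positivity)]
  calc (1 - ρ ^ 2) * (h ^ 2 + (θ - s) ^ 2) ≤ (2 * h) * (1800 * y ^ 2) := by
        apply mul_le_mul y6 (by nlinarith [sq_nonneg y]) (by positivity) (by positivity)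
    _ = _ := by ring

lemma poisson_dom {G : ℂ → ℂ} {R : ℝ} (hR : 1 < R) (hG : Hol(G, R))
    {I : Dy} {x : ℝ × ℝ} (hx : x ∈ I.Q) {θ : ℝ} (hθ : θ ∈ I.A) :
    ‖G cp(x)‖ₑ ≤ 3600 * pMx hsc (bvf G) θ := by
  obtain ⟨ρ, t⟩ := x
  have hb := Dy.Q_bd hx
  simp only at hb
  have hz : ‖circlePt ρ t‖ < 1 := by rw [circlePt_norm, abs_of_nonneg hb.1]; exact hb.2.1
  have hθ1 := I.A_sub hθ
  have htθ : |t - θ| ≤ I.len := by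
    have a : t ∈ I.A := hx.2
    rw [abs_le]; unfold Dy.A at a hθ
    constructor <;> linarith [a.1, a.2, hθ.1, hθ.2]
  rw [poisson_repr hR hG hz]
  set φ : ℝ → ℂ := fun s => (1 - circlePt ρ t * Ec (-s))⁻¹ * (G (Ec s) * (1 - (starRingEnd ℂ) (circlePt ρ t) * Ec s)⁻¹) with hφ
  have hper : Function.Periodic φ 1 := by
    intro s; simp only [hφ]; rw [Ec_per, show -(s + 1) = -s + -1 by ring, Ec_add, Ec_neg 1, Ec_one]; simp
  have h1 := hper.intervalIntegral_add_eq 0 (θ - 1 / 2)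
  rw [zero_add, show θ - 1 / 2 + 1 = θ + 1 / 2 by ring] at h1
  rw [h1, ← intervalIntegral.integral_const_mul, intervalIntegral.integral_of_le (by linarith)]
  refine (enorm_integral_le_lintegral_enorm _).trans ?_
  have h2 : pK (hsc I.1) (bvf G) θ ≤ pMx hsc (bvf G) θ := le_iSup (fun i => pK (hsc i) (bvf G) θ) I.1
  refine le_trans ?_ (mul_le_mul_right h2 _)
  unfold pK
  rw [← lintegral_const_mul' _ _ (by norm_num)]
  refine le_trans ?_ (setLIntegral_le_lintegral (Set.Ioc (θ - 1 / 2) (θ + 1 / 2)) _)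
  apply setLIntegral_mono' measurableSet_Ioc
  intro s hs
  have hs1 : |θ - s| ≤ 1 / 2 := by rw [abs_le]; constructor <;> linarith [hs.1, hs.2]
  have hs2 : s ∈ Icc (-1 / 2 : ℝ) (3 / 2) := ⟨by linarith [hs.1, hθ1.1], by linarith [hs.2, hθ1.2]⟩
  have hker := poisson_ker (s := s) hb.1 hb.2.2.1 hb.2.2.2.1 I.len_pos htθ hs1
  have n1 : ‖(1 - circlePt ρ t * Ec (-s))‖ = ‖1 - (ρ : ℂ) * Ec (t - s)‖ := by
    rw [circlePt_eq, sub_eq_add_neg t s, Ec_add, mul_assoc]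
  have n2 : ‖(1 - (starRingEnd ℂ) (circlePt ρ t) * Ec s)‖ = ‖1 - (ρ : ℂ) * Ec (t - s)‖ := by
    rw [← n1, ← Complex.norm_conj]; congr 1
    simp [Ec_neg]
  have e : ‖((1 - ‖circlePt ρ t‖ ^ 2 : ℝ) : ℂ) * φ s‖ₑ = ofReal ((1 - ρ ^ 2) * (‖1 - (ρ : ℂ) * Ec (t - s)‖⁻¹) ^ 2) * ‖G (Ec s)‖ₑ := by
    rw [← ofReal_norm, ← ofReal_norm, ← ofReal_mul (by
      have : 0 ≤ 1 - ρ ^ 2 := by nlinarith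
      positivity)]
    congr 1
    simp only [hφ, norm_mul, norm_inv, n1, n2, norm_real, norm_eq_abs]
    rw [circlePt_norm, sq_abs, abs_of_nonneg (by nlinarith)]
    ring
  rw [e]
  have e2 : bvf G s = ‖G (Ec s)‖ₑ := by simp only [bvf]; rw [indicator_of_mem hs2]
  rw [e2, ← mul_assoc]
  gcongr
  unfold pk
  rw [show (3600 : ℝ≥0∞) = ofReal 3600 by norm_num, ← ofReal_mul (by norm_num)]
  exact ofReal_le_ofReal hker

lemma per_lint {f : ℝ → ℝ≥0∞} (hf : Function.Periodic f 1) (a b : ℝ) :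
    ∫⁻ t in Ico a (a + 1), f t = ∫⁻ t in Ico b (b + 1), f t := by
  rw [setLIntegral_congr Ico_ae_eq_Ioc, setLIntegral_congr Ico_ae_eq_Ioc]
  refine IsAddFundamentalDomain.setLIntegral_eq (isAddFundamentalDomain_Ioc zero_lt_one a)
    (isAddFundamentalDomain_Ioc zero_lt_one b) f ?_
  rintro ⟨g, hg⟩ x
  obtain ⟨n, rfl⟩ := AddSubgroup.mem_zmultiples_iff.1 hg
  have := hf.zsmul n x
  rw [add_comm] at this
  exact this

lemma bvf_lint (G : ℂ → ℂ) : ∫⁻ s, bvf G s ^ 2 ≤ 2 * ∫⁻ t in 𝕀, ‖G (Ec t)‖ₑ ^ 2 := by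
  have h : ∀ s, bvf G s ^ 2 = (Icc (-1 / 2 : ℝ) (3 / 2)).indicator (fun s => ‖G (Ec s)‖ₑ ^ 2) s := by
    intro s; unfold bvf
    by_cases hs : s ∈ Icc (-1 / 2 : ℝ) (3 / 2) <;> simp [hs]
  simp_rw [h]
  rw [lintegral_indicator measurableSet_Icc, setLIntegral_congr Ico_ae_eq_Icc.symm]
  have hper : Function.Periodic (fun s => ‖G (Ec s)‖ₑ ^ 2) 1 := fun s => by simp only [Ec_per]
  have hu : Ico (-1 / 2 : ℝ) (3 / 2) ⊆ Ico (-1/2 : ℝ) (-1/2 + 1) ∪ Ico (1/2 : ℝ) (1/2 + 1) := fun x hx => by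
    by_cases h : x < 1 / 2
    · left; exact ⟨hx.1, by linarith⟩
    · right; exact ⟨by linarith, by linarith [hx.2]⟩
  refine (lintegral_mono_set hu).trans ((lintegral_union_le _ _ _).trans ?_)
  rw [per_lint hper (-1/2) 0, per_lint hper (1/2) 0, zero_add, two_mul]

lemma rop_zf (hp : 0 < p) (L : ℕ) {lam : ℂ → ℂ} {h G : ℂ → ℂ} {z : ℂ} (hl : DifferentiableAt ℂ lam z)
    (h1 : h =ᶠ[𝓝 z] fun w => exp (lam w))
    (h2 : G =ᶠ[𝓝 z] fun w => exp (p / 2 * lam w)) :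
    ‖Rop L h z‖ₑ ^ 2 ≤ ofReal (2 * (4 / p ^ 2 + L ^ 2)) * (‖G z‖ₑ ^ (4 / p - 2) *
      (‖z * deriv G z‖ₑ ^ 2 + ‖G z‖ₑ ^ 2)) := by
  have d1 : deriv h z = exp (lam z) * deriv lam z := by rw [h1.deriv_eq]; exact (hl.hasDerivAt.cexp).deriv
  have d2 : deriv G z = exp (p / 2 * lam z) * (p / 2 * deriv lam z) := by
    rw [h2.deriv_eq]; exact ((hl.hasDerivAt.const_mul _).cexp).deriv
  have e1 : h z = exp (lam z) := h1.eq_of_nhds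
  have e2 : G z = exp (p / 2 * lam z) := h2.eq_of_nhds
  have g0 : 0 < ‖G z‖ := by rw [e2]; simp
  have e3 : ‖h z‖ ^ 2 = ‖G z‖ ^ (4 / p) := by
    rw [e1, e2, norm_exp, norm_exp, ← Real.exp_mul, ← Real.exp_nat_mul]
    congr 1
    have : ((p : ℂ) / 2 * lam z).re = p / 2 * (lam z).re := by
      rw [show (p : ℂ) / 2 = ((p / 2 : ℝ) : ℂ) by push_cast; rfl, re_ofReal_mul]
    rw [this]; field_simp; push_cast; ring
  have e4 : Rop L h z = h z * (2 / p * (z * deriv G z) / G z + L) := by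
    unfold Rop; rw [d1, d2, e1, e2]
    have := Complex.exp_ne_zero (p / 2 * lam z)
    have hp' : (p : ℂ) ≠ 0 := by exact_mod_cast hp.ne'
    field_simp
  have key : ‖Rop L h z‖ ^ 2 ≤ 2 * (4 / p ^ 2 + L ^ 2) * (‖G z‖ ^ (4 / p - 2) *
      (‖z * deriv G z‖ ^ 2 + ‖G z‖ ^ 2)) := by
    rw [e4, norm_mul, mul_pow, e3, Real.rpow_sub g0]
    norm_num
    set A := ‖z * deriv G z‖ with hA
    have t1 : ‖(2 : ℂ) / p * (z * deriv G z) / G z + L‖ ≤ 2 / p * A / ‖G z‖ + L := by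
      refine (norm_add_le _ _).trans ?_
      rw [norm_div, norm_mul, norm_div]
      simp only [norm_real, Complex.norm_natCast, Complex.norm_ofNat, norm_eq_abs, abs_of_pos hp]
      exact le_rfl
    have t2 : ‖(2 : ℂ) / p * (z * deriv G z) / G z + L‖ ^ 2 ≤ 2 * ((2 / p * A / ‖G z‖) ^ 2 + L ^ 2) := by
      refine (pow_le_pow_left₀ (norm_nonneg _) t1 2).trans ?_
      nlinarith [sq_nonneg (2 / p * A / ‖G z‖ - L)]
    have t3 : 2 * ((2 / p * A / ‖G z‖) ^ 2 + L ^ 2) ≤ 2 * (4 / p ^ 2 + L ^ 2) * ((A ^ 2 + ‖G z‖ ^ 2) / ‖G z‖ ^ 2) := by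
      have : (2 / p * A / ‖G z‖) ^ 2 = 4 / p ^ 2 * (A ^ 2 / ‖G z‖ ^ 2) := by field_simp; ring
      rw [this, add_div, div_self (by positivity)]
      have : 0 ≤ A ^ 2 / ‖G z‖ ^ 2 := by positivity
      have : 0 ≤ 4 / p ^ 2 := by positivity
      have : (0 : ℝ) ≤ L ^ 2 := by positivity
      nlinarith [mul_nonneg this ‹0 ≤ A ^ 2 / ‖G z‖ ^ 2›]
    have n1 : ‖z‖ * ‖deriv G z‖ = A := by rw [hA, norm_mul]
    try rw [n1]
    calc ‖G z‖ ^ (4 / p) * ‖(2 : ℂ) / p * (z * deriv G z) / G z + L‖ ^ 2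
        ≤ ‖G z‖ ^ (4 / p) * (2 * (4 / p ^ 2 + L ^ 2) * ((A ^ 2 + ‖G z‖ ^ 2) / ‖G z‖ ^ 2)) := by gcongr; exact t2.trans t3
      _ = _ := by ring
  rw [← ofReal_norm, ← ofReal_norm, ← ofReal_norm, ofReal_rpow_of_pos g0,
    ← ofReal_pow (norm_nonneg _), ← ofReal_pow (norm_nonneg _), ← ofReal_pow (norm_nonneg _),
    ← ofReal_add (by positivity) (by positivity), ← ofReal_mul (by positivity),
    ← ofReal_mul (by positivity)]
  exact ofReal_le_ofReal key

lemma circlePt_meas : Measurable fun x : ℝ × ℝ => circlePt x.1 x.2 := by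
  have : Continuous fun x : ℝ × ℝ => circlePt x.1 x.2 := by unfold circlePt; fun_prop
  exact this.measurable

lemma vG_meas {G : ℂ → ℂ} (hG : Measurable G) : Measurable (vG G) := by
  unfold vG
  have h1 := circlePt_meas
  have h2 : Measurable fun x : ℝ × ℝ => deriv G cp(x) := (measurable_deriv G).comp h1
  have h3 : Measurable fun x : ℝ × ℝ => G cp(x) := hG.comp h1
  exact ((h1.mul h2).enorm.pow_const 2).add (h3.enorm.pow_const 2)

lemma Ar_mono {u v : ℝ × ℝ → ℝ≥0∞} {θ : ℝ} (h : ∀ I : Dy, θ ∈ I.A → ∀ x ∈ I.Q, u x ≤ v x) : Ar u θ ≤ Ar v θ := by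
  apply setLIntegral_mono' (Gm_meas θ)
  intro x hx
  simp only [Gm, mem_iUnion] at hx
  obtain ⟨I, h1, h2⟩ := hx
  exact h I h1 x h2

lemma Ar_lint' {v : ℝ × ℝ → ℝ≥0∞} (hv : Measurable v) :
    ∫⁻ θ, Ar v θ ≤ 2 * ∫⁻ ρ in 𝕀, ∫⁻ t in 𝕀, ofReal (1 - ρ) * v (ρ, t) := by
  refine (Ar_lint hv).trans ?_
  rw [Measure.volume_eq_prod, setLIntegral_prod]
  exact (Measurable.mul (by fun_prop) hv).aemeasurable

/-- zero free case -/
lemma E1_zf (hp : 0 < p) (hp1 : p ≤ 1) (L : ℕ) : ∃ C : ℝ≥0∞, C ≠ ∞ ∧ ∀ (R : ℝ) (_ : 1 < R) (lam h : ℂ → ℂ)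
    (_ : Hol(lam, R)) (_ : ∀ z ∈ ball (0 : ℂ) R, h z = exp (lam z)),
    ∫⁻ θ, (Ar (fun x => ‖Rop L h cp(x)‖ₑ ^ 2) θ) ^ (p / 2) ≤
      C * ∫⁻ t in 𝕀, ‖h (Ec t)‖ₑ ^ p := by
  set C1 := ofReal (2 * (4 / p ^ 2 + L ^ 2)) with hC1
  set K := (24 * ofReal Real.pi) ^ 2 * 2 with hK
  refine ⟨C1 ^ (p / 2) * (3600 ^ (2 - p)) * (K ^ (1 - p / 2) * 4 ^ (p / 2)), ?_, ?_⟩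
  · refine mul_ne_top (mul_ne_top ?_ ?_) (mul_ne_top ?_ ?_)
    · exact rpow_ne_top_of_nonneg (by positivity) ofReal_ne_top
    · exact rpow_ne_top_of_nonneg (by linarith) (by norm_num)
    · refine rpow_ne_top_of_nonneg (by linarith) ?_
      rw [hK]; finiteness
    · exact rpow_ne_top_of_nonneg (by positivity) (by norm_num)
  intro R hR lam h hlam hh
  set G : ℂ → ℂ := (ball (0 : ℂ) R).indicator fun w => exp (p / 2 * lam w) with hGdef
  have hGb : ∀ z ∈ ball (0 : ℂ) R, G z = exp (p / 2 * lam z) := fun z hz => by rw [hGdef, indicator_of_mem hz]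
  have hGd : Hol(G, R) :=
    DifferentiableOn.congr (f := fun w => exp (p / 2 * lam w)) (by fun_prop) hGb
  have hGm : Measurable G := by
    have := hlam.continuousOn
    have h1 : ContinuousOn (fun w => exp (p / 2 * lam w)) (ball 0 R) := by fun_prop
    classical
    exact h1.measurable_piecewise (g := fun _ => (0 : ℂ)) continuousOn_const isOpen_ball.measurableSet
  have hin : ∀ z : ℂ, ‖z‖ < R → z ∈ ball (0 : ℂ) R := fun z hz => by simpa using hz
  have hnorm : ∀ z : ℂ, ‖z‖ < R → ‖G z‖ₑ ^ 2 = ‖h z‖ₑ ^ p := fun z hz => by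
    have g1 := hGb z (hin z hz)
    have g2 := hh z (hin z hz)
    rw [g1, g2, ← ofReal_norm, ← ofReal_norm, ofReal_rpow_of_pos (by simp),
      ← ofReal_pow (norm_nonneg _), norm_exp, norm_exp, ← Real.exp_mul, ← Real.exp_nat_mul]
    congr 2
    have : ((p : ℂ) / 2 * lam z).re = p / 2 * (lam z).re := by
      rw [show (p : ℂ) / 2 = ((p / 2 : ℝ) : ℂ) by push_cast; rfl, re_ofReal_mul]
    rw [this]; push_cast; ring
  have hI : ∫⁻ t in 𝕀, ‖h (Ec t)‖ₑ ^ p = ∫⁻ t in 𝕀, ‖G (Ec t)‖ₑ ^ 2 := by congr 1; ext t; rw [hnorm _ (by rw [Ec_norm]; exact hR)]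
  set M := fun θ => pMx hsc (bvf G) θ with hM
  set D := fun θ => Ar (vG G) θ with hD
  have hbm : Measurable (bvf G) := by
    unfold bvf
    refine Measurable.indicator ?_ measurableSet_Icc
    exact (hGm.comp Ec_cont.measurable).enorm
  have hMm : Measurable M := pMx_meas _ hbm
  have hDm : Measurable D := Ar_meas _
  have step : ∀ θ, (Ar (fun x => ‖Rop L h cp(x)‖ₑ ^ 2) θ) ^ (p / 2) ≤
      (C1 ^ (p / 2) * (3600 ^ (2 - p))) * ((M θ ^ 2) ^ (1 - p / 2) * D θ ^ (p / 2)) := fun θ => by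
    have h1 : Ar (fun x => ‖Rop L h cp(x)‖ₑ ^ 2) θ ≤
        Ar (fun x => (C1 * (3600 * M θ) ^ (4 / p - 2)) * vG G x) θ := by
      apply Ar_mono
      intro I hθ x hx
      have hb := Dy.Q_bd hx
      have hz : circlePt x.1 x.2 ∈ ball (0 : ℂ) R := by apply hin; rw [circlePt_norm, abs_of_nonneg hb.1]; linarith [hb.2.1]
      have hn := isOpen_ball.mem_nhds hz
      refine (rop_zf hp L (hlam.differentiableAt hn) (eventually_of_mem hn hh) (eventually_of_mem hn hGb)).trans ?_
      rw [mul_assoc]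
      gcongr
      · have : (2 : ℝ) ≤ 4 / p := by rw [le_div_iff₀ hp]; linarith
        linarith
      · exact poisson_dom hR hGd hx hθ
      · exact le_rfl
    have h2 : Ar (fun x => (C1 * (3600 * M θ) ^ (4 / p - 2)) * vG G x) θ = (C1 * (3600 * M θ) ^ (4 / p - 2)) * D θ := by
      unfold Ar; rw [lintegral_const_mul _ (vG_meas hGm)]; rfl
    rw [h2] at h1
    refine (rpow_le_rpow h1 (by positivity)).trans (le_of_eq ?_)
    rw [mul_rpow_of_nonneg _ _ (by positivity), mul_rpow_of_nonneg _ _ (by positivity),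
      ← rpow_mul, show (4 / p - 2) * (p / 2) = 2 - p by field_simp; ring,
      mul_rpow_of_nonneg _ _ (by linarith)]
    have : (M θ ^ 2) ^ (1 - p / 2) = M θ ^ (2 - p) := by rw [← rpow_natCast, ← rpow_mul]; congr 1; push_cast; ring
    rw [this]; ring
  calc ∫⁻ θ, (Ar (fun x => ‖Rop L h cp(x)‖ₑ ^ 2) θ) ^ (p / 2)
      ≤ ∫⁻ θ, (C1 ^ (p / 2) * (3600 ^ (2 - p))) * ((M θ ^ 2) ^ (1 - p / 2) * D θ ^ (p / 2)) := lintegral_mono step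
    _ = (C1 ^ (p / 2) * (3600 ^ (2 - p))) * ∫⁻ θ, ((M θ ^ 2) ^ (1 - p / 2) * D θ ^ (p / 2)) :=
        lintegral_const_mul _ (by fun_prop)
    _ ≤ (C1 ^ (p / 2) * (3600 ^ (2 - p))) * ((∫⁻ θ, M θ ^ 2) ^ (1 - p / 2) * (∫⁻ θ, D θ) ^ (p / 2)) := by
        gcongr
        exact lintegral_mul_norm_pow_le (by fun_prop) (by fun_prop) (by linarith) (by linarith) (by ring)
    _ ≤ (C1 ^ (p / 2) * (3600 ^ (2 - p))) * ((K * ∫⁻ t in 𝕀, ‖h (Ec t)‖ₑ ^ p) ^ (1 - p / 2) *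
          (4 * ∫⁻ t in 𝕀, ‖h (Ec t)‖ₑ ^ p) ^ (p / 2)) := by
        have q1 : 0 ≤ 1 - p / 2 := by linarith
        gcongr
        · refine (pMx_bound hsc_pos hbm).trans ?_
          rw [hK, hI, mul_assoc]
          gcongr
          exact bvf_lint G
        · refine (Ar_lint' (vG_meas hGm)).trans ?_
          rw [hI]
          refine (mul_le_mul_right (vG_bound hR hGd) 2).trans (le_of_eq ?_)
          rw [← mul_assoc]; norm_num
    _ = _ := by
        clear_value K
        set J := ∫⁻ t in 𝕀, ‖h (Ec t)‖ₑ ^ p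
        rw [mul_rpow_of_nonneg K J (by linarith), mul_rpow_of_nonneg 4 J (by positivity)]
        have : J ^ (1 - p / 2) * J ^ (p / 2) = J := by rw [← rpow_add_of_nonneg _ _ (by linarith) (by positivity)]; simp
        calc _ = C1 ^ (p / 2) * 3600 ^ (2 - p) * (K ^ (1 - p / 2) * 4 ^ (p / 2)) * (J ^ (1 - p / 2) * J ^ (p / 2)) := by ring
          _ = _ := by rw [this]

lemma Gm_sub {θ : ℝ} {x : ℝ × ℝ} (hx : x ∈ Gm θ) : 0 ≤ x.1 ∧ x.1 < 1 ∧ ‖circlePt x.1 x.2‖ < 1 := by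
  simp only [Gm, mem_iUnion] at hx
  obtain ⟨I, h1, h2⟩ := hx
  have hb := Dy.Q_bd h2
  refine ⟨hb.1, hb.2.1, ?_⟩
  rw [circlePt_norm, abs_of_nonneg hb.1]; exact hb.2.1

lemma lint_liminf_le {α : Type*} [MeasurableSpace α] {μ : Measure α} {f : ℕ → α → ℝ≥0∞} (hf : ∀ n, AEMeasurable (f n) μ)
    {g : α → ℝ≥0∞} (hg : ∀ᵐ x ∂μ, Tendsto (fun n => f n x) atTop (𝓝 (g x))) :
    ∫⁻ x, g x ∂μ ≤ liminf (fun n => ∫⁻ x, f n x ∂μ) atTop := by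
  refine le_trans (le_of_eq ?_) (lintegral_liminf_le' hf)
  apply lintegral_congr_ae
  filter_upwards [hg] with x hx
  exact hx.liminf_eq.symm

/-- Fatou for sums of area functionals -/
lemma Ar_fatou {ι : Type*} (s : Finset ι) {q : ℝ} (hq : 0 < q) {v : ℕ → ι → ℝ × ℝ → ℝ≥0∞} {w : ι → ℝ × ℝ → ℝ≥0∞}
    (hm : ∀ n i θ, AEMeasurable (v n i) (volume.restrict (Gm θ)))
    (hv : ∀ i θ, ∀ x ∈ Gm θ, Tendsto (fun n => v n i x) atTop (𝓝 (w i x)))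
    {B : ℕ → ℝ≥0∞} {b : ℝ≥0∞} (hB : ∀ n, ∫⁻ θ, (∑ i ∈ s, Ar (v n i) θ) ^ q ≤ B n) (hb : Tendsto B atTop (𝓝 b)) :
    ∫⁻ θ, (∑ i ∈ s, Ar (w i) θ) ^ q ≤ b := by
  have h1 : ∀ θ, (∑ i ∈ s, Ar (w i) θ) ^ q ≤ liminf (fun n => (∑ i ∈ s, Ar (v n i) θ) ^ q) atTop := fun θ => by
    have e1 : ∀ u : ι → ℝ × ℝ → ℝ≥0∞, (∀ i, AEMeasurable (u i) (volume.restrict (Gm θ))) →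
        ∑ i ∈ s, Ar (u i) θ = ∫⁻ x in Gm θ, ∑ i ∈ s, u i x := fun u hu => by
      rw [lintegral_finsetSum' _ (fun i _ => hu i)]; rfl
    have hwm : ∀ i, AEMeasurable (w i) (volume.restrict (Gm θ)) := fun i =>
      aemeasurable_of_tendsto_metrizable_ae atTop (fun n => hm n i θ)
        ((ae_restrict_iff' (Gm_meas θ)).2 (ae_of_all _ fun x hx => hv i θ x hx))
    have h2 : ∑ i ∈ s, Ar (w i) θ ≤ liminf (fun n => ∑ i ∈ s, Ar (v n i) θ) atTop := by
      rw [e1 w hwm]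
      simp_rw [fun n => e1 (v n) (fun i => hm n i θ)]
      apply lint_liminf_le (fun n => Finset.aemeasurable_fun_sum _ fun i _ => hm n i θ)
      refine (ae_restrict_iff' (Gm_meas θ)).2 (ae_of_all _ fun x hx => ?_)
      exact tendsto_finset_sum _ fun i _ => hv i θ x hx
    refine (rpow_le_rpow h2 hq.le).trans (le_of_eq ?_)
    exact (orderIsoRpow q hq).liminf_apply
  calc _ ≤ ∫⁻ θ, liminf (fun n => (∑ i ∈ s, Ar (v n i) θ) ^ q) atTop := lintegral_mono h1
    _ ≤ liminf (fun n => ∫⁻ θ, (∑ i ∈ s, Ar (v n i) θ) ^ q) atTop := by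
        apply lintegral_liminf_le
        intro n
        exact (Finset.measurable_fun_sum _ fun i _ => Ar_meas _).pow_const q
    _ ≤ liminf B atTop := liminf_le_liminf (Eventually.of_forall hB)
    _ = b := hb.liminf_eq

lemma Rop_aem (L : ℕ) {f : ℂ → ℂ} (hf : Hol(f, 1)) (θ : ℝ) :
    AEStronglyMeasurable (fun x : ℝ × ℝ => Rop L f cp(x)) (volume.restrict (Gm θ)) := by
  apply ContinuousOn.aestronglyMeasurable _ (Gm_meas θ)
  apply (Rop_diff L hf).continuousOn.comp
  · have : Continuous fun x : ℝ × ℝ => circlePt x.1 x.2 := by unfold circlePt; fun_prop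
    exact this.continuousOn
  · intro x hx; simpa using (Gm_sub hx).2.2

lemma Rop_dil (L : ℕ) (f : ℂ → ℂ) (r : ℂ) (z : ℂ) : Rop L (fun w => f (r * w)) z = Rop L f (r * z) := by
  unfold Rop
  rw [deriv_comp_mul_left]; simp only [smul_eq_mul]; ring

/-- zero-free functions have logarithms -/
lemma exists_log {f : ℂ → ℂ} {R : ℝ} (hR : 0 < R) (hf : Hol(f, R))
    (h0 : ∀ z ∈ ball (0 : ℂ) R, f z ≠ 0) :
    ∃ lam : ℂ → ℂ, Hol(lam, R) ∧ ∀ z ∈ ball (0 : ℂ) R, f z = exp (lam z) := by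
  have hd : DifferentiableOn ℂ (fun z => deriv f z / f z) (ball 0 R) :=
    (hf.deriv isOpen_ball).div hf h0
  obtain ⟨l, hl⟩ := hd.isExactOn_ball
  have h00 : (0 : ℂ) ∈ ball (0 : ℂ) R := by simpa using hR
  refine ⟨fun z => l z - l 0 + Complex.log (f 0), ?_, ?_⟩
  · have : Hol(l, R) := fun z hz => (hl z hz).differentiableAt.differentiableWithinAt
    fun_prop
  · intro z hz
    have hc : ∀ w ∈ ball (0 : ℂ) R, HasDerivAt (fun w => f w * exp (-l w)) 0 w := fun w hw => by
      have h1 := (hf.differentiableAt (isOpen_ball.mem_nhds hw)).hasDerivAt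
      have h2 := h1.mul ((hl w hw).neg.cexp)
      have e : deriv f w * exp (-l w) + f w * (exp (-l w) * -(deriv f w / f w)) = 0 := by have := h0 w hw; field_simp; ring
      rw [← e]; exact h2
    have hk : f z * exp (-l z) = f 0 * exp (-l 0) := by
      refine (convex_ball (0 : ℂ) R).is_const_of_fderivWithin_eq_zero (𝕜 := ℂ)
        (f := fun w => f w * exp (-l w)) (fun w hw => (hc w hw).differentiableAt.differentiableWithinAt) ?_ hz h00
      intro w hw
      rw [fderivWithin_of_isOpen isOpen_ball hw]
      ext; simp [(hc w hw).deriv]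
    rw [Complex.exp_add, Complex.exp_log (h0 0 h00), Complex.exp_sub]
    rw [Complex.exp_neg, Complex.exp_neg] at hk
    have a := Complex.exp_ne_zero (l z)
    have b := Complex.exp_ne_zero (l 0)
    field_simp at hk ⊢
    rw [hk]

/-- continuity of circle means -/
lemma mean_tendsto (hp : 0 < p) {f : ℕ → ℝ → ℂ} {g : ℝ → ℂ} (hf : ∀ n, Continuous (f n)) {M : ℝ}
    (hM : ∀ n t, ‖f n t‖ ≤ M) (hl : ∀ t, Tendsto (fun n => f n t) atTop (𝓝 (g t))) :
    Tendsto (fun n => ∫⁻ t in 𝕀, ‖f n t‖ₑ ^ p) atTop (𝓝 (∫⁻ t in 𝕀, ‖g t‖ₑ ^ p)) := by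
  apply tendsto_lintegral_of_dominated_convergence (fun _ => (ofReal M) ^ p)
  · intro n; exact ((hf n).measurable.enorm).pow_const p
  · intro n; refine ae_of_all _ fun t => ?_
    simp only
    rw [← ofReal_norm]
    exact rpow_le_rpow (ofReal_le_ofReal (hM n t)) hp.le
  · rw [setLIntegral_const]
    exact mul_ne_top (rpow_ne_top_of_nonneg hp.le ofReal_ne_top) (by simp)
  · refine ae_of_all _ fun t => ?_
    exact (hl t).enorm.ennrpow_const p

lemma exists_radii : ∃ r : ℕ → ℝ, (∀ n, 0 < r n ∧ r n < 1) ∧ Tendsto r atTop (𝓝 1) ∧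
    Tendsto (fun n => (r n : ℂ)) atTop (𝓝 1) := by
  have r2 : Tendsto (fun n : ℕ => 1 - 1 / (n + 2 : ℝ)) atTop (𝓝 1) := by
    have h1 : Tendsto (fun n : ℕ => 1 / (n + 2 : ℝ)) atTop (𝓝 0) := by
      have := (tendsto_add_atTop_iff_nat 1).2 (tendsto_one_div_add_atTop_nhds_zero_nat (𝕜 := ℝ))
      refine this.congr fun n => ?_
      push_cast; ring
    have h2 := h1.const_sub 1
    rw [sub_zero] at h2; exact h2
  refine ⟨_, ?_, r2, ?_⟩
  · intro n
    have : (0 : ℝ) < n + 2 := by positivity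
    constructor
    · rw [sub_pos, div_lt_one this]; linarith [(Nat.cast_nonneg n : (0 : ℝ) ≤ n)]
    · have : 0 < 1 / (n + 2 : ℝ) := by positivity
      linarith
  · have := (Complex.continuous_ofReal.tendsto 1).comp r2
    rw [Complex.ofReal_one] at this; exact this

lemma E1_zf' (hp : 0 < p) (hp1 : p ≤ 1) (L : ℕ) : ∃ C : ℝ≥0∞, C ≠ ∞ ∧ ∀ (h : ℂ → ℂ)
    (_ : Differentiable ℂ h) (_ : ∀ z ∈ ball (0 : ℂ) 1, h z ≠ 0),
    ∫⁻ θ, (Ar (fun x => ‖Rop L h cp(x)‖ₑ ^ 2) θ) ^ (p / 2) ≤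
      C * ∫⁻ t in 𝕀, ‖h (Ec t)‖ₑ ^ p := by
  obtain ⟨C, hC, H⟩ := E1_zf hp hp1 L
  refine ⟨C, hC, fun h hd h0 => ?_⟩
  obtain ⟨r, r1, r2, r3⟩ := exists_radii
  have hdU : ∀ U, DifferentiableOn ℂ h U := fun U => hd.differentiableOn
  have key := Ar_fatou (ι := Unit) {()} (q := p / 2) (by positivity)
    (v := fun n _ x => ‖Rop L (fun w => h (r n * w)) cp(x)‖ₑ ^ 2)
    (w := fun _ x => ‖Rop L h cp(x)‖ₑ ^ 2)
    (B := fun n => C * ∫⁻ t in 𝕀, ‖h (r n * Ec t)‖ₑ ^ p)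
    (b := C * ∫⁻ t in 𝕀, ‖h (Ec t)‖ₑ ^ p) ?_ ?_ ?_ ?_
  · simpa using key
  · intro n _ θ
    exact (Rop_aem L (f := fun w => h (r n * w)) (by fun_prop) θ).enorm.pow_const 2
  · intro _ θ x hx
    simp_rw [Rop_dil]
    have hc : ContinuousAt (Rop L h) cp(x) :=
      ((Rop_diff L (hdU (ball 0 1))).continuousOn).continuousAt (isOpen_ball.mem_nhds (by simpa using (Gm_sub hx).2.2))
    have h1 : Tendsto (fun n => (r n : ℂ) * circlePt x.1 x.2) atTop (𝓝 cp(x)) := by simpa using r3.mul_const cp(x)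
    exact ((ENNReal.continuous_pow 2).tendsto _).comp ((hc.tendsto.comp h1).enorm)
  · intro n
    simp only [sum_singleton]
    have hz : ∀ z ∈ ball (0 : ℂ) (r n)⁻¹, h (r n * z) ≠ 0 := fun z hz => by
      apply h0
      simp only [mem_ball_zero_iff] at hz ⊢
      rw [norm_mul, norm_real, norm_eq_abs, abs_of_pos (r1 n).1]
      calc r n * ‖z‖ < r n * (r n)⁻¹ := mul_lt_mul_of_pos_left hz (r1 n).1
        _ = 1 := mul_inv_cancel₀ (r1 n).1.ne'
    obtain ⟨lam, hl1, hl2⟩ := exists_log (f := fun w => h (r n * w)) (inv_pos.2 (r1 n).1) (by fun_prop) hz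
    exact H _ ((one_lt_inv₀ (r1 n).1).2 (r1 n).2) lam _ hl1 hl2
  · apply ENNReal.Tendsto.const_mul _ (Or.inr hC)
    obtain ⟨M, hM⟩ := (isCompact_closedBall (0 : ℂ) 1).exists_bound_of_continuousOn hd.continuous.continuousOn
    apply mean_tendsto hp (M := M)
    · intro n; exact hd.continuous.comp (continuous_const.mul Ec_cont)
    · intro n t; apply hM
      simp only [mem_closedBall_zero_iff]
      rw [norm_mul, Ec_norm, norm_real, norm_eq_abs, abs_of_pos (r1 n).1, mul_one]; exact (r1 n).2.le
    · intro t
      have h1 : Tendsto (fun n => (r n : ℂ) * Ec t) atTop (𝓝 (Ec t)) := by simpa using r3.mul_const (Ec t)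
      exact (hd.continuous.tendsto _).comp h1

lemma refl_factor (α : ℂ) : ∃ g : Polynomial ℂ, (∀ w : ℂ, ‖w‖ < 1 → g.eval w ≠ 0) ∧
    (∀ w : ℂ, ‖w‖ ≤ 1 → ‖w - α‖ ≤ ‖g.eval w‖) ∧ (∀ w : ℂ, ‖w‖ = 1 → ‖w - α‖ = ‖g.eval w‖) := by
  by_cases h : 1 ≤ ‖α‖
  · refine ⟨Polynomial.X - Polynomial.C α, ?_, ?_, ?_⟩
    · intro w hw h0
      simp only [Polynomial.eval_sub, Polynomial.eval_X, Polynomial.eval_C] at h0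
      rw [sub_eq_zero.1 h0] at hw; linarith
    · intro w _; simp
    · intro w _; simp
  · push Not at h
    have key : ∀ w : ℂ, ‖1 - (starRingEnd ℂ) α * w‖ ^ 2 - ‖w - α‖ ^ 2 = (1 - ‖α‖ ^ 2) * (1 - ‖w‖ ^ 2) := fun w => by
      simp only [← Complex.normSq_eq_norm_sq, Complex.normSq_apply]
      simp; ring
    have ev : ∀ w, (1 - Polynomial.C ((starRingEnd ℂ) α) * Polynomial.X : Polynomial ℂ).eval w = 1 - (starRingEnd ℂ) α * w := by
      intro w; simp
    refine ⟨1 - Polynomial.C ((starRingEnd ℂ) α) * Polynomial.X, ?_, ?_, ?_⟩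
    · intro w hw h0
      rw [ev] at h0
      have h1 : ‖(starRingEnd ℂ) α * w‖ = 1 := by rw [← sub_eq_zero.1 h0]; simp
      rw [norm_mul, RCLike.norm_conj] at h1
      nlinarith [norm_nonneg α, norm_nonneg w]
    · intro w hw
      rw [ev]
      have h1 : 0 ≤ (1 - ‖α‖ ^ 2) * (1 - ‖w‖ ^ 2) := by apply mul_nonneg <;> nlinarith [norm_nonneg α, norm_nonneg w]
      rw [← key] at h1
      exact le_of_sq_le_sq (by linarith) (norm_nonneg _)
    · intro w hw
      rw [ev]
      have h1 := key w
      rw [hw] at h1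
      have : ‖1 - (starRingEnd ℂ) α * w‖ ^ 2 = ‖w - α‖ ^ 2 := by linarith
      exact ((sq_eq_sq₀ (norm_nonneg _) (norm_nonneg _)).1 this).symm

lemma refl_multi (s : Multiset ℂ) : ∃ g : Polynomial ℂ, (∀ w : ℂ, ‖w‖ < 1 → g.eval w ≠ 0) ∧
    (∀ w : ℂ, ‖w‖ ≤ 1 → ‖(s.map (w - ·)).prod‖ ≤ ‖g.eval w‖) ∧
    (∀ w : ℂ, ‖w‖ = 1 → ‖(s.map (w - ·)).prod‖ = ‖g.eval w‖) := by
  induction s using Multiset.induction with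
  | empty => exact ⟨1, by simp, by simp, by simp⟩
  | cons a s ih =>
    obtain ⟨g, g1, g2, g3⟩ := ih
    obtain ⟨h, h1, h2, h3⟩ := refl_factor a
    refine ⟨h * g, ?_, ?_, ?_⟩
    · intro w hw; rw [Polynomial.eval_mul]; exact mul_ne_zero (h1 w hw) (g1 w hw)
    · intro w hw
      simp only [Multiset.map_cons, Multiset.prod_cons, Polynomial.eval_mul, norm_mul]
      exact mul_le_mul (h2 w hw) (g2 w hw) (norm_nonneg _) (norm_nonneg _)
    · intro w hw
      simp only [Multiset.map_cons, Multiset.prod_cons, Polynomial.eval_mul, norm_mul]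
      rw [h3 w hw, g3 w hw]

lemma refl_poly (P : Polynomial ℂ) (hP : P ≠ 0) : ∃ g : Polynomial ℂ, (∀ w : ℂ, ‖w‖ < 1 → g.eval w ≠ 0) ∧
    (∀ w : ℂ, ‖w‖ ≤ 1 → ‖P.eval w‖ ≤ ‖g.eval w‖) ∧ (∀ w : ℂ, ‖w‖ = 1 → ‖P.eval w‖ = ‖g.eval w‖) := by
  obtain ⟨g, g1, g2, g3⟩ := refl_multi P.roots
  have hl : P.leadingCoeff ≠ 0 := by simpa using hP
  refine ⟨Polynomial.C P.leadingCoeff * g, ?_, ?_, ?_⟩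
  · intro w hw; rw [Polynomial.eval_mul, Polynomial.eval_C]; exact mul_ne_zero hl (g1 w hw)
  · intro w hw
    rw [(IsAlgClosed.splits P).eval_eq_prod_roots, Polynomial.eval_mul, Polynomial.eval_C, norm_mul, norm_mul]
    exact mul_le_mul_of_nonneg_left (g2 w hw) (norm_nonneg _)
  · intro w hw
    rw [(IsAlgClosed.splits P).eval_eq_prod_roots, Polynomial.eval_mul, Polynomial.eval_C, norm_mul, norm_mul, g3 w hw]

lemma Ar_cmul {c : ℝ≥0∞} (hc : c ≠ ∞) (v : ℝ × ℝ → ℝ≥0∞) (θ : ℝ) : Ar (fun x => c * v x) θ = c * Ar v θ :=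
  lintegral_const_mul' _ _ hc

lemma enorm_sub_sq_le (a b : ℂ) : ‖a - b‖ₑ ^ 2 ≤ 2 * (‖a‖ₑ ^ 2 + ‖b‖ₑ ^ 2) := by
  rw [← ofReal_norm, ← ofReal_norm, ← ofReal_norm, ← ofReal_pow (norm_nonneg _),
    ← ofReal_pow (norm_nonneg _), ← ofReal_pow (norm_nonneg _), ← ofReal_add (by positivity) (by positivity),
    show (2 : ℝ≥0∞) = ofReal 2 by norm_num, ← ofReal_mul (by norm_num)]
  apply ofReal_le_ofReal
  have := norm_sub_le a b
  have h0 := norm_nonneg (a - b)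
  nlinarith [sq_nonneg (‖a‖ - ‖b‖)]

/-- polynomials -/
lemma E1_poly (hp : 0 < p) (hp1 : p ≤ 1) (L : ℕ) : ∃ C : ℝ≥0∞, C ≠ ∞ ∧ ∀ (P : Polynomial ℂ),
    ∫⁻ θ, (Ar (fun x => ‖Rop L (fun w => P.eval w) cp(x)‖ₑ ^ 2) θ) ^ (p / 2) ≤
      C * ∫⁻ t in 𝕀, ‖P.eval (Ec t)‖ₑ ^ p := by
  obtain ⟨C, hC, H⟩ := E1_zf' hp hp1 L
  refine ⟨2 ^ (p / 2) * (C * 3 ^ p + C * 2 ^ p), ?_, fun P => ?_⟩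
  · have : ∀ x : ℝ≥0∞, ∀ q : ℝ, x ≠ ∞ → 0 ≤ q → x ^ q ≠ ∞ := fun x q h1 h2 => rpow_ne_top_of_nonneg h2 h1
    have a1 := this 2 (p / 2) (by norm_num) (by positivity)
    have a2 := this 2 p (by norm_num) hp.le
    have a3 := this 3 p (by norm_num) hp.le
    finiteness
  by_cases hP : P = 0
  · subst hP
    have : ∀ θ, Ar (fun x => ‖Rop L (fun w => (0 : Polynomial ℂ).eval w) cp(x)‖ₑ ^ 2) θ = 0 := by intro θ; simp [Ar, Rop]
    simp_rw [this]
    simp [hp]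
  obtain ⟨g, g1, g2, g3⟩ := refl_poly P hP
  set h1 : ℂ → ℂ := fun w => P.eval w + 2 * g.eval w with hh1
  set h2 : ℂ → ℂ := fun w => 2 * g.eval w with hh2
  have d1 : Differentiable ℂ h1 := by have := P.differentiable; have := g.differentiable; simp only [hh1]; fun_prop
  have d2 : Differentiable ℂ h2 := by have := g.differentiable; simp only [hh2]; fun_prop
  have z1 : ∀ z ∈ ball (0 : ℂ) 1, h1 z ≠ 0 := fun z hz h0 => by
    have hz' : ‖z‖ < 1 := by simpa using hz
    have e : P.eval z = -(2 * g.eval z) := by simp only [hh1] at h0; linear_combination h0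
    have := g2 z hz'.le
    rw [e, norm_neg, norm_mul] at this
    have h3 := norm_pos_iff.2 (g1 z hz')
    norm_num at this; linarith
  have z2 : ∀ z ∈ ball (0 : ℂ) 1, h2 z ≠ 0 := fun z hz => by exact mul_ne_zero two_ne_zero (g1 z (by simpa using hz))
  have H1 := H h1 d1 z1
  have H2 := H h2 d2 z2
  have b1 : ∀ t, ‖h1 (Ec t)‖ₑ ^ p ≤ 3 ^ p * ‖P.eval (Ec t)‖ₑ ^ p := fun t => by
    rw [← mul_rpow_of_nonneg _ _ hp.le]
    gcongr
    rw [← ofReal_norm, ← ofReal_norm, show (3 : ℝ≥0∞) = ofReal 3 by norm_num, ← ofReal_mul (by norm_num)]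
    apply ofReal_le_ofReal
    have h3 := g3 (Ec t) (Ec_norm t)
    simp only [hh1]
    refine (norm_add_le _ _).trans ?_
    rw [norm_mul, ← h3]; norm_num; linarith
  have b2 : ∀ t, ‖h2 (Ec t)‖ₑ ^ p ≤ 2 ^ p * ‖P.eval (Ec t)‖ₑ ^ p := fun t => by
    rw [← mul_rpow_of_nonneg _ _ hp.le]
    gcongr
    rw [← ofReal_norm, ← ofReal_norm, show (2 : ℝ≥0∞) = ofReal 2 by norm_num, ← ofReal_mul (by norm_num)]
    apply ofReal_le_ofReal
    have h3 := g3 (Ec t) (Ec_norm t)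
    simp only [hh2]
    rw [norm_mul, ← h3]; norm_num
  have hPm : Measurable fun t => ‖P.eval (Ec t)‖ₑ ^ p :=
    ((P.continuous.comp Ec_cont).measurable.enorm).pow_const p
  set J := ∫⁻ t in 𝕀, ‖P.eval (Ec t)‖ₑ ^ p with hJ
  have J1 : ∫⁻ t in 𝕀, ‖h1 (Ec t)‖ₑ ^ p ≤ 3 ^ p * J := by rw [hJ, ← lintegral_const_mul _ hPm]; exact lintegral_mono b1
  have J2 : ∫⁻ t in 𝕀, ‖h2 (Ec t)‖ₑ ^ p ≤ 2 ^ p * J := by rw [hJ, ← lintegral_const_mul _ hPm]; exact lintegral_mono b2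
  set u1 := fun x : ℝ × ℝ => ‖Rop L h1 cp(x)‖ₑ ^ 2 with hu1
  set u2 := fun x : ℝ × ℝ => ‖Rop L h2 cp(x)‖ₑ ^ 2 with hu2
  have step : ∀ θ, (Ar (fun x => ‖Rop L (fun w => P.eval w) cp(x)‖ₑ ^ 2) θ) ^ (p / 2) ≤
      2 ^ (p / 2) * (Ar u1 θ ^ (p / 2) + Ar u2 θ ^ (p / 2)) := fun θ => by
    have s1 : Ar (fun x => ‖Rop L (fun w => P.eval w) cp(x)‖ₑ ^ 2) θ ≤ Ar (fun x => 2 * (u1 x + u2 x)) θ := by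
      apply Ar_mono
      intro I _ x _
      have e : Rop L (fun w => P.eval w) cp(x) = Rop L h1 cp(x) - Rop L h2 cp(x) := by
        have : (fun w => P.eval w) = fun w => h1 w - h2 w := by ext w; simp only [hh1, hh2]; ring
        unfold Rop
        rw [this, deriv_fun_sub d1.differentiableAt d2.differentiableAt]; ring
      rw [e]; exact enorm_sub_sq_le _ _
    rw [Ar_cmul (by norm_num)] at s1
    have s2 : Ar (fun x => u1 x + u2 x) θ = Ar u1 θ + Ar u2 θ :=
      lintegral_add_left' ((Rop_aem L d1.differentiableOn θ).enorm.pow_const 2) _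
    rw [s2] at s1
    refine (rpow_le_rpow s1 (by positivity)).trans ?_
    rw [mul_rpow_of_nonneg _ _ (by positivity)]
    gcongr
    exact rpow_add_le_add_rpow _ _ (by positivity) (by linarith)
  have m1 : Measurable fun θ => Ar u1 θ ^ (p / 2) := (Ar_meas _).pow_const _
  have m2 : Measurable fun θ => Ar u2 θ ^ (p / 2) := (Ar_meas _).pow_const _
  refine (lintegral_mono step).trans ?_
  rw [lintegral_const_mul _ (by fun_prop), lintegral_add_left (by fun_prop), mul_assoc]
  gcongr
  rw [add_mul, mul_assoc, mul_assoc]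
  exact add_le_add (H1.trans (mul_le_mul_right J1 _)) (H2.trans (mul_le_mul_right J2 _))

/-- scalar square function estimate -/
lemma E1_s (hp : 0 < p) (hp1 : p ≤ 1) (L : ℕ) : ∃ C : ℝ≥0∞, C ≠ ∞ ∧ ∀ (R : ℝ) (_ : 1 < R) (f : ℂ → ℂ)
    (_ : Hol(f, R)),
    ∫⁻ θ, (Ar (fun x => ‖Rop L f cp(x)‖ₑ ^ 2) θ) ^ (p / 2) ≤
      C * ∫⁻ t in 𝕀, ‖f (Ec t)‖ₑ ^ p := by
  obtain ⟨C, hC, H⟩ := E1_poly hp hp1 L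
  refine ⟨C, hC, fun R hR f hf => ?_⟩
  set P : ℕ → Polynomial ℂ := fun m => ∑ n ∈ range m, Polynomial.C (tc f n) * Polynomial.X ^ n with hP
  have eP : ∀ m w, (P m).eval w = ∑ n ∈ range m, tc f n * w ^ n := by intro m w; simp [hP, Polynomial.eval_finset_sum]
  have rP : ∀ m z, Rop L (fun w => (P m).eval w) z = ∑ n ∈ range m, (n + L) * tc f n * z ^ n := fun m z => by
    unfold Rop
    simp only [eP]
    rw [deriv_fun_sum (fun i _ => by fun_prop), mul_sum, mul_sum, ← sum_add_distrib]
    apply sum_congr rfl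
    intro n _
    rw [deriv_const_mul _ (by fun_prop), deriv_pow_field]
    rcases n with _ | n
    · simp
    · simp only [Nat.add_sub_cancel]; push_cast; ring
  have key := Ar_fatou (ι := Unit) {()} (q := p / 2) (by positivity)
    (v := fun n _ x => ‖Rop L (fun w => (P n).eval w) cp(x)‖ₑ ^ 2)
    (w := fun _ x => ‖Rop L f cp(x)‖ₑ ^ 2)
    (B := fun n => C * ∫⁻ t in 𝕀, ‖(P n).eval (Ec t)‖ₑ ^ p)
    (b := C * ∫⁻ t in 𝕀, ‖f (Ec t)‖ₑ ^ p) ?_ ?_ ?_ ?_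
  · simpa using key
  · intro n _ θ
    exact (Rop_aem L (P n).differentiable.differentiableOn θ).enorm.pow_const 2
  · intro _ θ x hx
    simp_rw [rP]
    have h1 := (Rop_hasSum L hf ((Gm_sub hx).2.2.trans hR)).tendsto_sum_nat
    exact ((ENNReal.continuous_pow 2).tendsto _).comp h1.enorm
  · intro n
    simp only [sum_singleton]
    exact H (P n)
  · apply ENNReal.Tendsto.const_mul _ (Or.inr hC)
    have hs := tc_summable hf zero_le_one hR
    simp only [one_pow, mul_one] at hs
    apply mean_tendsto hp (M := ∑' n, ‖tc f n‖)
    · intro n; exact (P n).continuous.comp Ec_cont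
    · intro n t
      rw [eP]
      refine (norm_sum_le _ _).trans ?_
      refine le_trans (le_of_eq ?_) (hs.sum_le_tsum (range n) fun i _ => norm_nonneg _)
      apply sum_congr rfl; intro i _; simp [Ec_norm]
    · intro t
      simp_rw [eP]
      exact (tc_hasSum hf (by rw [Ec_norm]; exact hR)).tendsto_sum_nat

lemma sq_rpow (x : ℝ≥0∞) (p : ℝ) : (x ^ 2) ^ (p / 2) = x ^ p := by rw [← rpow_natCast, ← rpow_mul]; congr 1; push_cast; ring

/-- vector square function estimate, finitely many components -/
lemma E1_fin (hp : 0 < p) (hp1 : p ≤ 1) (L : ℕ) : ∃ C : ℝ≥0∞, C ≠ ∞ ∧ ∀ (R : ℝ) (_ : 1 < R) (s : Finset ℕ) (f : ℕ → ℂ → ℂ)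
    (_ : ∀ n, DifferentiableOn ℂ (f n) (ball 0 R)),
    ∫⁻ θ, (∑ n ∈ s, Ar (fun x => ‖Rop L (f n) cp(x)‖ₑ ^ 2) θ) ^ (p / 2) ≤
      C * ∫⁻ t in 𝕀, (∑ n ∈ s, ‖f n (Ec t)‖ₑ ^ 2) ^ (p / 2) := by
  obtain ⟨C, hC, H⟩ := E1_s hp hp1 L
  refine ⟨12 * C, mul_ne_top (by norm_num) hC, fun R hR s f hf => ?_⟩
  have hf1 : ∀ n, DifferentiableOn ℂ (f n) (ball 0 1) := fun n => (hf n).mono (ball_subset_ball hR.le)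
  have c0 : (2 : ℝ≥0∞) ^ s.card ≠ 0 := by positivity
  have c1 : (2 : ℝ≥0∞) ^ s.card ≠ ∞ := by finiteness
  rw [← ENNReal.mul_le_mul_iff_right c0 c1]
  have m : ∀ A, Measurable fun θ => Ar (fun x => ‖Rop L (fun w => ∑ i ∈ s, sg A i * f i w) cp(x)‖ₑ ^ 2) θ ^ (p / 2) :=
    fun A => (Ar_meas _).pow_const _
  have fc : ∀ i, Continuous fun t => f i (Ec t) := fun i => by
    refine (hf i).continuousOn.comp_continuous Ec_cont fun t => ?_
    simpa [Ec_norm] using hR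
  calc 2 ^ s.card * ∫⁻ θ, (∑ n ∈ s, Ar (fun x => ‖Rop L (f n) cp(x)‖ₑ ^ 2) θ) ^ (p / 2)
      = ∫⁻ θ, 2 ^ s.card * (∑ n ∈ s, Ar (fun x => ‖Rop L (f n) cp(x)‖ₑ ^ 2) θ) ^ (p / 2) :=
        (lintegral_const_mul' _ _ c1).symm
    _ ≤ ∫⁻ θ, 12 * ∑ A ∈ s.powerset, Ar (fun x => ‖Rop L (fun w => ∑ i ∈ s, sg A i * f i w) cp(x)‖ₑ ^ 2) θ ^ (p / 2) := by
        apply lintegral_mono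
        intro θ
        refine (khin_lower (volume.restrict (Gm θ)) hp (by linarith) s (fun i x => Rop L (f i) cp(x))
          fun i _ => Rop_aem L (hf1 i) θ).trans (le_of_eq ?_)
        congr 1
        apply sum_congr rfl
        intro A _
        congr 1
        apply setLIntegral_congr_fun (Gm_meas θ)
        intro x hx
        simp only
        congr 2
        have hd : ∀ i, DifferentiableAt ℂ (f i) cp(x) := fun i =>
          (hf1 i).differentiableAt (isOpen_ball.mem_nhds (by simpa using (Gm_sub hx).2.2))
        unfold Rop
        rw [deriv_fun_sum (fun i _ => (hd i).const_mul _), mul_sum, mul_sum, ← sum_add_distrib]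
        apply sum_congr rfl
        intro i _
        rw [deriv_const_mul _ (hd i)]; ring
    _ = 12 * ∑ A ∈ s.powerset, ∫⁻ θ, Ar (fun x => ‖Rop L (fun w => ∑ i ∈ s, sg A i * f i w) cp(x)‖ₑ ^ 2) θ ^ (p / 2) := by
        rw [lintegral_const_mul _ (by fun_prop), lintegral_finsetSum _ (fun A _ => m A)]
    _ ≤ 12 * ∑ A ∈ s.powerset, C * ∫⁻ t in 𝕀, ‖∑ i ∈ s, sg A i * f i (Ec t)‖ₑ ^ p := by
        gcongr with A hA
        exact H R hR _ (by fun_prop)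
    _ = 12 * C * ∫⁻ t in 𝕀, ∑ A ∈ s.powerset, ‖∑ i ∈ s, sg A i * f i (Ec t)‖ₑ ^ p := by
        rw [lintegral_finsetSum _ (fun A _ => by
          have : Continuous fun t => ∑ i ∈ s, sg A i * f i (Ec t)   := continuous_finset_sum _ fun i _ => continuous_const.mul (fc i)
          exact (this.measurable.enorm).pow_const p), ← mul_sum, mul_assoc]
    _ ≤ 12 * C * ∫⁻ t in 𝕀, 2 ^ s.card * (∑ n ∈ s, ‖f n (Ec t)‖ₑ ^ 2) ^ (p / 2) := by
        gcongr with t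
        have := khin_upper_tsum (κ := Unit) (fun _ => 1) hp (by linarith) s (fun i _ => f i (Ec t))
        simpa [sq_rpow] using this
    _ = _ := by rw [lintegral_const_mul' _ _ c1]; ring

/-- vector square function estimate on the disc -/
lemma E1_vec (hp : 0 < p) (hp1 : p ≤ 1) (L : ℕ) : ∃ C : ℝ≥0∞, C ≠ ∞ ∧ ∀ (f : ℕ → ℂ → ℂ)
    (_ : ∀ n, DifferentiableOn ℂ (f n) (ball 0 1)) (B : ℝ≥0∞)
    (_ : ∀ r : ℝ, 0 < r → r < 1 → ∫⁻ t in 𝕀, (∑' n, ‖f n (r * Ec t)‖ₑ ^ 2) ^ (p / 2) ≤ B),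
    ∫⁻ θ, (∑' n, Ar (fun x => ‖Rop L (f n) cp(x)‖ₑ ^ 2) θ) ^ (p / 2) ≤ C * B := by
  obtain ⟨C, hC, H⟩ := E1_fin hp hp1 L
  refine ⟨C, hC, fun f hf B hB => ?_⟩
  obtain ⟨r, r1, r2, r3⟩ := exists_radii
  have fin : ∀ N, ∫⁻ θ, (∑ n ∈ range N, Ar (fun x => ‖Rop L (f n) cp(x)‖ₑ ^ 2) θ) ^ (p / 2) ≤ C * B := fun N => by
    have hd : ∀ m n, DifferentiableOn ℂ (fun w => f n (r m * w)) (ball 0 (r m)⁻¹) := fun m n => by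
      refine (hf n).comp (by fun_prop) fun z hz => ?_
      simp only [mem_ball_zero_iff] at hz ⊢
      rw [norm_mul, norm_real, norm_eq_abs, abs_of_pos (r1 m).1]
      calc r m * ‖z‖ < r m * (r m)⁻¹ := mul_lt_mul_of_pos_left hz (r1 m).1
        _ = 1 := mul_inv_cancel₀ (r1 m).1.ne'
    have hr1 : ∀ m, 1 < (r m)⁻¹ := fun m => (one_lt_inv₀ (r1 m).1).2 (r1 m).2
    refine Ar_fatou (range N) (q := p / 2) (by positivity)
      (v := fun m n x => ‖Rop L (fun w => f n (r m * w)) cp(x)‖ₑ ^ 2) (B := fun _ => C * B) ?_ ?_ ?_ tendsto_const_nhds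
    · intro m n θ
      exact (Rop_aem L ((hd m n).mono (ball_subset_ball (hr1 m).le)) θ).enorm.pow_const 2
    · intro n θ x hx
      simp_rw [Rop_dil]
      have hc : ContinuousAt (Rop L (f n)) cp(x) :=
        ((Rop_diff L (hf n)).continuousOn).continuousAt (isOpen_ball.mem_nhds (by simpa using (Gm_sub hx).2.2))
      have h1 : Tendsto (fun m => (r m : ℂ) * circlePt x.1 x.2) atTop (𝓝 cp(x)) := by simpa using r3.mul_const cp(x)
      exact ((ENNReal.continuous_pow 2).tendsto _).comp (hc.tendsto.comp h1).enorm
    · intro m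
      refine (H _ (hr1 m) (range N) _ (hd m)).trans ?_
      gcongr
      refine le_trans (lintegral_mono fun t => ?_) (hB (r m) (r1 m).1 (r1 m).2)
      gcongr
      exact ENNReal.sum_le_tsum _
  have e : ∀ θ, (∑' n, Ar (fun x => ‖Rop L (f n) cp(x)‖ₑ ^ 2) θ) ^ (p / 2) =
      ⨆ N, (∑ n ∈ range N, Ar (fun x => ‖Rop L (f n) cp(x)‖ₑ ^ 2) θ) ^ (p / 2) := fun θ => by
    rw [ENNReal.tsum_eq_iSup_nat]
    exact (orderIsoRpow (p / 2) (by positivity)).map_iSup _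
  simp_rw [e]
  rw [lintegral_iSup]
  · exact iSup_le fin
  · intro N; exact (Finset.measurable_fun_sum _ fun i _ => Ar_meas _).pow_const _
  · intro N M hNM θ
    simp only
    gcongr

/-- radial weight -/
def rw1 (l : ℕ) (ρ : ℝ) : ℝ := 2 * ρ * (1 - ρ ^ 2) ^ l

lemma rw1_cont (l : ℕ) : Continuous (rw1 l) := by unfold rw1; fun_prop
lemma rw1_bd (l : ℕ) {ρ : ℝ} (h0 : 0 ≤ ρ) (h1 : ρ < 1) : 0 ≤ rw1 l ρ ∧ rw1 l ρ ≤ 2 := by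
  have h2 : 0 ≤ 1 - ρ ^ 2 := by nlinarith
  have h3 : (1 - ρ ^ 2) ^ l ≤ 1 := pow_le_one₀ h2 (by nlinarith)
  unfold rw1
  refine ⟨by positivity, ?_⟩
  have : 0 ≤ (1 - ρ ^ 2) ^ l := by positivity
  nlinarith

lemma fact_sq (n l : ℕ) : ((n + l).factorial : ℝ) ^ 2 ≤ n.factorial * (n + 2 * l).factorial := by
  have h : (n + l).factorial ^ 2 ≤ n.factorial * (n + 2 * l).factorial := by
    have e1 : (n + l).factorial = n.factorial * (n + 1).ascFactorial l := (Nat.factorial_mul_ascFactorial n l).symm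
    have e2 : (n + 2 * l).factorial = (n + l).factorial * (n + l + 1).ascFactorial l := by
      rw [Nat.factorial_mul_ascFactorial]; congr 1; ring
    have e3 : (n + 1).ascFactorial l ≤ (n + l + 1).ascFactorial l := Nat.ascFactorial_le l (show n + 1 ≤ n + l + 1 by omega)
    calc (n + l).factorial ^ 2 = (n + l).factorial * (n.factorial * (n + 1).ascFactorial l) := by rw [← e1]; ring
      _ ≤ (n + l).factorial * (n.factorial * (n + l + 1).ascFactorial l) := by gcongr
      _ = _ := by rw [e2]; ring
  exact_mod_cast h

/-- the constant -/
def wK (m : ℕ) : ℝ := 4 * (2 * m + 1).factorial / ((m + 1).factorial : ℝ) ^ 2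

lemma wt_int (m n : ℕ) : ∫⁻ ρ in 𝕀, ofReal ((1 - ρ)⁻¹ * (bt (m + 1) n * rw1 (m + 1) ρ * ρ ^ n) ^ 2) ≤
    ofReal (wK m) := by
  have h1 : ∫⁻ ρ in 𝕀, ofReal ((1 - ρ)⁻¹ * (bt (m + 1) n * rw1 (m + 1) ρ * ρ ^ n) ^ 2) ≤
      ∫⁻ ρ in 𝕀, ofReal ((4 * bt (m + 1) n ^ 2) * (2 * ρ * (1 - ρ ^ 2) ^ (2 * m + 1) * ρ ^ (2 * n))) := by
    apply setLIntegral_mono' measurableSet_Ico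
    intro ρ hρ
    apply ofReal_le_ofReal
    have hρ0 := hρ.1
    have hρ1 : 0 < 1 - ρ := by linarith [hρ.2]
    have h2 : 0 ≤ 1 - ρ ^ 2 := by nlinarith
    unfold rw1
    have e : (1 - ρ)⁻¹ * (bt (m + 1) n * (2 * ρ * (1 - ρ ^ 2) ^ (m + 1)) * ρ ^ n) ^ 2 =
        (bt (m + 1) n ^ 2 * ((1 - ρ ^ 2) ^ (2 * m + 1) * ρ ^ (2 * n))) * (4 * ρ * (ρ * (1 + ρ))) := by
      have : (1 - ρ)⁻¹ * (1 - ρ ^ 2) = 1 + ρ := by field_simp; ring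
      calc _ = (bt (m + 1) n ^ 2 * ((1 - ρ ^ 2) ^ (2 * m + 1) * ρ ^ (2 * n))) * (4 * ρ * (ρ * ((1 - ρ)⁻¹ * (1 - ρ ^ 2)))) := by ring
        _ = _ := by rw [this]
    rw [e]
    have h3 : ρ * (1 + ρ) ≤ 2 := by nlinarith
    calc _ ≤ (bt (m + 1) n ^ 2 * ((1 - ρ ^ 2) ^ (2 * m + 1) * ρ ^ (2 * n))) * (4 * ρ * 2) := by gcongr
      _ = _ := by ring
  refine h1.trans ?_
  rw [← ofReal_integral_eq_lintegral_ofReal]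
  · apply ofReal_le_ofReal
    rw [integral_Ico_eq_integral_Ioc, ← intervalIntegral.integral_of_le zero_le_one, intervalIntegral.integral_const_mul]
    change _ * bI n (2 * m + 1) 1 ≤ _
    rw [bI_one, bt_eq, wK]
    have := fact_sq n (m + 1)
    rw [show n + (2 * m + 1) + 1 = n + 2 * (m + 1) by ring]
    have p1 : (0 : ℝ) < n.factorial := by positivity
    have p2 : (0 : ℝ) < (m + 1).factorial := by positivity
    have p3 : (0 : ℝ) < (n + 2 * (m + 1)).factorial := by positivity
    have p4 : (0 : ℝ) < (2 * m + 1).factorial := by positivity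
    have e : 4 * (((n + (m + 1)).factorial : ℝ) / (n.factorial * (m + 1).factorial)) ^ 2 *
        (n.factorial * (2 * m + 1).factorial / (n + 2 * (m + 1)).factorial) =
        4 * (2 * m + 1).factorial / ((m + 1).factorial : ℝ) ^ 2 *
          (((n + (m + 1)).factorial : ℝ) ^ 2 / (n.factorial * (n + 2 * (m + 1)).factorial)) := by
      field_simp
    rw [e]
    apply mul_le_of_le_one_right (by positivity)
    rw [div_le_one (by positivity)]; exact this
  · exact (Continuous.integrableOn_Icc (by fun_prop)).mono_set Ico_subset_Icc_self
  · filter_upwards [ae_restrict_mem measurableSet_Ico] with ρ hρ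
    have := hρ.1; have : 0 ≤ 1 - ρ ^ 2 := by nlinarith [hρ.2]
    simp only [Pi.zero_apply]; positivity

/-- moments -/
def mo (l : ℕ) (E : Set (ℝ × ℝ)) (s : ℝ × ℝ → ℂ) (n : ℕ) : ℂ :=
  ∫ x in E, ((bt l n * rw1 l x.1 * x.1 ^ n : ℝ) : ℂ) * Ec (-x.2) ^ n * s x

lemma mo_int (l : ℕ) {E : Set (ℝ × ℝ)} (hE : MeasurableSet E) (hE1 : E ⊆ 𝕀 ×ˢ 𝕀)
    {s : ℝ × ℝ → ℂ} (hs : IntegrableOn s E) (n : ℕ) (z : ℂ) (hz : ‖z‖ ≤ 1) :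
    IntegrableOn (fun x => ((bt l n * rw1 l x.1 * x.1 ^ n : ℝ) : ℂ) * Ec (-x.2) ^ n * s x * z ^ n) E ∧
    ∫ x in E, ‖((bt l n * rw1 l x.1 * x.1 ^ n : ℝ) : ℂ) * Ec (-x.2) ^ n * s x * z ^ n‖ ≤ bt l n * ‖z‖ ^ n * (2 * ∫ x in E, ‖s x‖) := by
  have hb : ∀ x ∈ E, ‖((bt l n * rw1 l x.1 * x.1 ^ n : ℝ) : ℂ) * Ec (-x.2) ^ n * s x * z ^ n‖ ≤ (bt l n * ‖z‖ ^ n * 2) * ‖s x‖ := fun x hx => by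
    have h1 := (hE1 hx).1
    have h2 := rw1_bd l h1.1 h1.2
    have h3 := bt_pos l n
    have h4 : x.1 ^ n ≤ 1 := pow_le_one₀ h1.1 h1.2.le
    have h5 : 0 ≤ x.1 ^ n := pow_nonneg h1.1 n
    rw [norm_mul, norm_mul, norm_mul, norm_pow, norm_pow, Ec_norm, one_pow, mul_one, norm_real, norm_eq_abs,
      abs_of_nonneg (mul_nonneg (mul_nonneg h3.le h2.1) h5)]
    calc bt l n * rw1 l x.1 * x.1 ^ n * ‖s x‖ * ‖z‖ ^ n = (bt l n * ‖z‖ ^ n * ‖s x‖) * (rw1 l x.1 * x.1 ^ n) := by ring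
      _ ≤ (bt l n * ‖z‖ ^ n * ‖s x‖) * (2 * 1) := by
          apply mul_le_mul_of_nonneg_left (mul_le_mul h2.2 h4 h5 (by norm_num)) (by positivity)
      _ = _ := by ring
  have hi : IntegrableOn (fun x => ((bt l n * rw1 l x.1 * x.1 ^ n : ℝ) : ℂ) * Ec (-x.2) ^ n * s x * z ^ n) E := by
    refine Integrable.mono' (hs.norm.const_mul (bt l n * ‖z‖ ^ n * 2)) ?_ ?_
    · have c1 : Continuous fun x : ℝ × ℝ => ((bt l n * rw1 l x.1 * x.1 ^ n : ℝ) : ℂ) * Ec (-x.2) ^ n := by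
        have := rw1_cont l; have := Ec_cont; fun_prop
      exact (c1.aestronglyMeasurable.mul hs.aestronglyMeasurable).mul aestronglyMeasurable_const
    · exact (ae_restrict_iff' hE).2 (ae_of_all _ hb)
  refine ⟨hi, ?_⟩
  have := setIntegral_mono_on hi.norm (hs.norm.const_mul (bt l n * ‖z‖ ^ n * 2)) hE hb
  refine this.trans (le_of_eq ?_)
  rw [integral_const_mul]; ring

lemma mo_hasSum (l : ℕ) {E : Set (ℝ × ℝ)} (hE : MeasurableSet E) (hE1 : E ⊆ 𝕀 ×ˢ 𝕀)
    {s : ℝ × ℝ → ℂ} (hs : IntegrableOn s E) {z : ℂ} (hz : ‖z‖ < 1) :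
    HasSum (fun n => mo l E s n * z ^ n) (∫ x in E, kz l z x * s x) := by
  have h := hasSum_integral_of_summable_integral_norm (μ := volume.restrict E)
    (F := fun n x => ((bt l n * rw1 l x.1 * x.1 ^ n : ℝ) : ℂ) * Ec (-x.2) ^ n * s x * z ^ n)
    (fun n => (mo_int l hE hE1 hs n z hz.le).1) ?_
  · have e : ∀ x ∈ E, (∑' n, ((bt l n * rw1 l x.1 * x.1 ^ n : ℝ) : ℂ) * Ec (-x.2) ^ n * s x * z ^ n) = kz l z x * s x := fun x hx => by
      have h1 := (hE1 hx).1
      have hw : ‖(x.1 : ℂ) * Ec (-x.2) * z‖ < 1 := by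
        rw [norm_mul, norm_mul, Ec_norm, Complex.norm_of_nonneg h1.1]
        nlinarith [norm_nonneg z, h1.1, h1.2]
      have h2 := ((bt_hasSum l hw).mul_left ((rw1 l x.1 : ℝ) : ℂ)).mul_right (s x)
      have h3 : kz l z x * s x = ((rw1 l x.1 : ℝ) : ℂ) * (1 - (x.1 : ℂ) * Ec (-x.2) * z)⁻¹ ^ (l + 1) * s x := rfl
      rw [h3, ← h2.tsum_eq]
      congr 1; ext n; push_cast; ring
    rw [setIntegral_congr_fun hE e] at h
    refine h.congr_fun fun n => ?_
    unfold mo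
    rw [← integral_mul_const]
  · have hsum : Summable fun n => bt l n * ‖z‖ ^ n * (2 * ∫ x in E, ‖s x‖) := by
      apply Summable.mul_right
      have := (bt_hasSum l (w := (‖z‖ : ℂ)) (by simpa using hz)).summable.norm
      refine this.congr fun n => ?_
      simp [abs_of_pos (bt_pos l n)]
    exact Summable.of_nonneg_of_le (fun n => integral_nonneg fun x => norm_nonneg _) (fun n => (mo_int l hE hE1 hs n z hz.le).2) hsum

lemma mo_bessel (m : ℕ) {E : Set (ℝ × ℝ)} (hE : MeasurableSet E) (hE1 : E ⊆ 𝕀 ×ˢ 𝕀)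
    {s : ℝ × ℝ → ℂ} (hs : IntegrableOn s E) (N : ℕ) :
    ∑ n ∈ range N, ‖mo (m + 1) E s n‖ₑ ^ 2 ≤ ofReal (wK m) * ∫⁻ x in E, ofReal (1 - x.1) * ‖s x‖ₑ ^ 2 := by
  set l := m + 1 with hl
  set c := mo l E s with hc
  set q : ℕ → ℝ × ℝ → ℂ := fun n x => ((bt l n * rw1 l x.1 * x.1 ^ n : ℝ) : ℂ) * Ec (-x.2) ^ n with hq
  have qc : ∀ n, Continuous (q n) := by intro n; have := rw1_cont l; have := Ec_cont; simp only [hq]; fun_prop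
  set W : ℝ × ℝ → ℂ := fun x => ∑ n ∈ range N, (starRingEnd ℂ) (c n) * q n x with hW
  have Wc : Continuous W := by simp only [hW]; fun_prop
  set S := ∑ n ∈ range N, ‖c n‖ₑ ^ 2 with hS
  have hSfin : S ≠ ∞ := by rw [hS]; exact sum_ne_top.2 fun n _ => by finiteness
  have e1 : ∫ x in E, W x * s x = ∑ n ∈ range N, (starRingEnd ℂ) (c n) * c n := by
    simp only [hW, sum_mul]
    rw [integral_finset_sum]
    · apply sum_congr rfl
      intro n _
      simp_rw [mul_assoc]
      rw [integral_const_mul]; rfl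
    · intro n _
      have := (mo_int l hE hE1 hs n 1 (by simp)).1
      simp only [one_pow, mul_one] at this
      refine (this.const_mul ((starRingEnd ℂ) (c n))).congr (ae_of_all _ fun x => ?_)
      simp only [hq]; ring
  have e2 : S = ‖∫ x in E, W x * s x‖ₑ := by
    rw [e1]
    have : ∑ n ∈ range N, (starRingEnd ℂ) (c n) * c n = ((∑ n ∈ range N, ‖c n‖ ^ 2 : ℝ) : ℂ) := by
      push_cast
      apply sum_congr rfl; intro n _; rw [Complex.conj_mul']
    rw [this, ← ofReal_norm, Complex.norm_of_nonneg (by positivity),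
      ofReal_sum_of_nonneg (fun i _ => by positivity), hS]
    apply sum_congr rfl; intro n _
    rw [ofReal_pow (norm_nonneg _), ofReal_norm]
  set Y := ∫⁻ x in E, ofReal (1 - x.1) * ‖s x‖ₑ ^ 2 with hY
  have e3 : S ^ 2 ≤ (∫⁻ x in E, ofReal ((1 - x.1)⁻¹) * ‖W x‖ₑ ^ 2) * Y := by
    have h1 : S ≤ ∫⁻ x in E, (ofReal (√(1 - x.1))⁻¹ * ‖W x‖ₑ) * (ofReal (√(1 - x.1)) * ‖s x‖ₑ) := by
      rw [e2]
      refine (enorm_integral_le_lintegral_enorm _).trans (le_of_eq ?_)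
      apply setLIntegral_congr_fun hE
      intro x hx
      have h2 := (hE1 hx).1
      have h3 : 0 < √(1 - x.1) := Real.sqrt_pos.2 (by linarith [h2.2])
      simp only
      rw [enorm_mul, mul_mul_mul_comm, ← ofReal_mul (by positivity), inv_mul_cancel₀ h3.ne']; simp
    refine (pow_le_pow_left' h1 2).trans ?_
    have hsm := hs.aestronglyMeasurable.enorm
    have hWm := Wc.measurable
    refine (lint_CS (volume.restrict E) (by fun_prop) (by fun_prop)).trans (le_of_eq ?_)
    congr 1
    · apply setLIntegral_congr_fun hE
      intro x hx
      have h2 := (hE1 hx).1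
      have h3 : 0 < 1 - x.1 := by linarith [h2.2]
      simp only
      rw [mul_pow, ← ofReal_pow (by positivity), inv_pow, Real.sq_sqrt h3.le]
    · apply setLIntegral_congr_fun hE
      intro x hx
      have h2 := (hE1 hx).1
      have h3 : 0 < 1 - x.1 := by linarith [h2.2]
      simp only
      rw [mul_pow, ← ofReal_pow (by positivity), Real.sq_sqrt h3.le]
  have e4 : ∫⁻ x in E, ofReal ((1 - x.1)⁻¹) * ‖W x‖ₑ ^ 2 ≤ ofReal (wK m) * S := by
    have hWm := Wc.measurable
    refine (lintegral_mono_set hE1).trans ?_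
    rw [Measure.volume_eq_prod, setLIntegral_prod _ (by fun_prop)]
    have hin : ∀ ρ ∈ 𝕀, ∫⁻ t in 𝕀, ofReal ((1 - ρ)⁻¹) * ‖W (ρ, t)‖ₑ ^ 2 =
        ∑ n ∈ range N, ofReal ((1 - ρ)⁻¹ * (bt l n * rw1 l ρ * ρ ^ n) ^ 2) * ‖c n‖ₑ ^ 2 := fun ρ hρ => by
      rw [lintegral_const_mul' _ _ ofReal_ne_top]
      set b : ℕ → ℂ := fun n => if n ∈ range N then c n * ((bt l n * rw1 l ρ * ρ ^ n : ℝ) : ℂ) else 0 with hb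
      have hbs : Summable fun n => ‖b n‖ := by
        apply summable_of_ne_finset_zero (s := range N)
        intro n hn; simp only [hb, if_neg hn, norm_zero]
      have ew : ∀ t, ‖W (ρ, t)‖ₑ = ‖∑' n, b n * Ec t ^ n‖ₑ := fun t => by
        rw [tsum_eq_sum (s := range N) (fun n hn => by simp only [hb, if_neg hn, zero_mul])]
        rw [← ofReal_norm, ← ofReal_norm, ← Complex.norm_conj]
        congr 2
        simp only [hW, map_sum]
        apply sum_congr rfl
        intro n hn
        simp only [hb, hq, hn, if_true, map_mul, map_pow, Complex.conj_conj, Complex.conj_ofReal, Ec_neg]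
        ring
      simp_rw [ew]
      rw [eparseval hbs, tsum_eq_sum (s := range N) (fun n hn => by simp only [hb, if_neg hn]; simp), mul_sum]
      apply sum_congr rfl
      intro n hn
      simp only [hb, hn, if_true]
      have hρ1 : 0 < 1 - ρ := by linarith [hρ.2]
      have e : ‖((bt l n * rw1 l ρ * ρ ^ n : ℝ) : ℂ)‖ₑ ^ 2 = ofReal ((bt l n * rw1 l ρ * ρ ^ n) ^ 2) := by
        rw [← ofReal_norm, ← ofReal_pow (norm_nonneg _), norm_real, norm_eq_abs, sq_abs]
      rw [enorm_mul, mul_pow, e, ofReal_mul (by positivity)]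
      ring
    have hrc := (rw1_cont l).measurable
    rw [setLIntegral_congr_fun measurableSet_Ico hin, lintegral_finsetSum _ (fun n _ => by fun_prop), hS, mul_sum]
    gcongr with n hn
    rw [lintegral_mul_const _ (by fun_prop)]
    gcongr
    exact wt_int m n
  have e5 : S * S ≤ S * (ofReal (wK m) * Y) := by rw [← sq]; refine e3.trans ((mul_le_mul_left e4 Y).trans (le_of_eq ?_)); ring
  by_cases hS0 : S = 0
  · rw [hS0]; exact zero_le
  exact (ENNReal.mul_le_mul_iff_right hS0 hSfin).1 e5

/-- the L² bound -/
lemma L2b (m : ℕ) {E : Set (ℝ × ℝ)} (hE : MeasurableSet E) (hE1 : E ⊆ 𝕀 ×ˢ 𝕀)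
    {s : ℝ × ℝ → ℂ} (hs : IntegrableOn s E) {r : ℝ} (h0 : 0 ≤ r) (h1 : r < 1) :
    ∫⁻ t in 𝕀, ‖∫ x in E, kz (m + 1) (circlePt r t) x * s x‖ₑ ^ 2 ≤
      ofReal (wK m) * ∫⁻ x in E, ofReal (1 - x.1) * ‖s x‖ₑ ^ 2 := by
  have hz : ∀ t, ‖circlePt r t‖ < 1 := fun t => by rw [circlePt_norm, abs_of_nonneg h0]; exact h1
  have e1 : ∀ t, ∫ x in E, kz (m + 1) (circlePt r t) x * s x = ∑' n, mo (m + 1) E s n * (r : ℂ) ^ n * Ec t ^ n := fun t => by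
    rw [← (mo_hasSum (m + 1) hE hE1 hs (hz t)).tsum_eq]
    congr 1; ext n; rw [circlePt_eq]; ring
  have hsum : Summable fun n => ‖mo (m + 1) E s n * (r : ℂ) ^ n‖ := by
    have := (mo_hasSum (m + 1) hE hE1 hs (z := (r : ℂ)) (by
      rw [Complex.norm_of_nonneg h0]; exact h1)).summable.norm
    exact this
  simp_rw [e1]
  rw [eparseval hsum, ENNReal.tsum_eq_iSup_nat]
  apply iSup_le
  intro N
  refine le_trans ?_ (mo_bessel m hE hE1 hs N)
  apply sum_le_sum
  intro n _
  gcongr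
  rw [enorm_mul]
  apply mul_le_of_le_one_right zero_le
  rw [← ofReal_norm, ofReal_le_one, norm_pow, Complex.norm_of_nonneg h0]
  exact pow_le_one₀ h0 h1.le

/-- box operator -/
def TI (l : ℕ) (I : Dy) (s : ℝ × ℝ → ℂ) (z : ℂ) : ℂ := ∫ x in I.Q, kz l z x * s x

/-- energy of a box -/
def bq (s : ℝ × ℝ → ℂ) (I : Dy) : ℝ≥0∞ := ∫⁻ x in I.Q, ‖s x‖ₑ ^ 2

lemma bq_ne_top {s : ℝ × ℝ → ℂ} (hs : MemLp s 2 volume) (I : Dy) : bq s I ≠ ∞ := by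
  have h := (hs.restrict I.Q).2
  rw [eLpNorm_lt_top_iff_lintegral_rpow_enorm_lt_top (by simp) (by simp)] at h
  unfold bq
  simpa using h.ne

lemma Q_fin (I : Dy) : volume I.Q ≠ ∞ := by rw [Dy.volQ]; exact ofReal_ne_top

lemma s_int {s : ℝ × ℝ → ℂ} (hs : MemLp s 2 volume) (I : Dy) : IntegrableOn s I.Q := by
  have : IsFiniteMeasure (volume.restrict I.Q) := ⟨by rw [Measure.restrict_apply_univ]; exact (Q_fin I).lt_top⟩
  exact (hs.restrict I.Q).integrable (by norm_num)

lemma sint_le {s : ℝ × ℝ → ℂ} (hs : MemLp s 2 volume) (I : Dy) {M : ℝ≥0∞} (hM : bq s I ≤ M) :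
    ∫⁻ x in I.Q, ‖s x‖ₑ ≤ ofReal I.len * M ^ (1 / 2 : ℝ) := by
  have h := lint_CS (volume.restrict I.Q) (u := fun _ => 1) aemeasurable_const (hs.restrict I.Q).1.enorm
  simp only [one_mul, one_pow, lintegral_const, Measure.restrict_apply_univ, Dy.volQ] at h
  have h2 : (∫⁻ x in I.Q, ‖s x‖ₑ) ^ 2 ≤ (ofReal I.len * M ^ (1 / 2 : ℝ)) ^ 2 := by
    refine h.trans ?_
    rw [mul_pow, ← ofReal_pow I.len_pos.le]
    gcongr
    · nlinarith [I.len_pos]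
    · rw [← rpow_natCast, ← rpow_mul]; simpa [bq] using hM
  exact (ENNReal.pow_le_pow_left_iff (by norm_num)).1 h2

/-- general bound from a kernel bound -/
lemma TI_le {s : ℝ × ℝ → ℂ} (hs : MemLp s 2 volume) (l : ℕ) (I : Dy) {M : ℝ≥0∞} (hM : bq s I ≤ M) {z : ℂ} {D : ℝ}
    (hD : ∀ x ∈ I.Q, ‖kz l z x‖ ≤ D) : ‖TI l I s z‖ₑ ≤ ofReal (D * I.len) * M ^ (1 / 2 : ℝ) := by
  have hD0 : 0 ≤ D := by
    have := hD (1 - I.len, I.lf) ⟨⟨le_refl _, by have := I.len_pos; simp only; linarith⟩, le_refl _, by have := I.len_pos; simp only; linarith⟩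
    exact (norm_nonneg _).trans this
  unfold TI
  refine (enorm_integral_le_lintegral_enorm _).trans ?_
  calc ∫⁻ x in I.Q, ‖kz l z x * s x‖ₑ ≤ ∫⁻ x in I.Q, ofReal D * ‖s x‖ₑ := by
        apply setLIntegral_mono' I.measQ
        intro x hx
        rw [enorm_mul]
        gcongr
        rw [← ofReal_norm]
        exact ofReal_le_ofReal (hD x hx)
    _ = ofReal D * ∫⁻ x in I.Q, ‖s x‖ₑ := lintegral_const_mul' _ _ ofReal_ne_top
    _ ≤ _ := by
        rw [ofReal_mul hD0, mul_assoc]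
        gcongr
        exact sint_le hs I hM

lemma kz_far (l : ℕ) {I : Dy} {x : ℝ × ℝ} (hx : x ∈ I.Q) {r θ d : ℝ} (h0 : 0 ≤ r) (hd : 0 < d) (h1 : d / 2 ≤ |θ - x.2|)
    (h2 : |θ - x.2| ≤ 3 / 4) : ‖kz l (circlePt r θ) x‖ ≤ (8 / d) ^ (l + 1) * I.len ^ l := by
  have hb := Dy.Q_bd hx
  have hden : d / 4 ≤ ‖1 - (x.1 : ℂ) * Ec (-x.2) * circlePt r θ‖ := by
    have := one_sub_low (x := x.1 * r) (mul_nonneg hb.1 h0) h2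
    rw [circlePt_eq]
    have e : (x.1 : ℂ) * Ec (-x.2) * (r * Ec θ) = ((x.1 * r : ℝ) : ℂ) * Ec (θ - x.2) := by
      rw [sub_eq_add_neg, Ec_add]; push_cast; ring
    rw [e]; linarith
  unfold kz
  rw [norm_mul, norm_pow, norm_inv, norm_real, norm_eq_abs]
  have h3 : 0 ≤ 1 - x.1 ^ 2 := by nlinarith
  have h4 : |2 * x.1 * (1 - x.1 ^ 2) ^ l| ≤ 2 ^ (l + 1) * I.len ^ l := by
    rw [abs_of_nonneg (by have := hb.1; positivity)]
    have h5 : (1 - x.1 ^ 2) ^ l ≤ (2 * I.len) ^ l := pow_le_pow_left₀ h3 (by nlinarith [hb.2.2.2.1]) l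
    rw [mul_pow] at h5
    rw [pow_succ (2:ℝ) l]
    have : 0 ≤ (1 - x.1 ^ 2) ^ l := by positivity
    have h6 := mul_le_mul_of_nonneg_right hb.2.1.le this
    generalize (1 - x.1 ^ 2) ^ l = Y at h5 h6 this ⊢
    generalize (2:ℝ) ^ l = U at h5 ⊢
    generalize I.len ^ l = V at h5 ⊢
    nlinarith
  have h5 : ‖1 - (x.1 : ℂ) * Ec (-x.2) * circlePt r θ‖⁻¹ ^ (l + 1) ≤ (4 / d) ^ (l + 1) := by
    apply pow_le_pow_left₀ (by positivity)
    rw [inv_le_comm₀ (by linarith [hden, hd] ) (by positivity), inv_div]; exact hden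
  refine (mul_le_mul h4 h5 (by positivity) (by have := I.len_pos; positivity)).trans (le_of_eq ?_)
  have : (8 / d) ^ (l + 1) = 2 ^ (l + 1) * (4 / d) ^ (l + 1) := by rw [← mul_pow]; congr 1; ring
  rw [this]; ring

lemma sub_lev {I J : Dy} (h : I.A ⊆ J.A) : J.1 ≤ I.1 := by
  have := measure_mono (μ := volume) h
  rw [I.volA, J.volA, ENNReal.inv_le_inv] at this
  by_contra hh
  push Not at hh
  have h2 : (2 : ℝ≥0∞) ^ I.1 < 2 ^ J.1 := by exact_mod_cast (pow_lt_pow_right₀ (by norm_num : (1:ℕ) < 2) hh)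
  exact absurd this (not_le.2 h2)

lemma geo_tail (l : ℕ) (hl : 1 ≤ l) (j : ℕ) : ∑' i, (if j ≤ i then (2⁻¹ : ℝ≥0∞) ^ (l * i) else 0) ≤ 2 * (2⁻¹ : ℝ≥0∞) ^ (l * j) := by
  set f : ℕ → ℝ≥0∞ := fun i => (if j ≤ i then (2⁻¹ : ℝ≥0∞) ^ (l * i) else 0) with hf
  have h := Summable.sum_add_tsum_nat_add' (f := f) (k := j) ENNReal.summable
  have h0 : ∑ i ∈ range j, f i = 0 := Finset.sum_eq_zero (fun i hi => if_neg (by simpa using hi))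
  rw [h0, zero_add] at h
  calc _ = ∑' n, f (n + j) := h.symm
    _ ≤ ∑' n : ℕ, (2⁻¹ : ℝ≥0∞) ^ n * (2⁻¹ : ℝ≥0∞) ^ (l * j) := by
        apply ENNReal.tsum_le_tsum; intro n
        simp only [hf]
        rw [if_pos (by omega), mul_add, pow_add]
        gcongr ?_ * _
        exact pow_le_pow_right_of_le_one' (ENNReal.inv_le_one.2 (by norm_num)) (Nat.le_mul_of_pos_left n hl)
    _ = _ := by rw [ENNReal.tsum_mul_right, tsum_geometric, one_sub_inv_two, inv_inv]

/-- ∑ |I|^{l+1} over subintervals -/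
lemma sum_len (l : ℕ) (hl : 1 ≤ l) (J : Dy) (S : Finset Dy) (hS : ∀ I ∈ S, I.A ⊆ J.A) :
    ∑ I ∈ S, ofReal (I.len ^ (l + 1)) ≤ ofReal (2 * J.len ^ (l + 1)) := by
  have hofl : ∀ I : Dy, ofReal (I.len ^ l) = (2⁻¹ : ℝ≥0∞) ^ (l * I.1) := fun I => by
    rw [mul_comm, pow_mul, ofReal_pow I.len_pos.le]
    congr 1
    rw [← Dy.volA', Dy.volA, ENNReal.inv_pow]
  calc ∑ I ∈ S, ofReal (I.len ^ (l + 1)) = ∑ I ∈ S, ∫⁻ θ, I.A.indicator (fun _ => ofReal (I.len ^ l)) θ := by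
        apply sum_congr rfl; intro I _
        rw [lintegral_indicator I.measA, setLIntegral_const, Dy.volA', pow_succ, ofReal_mul (by have := I.len_pos; positivity)]
    _ = ∫⁻ θ, ∑ I ∈ S, I.A.indicator (fun _ => ofReal (I.len ^ l)) θ := by
        rw [lintegral_finsetSum]; intro I _; exact measurable_const.indicator I.measA
    _ ≤ ∫⁻ θ, J.A.indicator (fun _ => 2 * ofReal (J.len ^ l)) θ := by
        apply lintegral_mono
        intro θ
        by_cases hθ : θ ∈ J.A
        · rw [indicator_of_mem hθ]
          simp only
          set F : Dy → ℝ≥0∞ := fun I => if J.1 ≤ I.1 then I.A.indicator (fun _ => ofReal (I.len ^ l)) θ else 0 with hF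
          calc _ = ∑ I ∈ S, F I := by apply sum_congr rfl; intro I hI; simp only [hF, if_pos (sub_lev (hS I hI))]
            _ ≤ ∑' I, F I := ENNReal.sum_le_tsum S
            _ = ∑' i, F (Dy.lv i θ) := Dy.tsum_lv (fun I h => by simp [hF, h])
            _ ≤ ∑' i, (if J.1 ≤ i then (2⁻¹ : ℝ≥0∞) ^ (l * i) else 0) := by
                apply ENNReal.tsum_le_tsum; intro i
                have e : (Dy.lv i θ).1 = i := Dy.lv_fst i θ
                simp only [hF]
                rw [hofl, e]
                split_ifs
                · exact Set.indicator_le_self' (fun _ _ => bot_le) _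
                · exact le_rfl
            _ ≤ _ := by rw [hofl]; exact geo_tail l hl J.1
        · rw [indicator_of_notMem hθ]
          refine (Finset.sum_eq_zero ?_).le
          intro I hI
          exact indicator_of_notMem (fun h => hθ (hS I hI h)) _
    _ = _ := by
        rw [lintegral_indicator J.measA, setLIntegral_const, Dy.volA', pow_succ, ← mul_assoc, ofReal_mul (by have := J.len_pos; positivity),
          ofReal_mul (by norm_num), ofReal_ofNat]

lemma circ_per (r : ℝ) : Function.Periodic (circlePt r) 1 := by intro t; rw [circlePt_eq, circlePt_eq, Ec_add, Ec_one, mul_one]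

lemma kz_int (l : ℕ) {s : ℝ × ℝ → ℂ} (hs : MemLp s 2 volume) (I : Dy) {z : ℂ} (hz : ‖z‖ < 1) :
    IntegrableOn (fun x => kz l z x * s x) I.Q := by
  have hc : ContinuousOn (kz l z) I.Q := (kz_contOn l hz).mono fun x hx => ⟨(Dy.Q_bd hx).1, (Dy.Q_bd hx).2.1.le⟩
  refine Integrable.bdd_mul (c := 2 ^ (l + 1) * 1 ^ l * (1 - ‖z‖)⁻¹ ^ (l + 1)) (s_int hs I) (hc.aestronglyMeasurable I.measQ) ?_
  refine (ae_restrict_iff' I.measQ).2 (ae_of_all _ fun x hx => ?_)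
  have hb := Dy.Q_bd hx
  have : 0 < 1 - ‖z‖ := by linarith
  refine (kz_norm_le l hz hb.1 hb.2.1.le).trans ?_
  gcongr
  · linarith [hb.2.1]
  · linarith [hb.1]

lemma TI_sum (l : ℕ) {s : ℝ × ℝ → ℂ} (hs : MemLp s 2 volume) (S : Finset Dy) {z : ℂ} (hz : ‖z‖ < 1) :
    ∑ I ∈ S, TI l I s z = ∫ x in ⋃ I ∈ S, I.Q, kz l z x * s x := by
  rw [integral_biUnion_finset _ (fun I _ => I.measQ) (fun I _ J _ h => Dy.Q_disj h) (fun I _ => kz_int l hs I hz)]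
  rfl

lemma TI_L2 (m : ℕ) {s : ℝ × ℝ → ℂ} (hs : MemLp s 2 volume) (S : Finset Dy) {r : ℝ} (h0 : 0 ≤ r) (h1 : r < 1) :
    ∫⁻ t in 𝕀, ‖∑ I ∈ S, TI (m + 1) I s (circlePt r t)‖ₑ ^ 2 ≤
      ofReal (wK m) * ∑ I ∈ S, ofReal I.len * bq s I := by
  have hz : ∀ t, ‖circlePt r t‖ < 1 := fun t => by rw [circlePt_norm, abs_of_nonneg h0]; exact h1
  simp_rw [fun t => TI_sum (m + 1) hs S (hz t)]
  have hE : MeasurableSet (⋃ I ∈ S, I.Q) := S.measurableSet_biUnion fun I _ => I.measQ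
  have hE1 : (⋃ I ∈ S, I.Q) ⊆ 𝕀 ×ˢ 𝕀 := fun x hx => by
    simp only [mem_iUnion] at hx
    obtain ⟨I, _, hx⟩ := hx
    have hb := Dy.Q_bd hx
    exact ⟨⟨hb.1, hb.2.1⟩, hb.2.2.2.2⟩
  refine (L2b m hE hE1 ((integrableOn_finset_iUnion (s := S)).2 fun I _ => s_int hs I) h0 h1).trans ?_
  gcongr
  rw [lintegral_biUnion_finset (fun I _ J _ h => Dy.Q_disj h) (fun I _ => I.measQ)]
  gcongr with I hI
  unfold bq
  rw [← lintegral_const_mul' _ _ ofReal_ne_top]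
  apply setLIntegral_mono' I.measQ
  intro x hx
  gcongr
  exact (Dy.Q_bd hx).2.2.2.1

lemma rp_split (hp : 0 < p) (hp1 : p ≤ 1) {M : ℝ≥0∞} (hM0 : M ≠ 0) (hM : M ≠ ∞) (u : ℝ≥0∞) :
    u ^ p ≤ M ^ (p / 2 - 1) * u ^ 2 + M ^ (p / 2) := by
  have e : M ^ (p / 2) = (M ^ (1 / 2 : ℝ)) ^ p := by rw [← rpow_mul]; congr 1; ring
  have e2 : M ^ (p / 2 - 1) = (M ^ (1 / 2 : ℝ)) ^ (p - 2) := by rw [← rpow_mul]; congr 1; ring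
  rw [e, e2]
  have hk0 : M ^ (1 / 2 : ℝ) ≠ 0 := by simp [hM0]
  have hk : M ^ (1 / 2 : ℝ) ≠ ∞ := by simp [hM]
  generalize M ^ (1 / 2 : ℝ) = k at hk0 hk
  rcases le_total u k with h | h
  · exact (rpow_le_rpow h hp.le).trans le_add_self
  · refine le_trans ?_ le_self_add
    by_cases hu : u = ∞
    · rw [hu]
      have : k ^ (p - 2) ≠ 0 := by simp [hk0, hk]
      rw [ENNReal.top_pow (by norm_num), mul_top this]; exact le_top
    have hu0 : u ≠ 0 := fun hh => hk0 (by simpa [hh] using h)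
    have : u ^ p = u ^ (p - 2) * u ^ 2 := by rw [← rpow_natCast u 2, ← rpow_add _ _ hu0 hu]; congr 1; simp
    rw [this]
    gcongr ?_ * _
    rw [show p - 2 = -(2 - p) by ring, rpow_neg, rpow_neg, ENNReal.inv_le_inv]
    exact rpow_le_rpow h (by linarith)

lemma TI_far (l : ℕ) (hl : 1 ≤ l) (hp : 0 < p) (hL : 2 ≤ (l + 1) * p) {s : ℝ × ℝ → ℂ} (hs : MemLp s 2 volume)
    {J : Dy} {S : Finset Dy} (hS : ∀ I ∈ S, I.A ⊆ J.A) {M : ℝ≥0∞} (hM : ∀ I ∈ S, bq s I ≤ M) {r θ : ℝ} (h0 : 0 ≤ r)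
    (h1 : 2 * J.len ≤ |θ - J.lf|) (h2 : |θ - J.lf| ≤ 1 / 2) :
    ‖∑ I ∈ S, TI l I s (circlePt r θ)‖ₑ ^ p ≤
      ofReal ((2 * 8 ^ (l + 1)) ^ p * (5 / 4) * J.len) * pk J.len (J.lf - θ) * M ^ (p / 2) := by
  set d := |θ - J.lf| with hd
  have hJ := J.len_pos
  have hd0 : 0 < d := by linarith
  have e1 : ‖∑ I ∈ S, TI l I s (circlePt r θ)‖ₑ ≤ ofReal (2 * 8 ^ (l + 1) * (J.len / d) ^ (l + 1)) * M ^ (1 / 2 : ℝ) := by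
    calc _ ≤ ∑ I ∈ S, ‖TI l I s (circlePt r θ)‖ₑ := enorm_sum_le _ _
      _ ≤ ∑ I ∈ S, ofReal ((8 / d) ^ (l + 1)) * ofReal (I.len ^ (l + 1)) * M ^ (1 / 2 : ℝ) := by
          apply sum_le_sum
          intro I hI
          refine (TI_le hs l I (hM I hI) (D := (8 / d) ^ (l + 1) * I.len ^ l) ?_).trans (le_of_eq ?_)
          · intro x hx
            have hx2 := hS I hI hx.2
            have a1 : |x.2 - J.lf| ≤ J.len := by rw [abs_of_nonneg (by linarith [hx2.1])]; linarith [hx2.2]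
            have a2 : d ≤ |θ - x.2| + |x.2 - J.lf| := abs_sub_le _ _ _
            have a3 : |θ - x.2| ≤ d + |x.2 - J.lf| := by rw [abs_sub_comm x.2]; exact abs_sub_le _ _ _
            exact kz_far l hx h0 hd0 (by linarith) (by linarith)
          · rw [← ofReal_mul (by positivity), mul_assoc ((8 / d) ^ (l + 1)), pow_succ I.len]
      _ = ofReal ((8 / d) ^ (l + 1)) * (∑ I ∈ S, ofReal (I.len ^ (l + 1))) * M ^ (1 / 2 : ℝ) := by rw [mul_sum, sum_mul]
      _ ≤ ofReal ((8 / d) ^ (l + 1)) * ofReal (2 * J.len ^ (l + 1)) * M ^ (1 / 2 : ℝ) := by gcongr; exact sum_len l hl J S hS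
      _ = _ := by
          rw [← ofReal_mul (by positivity)]
          congr 2
          rw [div_pow, div_pow]; ring
  calc _ ≤ (ofReal (2 * 8 ^ (l + 1) * (J.len / d) ^ (l + 1)) * M ^ (1 / 2 : ℝ)) ^ p := rpow_le_rpow e1 hp.le
    _ = ofReal ((2 * 8 ^ (l + 1)) ^ p * (J.len / d) ^ ((l + 1) * p)) * M ^ (p / 2) := by
        rw [mul_rpow_of_nonneg _ _ hp.le, ← rpow_mul, ofReal_rpow_of_nonneg (by positivity) hp.le,
          Real.mul_rpow (by positivity) (by positivity), ← Real.rpow_natCast (J.len / d) (l + 1), ← Real.rpow_mul (by positivity)]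
        congr 2
        · push_cast; rfl
        · ring
    _ ≤ _ := by
        gcongr
        unfold pk
        rw [← ofReal_mul (by positivity)]
        apply ofReal_le_ofReal
        have b1 : J.len / d ≤ 1 := by rw [div_le_one hd0]; linarith
        have b2 : (J.len / d) ^ ((l + 1) * p) ≤ (J.len / d) ^ (2 : ℝ) :=
          Real.rpow_le_rpow_of_exponent_ge (by positivity) b1 hL
        have b3 : (J.len / d) ^ (2 : ℝ) ≤ 5 / 4 * J.len * (J.len / (J.len ^ 2 + (J.lf - θ) ^ 2)) := by
          rw [Real.rpow_two, ← neg_sub, neg_sq, ← sq_abs (θ - J.lf), ← hd, div_pow, ← mul_div_assoc, div_le_div_iff₀ (by positivity) (by positivity)]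
          nlinarith [mul_pos hJ hJ, mul_pos (mul_pos hJ hJ) (mul_pos hd0 hd0), mul_self_le_mul_self (by positivity) h1]
        calc _ ≤ (2 * 8 ^ (l + 1)) ^ p * (5 / 4 * J.len * (J.len / (J.len ^ 2 + (J.lf - θ) ^ 2))) := by gcongr; exact b2.trans b3
          _ = _ := by ring

lemma atom_bd (m : ℕ) (hp : 0 < p) (hp1 : p ≤ 1) (hL : 2 ≤ ((m + 1 : ℕ) + 1) * p) : ∃ C : ℝ≥0∞, C ≠ ∞ ∧
    ∀ (s : ℝ × ℝ → ℂ), MemLp s 2 volume → ∀ (J : Dy) (S : Finset Dy), (∀ I ∈ S, I.A ⊆ J.A) → ∀ (M : ℝ≥0∞), M ≠ 0 → M ≠ ∞ →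
    (∀ I ∈ S, bq s I ≤ M) → (∑ I ∈ S, ofReal I.len * bq s I ≤ M * ofReal J.len) → ∀ r : ℝ, 0 ≤ r → r < 1 →
    ∫⁻ θ in 𝕀, ‖∑ I ∈ S, TI (m + 1) I s (circlePt r θ)‖ₑ ^ p ≤ C * (M ^ (p / 2) * ofReal J.len) := by
  refine ⟨ofReal (wK m) + 4 + ofReal ((2 * 8 ^ (m + 1 + 1)) ^ p * (5 / 4)) * ofReal Real.pi, by finiteness, ?_⟩
  intro s hs J S hS M hM0 hM1 hM hsum r h0 h1
  have hJ := J.len_pos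
  set u : ℝ → ℝ≥0∞ := fun θ => ‖∑ I ∈ S, TI (m + 1) I s (circlePt r θ)‖ₑ with hu
  have hper : Function.Periodic u 1 := by intro t; simp only [hu, circ_per r t]
  set a := J.lf - 1 / 2 with ha
  have w1 : ∫⁻ θ in 𝕀, u θ ^ p = ∫⁻ θ in Ico a (a + 1), u θ ^ p := by
    have := per_lint (f := fun θ => u θ ^ p) (fun t => by simp only [hper t]) 0 a
    rwa [zero_add] at this
  have w2 : ∫⁻ θ in Ico a (a + 1), u θ ^ 2 ≤ ofReal (wK m) * (M * ofReal J.len) := by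
    have := per_lint (f := fun θ => u θ ^ 2) (fun t => by simp only [hper t]) 0 a
    rw [zero_add] at this
    rw [← this]
    exact (TI_L2 m hs S h0 h1).trans (by gcongr)
  set N : Set ℝ := Set.Ioo (J.lf - 2 * J.len) (J.lf + 2 * J.len) with hN
  set K := (2 * 8 ^ (m + 1 + 1) : ℝ) ^ p * (5 / 4) with hK
  have pt : ∀ θ ∈ Ico a (a + 1), u θ ^ p ≤ M ^ (p / 2 - 1) * u θ ^ 2 +
      (N.indicator (fun _ => M ^ (p / 2)) θ + ofReal (K * J.len) * M ^ (p / 2) * pk J.len (J.lf - θ)) := fun θ hθ => by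
    by_cases hn : θ ∈ N
    · rw [indicator_of_mem hn, ← add_assoc]
      exact (rp_split hp hp1 hM0 hM1 (u θ)).trans le_self_add
    · have a1 : 2 * J.len ≤ |θ - J.lf| := by
        by_contra hh
        push Not at hh
        rw [abs_lt] at hh
        exact hn ⟨by linarith [hh.1], by linarith [hh.2]⟩
      have a2 : |θ - J.lf| ≤ 1 / 2 := abs_le.2 ⟨by linarith [hθ.1], by linarith [hθ.2]⟩
      have := TI_far (m + 1) (by omega) hp hL hs hS hM h0 a1 a2
      refine this.trans (le_trans (le_of_eq ?_) (le_add_left le_add_self))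
      ring
  have hpm : Measurable fun θ => pk J.len (J.lf - θ) := (pk_meas _).comp (by fun_prop)
  have hNm : MeasurableSet N := measurableSet_Ioo
  have hNi : Measurable (N.indicator fun _ => M ^ (p / 2)) := measurable_const.indicator hNm
  rw [w1]
  calc _ ≤ ∫⁻ θ in Ico a (a + 1), (M ^ (p / 2 - 1) * u θ ^ 2 +
      (N.indicator (fun _ => M ^ (p / 2)) θ + ofReal (K * J.len) * M ^ (p / 2) * pk J.len (J.lf - θ))) :=
        setLIntegral_mono' measurableSet_Ico pt
    _ = M ^ (p / 2 - 1) * (∫⁻ θ in Ico a (a + 1), u θ ^ 2) + ((∫⁻ θ in Ico a (a + 1), N.indicator (fun _ => M ^ (p / 2)) θ) +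
        ∫⁻ θ in Ico a (a + 1), ofReal (K * J.len) * M ^ (p / 2) * pk J.len (J.lf - θ)) := by
        rw [lintegral_add_right _ (by fun_prop), lintegral_add_right _ (by fun_prop), lintegral_const_mul']
        simp [hM0, hM1]
    _ ≤ M ^ (p / 2 - 1) * (ofReal (wK m) * (M * ofReal J.len)) + (M ^ (p / 2) * ofReal (4 * J.len) +
        ofReal (K * J.len) * M ^ (p / 2) * ofReal Real.pi) := by
        gcongr
        · refine (setLIntegral_le_lintegral _ _).trans ?_
          rw [lintegral_indicator hNm, setLIntegral_const, hN, Real.volume_Ioo]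
          apply le_of_eq; congr 2; ring
        · refine (setLIntegral_le_lintegral _ _).trans ?_
          rw [lintegral_const_mul _ (by fun_prop), pk_int hJ]
    _ = _ := by
        have e : M ^ (p / 2 - 1) * M = M ^ (p / 2) := by
          nth_rewrite 2 [← rpow_one M]
          rw [← rpow_add _ _ hM0 hM1]; congr 1; ring
        rw [← e, ofReal_mul (by positivity), ofReal_mul (by positivity), ofReal_ofNat]
        ring

lemma Dy.fl {I K : Dy} (h : I.1 ≤ K.1) {t t' : ℝ} (ht : t ∈ K.A) (ht' : t' ∈ K.A) (hI : t ∈ I.A) : t' ∈ I.A := by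
  rw [Dy.mem_A_iff] at *
  refine ⟨ht'.1, ?_⟩
  rw [← hI.2]
  have e : ∀ x : ℝ, ⌊2 ^ I.1 * x⌋₊ = ⌊2 ^ K.1 * x⌋₊ / 2 ^ (K.1 - I.1) := fun x => by
    rw [← Nat.floor_div_natCast]
    congr 1
    push_cast
    rw [_root_.eq_div_iff (by positivity), mul_right_comm, ← pow_add, Nat.add_sub_cancel' h]
  rw [e, e, ht.2, ht'.2]

lemma Dy.lf_mem (I : Dy) : I.lf ∈ I.A := ⟨le_refl _, by have := I.len_pos; linarith⟩

/-- truncated square function -/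
def gl (S : Finset Dy) (b : Dy → ℝ≥0∞) (i : ℕ) (θ : ℝ) : ℝ≥0∞ :=
  ∑ I ∈ S, if I.1 ≤ i then I.A.indicator (fun _ => b I) θ else 0
/-- full square function -/
def gf (S : Finset Dy) (b : Dy → ℝ≥0∞) (θ : ℝ) : ℝ≥0∞ := ∑ I ∈ S, I.A.indicator (fun _ => b I) θ

lemma gl_le_gf (S : Finset Dy) (b : Dy → ℝ≥0∞) (i : ℕ) (θ : ℝ) : gl S b i θ ≤ gf S b θ := by
  unfold gl gf
  apply sum_le_sum; intro I _
  split_ifs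
  · exact le_rfl
  · exact bot_le

lemma gl_congr (S : Finset Dy) (b : Dy → ℝ≥0∞) {i : ℕ} {K : Dy} (h : i ≤ K.1) {t t' : ℝ} (ht : t ∈ K.A) (ht' : t' ∈ K.A) :
    gl S b i t = gl S b i t' := by
  unfold gl
  apply sum_congr rfl; intro I _
  split_ifs with hi
  · by_cases h1 : t ∈ I.A
    · rw [indicator_of_mem h1, indicator_of_mem (Dy.fl (hi.trans h) ht ht' h1)]
    · rw [indicator_of_notMem h1, indicator_of_notMem (fun h2 => h1 (Dy.fl (hi.trans h) ht' ht h2))]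
  · rfl

/-- stopping level -/
def stp (S : Finset Dy) (b : Dy → ℝ≥0∞) (k : ℤ) (θ : ℝ) : ℕ := sInf {i | (4 : ℝ≥0∞) ^ k ≤ gl S b i θ}

lemma stp_congr (S : Finset Dy) (b : Dy → ℝ≥0∞) {k : ℤ} {K : Dy} {t t' : ℝ} (ht : t ∈ K.A) (ht' : t' ∈ K.A)
    (h : stp S b k t = K.1) (hk : (4 : ℝ≥0∞) ^ k ≤ gl S b K.1 t) : stp S b k t' = K.1 := by
  apply le_antisymm
  · apply Nat.sInf_le
    rw [Set.mem_setOf_eq, ← gl_congr S b le_rfl ht ht']; exact hk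
  · by_contra hh
    push Not at hh
    have h1 : (4 : ℝ≥0∞) ^ k ≤ gl S b (stp S b k t') t' :=
      Nat.sInf_mem (s := {i | (4 : ℝ≥0∞) ^ k ≤ gl S b i t'}) ⟨K.1, by rw [Set.mem_setOf_eq, ← gl_congr S b le_rfl ht ht']; exact hk⟩
    rw [← gl_congr S b hh.le ht ht'] at h1
    have h2 : stp S b k t ≤ stp S b k t' := Nat.sInf_le h1
    omega

lemma geo_k (hp : 0 < p) : ∃ C : ℝ≥0∞, C ≠ ∞ ∧ ∀ (K : Finset ℤ) (g : ℝ≥0∞), (∀ k ∈ K, (4 : ℝ≥0∞) ^ k ≤ g) →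
    ∑ k ∈ K, ((4 : ℝ≥0∞) ^ k) ^ (p / 2) ≤ C * g ^ (p / 2) := by
  refine ⟨∑' n : ℕ, (2 : ℝ≥0∞) ^ (-(n * p)), tsum_two_rpow hp, ?_⟩
  intro K g hK
  rcases K.eq_empty_or_nonempty with rfl | hne
  · simp
  set k0 := K.max' hne with hk0
  have hle : ∀ k ∈ K, k ≤ k0 := fun k hk => K.le_max' k hk
  have e : ∀ k ∈ K, ((4 : ℝ≥0∞) ^ k) ^ (p / 2) = (2 : ℝ≥0∞) ^ (-(((k0 - k).toNat : ℕ) * p)) * ((4 : ℝ≥0∞) ^ k0) ^ (p / 2) := fun k hk => by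
    have hc : (((k0 - k).toNat : ℕ) : ℝ) = k0 - k := by
      have := Int.toNat_of_nonneg (sub_nonneg.2 (hle k hk))
      exact_mod_cast congrArg (Int.cast : ℤ → ℝ) this
    have e4 : ∀ j : ℤ, ((4 : ℝ≥0∞) ^ j) ^ (p / 2) = (2 : ℝ≥0∞) ^ (j * p) := fun j => by
      rw [← rpow_intCast, ← rpow_mul, show (4 : ℝ≥0∞) = 2 ^ (2 : ℝ) by norm_num, ← rpow_mul]
      congr 1; ring
    rw [e4, e4, hc, ← rpow_add _ _ (by simp) (by simp)]
    congr 1; ring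
  rw [sum_congr rfl e, ← sum_mul]
  gcongr
  · have hinj : InjOn (fun k : ℤ => (k0 - k).toNat) K := fun a ha b hb hab => by
      have := hle a ha; have := hle b hb
      simp only at hab
      omega
    rw [← sum_image (f := fun n : ℕ => (2 : ℝ≥0∞) ^ (-(n * p))) hinj]
    exact ENNReal.sum_le_tsum _
  · exact hK k0 (K.max'_mem hne)

lemma rpow_sum_le' {ι : Type*} (S : Finset ι) (f : ι → ℝ≥0∞) (hp : 0 < p) (hp1 : p ≤ 1) :
    (∑ i ∈ S, f i) ^ p ≤ ∑ i ∈ S, f i ^ p := by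
  classical
  induction S using Finset.induction_on with
  | empty => simp [hp]
  | insert a S ha ih =>
    rw [sum_insert ha, sum_insert ha]
    exact (rpow_add_le_add_rpow _ _ hp.le hp1).trans (by gcongr)

lemma Q_sub (I : Dy) : I.Q ⊆ 𝕀 ×ˢ 𝕀 := fun _ hx =>
  have hb := Dy.Q_bd hx
  ⟨⟨hb.1, hb.2.1⟩, hb.2.2.2.2⟩

lemma TI_cont (l : ℕ) {s : ℝ × ℝ → ℂ} (hs : MemLp s 2 volume) (I : Dy) {r : ℝ} (h0 : 0 ≤ r) (h1 : r < 1) :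
    Continuous fun t => TI l I s (circlePt r t) := by
  have hz : ∀ t, ‖circlePt r t‖ < 1 := fun t => by rw [circlePt_norm, abs_of_nonneg h0]; exact h1
  have e1 : (fun t => TI l I s (circlePt r t)) = fun t => ∑' n, mo l I.Q s n * (r : ℂ) ^ n * Ec t ^ n := by
    ext t
    unfold TI
    rw [← (mo_hasSum l I.measQ (Q_sub I) (s_int hs I) (hz t)).tsum_eq]
    congr 1; ext n; rw [circlePt_eq]; ring
  rw [e1]
  apply ser_cont
  exact (mo_hasSum l I.measQ (Q_sub I) (s_int hs I) (z := (r : ℂ)) (by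
      rw [Complex.norm_of_nonneg h0]; exact h1)).summable.norm

lemma TI_zero (l : ℕ) {s : ℝ × ℝ → ℂ} (hs : MemLp s 2 volume) (I : Dy) (h : bq s I = 0) {z : ℂ} (hz : ‖z‖ < 1) : TI l I s z = 0 := by
  have := TI_le hs l I h.le (z := z) (D := 2 ^ (l + 1) * 1 ^ l * (1 - ‖z‖)⁻¹ ^ (l + 1)) (fun x hx => by
    have hb := Dy.Q_bd hx
    have : 0 < 1 - ‖z‖ := by linarith
    refine (kz_norm_le l hz hb.1 hb.2.1.le).trans ?_
    gcongr
    · linarith [hb.2.1]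
    · linarith [hb.1])
  simpa using this

lemma E2_sc (m : ℕ) (hp : 0 < p) (hp1 : p ≤ 1) (hL : 2 ≤ ((m + 1 : ℕ) + 1) * p) : ∃ C : ℝ≥0∞, C ≠ ∞ ∧
    ∀ (s : ℝ × ℝ → ℂ), MemLp s 2 volume → ∀ (S : Finset Dy), ∀ r : ℝ, 0 ≤ r → r < 1 →
    ∫⁻ θ in 𝕀, ‖∑ I ∈ S, TI (m + 1) I s (circlePt r θ)‖ₑ ^ p ≤ C * ∫⁻ θ, gf S (bq s) θ ^ (p / 2) := by
  classical
  obtain ⟨C, hC, hat⟩ := atom_bd m hp hp1 hL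
  obtain ⟨D, hD, hgeo⟩ := geo_k hp
  refine ⟨C * 4 ^ (p / 2) * D, by finiteness, ?_⟩
  intro s hs S0 r h0 h1
  set S := S0.filter fun I => bq s I ≠ 0 with hSdef
  set b := bq s with hb
  have hz : ∀ t, ‖circlePt r t‖ < 1 := fun t => by rw [circlePt_norm, abs_of_nonneg h0]; exact h1
  have hSe : ∀ θ, ∑ I ∈ S0, TI (m + 1) I s (circlePt r θ) = ∑ I ∈ S, TI (m + 1) I s (circlePt r θ) := fun θ => by
    rw [hSdef, Finset.sum_filter_of_ne]
    intro I _ h hh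
    exact h (TI_zero _ hs I hh (hz θ))
  have hgS : ∀ θ, gf S b θ ≤ gf S0 b θ := fun θ => Finset.sum_le_sum_of_subset (filter_subset _ _)
  have hGpos : ∀ I ∈ S, b I ≤ gl S b I.1 I.lf := fun I hI => by
    have := Finset.single_le_sum (f := fun K : Dy => if K.1 ≤ I.1 then K.A.indicator (fun _ => b K) I.lf else 0) (fun _ _ => bot_le) hI
    simpa [I.lf_mem, gl] using this
  have hGfin : ∀ i θ, gl S b i θ ≠ ∞ := fun i θ => by
    unfold gl
    refine sum_ne_top.2 fun I _ => ?_
    split_ifs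
    · unfold Set.indicator; split_ifs
      · exact bq_ne_top hs I
      · simp
    · simp
  have hex : ∀ I, ∃ k : ℤ, I ∈ S → (4 : ℝ≥0∞) ^ k ≤ gl S b I.1 I.lf ∧ gl S b I.1 I.lf < 4 ^ (k + 1) := fun I => by
    by_cases hI : I ∈ S
    · obtain ⟨k, hk⟩ := ENNReal.exists_mem_Ico_zpow (x := gl S b I.1 I.lf) (y := 4)
        (fun h => (mem_filter.1 hI).2 (by simpa [h] using hGpos I hI)) (hGfin _ _) (by norm_num) (by simp)
      exact ⟨k, fun _ => hk⟩
    · exact ⟨0, fun h => absurd h hI⟩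
  choose k hk using hex
  set J : Dy → Dy := fun I => Dy.lv (stp S b (k I) I.lf) I.lf with hJ
  have hI01 : ∀ I : Dy, I.lf ∈ Ico (0:ℝ) 1 := fun I => I.A_sub I.lf_mem
  have hJ1 : ∀ I, (J I).1 = stp S b (k I) I.lf := fun I => Dy.lv_fst _ _
  have hJm : ∀ I, I.lf ∈ (J I).A := fun I => Dy.mem_lv (hI01 I) _
  have hJle : ∀ I ∈ S, (J I).1 ≤ I.1 := fun I hI => by rw [hJ1]; exact Nat.sInf_le (hk I hI).1
  have hJA : ∀ I ∈ S, I.A ⊆ (J I).A := fun I hI t ht => Dy.fl (hJle I hI) I.lf_mem ht (hJm I)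
  have hJG : ∀ I ∈ S, (4 : ℝ≥0∞) ^ (k I) ≤ gl S b (J I).1 I.lf := fun I hI => by
    rw [hJ1]; exact Nat.sInf_mem (s := {i | (4 : ℝ≥0∞) ^ (k I) ≤ gl S b i I.lf}) ⟨I.1, (hk I hI).1⟩
  set key : Dy → ℤ × Dy := fun I => (k I, J I) with hkey
  set 𝓐 := S.image key with h𝓐
  have hfib : ∀ θ, ∑ I ∈ S, TI (m + 1) I s (circlePt r θ) = ∑ α ∈ 𝓐, ∑ I ∈ S with key I = α, TI (m + 1) I s (circlePt r θ) := fun θ =>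
    (sum_fiberwise_of_maps_to (fun I hI => mem_image_of_mem key hI) _).symm
  have hatom : ∀ α ∈ 𝓐, ∫⁻ θ in 𝕀, ‖∑ I ∈ S with key I = α, TI (m + 1) I s (circlePt r θ)‖ₑ ^ p ≤
      C * (((4 : ℝ≥0∞) ^ (α.1 + 1)) ^ (p / 2) * ofReal α.2.len) := by
    rintro ⟨k', J'⟩ _
    have hmem : ∀ I ∈ S.filter (fun I => key I = (k', J')), I ∈ S ∧ k I = k' ∧ J I = J' := fun I hI => by
      rw [mem_filter, hkey, Prod.mk.injEq] at hI
      exact hI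
    apply hat s hs J' _ _ _ _ _ _ _ r h0 h1
    · intro I hI
      obtain ⟨a1, -, a3⟩ := hmem I hI
      rw [← a3]; exact hJA I a1
    · exact (ENNReal.zpow_pos (by norm_num) (by simp) _).ne'
    · exact zpow_ne_top (by norm_num) (by simp) _
    · intro I hI
      obtain ⟨a1, a2, -⟩ := hmem I hI
      rw [← a2]
      exact (hGpos I a1).trans (hk I a1).2.le
    · calc ∑ I ∈ S with key I = (k', J'), ofReal I.len * bq s I
          = ∑ I ∈ S with key I = (k', J'), ∫⁻ θ, I.A.indicator (fun _ => b I) θ := by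
            apply sum_congr rfl; intro I _
            rw [lintegral_indicator I.measA, setLIntegral_const, Dy.volA', mul_comm]
        _ = ∫⁻ θ, ∑ I ∈ S with key I = (k', J'), I.A.indicator (fun _ => b I) θ := by
            rw [lintegral_finsetSum]; intro I _; exact measurable_const.indicator I.measA
        _ ≤ ∫⁻ θ, J'.A.indicator (fun _ => (4 : ℝ≥0∞) ^ (k' + 1)) θ := by
            apply lintegral_mono; intro θ
            simp only
            set R := (S.filter (fun I => key I = (k', J'))).filter (fun I => θ ∈ I.A) with hR
            have eR : ∑ I ∈ S with key I = (k', J'), I.A.indicator (fun _ => b I) θ = ∑ I ∈ R, b I := by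
              rw [hR, sum_filter (s := S.filter _)]
              apply sum_congr rfl; intro I _; simp [Set.indicator]
            rw [eR]
            rcases R.eq_empty_or_nonempty with h | h
            · simp [h]
            obtain ⟨I, hI, hmax⟩ := R.exists_max_image (fun I => I.1) h
            rw [hR, mem_filter] at hI
            obtain ⟨a1, a2, a3⟩ := hmem I hI.1
            have hθJ : θ ∈ J'.A := by rw [← a3]; exact hJA I a1 hI.2
            rw [indicator_of_mem hθJ]
            have : ∑ K ∈ R, b K ≤ gl S b I.1 θ := by
              unfold gl
              calc _ = ∑ K ∈ R, (if K.1 ≤ I.1 then K.A.indicator (fun _ => b K) θ else 0) := by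
                    apply sum_congr rfl; intro K hK
                    rw [if_pos (hmax K hK), indicator_of_mem (mem_filter.1 hK).2]
                _ ≤ _ := Finset.sum_le_sum_of_subset ((filter_subset _ _).trans (filter_subset _ _))
            refine this.trans ?_
            rw [gl_congr S b le_rfl hI.2 I.lf_mem, ← a2]
            exact (hk I a1).2.le
        _ = _ := by rw [lintegral_indicator J'.measA, setLIntegral_const, Dy.volA']
  have hpt : ∀ θ, ∑ α ∈ 𝓐, α.2.A.indicator (fun _ => ((4 : ℝ≥0∞) ^ α.1) ^ (p / 2)) θ ≤ D * gf S0 b θ ^ (p / 2) := fun θ => by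
    set R := 𝓐.filter (fun α => θ ∈ α.2.A) with hR
    have eR : ∑ α ∈ 𝓐, α.2.A.indicator (fun _ => ((4 : ℝ≥0∞) ^ α.1) ^ (p / 2)) θ = ∑ α ∈ R, ((4 : ℝ≥0∞) ^ α.1) ^ (p / 2) := by
      rw [hR, sum_filter]
      apply sum_congr rfl; intro I _; simp [Set.indicator]
    have hRp : ∀ α ∈ R, α.2 = Dy.lv (stp S b α.1 θ) θ ∧ (4 : ℝ≥0∞) ^ α.1 ≤ gf S0 b θ := fun α hα => by
      rw [hR, mem_filter, h𝓐, Finset.mem_image] at hα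
      obtain ⟨⟨I, hI, rfl⟩, hθ⟩ := hα
      simp only [hkey] at hθ ⊢
      have hst := stp_congr S b (hJm I) hθ (hJ1 I).symm (hJG I hI)
      refine ⟨?_, ?_⟩
      · rw [hst]; exact Dy.eq_lv hθ
      · refine (hJG I hI).trans ?_
        rw [gl_congr S b le_rfl (hJm I) hθ]
        exact (gl_le_gf _ _ _ _).trans (hgS θ)
    have hinj : InjOn (Prod.fst : ℤ × Dy → ℤ) R := fun α hα β hβ h => by
      have a := (hRp α hα).1
      have b' := (hRp β hβ).1
      rw [← h] at b'
      exact Prod.ext h (a.trans b'.symm)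
    rw [eR, ← sum_image (f := fun j : ℤ => ((4 : ℝ≥0∞) ^ j) ^ (p / 2)) hinj]
    apply hgeo
    intro j hj
    obtain ⟨α, hα, rfl⟩ := Finset.mem_image.1 hj
    exact (hRp α hα).2
  have hmeas : ∀ α, Measurable fun θ => ‖∑ I ∈ S with key I = α, TI (m + 1) I s (circlePt r θ)‖ₑ ^ p := fun α =>
    ((continuous_finset_sum _ fun I _ => TI_cont (m + 1) hs I h0 h1).measurable.enorm).pow_const p
  calc _ = ∫⁻ θ in 𝕀, ‖∑ α ∈ 𝓐, ∑ I ∈ S with key I = α, TI (m + 1) I s (circlePt r θ)‖ₑ ^ p := by simp_rw [hSe, hfib]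
    _ ≤ ∫⁻ θ in 𝕀, ∑ α ∈ 𝓐, ‖∑ I ∈ S with key I = α, TI (m + 1) I s (circlePt r θ)‖ₑ ^ p := by
        apply lintegral_mono; intro θ
        exact (rpow_le_rpow (enorm_sum_le _ _) hp.le).trans (rpow_sum_le' _ _ hp hp1)
    _ = ∑ α ∈ 𝓐, ∫⁻ θ in 𝕀, ‖∑ I ∈ S with key I = α, TI (m + 1) I s (circlePt r θ)‖ₑ ^ p :=
        lintegral_finsetSum _ (fun α _ => hmeas α)
    _ ≤ ∑ α ∈ 𝓐, C * (((4 : ℝ≥0∞) ^ (α.1 + 1)) ^ (p / 2) * ofReal α.2.len) := sum_le_sum hatom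
    _ = C * 4 ^ (p / 2) * ∑ α ∈ 𝓐, ∫⁻ θ, α.2.A.indicator (fun _ => ((4 : ℝ≥0∞) ^ α.1) ^ (p / 2)) θ := by
        rw [mul_sum]
        apply sum_congr rfl; intro α _
        rw [lintegral_indicator α.2.measA, setLIntegral_const, Dy.volA', ENNReal.zpow_add (by norm_num) (by simp), zpow_one,
          mul_rpow_of_nonneg _ _ (by positivity)]
        ring
    _ = C * 4 ^ (p / 2) * ∫⁻ θ, ∑ α ∈ 𝓐, α.2.A.indicator (fun _ => ((4 : ℝ≥0∞) ^ α.1) ^ (p / 2)) θ := by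
        rw [lintegral_finsetSum]; intro α _; exact measurable_const.indicator α.2.measA
    _ ≤ C * 4 ^ (p / 2) * ∫⁻ θ, D * gf S0 b θ ^ (p / 2) := by gcongr with θ; exact hpt θ
    _ = _ := by rw [lintegral_const_mul' _ _ hD]; ring

lemma TI_lin (l : ℕ) {ι : Type*} (N : Finset ι) (c : ι → ℂ) (s : ι → ℝ × ℝ → ℂ) (hs : ∀ n ∈ N, MemLp (s n) 2 volume) (I : Dy)
    {z : ℂ} (hz : ‖z‖ < 1) : TI l I (fun x => ∑ n ∈ N, c n * s n x) z = ∑ n ∈ N, c n * TI l I (s n) z := by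
  unfold TI
  simp_rw [mul_sum, ← integral_const_mul]
  rw [← integral_finsetSum]
  · congr 1; ext x; apply sum_congr rfl; intro n _; ring
  · intro n hn; exact (kz_int l (hs n hn) I hz).const_mul _

lemma memLp_lin {ι : Type*} (N : Finset ι) (c : ι → ℂ) (s : ι → ℝ × ℝ → ℂ) (hs : ∀ n ∈ N, MemLp (s n) 2 volume) :
    MemLp (fun x => ∑ n ∈ N, c n * s n x) 2 volume :=
  memLp_finset_sum N fun n hn => (hs n hn).const_mul (c n)

lemma gf_meas (S : Finset Dy) (b : Dy → ℝ≥0∞) : Measurable (gf S b) := by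
  unfold gf
  exact Finset.measurable_fun_sum S fun I _ => measurable_const.indicator I.measA

lemma gf_eq (S : Finset Dy) (s : ℝ × ℝ → ℂ) (θ : ℝ) [DecidablePred fun I : Dy => θ ∈ I.A] :
    gf S (bq s) θ = ∫⁻ x in ⋃ I ∈ S.filter (fun I => θ ∈ I.A), I.Q, ‖s x‖ₑ ^ 2 := by
  classical
  rw [lintegral_biUnion_finset (fun I _ J _ h => Dy.Q_disj h) (fun I _ => I.measQ), sum_filter]
  unfold gf
  apply sum_congr rfl; intro I _; simp [Set.indicator, bq]

lemma E2_vec (m : ℕ) (hp : 0 < p) (hp1 : p ≤ 1) (hL : 2 ≤ ((m + 1 : ℕ) + 1) * p) : ∃ C : ℝ≥0∞, C ≠ ∞ ∧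
    ∀ (N : Finset ℕ) (s : ℕ → ℝ × ℝ → ℂ), (∀ n, MemLp (s n) 2 volume) → ∀ (S : Finset Dy), ∀ r : ℝ, 0 ≤ r → r < 1 →
    ∫⁻ θ in 𝕀, (∑ n ∈ N, ‖∑ I ∈ S, TI (m + 1) I (s n) (circlePt r θ)‖ₑ ^ 2) ^ (p / 2) ≤
      C * ∫⁻ θ, (∑ n ∈ N, gf S (bq (s n)) θ) ^ (p / 2) := by
  classical
  obtain ⟨C, hC, hsc⟩ := E2_sc m hp hp1 hL
  refine ⟨12 * C, by finiteness, ?_⟩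
  intro N s hs S r h0 h1
  have hz : ∀ t, ‖circlePt r t‖ < 1 := fun t => by rw [circlePt_norm, abs_of_nonneg h0]; exact h1
  set h : ℕ → ℝ → ℂ := fun n θ => ∑ I ∈ S, TI (m + 1) I (s n) (circlePt r θ) with hh
  have hcont : ∀ n, Continuous (h n) := fun n => continuous_finset_sum _ fun I _ => TI_cont (m + 1) (hs n) I h0 h1
  set sA : Finset ℕ → ℝ × ℝ → ℂ := fun A x => ∑ n ∈ N, sg A n * s n x with hsA
  have hsAm : ∀ A, MemLp (sA A) 2 volume := fun A => memLp_lin N _ s fun n _ => hs n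
  have e1 : ∀ A θ, ∑ n ∈ N, sg A n * h n θ = ∑ I ∈ S, TI (m + 1) I (sA A) (circlePt r θ) := fun A θ => by
    simp_rw [hsA, fun I => TI_lin (m + 1) N (sg A) s (fun n _ => hs n) I (hz θ), hh, mul_sum]
    exact Finset.sum_comm
  have k1 : ∀ θ, 2 ^ N.card * (∑ n ∈ N, ‖h n θ‖ₑ ^ 2) ^ (p / 2) ≤ 12 * ∑ A ∈ N.powerset, ‖∑ n ∈ N, sg A n * h n θ‖ₑ ^ p := fun θ => by
    have := khin_lower_tsum (κ := Unit) (fun _ => 1) hp (by linarith) N (fun n _ => h n θ)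
    simpa [sq_rpow] using this
  have k2 : ∀ θ, ∑ A ∈ N.powerset, gf S (bq (sA A)) θ ^ (p / 2) ≤ 2 ^ N.card * (∑ n ∈ N, gf S (bq (s n)) θ) ^ (p / 2) := fun θ => by
    simp_rw [gf_eq]
    exact khin_upper _ hp (by linarith) N s fun n _ => (hs n).1.restrict
  have hm1 : ∀ A, Measurable fun θ => ‖∑ n ∈ N, sg A n * h n θ‖ₑ ^ p := fun A =>
    ((continuous_finset_sum _ fun n _ => continuous_const.mul (hcont n)).measurable.enorm).pow_const p
  have hc0 : (2 : ℝ≥0∞) ^ N.card ≠ 0 := by positivity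
  have hct : (2 : ℝ≥0∞) ^ N.card ≠ ∞ := by finiteness
  rw [← ENNReal.mul_le_mul_iff_right hc0 hct, ← lintegral_const_mul' _ _ hct]
  calc _ ≤ ∫⁻ θ in 𝕀, 12 * ∑ A ∈ N.powerset, ‖∑ n ∈ N, sg A n * h n θ‖ₑ ^ p := lintegral_mono k1
    _ = 12 * ∑ A ∈ N.powerset, ∫⁻ θ in 𝕀, ‖∑ I ∈ S, TI (m + 1) I (sA A) (circlePt r θ)‖ₑ ^ p := by
        rw [lintegral_const_mul' _ _ (by simp), lintegral_finsetSum _ (fun A _ => hm1 A)]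
        simp_rw [e1]
    _ ≤ 12 * ∑ A ∈ N.powerset, C * ∫⁻ θ, gf S (bq (sA A)) θ ^ (p / 2) := by gcongr with A _; exact hsc _ (hsAm A) S r h0 h1
    _ = 12 * C * ∫⁻ θ, ∑ A ∈ N.powerset, gf S (bq (sA A)) θ ^ (p / 2) := by
        rw [lintegral_finsetSum _ (fun A _ => (gf_meas S _).pow_const _), ← mul_sum]; ring
    _ ≤ 12 * C * ∫⁻ θ, 2 ^ N.card * (∑ n ∈ N, gf S (bq (s n)) θ) ^ (p / 2) := by gcongr with θ; exact k2 θ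
    _ = _ := by rw [lintegral_const_mul' _ _ hct]; ring

/-- `Rop L f` on a box -/
def rq (L : ℕ) (f : ℂ → ℂ) (I : Dy) : ℝ × ℝ → ℂ := I.Q.indicator fun x => Rop L f cp(x)

lemma bdd_mem {I : Dy} {E : Set (ℝ × ℝ)} (hE : E ⊆ I.Q) (hm : MeasurableSet E) {u : ℝ × ℝ → ℂ}
    (hu : AEStronglyMeasurable u (volume.restrict E)) {M : ℝ} (hM : ∀ x ∈ E, ‖u x‖ ≤ M) :
    MemLp (E.indicator u) 2 volume := by
  rw [memLp_indicator_iff_restrict hm]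
  have hfin : volume E ≠ ∞ := ne_top_of_le_ne_top (Q_fin I) (measure_mono hE)
  have : IsFiniteMeasure (volume.restrict E) := ⟨by
    rw [Measure.restrict_apply_univ]; exact hfin.lt_top⟩
  exact MemLp.of_bound hu M ((ae_restrict_iff' hm).2 (Eventually.of_forall hM))

lemma rop_bdd (L : ℕ) {f : ℂ → ℂ} (hf : Hol(f, 1)) (I : Dy) :
    ∃ M : ℝ, ∀ x ∈ I.Q, ‖Rop L f cp(x)‖ ≤ M := by
  have h1 : Metric.closedBall (0 : ℂ) (1 - I.len / 2) ⊆ ball 0 1 :=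
    Metric.closedBall_subset_ball (by have := I.len_pos; linarith)
  obtain ⟨M, hM⟩ := (isCompact_closedBall (0 : ℂ) (1 - I.len / 2)).exists_bound_of_continuousOn
    (((Rop_diff L hf).continuousOn).mono h1)
  refine ⟨M, fun x hx => hM _ ?_⟩
  have hb := Dy.Q_bd hx
  rw [mem_closedBall_zero_iff, circlePt_norm, abs_of_nonneg hb.1]
  linarith [hb.2.2.1]

lemma rop_cont (L : ℕ) {f : ℂ → ℂ} (hf : Hol(f, 1)) (I : Dy) :
    ContinuousOn (fun x : ℝ × ℝ => Rop L f cp(x)) I.Q :=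
  ((Rop_diff L hf).continuousOn).comp circlePt_cont.continuousOn fun x hx => by
    have hb := Dy.Q_bd hx
    rw [mem_ball_zero_iff, circlePt_norm, abs_of_nonneg hb.1]; exact hb.2.1

lemma rq_mem (L : ℕ) {f : ℂ → ℂ} (hf : Hol(f, 1)) (I : Dy) :
    MemLp (rq L f I) 2 volume := by
  obtain ⟨M, hM⟩ := rop_bdd L hf I
  exact bdd_mem subset_rfl I.measQ ((rop_cont L hf I).aestronglyMeasurable I.measQ) hM

lemma rq_TI (L l : ℕ) (f : ℂ → ℂ) (I : Dy) (z : ℂ) :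
    TI l I (rq L f I) z = ∫ x in I.Q, kz l z x * Rop L f cp(x) := by
  unfold TI
  refine setIntegral_congr_fun I.measQ fun x hx => ?_
  simp only [rq, indicator_of_mem hx]

lemma rq_bq (L : ℕ) (f : ℂ → ℂ) (I : Dy) :
    bq (rq L f I) I = ∫⁻ x in I.Q, ‖Rop L f cp(x)‖ₑ ^ 2 := by
  unfold bq
  refine setLIntegral_congr_fun I.measQ fun x hx => ?_
  simp only [rq, indicator_of_mem hx]

lemma tsum_Dy_pow {ε : ℝ} (hε : 0 < ε) : ∑' I : Dy, (2 : ℝ≥0∞) ^ (-(I.1 * (1 + ε))) ≠ ∞ := by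
  rw [ENNReal.tsum_sigma']
  refine ne_top_of_le_ne_top (tsum_two_rpow hε) (ENNReal.tsum_le_tsum fun i => ?_)
  simp only [tsum_fintype]
  rw [sum_const, Finset.card_univ, Fintype.card_fin, nsmul_eq_mul]
  push_cast
  rw [← rpow_natCast, ← rpow_add _ _ (by simp) (by simp)]
  exact le_of_eq (by congr 1; ring)

lemma Dy.len_two (I : Dy) : ofReal I.len = (2 : ℝ≥0∞) ^ (-(I.1 : ℝ)) := by
  unfold Dy.len
  rw [ofReal_inv_of_pos (by positivity), ofReal_pow (by norm_num), rpow_neg,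
    rpow_natCast]
  norm_num

lemma ev_sc (hp : 0 < p) (hp1 : p ≤ 1) : ∃ (l : ℕ) (C : ℝ≥0∞), C ≠ ∞ ∧ ∀ (f : ℂ → ℂ)
    (_ : Hol(f, 1)) (B : ℝ≥0∞)
    (_ : ∀ r : ℝ, 0 < r → r < 1 → ∫⁻ t in 𝕀, ‖f (r * Ec t)‖ₑ ^ p ≤ B) (z : ℂ), ‖z‖ < 1 →
    ‖f z‖ₑ ≤ C * ofReal ((1 - ‖z‖)⁻¹ ^ (l + 1)) * B ^ (1 / p) := by
  obtain ⟨l, hl⟩ := exists_nat_gt (1 / p)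
  obtain ⟨C1, hC1, H⟩ := E1_vec hp hp1 (l + 1)
  have hε : 0 < (l : ℝ) - 1 / p := by linarith
  refine ⟨l, ofReal (2 ^ (l + 1)) * C1 ^ (1 / p) * ∑' I : Dy, (2 : ℝ≥0∞) ^ (-(I.1 * (1 + (l - 1 / p)))), ?_, ?_⟩
  · have := tsum_Dy_pow hε
    have : C1 ^ (1 / p) ≠ ∞ := rpow_ne_top_of_nonneg (by positivity) hC1
    finiteness
  intro f hf B hB z hz
  have h1 := H (fun n => if n = 0 then f else 0) (fun n => by
    split_ifs
    · exact hf
    · exact differentiableOn_const 0) B (fun r h0 h1 => by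
      refine le_trans (lintegral_mono fun t => ?_) (hB r h0 h1)
      rw [tsum_eq_single 0 (fun n hn => by simp [hn])]
      simp only [if_true]
      rw [sq_rpow])
  have key : ∀ I : Dy, ‖∫ x in I.Q, kz l z x * Rop (l + 1) f cp(x)‖ₑ ≤
      ofReal (2 ^ (l + 1)) * C1 ^ (1 / p) * (2 : ℝ≥0∞) ^ (-(I.1 * (1 + (l - 1 / p)))) *
        ofReal ((1 - ‖z‖)⁻¹ ^ (l + 1)) * B ^ (1 / p) := fun I => by
    have hq : ofReal I.len * bq (rq (l + 1) f I) I ^ (p / 2) ≤ C1 * B := by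
      refine le_trans ?_ h1
      rw [← I.volA', mul_comm, ← setLIntegral_const]
      refine le_trans (setLIntegral_mono_ae' I.measA (Eventually.of_forall fun θ hθ => ?_)) (setLIntegral_le_lintegral I.A _)
      refine rpow_le_rpow ?_ (by positivity)
      refine le_trans ?_ (ENNReal.le_tsum 0)
      simp only [if_true]
      rw [Ar_eq, rq_bq]
      refine le_trans (le_of_eq ?_) (ENNReal.le_tsum I)
      rw [indicator_of_mem hθ]
    have hq2 : bq (rq (l + 1) f I) I ^ (1 / 2 : ℝ) ≤ (2 : ℝ≥0∞) ^ (I.1 / p) * (C1 ^ (1 / p) * B ^ (1 / p)) := by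
      have h2 : bq (rq (l + 1) f I) I ^ (p / 2) ≤ (2 : ℝ≥0∞) ^ (I.1 : ℝ) * (C1 * B) := by
        refine le_trans (le_of_eq ?_) (mul_le_mul_right hq _)
        rw [I.len_two, ← mul_assoc, ← rpow_add _ _ (by simp) (by simp)]
        simp
      have h3 := rpow_le_rpow h2 (z := 1 / p) (by positivity)
      rw [← rpow_mul, mul_rpow_of_nonneg _ _ (by positivity),
        mul_rpow_of_nonneg _ _ (by positivity), ← rpow_mul] at h3
      convert h3 using 2
      · field_simp
      · congr 1; field_simp
    rw [← rq_TI]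
    refine (TI_le (rq_mem (l + 1) hf I) l I le_rfl (D := 2 ^ (l + 1) * I.len ^ l * (1 - ‖z‖)⁻¹ ^ (l + 1))
      fun x hx => ?_).trans ?_
    · have hb := Dy.Q_bd hx
      refine (kz_norm_le l hz hb.1 hb.2.1.le).trans ?_
      have : 0 ≤ (1 - ‖z‖)⁻¹ := inv_nonneg.2 (by linarith)
      have : 0 ≤ 1 - x.1 := by linarith [hb.2.1]
      have := hb.2.2.2.1
      gcongr
    · refine (mul_le_mul_right hq2 _).trans (le_of_eq ?_)
      have hz0 : 0 ≤ (1 - ‖z‖)⁻¹ := inv_nonneg.2 (by linarith)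
      have e1 : ofReal (2 ^ (l + 1) * I.len ^ l * (1 - ‖z‖)⁻¹ ^ (l + 1) * I.len) =
          ofReal (2 ^ (l + 1)) * ofReal ((1 - ‖z‖)⁻¹ ^ (l + 1)) * (2 : ℝ≥0∞) ^ (-(I.1 : ℝ) * (l + 1)) := by
        have hp0 := I.len_pos
        rw [show (2 ^ (l + 1) * I.len ^ l * (1 - ‖z‖)⁻¹ ^ (l + 1) * I.len : ℝ) =
          2 ^ (l + 1) * (1 - ‖z‖)⁻¹ ^ (l + 1) * I.len ^ (l + 1) by ring, ofReal_mul (by positivity),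
          ofReal_mul (by positivity), ofReal_pow hp0.le, I.len_two, ← rpow_natCast,
          ← rpow_mul]
        push_cast; rfl
      have e2 : (2 : ℝ≥0∞) ^ (-(I.1 * (1 + (l - 1 / p)))) = 2 ^ (-(I.1 : ℝ) * (l + 1)) * 2 ^ (I.1 / p) := by
        rw [← rpow_add _ _ (by simp) (by simp)]
        congr 1; ring
      rw [e1, e2]; ring
  refine le_of_tendsto (repr_box l hf hz).enorm (Eventually.of_forall fun N => ?_)
  refine (enorm_sum_le _ _).trans ((sum_le_sum fun I _ => key I).trans ?_)
  rw [← sum_mul, ← sum_mul, ← mul_sum]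
  gcongr
  exact ENNReal.sum_le_tsum _

/-! ### the Hardy space -/

lemma hpI_eq (p : ℝ) (F : ℂ → ELL2) (r : ℝ) :
    hpIntegral p F r = ∫⁻ t in 𝕀, ‖F (r * Ec t)‖ₑ ^ p := by
  have := per_lint (f := fun t => ‖F (circlePt r t)‖ₑ ^ p) (fun t => by simp only [circ_per r t]) (-(1 : ℝ) / 2) 0
  rw [zero_add, show -(1 : ℝ) / 2 + 1 = 1 / 2 by norm_num] at this
  exact this

lemma ell_sq (v : ELL2) : ‖v‖ₑ ^ 2 = ∑' n, ‖v n‖ₑ ^ 2 := by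
  have h := lp.hasSum_norm (p := 2) (by norm_num) v
  have h2 : ∀ n, ‖v n‖ₑ ^ 2 = ofReal (‖v n‖ ^ (2 : ℝ≥0∞).toReal) := fun n => by
    rw [← ofReal_norm, ← ofReal_pow (norm_nonneg _)]; simp
  simp_rw [h2]
  rw [← ofReal_tsum_of_nonneg (fun n => by positivity) h.summable, h.tsum_eq, ← ofReal_norm,
    ← ofReal_pow (norm_nonneg _)]
  simp

/-- coordinates in `ℓ₂` -/
def cL (n : ℕ) : ELL2 →L[ℂ] ℂ :=
  LinearMap.mkContinuous { toFun := fun v => v n, map_add' := fun _ _ => rfl, map_smul' := fun _ _ => rfl } 1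
    fun v => by rw [one_mul]; exact lp.norm_apply_le_norm (by norm_num) v n

@[simp] lemma cL_apply (n : ℕ) (v : ELL2) : cL n v = v n := rfl

/-- holomorphic functions on the disc (extended by zero) -/
def HD : Submodule ℂ (ℂ → ELL2) where
  carrier := {F | Hol(F, 1) ∧ ∀ z, 1 ≤ ‖z‖ → F z = 0}
  zero_mem' := ⟨differentiableOn_const 0, fun _ _ => rfl⟩
  add_mem' := fun hF hG => ⟨hF.1.add hG.1, fun z hz => by simp [hF.2 z hz, hG.2 z hz]⟩
  smul_mem' := fun c F hF => ⟨hF.1.const_smul c, fun z hz => by simp [hF.2 z hz]⟩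

lemma ball_pt {r t : ℝ} (h0 : 0 ≤ r) (h1 : r < 1) : (r * Ec t : ℂ) ∈ ball (0 : ℂ) 1 := by
  rw [mem_ball_zero_iff, ← circlePt_eq, circlePt_norm, abs_of_nonneg h0]; exact h1

lemma hol_aem {E : Type*} [NormedAddCommGroup E] [NormedSpace ℂ E] {F : ℂ → E}
    (hF : Hol(F, 1)) {r : ℝ} (h0 : 0 ≤ r) (h1 : r < 1) (p : ℝ) :
    Measurable fun t : ℝ => ‖F (r * Ec t)‖ₑ ^ p := by
  have : Continuous fun t : ℝ => F (r * Ec t) := by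
    rw [← continuousOn_univ]
    exact hF.continuousOn.comp (continuous_const.mul Ec_cont).continuousOn fun t _ => ball_pt h0 h1
  exact this.enorm.measurable.pow_const p

/-- the quasi-norm (to the power `p`) -/
def hpN (p : ℝ) (F : ℂ → ELL2) : ℝ≥0∞ := ⨆ r : 𝕀, hpIntegral p F r.1

lemma hpI_le (p : ℝ) (F : ℂ → ELL2) {r : ℝ} (h0 : 0 ≤ r) (h1 : r < 1) :
    ∫⁻ t in 𝕀, ‖F (r * Ec t)‖ₑ ^ p ≤ hpN p F := by
  rw [← hpI_eq]; exact le_iSup (fun r : 𝕀 => hpIntegral p F r.1) ⟨r, h0, h1⟩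

lemma ev_vec (hp : 0 < p) (hp1 : p ≤ 1) : ∃ (l : ℕ) (C : ℝ≥0∞), C ≠ ∞ ∧ ∀ (F : ℂ → ELL2)
    (_ : Hol(F, 1)) (z : ℂ), ‖z‖ < 1 →
    ‖F z‖ₑ ≤ C * ofReal ((1 - ‖z‖)⁻¹ ^ (l + 1)) * hpN p F ^ (1 / p) := by
  obtain ⟨l, C, hC, H⟩ := ev_sc hp hp1
  refine ⟨l, C, hC, fun F hF z hz => ?_⟩
  by_cases h0 : F z = 0
  · simp [h0]
  obtain ⟨g, hg1, hg2⟩ := exists_dual_vector ℂ (F z) (norm_ne_zero_iff.2 h0)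
  have h := H (fun w => g (F w)) (g.differentiable.comp_differentiableOn hF) (hpN p F) (fun r r0 r1 => by
    refine le_trans (lintegral_mono fun t => ?_) (hpI_le p F r0.le r1)
    refine rpow_le_rpow ?_ hp.le
    have := g.le_opNorm (F (r * Ec t))
    rw [hg1, one_mul] at this
    rw [← ofReal_norm, ← ofReal_norm]
    exact ofReal_le_ofReal this) z hz
  rw [hg2] at h
  refine le_trans (le_of_eq ?_) h
  rw [← ofReal_norm, ← ofReal_norm]; simp

lemma hpN_eq_zero (hp : 0 < p) (hp1 : p ≤ 1) {F : ℂ → ELL2} (hF : F ∈ HD) (h : hpN p F = 0) : F = 0 := by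
  obtain ⟨l, C, hC, H⟩ := ev_vec hp hp1
  ext1 z
  by_cases hz : ‖z‖ < 1
  · have := H F hF.1 z hz
    rw [h, zero_rpow_of_pos (by positivity), mul_zero] at this
    simpa using this
  · exact hF.2 z (not_lt.1 hz)

/-- the Hardy space -/
def hpPN (hp : 0 < p) (hp1 : p ≤ 1) : PN HD where
  p := p
  hp := hp
  N := fun F => hpN p F.1
  zero := by
    simp only [hpN, iSup_eq_zero]
    intro r
    rw [hpI_eq]; simp [hp]
  add := fun F G => by
    refine iSup_le fun r => ?_
    rw [hpI_eq]
    refine le_trans ?_ (add_le_add (hpI_le p F.1 r.2.1 r.2.2) (hpI_le p G.1 r.2.1 r.2.2))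
    rw [← lintegral_add_left (hol_aem F.2.1 r.2.1 r.2.2 p)]
    refine lintegral_mono fun t => ?_
    exact (rpow_le_rpow (enorm_add_le _ _) hp.le).trans (rpow_add_le_add_rpow _ _ hp.le hp1)
  smul := fun c F => by
    unfold hpN
    rw [mul_iSup]
    congr 1; ext1 r
    rw [hpI_eq, hpI_eq, ← lintegral_const_mul _ (hol_aem F.2.1 r.2.1 r.2.2 p)]
    congr 1; ext1 t
    rw [← mul_rpow_of_nonneg _ _ hp.le, ← enorm_smul]; rfl
  eq_zero := fun F h => Subtype.ext (hpN_eq_zero hp hp1 F.2 h)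

/-- the Hardy space -/
abbrev HX (hp : 0 < p) (hp1 : p ≤ 1) : Type := (hpPN hp hp1).Sp

section
variable {hp : 0 < p} {hp1 : p ≤ 1}

/-- the function -/
def fn (F : HX hp hp1) : ℂ → ELL2 := ((hpPN hp hp1).val F).1

lemma fn_hol (F : HX hp hp1) : DifferentiableOn ℂ (fn F) (ball 0 1) := ((hpPN hp hp1).val F).2.1
lemma fn_out (F : HX hp hp1) {z : ℂ} (h : 1 ≤ ‖z‖) : fn F z = 0 := ((hpPN hp hp1).val F).2.2 z h
lemma fn_enorm (F : HX hp hp1) : ‖F‖ₑ = hpN p (fn F) := PN.enorm_def F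
lemma fn_sub (F G : HX hp hp1) : fn (F - G) = fn F - fn G := rfl
lemma fn_smul (c : ℂ) (F : HX hp hp1) : fn (c • F) = c • fn F := rfl
lemma fn_sum {ι : Type*} (s : Finset ι) (F : ι → HX hp hp1) : fn (∑ i ∈ s, F i) = ∑ i ∈ s, fn (F i) := by
  unfold fn; rw [PN.val_sum, AddSubmonoidClass.coe_finset_sum]
lemma fn_inj {F G : HX hp hp1} (h : ∀ z, ‖z‖ < 1 → fn F z = fn G z) : F = G := by
  apply PN.val_inj; apply Subtype.ext; ext1 z
  by_cases hz : ‖z‖ < 1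
  · exact h z hz
  · exact (fn_out F (not_lt.1 hz)).trans (fn_out G (not_lt.1 hz)).symm

/-- constructor -/
def mkX (hp : 0 < p) (hp1 : p ≤ 1) (F : ℂ → ELL2) (hF : Hol(F, 1))
    (h : hpN p F < ∞) : HX hp hp1 :=
  (hpPN hp hp1).mk' ⟨(ball 0 1).indicator F, by
      refine hF.congr fun z hz => indicator_of_mem hz _, fun z hz => indicator_of_notMem (by simpa using hz) _⟩ (by
    refine lt_of_le_of_lt (le_of_eq ?_) h
    show hpN p _ = hpN p _
    unfold hpN; congr 1; ext1 r
    rw [hpI_eq, hpI_eq]; congr 1; ext1 t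
    simp only [indicator_of_mem (ball_pt r.2.1 r.2.2)])

lemma fn_mkX (F : ℂ → ELL2) (hF : Hol(F, 1)) (h : hpN p F < ∞) {z : ℂ} (hz : ‖z‖ < 1) :
    fn (mkX hp hp1 F hF h) z = F z := indicator_of_mem (by simpa using hz) _

lemma hpN_congr {F G : ℂ → ELL2} (h : ∀ z, ‖z‖ < 1 → F z = G z) : hpN p F = hpN p G := by
  unfold hpN; congr 1; ext1 r
  rw [hpI_eq, hpI_eq]; congr 1; ext1 t
  rw [h _ (by simpa using ball_pt (t := t) r.2.1 r.2.2)]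

lemma fn_ev (ρ : ℝ) (hρ : ρ < 1) : ∃ C : ℝ, 0 ≤ C ∧ ∀ F : HX hp hp1, ∀ z, ‖z‖ ≤ ρ → ‖fn F z‖ ≤ C * ‖F‖ ^ (1 / p) := by
  obtain ⟨l, C, hC, H⟩ := ev_vec hp hp1
  have hfin : C * ofReal ((1 - ρ)⁻¹ ^ (l + 1)) ≠ ∞ := by finiteness
  refine ⟨(C * ofReal ((1 - ρ)⁻¹ ^ (l + 1))).toReal, by positivity, fun F z hz => ?_⟩
  have h := H (fn F) (fn_hol F) z (by linarith)
  rw [← fn_enorm] at h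
  have h2 : ‖fn F z‖ₑ ≤ C * ofReal ((1 - ρ)⁻¹ ^ (l + 1)) * ‖F‖ₑ ^ (1 / p) := by
    refine h.trans ?_
    have h3 : (1 - ‖z‖)⁻¹ ≤ (1 - ρ)⁻¹ := inv_anti₀ (by linarith) (by linarith)
    have h4 : 0 ≤ (1 - ‖z‖)⁻¹ := inv_nonneg.2 (by linarith)
    gcongr
  have h3 := toReal_mono (by finiteness) h2
  rw [toReal_mul, ← toReal_rpow] at h3
  simpa using h3

instance : CompleteSpace (HX hp hp1) := by
  apply PN.complete
  intro f hf
  have hu : ∀ ρ : ℝ, ρ < 1 → UniformCauchySeqOn (fun m => fn (f m)) atTop (Metric.closedBall 0 ρ) := fun ρ hρ => by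
    obtain ⟨C, hC, H⟩ := fn_ev (hp := hp) (hp1 := hp1) ρ hρ
    rw [Metric.uniformCauchySeqOn_iff]
    intro ε hε
    have : Tendsto (fun x : ℝ => C * x ^ (1 / p)) (𝓝 0) (𝓝 0) := by
      have h1 : ContinuousAt (fun x : ℝ => C * x ^ (1 / p)) 0 :=
        (Real.continuousAt_rpow_const 0 (1 / p) (Or.inr (by positivity))).const_mul C
      have h2 := h1.tendsto
      simpa [Real.zero_rpow (by positivity : 1 / p ≠ 0), hp.ne'] using h2
    obtain ⟨δ, hδ, hd⟩ := Metric.tendsto_nhds_nhds.1 this ε hε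
    obtain ⟨N, hN⟩ := Metric.cauchySeq_iff.1 hf δ hδ
    refine ⟨N, fun m hm n hn z hz => ?_⟩
    have h1 := hN m hm n hn
    rw [dist_eq_norm] at h1
    have h2 := hd (x := ‖f m - f n‖) (by simpa using h1)
    rw [dist_eq_norm]
    have h3 := H (f m - f n) z (by simpa using hz)
    rw [fn_sub] at h3
    refine lt_of_le_of_lt h3 ?_
    simpa [abs_of_nonneg hC, abs_of_nonneg (Real.rpow_nonneg (norm_nonneg (f m - f n)) _)] using h2
  have hl : ∀ z, ∃ v, Tendsto (fun m => fn (f m) z) atTop (𝓝 v) := fun z => by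
    by_cases hz : ‖z‖ < 1
    · exact cauchySeq_tendsto_of_complete ((hu ‖z‖ hz).cauchySeq (by simp))
    · exact ⟨0, tendsto_const_nhds.congr fun m => (fn_out _ (not_lt.1 hz)).symm⟩
  choose G hG using hl
  have hd : Hol(G, 1) := fun z hz => by
    have hz1 : ‖z‖ < 1 := by simpa using hz
    obtain ⟨ρ, h1, h2⟩ := exists_between hz1
    have h3 := ((hu ρ h2).tendstoUniformlyOn_of_tendsto fun z _ => hG z).mono Metric.ball_subset_closedBall
    have h4 : Hol(G, ρ) :=
      h3.tendstoLocallyUniformlyOn.differentiableOn (Eventually.of_forall fun m =>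
        (fn_hol (f m)).mono (ball_subset_ball h2.le)) isOpen_ball
    exact ((h4 z (by simpa using h1)).differentiableAt (isOpen_ball.mem_nhds (by simpa using h1))).differentiableWithinAt
  refine ⟨⟨G, hd, fun z hz => tendsto_nhds_unique (hG z) (tendsto_const_nhds.congr fun m => (fn_out _ hz).symm)⟩, fun k B hB => ?_⟩
  refine iSup_le fun r => ?_
  rw [hpI_eq]
  refine (lint_liminf_le (f := fun m t => ‖(fn (f m) - fn (f k)) (r.1 * Ec t)‖ₑ ^ p)
    (fun m => (hol_aem ((fn_hol (f m)).sub (fn_hol (f k))) r.2.1 r.2.2 p).aemeasurable)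
    (Eventually.of_forall fun t => ?_)).trans ?_
  · exact (((hG _).sub_const _).enorm).ennrpow_const p
  · refine liminf_le_of_frequently_le' (Eventually.frequently ?_)
    filter_upwards [hB] with m hm
    exact (hpI_le p _ r.2.1 r.2.2).trans hm

/-- point evaluation of a coordinate -/
lemma ev_cont (z : ℂ) (n : ℕ) : Continuous fun F : HX hp hp1 => fn F z n := by
  by_cases hz : ‖z‖ < 1
  · obtain ⟨C, hC, H⟩ := fn_ev (hp := hp) (hp1 := hp1) ‖z‖ hz
    have : Continuous fun F : HX hp hp1 => fn F z := by
      refine continuous_iff_continuousAt.2 fun F => ?_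
      rw [ContinuousAt, tendsto_iff_norm_sub_tendsto_zero]
      have h0 : Tendsto (fun G : HX hp hp1 => C * ‖G - F‖ ^ (1 / p)) (𝓝 F) (𝓝 0) := by
        have : Continuous fun G : HX hp hp1 => C * ‖G - F‖ ^ (1 / p) :=
          continuous_const.mul (((continuous_id.sub continuous_const).norm).rpow_const fun _ => Or.inr (by positivity))
        have h := this.tendsto F
        simpa [Real.zero_rpow (by positivity : 1 / p ≠ 0), hp.ne'] using h
      refine squeeze_zero (fun _ => norm_nonneg _) (fun G => ?_) h0
      have := H (G - F) z le_rfl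
      rwa [fn_sub] at this
    exact (cL n).continuous.comp this
  · have : (fun F : HX hp hp1 => fn F z n) = fun _ => 0 := by ext F; rw [fn_out F (not_lt.1 hz)]; rfl
    rw [this]; exact continuous_const

end

lemma pow_hol {c : ℕ → ℂ} {f : ℂ → ℂ} (h : ∀ z, ‖z‖ < 1 → HasSum (fun n => c n * z ^ n) (f z)) :
    Hol(f, 1) := fun z hz => by
  obtain ⟨ρ, h1, h2⟩ := exists_between (show ‖z‖ < 1 by simpa using hz)
  have h0 : 0 ≤ ρ := (norm_nonneg z).trans h1.le
  have hs := (h (ρ : ℂ) (by rw [Complex.norm_of_nonneg h0]; exact h2)).summable.norm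
  have hd : DifferentiableOn ℂ (fun w => ∑' n, c n * w ^ n) (ball 0 ρ) := by
    refine Complex.differentiableOn_tsum_of_summable_norm hs (fun n => by fun_prop) isOpen_ball fun n w hw => ?_
    rw [norm_mul, norm_mul, norm_pow, norm_pow, Complex.norm_of_nonneg h0]
    have : ‖w‖ ≤ ρ := by simpa using (mem_ball_zero_iff.1 hw).le
    gcongr
  have h3 : Hol(f, ρ) := hd.congr fun w hw =>
    ((h w ((mem_ball_zero_iff.1 hw).trans h2)).tsum_eq).symm
  exact ((h3 z (by simpa using h1)).differentiableAt (isOpen_ball.mem_nhds (by simpa using h1))).differentiableWithinAt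

lemma TI_hol (l : ℕ) {s : ℝ × ℝ → ℂ} (hs : MemLp s 2 volume) (I : Dy) :
    DifferentiableOn ℂ (TI l I s) (ball 0 1) :=
  pow_hol fun _ hz => mo_hasSum l I.measQ (Q_sub I) (s_int hs I) hz

/-- unit vectors of `ℓ₂` -/
def ee (n : ℕ) : ELL2 := lp.single 2 n (1 : ℂ)

lemma ee_apply (n k : ℕ) : ee n k = if k = n then 1 else 0 := by unfold ee; rw [lp.single_apply, Pi.single_apply]

lemma lsum_apply {ι : Type*} (G : Finset ι) (v : ι → ELL2) (n : ℕ) : (∑ i ∈ G, v i) n = ∑ i ∈ G, v i n := by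
  rw [← cL_apply, map_sum]; rfl

theorem T_gen (m : ℕ) (hp : 0 < p) (hp1 : p ≤ 1) (hL : 2 ≤ ((m + 1 : ℕ) + 1) * p)
    {Λ : Type} [Countable Λ] [DecidableEq Λ] (I : Λ → Dy) (ν : Λ → ℕ) (s : Λ → ℝ × ℝ → ℂ)
    (hs : ∀ k, MemLp (s k) 2 volume) (h0 : ∀ k x, x ∉ (I k).Q → s k x = 0) {K : ℝ≥0∞} (hK : K ≠ ∞)
    (bes : ∀ (G : Finset Λ) (c : Λ → ℂ) (J : Dy) (n : ℕ), (∀ k ∈ G, I k = J ∧ ν k = n) →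
      bq (fun x => ∑ k ∈ G, c k * s k x) J ≤ K * ∑ k ∈ G, ‖c k‖ₑ ^ 2 * 2 ^ (2 * J.1 / p)) :
    ∃ (T : ((dyW p hp hp1).comap I).F →L[ℂ] HX hp hp1) (τ : Λ → HX hp hp1),
      (∀ k z, ‖z‖ < 1 → ∀ n, fn (τ k) z n = if n = ν k then TI (m + 1) (I k) (s k) z else 0) ∧
      ∀ c, HasSum (fun k => ((dyW p hp hp1).comap I).cd c k • τ k) (T c) := by
  obtain ⟨C, hC, hE⟩ := E2_vec m hp hp1 hL
  have raw : ∀ (c : Λ → ℂ) (G : Finset Λ), hpN p (fun z => ∑ k ∈ G, c k • (TI (m + 1) (I k) (s k) z • ee (ν k))) ≤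
      C * K ^ (p / 2) * ((dyW p hp hp1).comap I).Ph (fun k => if k ∈ G then ‖c k‖ₑ else 0) := fun c G => by
    have hsn := fun n => memLp_lin (G.filter fun k => ν k = n) c s (fun k _ => hs k)
    refine iSup_le fun r => ?_
    have hE' := hE (G.image ν) (fun n x => ∑ k ∈ G.filter (fun k => ν k = n), c k * s k x) hsn (G.image I) r.1 r.2.1 r.2.2
    have e1 : hpIntegral p (fun z => ∑ k ∈ G, c k • (TI (m + 1) (I k) (s k) z • ee (ν k))) r.1 =
        ∫⁻ θ in 𝕀, (∑ n ∈ G.image ν, ‖∑ J ∈ G.image I, TI (m + 1) J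
          (fun x => ∑ k ∈ G.filter (fun k => ν k = n), c k * s k x) (circlePt r.1 θ)‖ₑ ^ 2) ^ (p / 2) := by
      rw [hpI_eq]
      congr 1; ext1 θ
      rw [← sq_rpow, ell_sq]
      congr 1
      have e2 : ∀ n, (∑ k ∈ G, c k • (TI (m + 1) (I k) (s k) (r.1 * Ec θ) • ee (ν k)) : ELL2) n =
          ∑ k ∈ G.filter (fun k => ν k = n), c k * TI (m + 1) (I k) (s k) (r.1 * Ec θ) := fun n => by
        rw [lsum_apply, sum_filter]
        refine sum_congr rfl fun k _ => ?_
        rw [lp.coeFn_smul, lp.coeFn_smul, Pi.smul_apply, Pi.smul_apply, ee_apply]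
        by_cases h : ν k = n
        · simp [h]
        · simp [h, Ne.symm h]
      rw [tsum_eq_sum (s := G.image ν)]
      · refine sum_congr rfl fun n _ => ?_
        congr 2
        rw [e2]
        have hz : ‖circlePt r.1 θ‖ < 1 := by rw [circlePt_norm, abs_of_nonneg r.2.1]; exact r.2.2
        simp_rw [TI_lin (m + 1) _ c s (fun k _ => hs k) _ hz]
        rw [Finset.sum_comm]
        refine sum_congr rfl fun k hk => ?_
        rw [Finset.sum_eq_single (I k)]
        · rfl
        · intro J _ hJ
          have : TI (m + 1) J (s k) (circlePt r.1 θ) = 0 := by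
            unfold TI
            refine setIntegral_eq_zero_of_forall_eq_zero fun x hx => ?_
            rw [h0 k x fun hx' => hJ (Dy.Q_inj hx hx'), mul_zero]
          rw [this, mul_zero]
        · intro h; exact absurd (mem_image_of_mem I (mem_filter.1 hk).1) h
      · intro n hn
        rw [e2, Finset.filter_eq_empty_iff.2, Finset.sum_empty]
        · simp
        · intro k hk h; exact hn (h ▸ mem_image_of_mem ν hk)
    rw [e1]
    refine hE'.trans ?_
    rw [mul_assoc]
    refine mul_le_mul_right ?_ C
    have hm := (((dyW p hp hp1).comap I).sq_meas (fun k => if k ∈ G then ‖c k‖ₑ else 0)).pow_const (p / 2)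
    unfold WS.Ph
    change _ ≤ K ^ (p / 2) * ∫⁻ θ, _ ^ (p / 2)
    rw [← lintegral_const_mul _ hm]
    refine lintegral_mono fun θ => ?_
    simp only
    rw [← mul_rpow_of_nonneg _ _ (by positivity)]
    refine rpow_le_rpow ?_ (by positivity)
    have e3 : ∀ n, gf (G.image I) (bq fun x => ∑ k ∈ G.filter (fun k => ν k = n), c k * s k x) θ ≤
        ∑ k ∈ G.filter (fun k => ν k = n), K * (‖c k‖ₑ ^ 2 * (dyW p hp hp1).g (I k) θ) := fun n => by
      unfold gf
      rw [← sum_fiberwise_of_maps_to (s := G.filter fun k => ν k = n) (t := G.image I) (g := I)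
        fun k hk => mem_image_of_mem I (mem_filter.1 hk).1]
      refine sum_le_sum fun J _ => ?_
      by_cases hθ : θ ∈ J.A
      · rw [indicator_of_mem hθ]
        have e4 : bq (fun x => ∑ k ∈ G.filter (fun k => ν k = n), c k * s k x) J =
            bq (fun x => ∑ k ∈ (G.filter (fun k => ν k = n)).filter (fun k => I k = J), c k * s k x) J := by
          unfold bq
          refine setLIntegral_congr_fun J.measQ fun x hx => ?_
          simp only
          congr 2
          refine (Finset.sum_filter_of_ne fun k _ hk => ?_).symm
          by_contra h
          exact hk (by rw [h0 k x fun hx' => h (Dy.Q_inj hx' hx), mul_zero])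
        rw [e4]
        refine (bes _ c J n fun k hk => ?_).trans (le_of_eq ?_)
        · simp only [mem_filter] at hk; exact ⟨hk.2, hk.1.2⟩
        · rw [mul_sum]
          refine sum_congr rfl fun k hk => ?_
          rw [(mem_filter.1 hk).2]
          simp only [dyW, indicator_of_mem hθ]
      · rw [indicator_of_notMem hθ]; exact bot_le
    refine (sum_le_sum fun n _ => e3 n).trans ?_
    rw [sum_fiberwise_of_maps_to fun k hk => mem_image_of_mem ν hk, ← mul_sum]
    refine mul_le_mul_right ?_ K
    unfold WS.sq
    refine le_trans (le_of_eq ?_) (ENNReal.sum_le_tsum G)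
    exact sum_congr rfl fun k hk => by simp only [hk, if_true]; rfl
  have hK2 : C * K ^ (p / 2) ≠ ∞ := by
    have : K ^ (p / 2) ≠ ∞ := rpow_ne_top_of_nonneg (by positivity) hK
    finiteness
  have hfin : ∀ k, hpN p (fun z => TI (m + 1) (I k) (s k) z • ee (ν k)) < ∞ := fun k => by
    have := raw (fun _ => 1) {k}
    simp only [sum_singleton, one_smul, Finset.mem_singleton] at this
    refine lt_of_le_of_lt this ?_
    rw [WS.Ph_single]
    have : ‖(1 : ℂ)‖ₑ ^ ((dyW p hp hp1).comap I).p ≠ ∞ := by simp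
    finiteness
  have hhol : ∀ k, DifferentiableOn ℂ (fun z => TI (m + 1) (I k) (s k) z • ee (ν k)) (ball 0 1) := fun k =>
    (TI_hol (m + 1) (hs k) (I k)).smul_const _
  obtain ⟨T, hT⟩ := ((dyW p hp hp1).comap I).extend (fun k => mkX hp hp1 _ (hhol k) (hfin k)) _ hK2 (by
    intro c G
    refine le_trans (le_of_eq ?_) (raw c G)
    rw [fn_enorm]
    apply hpN_congr
    intro z hz
    rw [fn_sum, Finset.sum_apply]
    refine sum_congr rfl fun k _ => ?_
    rw [fn_smul, Pi.smul_apply, fn_mkX _ _ _ hz])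
  refine ⟨T, _, fun k z hz n => ?_, hT⟩
  rw [fn_mkX _ _ _ hz, lp.coeFn_smul, Pi.smul_apply, ee_apply]
  split_ifs <;> simp

lemma co_hol {F : ℂ → ELL2} (hF : Hol(F, 1)) (n : ℕ) :
    DifferentiableOn ℂ (fun z => F z n) (ball 0 1) := (cL n).differentiable.comp_differentiableOn hF

lemma Rop_congr (L : ℕ) {f g : ℂ → ℂ} (h : ∀ z, ‖z‖ < 1 → f z = g z) {z : ℂ} (hz : ‖z‖ < 1) : Rop L f z = Rop L g z := by
  unfold Rop
  have : f =ᶠ[𝓝 z] g := by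
    filter_upwards [isOpen_ball.mem_nhds (show z ∈ ball (0 : ℂ) 1 by simpa using hz)] with w hw
    exact h w (by simpa using hw)
  rw [this.deriv_eq, h z hz]

lemma Q_pt {I : Dy} {x : ℝ × ℝ} (h : x ∈ I.Q) : ‖circlePt x.1 x.2‖ < 1 := by
  have hb := Dy.Q_bd h
  rw [circlePt_norm, abs_of_nonneg hb.1]; exact hb.2.1

lemma rq_add (L : ℕ) {f g : ℂ → ℂ} (hf : Hol(f, 1))
    (hg : Hol(g, 1)) (I : Dy) (x : ℝ × ℝ) :
    rq L (fun z => f z + g z) I x = rq L f I x + rq L g I x := by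
  unfold rq
  by_cases hx : x ∈ I.Q
  · simp only [indicator_of_mem hx, Rop]
    have hb := isOpen_ball.mem_nhds (show circlePt x.1 x.2 ∈ ball (0 : ℂ) 1 by simpa using Q_pt hx)
    rw [deriv_fun_add (hf.differentiableAt hb) (hg.differentiableAt hb)]
    ring
  · simp [indicator_of_notMem hx]

lemma rq_smul (L : ℕ) (c : ℂ) (f : ℂ → ℂ) (I : Dy) (x : ℝ × ℝ) :
    rq L (fun z => c * f z) I x = c * rq L f I x := by
  unfold rq
  by_cases hx : x ∈ I.Q
  · simp only [indicator_of_mem hx, Rop]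
    rw [deriv_const_mul_field]
    ring
  · simp [indicator_of_notMem hx]

lemma rq_congr (L : ℕ) {f g : ℂ → ℂ} (h : ∀ z, ‖z‖ < 1 → f z = g z) (I : Dy) : rq L f I = rq L g I := by
  unfold rq
  ext1 x
  by_cases hx : x ∈ I.Q
  · simp only [indicator_of_mem hx]; exact Rop_congr L h (Q_pt hx)
  · simp [indicator_of_notMem hx]

theorem S_gen (L : ℕ) (hp : 0 < p) (hp1 : p ≤ 1)
    {Λ : Type} [Countable Λ] [DecidableEq Λ] (I : Λ → Dy) (ν : Λ → ℕ) (w : Λ → ℝ × ℝ → ℂ)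
    (hw : ∀ k, MemLp (w k) 2 volume) {K : ℝ≥0∞} (hK : K ≠ ∞)
    (bes : ∀ (G : Finset Λ) (J : Dy) (n : ℕ), (∀ k ∈ G, I k = J ∧ ν k = n) → ∀ u, MemLp u 2 volume →
      ∑ k ∈ G, ‖∫ x in J.Q, w k x * u x‖ₑ ^ 2 * 2 ^ (2 * J.1 / p) ≤ K * bq u J) :
    ∃ S : HX hp hp1 →L[ℂ] ((dyW p hp hp1).comap I).F, ∀ F k,
      ((dyW p hp hp1).comap I).cd (S F) k = ∫ x in (I k).Q, w k x * rq L (fun z => fn F z (ν k)) (I k) x := by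
  obtain ⟨C, hC, hE⟩ := E1_vec hp hp1 L
  have bd : ∀ F : HX hp hp1, ((dyW p hp hp1).comap I).Ph (fun k => ‖∫ x in (I k).Q, w k x * rq L (fun z => fn F z (ν k)) (I k) x‖ₑ) ≤
      K ^ (p / 2) * C * ‖F‖ₑ := fun F => by
    have h1 := hE (fun n z => fn F z n) (co_hol (fn_hol F)) ‖F‖ₑ (fun r r0 r1 => by
      rw [fn_enorm]
      refine le_trans (le_of_eq ?_) (hpI_le p (fn F) r0.le r1)
      congr 1; ext1 t
      rw [← ell_sq, sq_rpow])
    rw [mul_assoc]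
    refine le_trans ?_ (mul_le_mul_right h1 _)
    rw [← lintegral_const_mul' _ _ (rpow_ne_top_of_nonneg (by positivity) hK)]
    refine lintegral_mono fun θ => ?_
    rw [← mul_rpow_of_nonneg _ _ (by positivity)]
    refine rpow_le_rpow ?_ (by positivity)
    unfold WS.sq
    have e1 : ∀ n, Ar (fun x => ‖Rop L (fun z => fn F z n) cp(x)‖ₑ ^ 2) θ =
        ∑' J : Dy, J.A.indicator (fun _ => bq (rq L (fun z => fn F z n) J) J) θ := fun n => by
      simp_rw [Ar_eq, rq_bq]
    simp_rw [e1]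
    rw [ENNReal.tsum_comm, ← ENNReal.tsum_prod, ENNReal.tsum_eq_iSup_sum]
    refine iSup_le fun G => ?_
    rw [← sum_fiberwise_of_maps_to (s := G) (t := G.image fun k => (I k, ν k)) (g := fun k => (I k, ν k))
      fun k hk => mem_image_of_mem _ hk]
    refine le_trans ?_ (mul_le_mul_right (ENNReal.sum_le_tsum (G.image fun k => (I k, ν k))) K)
    rw [mul_sum]
    refine sum_le_sum fun Jn _ => ?_
    obtain ⟨J, n⟩ := Jn
    have hG : ∀ k ∈ G.filter (fun k => (I k, ν k) = (J, n)), I k = J ∧ ν k = n := fun k hk => by simpa using (mem_filter.1 hk).2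
    by_cases hθ : θ ∈ J.A
    · simp only [indicator_of_mem hθ]
      refine le_trans (le_of_eq ?_) (bes _ J n hG _ (rq_mem L (co_hol (fn_hol F) n) J))
      refine sum_congr rfl fun k hk => ?_
      obtain ⟨h1, h2⟩ := hG k hk
      simp only [WS.comap, dyW, h1, h2, indicator_of_mem hθ]
    · simp only [indicator_of_notMem hθ, mul_zero, nonpos_iff_eq_zero]
      refine Finset.sum_eq_zero fun k hk => ?_
      simp only [WS.comap, dyW, (hG k hk).1, indicator_of_notMem hθ, mul_zero]
  have hKC : K ^ (p / 2) * C ≠ ∞ := by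
    have : K ^ (p / 2) ≠ ∞ := rpow_ne_top_of_nonneg (by positivity) hK
    finiteness
  have hfin : ∀ F : HX hp hp1, ((dyW p hp hp1).comap I).pn.N (fun k => ∫ x in (I k).Q, w k x * rq L (fun z => fn F z (ν k)) (I k) x) < ∞ :=
    fun F => lt_of_le_of_lt (bd F) (by finiteness)
  have hInt : ∀ (F : HX hp hp1) k, IntegrableOn (fun x => w k x * rq L (fun z => fn F z (ν k)) (I k) x) (I k).Q := fun F k =>
    ((hw k).integrable_mul (rq_mem L (co_hol (fn_hol F) _) _)).integrableOn
  let S0 : HX hp hp1 →ₗ[ℂ] ((dyW p hp hp1).comap I).F :=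
    { toFun := fun F => ((dyW p hp hp1).comap I).pn.mk' _ (hfin F)
      map_add' := fun F G => by
        apply PN.val_inj; ext1 k
        show (∫ x in (I k).Q, (_ : ℂ)) = (∫ x in (I k).Q, (_ : ℂ)) + ∫ x in (I k).Q, (_ : ℂ)
        rw [← integral_add (hInt F k) (hInt G k)]
        congr 1; ext1 x
        rw [← mul_add, ← rq_add L (co_hol (fn_hol F) _) (co_hol (fn_hol G) _)]; rfl
      map_smul' := fun c F => by
        apply PN.val_inj; ext1 k
        show (∫ x in (I k).Q, (_ : ℂ)) = c * ∫ x in (I k).Q, (_ : ℂ)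
        rw [← integral_const_mul]
        congr 1; ext1 x
        rw [mul_left_comm c, ← rq_smul L c]; rfl }
  refine ⟨⟨S0, AddMonoidHomClass.continuous_of_bound S0 (K ^ (p / 2) * C).toReal fun F => ?_⟩, fun F k => rfl⟩
  have h := toReal_mono (by finiteness) (bd F)
  rw [toReal_mul, toReal_enorm] at h
  exact h

lemma L2_sq (u : ℝ × ℝ → ℂ) : ∫⁻ x, ‖u x‖ₑ ^ 2 = eLpNorm u 2 volume ^ 2 := by
  rw [eLpNorm_eq_lintegral_rpow_enorm_toReal (by simp) (by simp), ← rpow_natCast, ← rpow_mul]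
  simp

lemma exists_hb {H : Type*} [NormedAddCommGroup H] [InnerProductSpace ℂ H] [CompleteSpace H]
    [TopologicalSpace.SeparableSpace H] : ∃ b : ℕ → H, ∀ u, HasSum (fun m => inner ℂ (b m) u • b m) u := by
  classical
  obtain ⟨w, b, hb⟩ := exists_hilbertBasis ℂ H
  have ho := b.orthonormal
  have hc : Countable w := by
    refine Pairwise.countable_of_isOpen_disjoint (s := fun i => ball (b i) (1 / 2)) (fun i j hij => ?_)
      (fun i => isOpen_ball) fun i => ⟨b i, Metric.mem_ball_self (by norm_num)⟩
    refine Metric.ball_disjoint_ball ?_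
    rw [dist_eq_norm]
    have h2 := norm_sub_sq (𝕜 := ℂ) (b i) (b j)
    rw [ho.1 i, ho.1 j, ho.2 hij] at h2
    simp at h2
    nlinarith [norm_nonneg (b i - b j)]
  obtain ⟨e, he⟩ := exists_injective_nat w
  refine ⟨Function.extend e b 0, fun u => ?_⟩
  have h := b.hasSum_repr u
  rw [← hasSum_extend_zero he] at h
  refine h.congr_fun fun m => ?_
  by_cases hm : ∃ i, e i = m
  · obtain ⟨i, rfl⟩ := hm
    rw [he.extend_apply, he.extend_apply, b.repr_apply_apply]
  · rw [Function.extend_apply' _ _ _ hm, Function.extend_apply' _ _ _ hm]; simp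

lemma exists_b : ∃ b : ℕ → ℝ × ℝ → ℂ, (∀ m, MemLp (b m) 2 volume) ∧
    (∀ u, MemLp u 2 volume → ∀ G : Finset ℕ, ∑ m ∈ G, ‖∫ x, (starRingEnd ℂ) (b m x) * u x‖ₑ ^ 2 ≤ ∫⁻ x, ‖u x‖ₑ ^ 2) ∧
    (∀ (c : ℕ → ℂ) (G : Finset ℕ), ∫⁻ x, ‖∑ m ∈ G, c m * b m x‖ₑ ^ 2 ≤ ∑ m ∈ G, ‖c m‖ₑ ^ 2) ∧
    ∀ u v, MemLp u 2 volume → MemLp v 2 volume →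
      HasSum (fun m => (∫ x, (starRingEnd ℂ) (b m x) * u x) * ∫ x, v x * b m x) (∫ x, v x * u x) := by
  have : Fact ((2 : ℝ≥0∞) ≠ ∞) := ⟨by simp⟩
  obtain ⟨b, hb⟩ := exists_hb (H := Lp ℂ 2 (volume : Measure (ℝ × ℝ)))
  have inn : ∀ (f : Lp ℂ 2 (volume : Measure (ℝ × ℝ))) (u : ℝ × ℝ → ℂ) (hu : MemLp u 2 volume),
      inner ℂ f (hu.toLp u) = ∫ x, (starRingEnd ℂ) (f x) * u x := fun f u hu => by
    rw [L2.inner_def]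
    apply integral_congr_ae
    filter_upwards [hu.coeFn_toLp] with x hx
    rw [hx, RCLike.inner_apply, mul_comm]
  have P2 : ∀ (u : Lp ℂ 2 (volume : Measure (ℝ × ℝ))) (G : Finset ℕ), ∑ m ∈ G, ‖inner ℂ (b m) u‖ ^ 2 ≤ ‖u‖ ^ 2 := fun u G => by
    have h := (hb u).mapL (innerSL ℂ u)
    simp only [innerSL_apply_apply, inner_smul_right] at h
    have h2 := h.mapL Complex.reCLM
    have h3 : HasSum (fun m => ‖inner ℂ (b m) u‖ ^ 2) (‖u‖ ^ 2) := by
      have e : Complex.reCLM (inner ℂ u u) = ‖u‖ ^ 2 := by rw [inner_self_eq_norm_sq_to_K]; norm_cast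
      rw [e] at h2
      refine h2.congr_fun fun m => ?_
      rw [← inner_conj_symm u (b m), Complex.mul_conj, Complex.normSq_eq_norm_sq]; norm_cast
    exact sum_le_hasSum G (fun _ _ => by positivity) h3
  have P1 : ∀ (c : ℕ → ℂ) (G : Finset ℕ), ‖∑ m ∈ G, c m • b m‖ ^ 2 ≤ ∑ m ∈ G, ‖c m‖ ^ 2 := fun c G => by
    have h1 : ‖∑ m ∈ G, c m • b m‖ ^ 2 ≤ ∑ m ∈ G, ‖c m‖ * ‖inner ℂ (b m) (∑ m ∈ G, c m • b m)‖ := by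
      have : ((‖∑ m ∈ G, c m • b m‖ ^ 2 : ℝ) : ℂ) = ∑ m ∈ G, (starRingEnd ℂ) (c m) * inner ℂ (b m) (∑ m ∈ G, c m • b m) := by
        have h := inner_self_eq_norm_sq_to_K (𝕜 := ℂ) (∑ m ∈ G, c m • b m)
        rw [sum_inner] at h
        simp only [inner_smul_left] at h
        rw [h]; norm_cast
      have h2 := congrArg norm this
      rw [Complex.norm_of_nonneg (by positivity)] at h2
      rw [h2]
      refine (norm_sum_le _ _).trans (le_of_eq (sum_congr rfl fun m _ => by simp))
    have h2 := Finset.sum_mul_sq_le_sq_mul_sq G (fun m => ‖c m‖) fun m => ‖inner ℂ (b m) (∑ m ∈ G, c m • b m)‖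
    have h3 := P2 (∑ m ∈ G, c m • b m) G
    have h4 : 0 ≤ ∑ m ∈ G, ‖c m‖ ^ 2 := by positivity
    generalize ‖∑ m ∈ G, c m • b m‖ ^ 2 = A at *
    generalize (∑ m ∈ G, ‖c m‖ * ‖inner ℂ (b m) (∑ m ∈ G, c m • b m)‖) = B at *
    generalize (∑ m ∈ G, ‖inner ℂ (b m) (∑ m ∈ G, c m • b m)‖ ^ 2) = D at *
    generalize (∑ m ∈ G, ‖c m‖ ^ 2) = E at *
    by_contra hh
    push Not at hh
    have : B ^ 2 ≤ E * A := h2.trans (by gcongr)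
    nlinarith
  refine ⟨fun m => b m, fun m => Lp.memLp _, fun u hu G => ?_, fun c G => ?_, fun u v hu hv => ?_⟩
  · have := ofReal_le_ofReal (P2 (hu.toLp u) G)
    rw [ofReal_sum_of_nonneg (fun _ _ => by positivity)] at this
    simp_rw [ofReal_pow (norm_nonneg _), ofReal_norm] at this
    rw [Lp.enorm_toLp] at this
    rw [L2_sq]
    refine le_trans (le_of_eq (sum_congr rfl fun m _ => ?_)) this
    rw [inn]
  · have := ofReal_le_ofReal (P1 c G)
    rw [ofReal_sum_of_nonneg (fun _ _ => by positivity)] at this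
    simp_rw [ofReal_pow (norm_nonneg _), ofReal_norm] at this
    refine le_trans (le_of_eq ?_) this
    rw [Lp.enorm_def, ← L2_sq]
    apply lintegral_congr_ae
    have h1 : ∀ᵐ x, ∀ m ∈ G, (c m • b m : Lp ℂ 2 (volume : Measure (ℝ × ℝ))) x = c m * b m x := by
      rw [Finset.eventually_all]
      intro m _
      filter_upwards [Lp.coeFn_smul (c m) (b m)] with x hx
      rw [hx]; rfl
    filter_upwards [h1, Lp.coeFn_finsetSum G (fun m => c m • b m)] with x hx hy
    rw [hy, Finset.sum_apply]
    rw [sum_congr rfl hx]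
  · have hv' : MemLp (fun x => (starRingEnd ℂ) (v x)) 2 volume := hv.star
    have h := (hb (hu.toLp u)).mapL (innerSL ℂ (hv'.toLp _))
    simp only [innerSL_apply_apply, inner_smul_right] at h
    have e1 : ∀ m, inner ℂ (hv'.toLp _) (b m) = ∫ x, v x * b m x := fun m => by
      rw [← inner_conj_symm, inn, ← integral_conj]
      congr 1; ext1 x; simp [mul_comm]
    have e2 : inner ℂ (hv'.toLp _) (hu.toLp u) = ∫ x, v x * u x := by
      rw [inn]
      apply integral_congr_ae
      filter_upwards [hv'.coeFn_toLp] with x hx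
      rw [hx]; simp
    rw [e2] at h
    refine h.congr_fun fun m => ?_
    rw [e1, inn]

/-- normalizing factor -/
def al (p : ℝ) (J : Dy) : ℂ := ((2 : ℝ) ^ (J.1 / p) : ℝ)

lemma al_ne (p : ℝ) (J : Dy) : al p J ≠ 0 := by unfold al; exact_mod_cast (Real.rpow_pos_of_pos two_pos _).ne'

lemma al_sq (p : ℝ) (J : Dy) : ‖al p J‖ₑ ^ 2 = 2 ^ (2 * J.1 / p) := by
  have h := Real.rpow_pos_of_pos (two_pos (α := ℝ)) (J.1 / p)
  unfold al
  rw [← ofReal_norm, norm_real, norm_eq_abs, abs_of_pos h, ← ofReal_rpow_of_pos two_pos,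
    ← rpow_natCast, ← rpow_mul]
  simp only [ofReal_ofNat]
  congr 1; push_cast; ring

lemma al_inv (p : ℝ) (J : Dy) : ‖(al p J)⁻¹‖ₑ ^ 2 * 2 ^ (2 * J.1 / p) = 1 := by
  rw [← al_sq, ← mul_pow, ← enorm_mul, inv_mul_cancel₀ (al_ne p J)]; simp

lemma TI_ind (l : ℕ) (I : Dy) (s : ℝ × ℝ → ℂ) (z : ℂ) : TI l I (I.Q.indicator s) z = TI l I s z := by
  unfold TI
  exact setIntegral_congr_fun I.measQ fun x hx => by simp only [indicator_of_mem hx]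

lemma TI_smul (l : ℕ) (I : Dy) (c : ℂ) (s : ℝ × ℝ → ℂ) (z : ℂ) : TI l I (fun x => c * s x) z = c * TI l I s z := by
  unfold TI
  rw [← integral_const_mul]
  congr 1; ext1 x; ring

lemma kz_mem (l : ℕ) (I : Dy) {z : ℂ} (hz : ‖z‖ < 1) : MemLp (I.Q.indicator (kz l z)) 2 volume := by
  have hi := kz_int l (s := I.Q.indicator fun _ => 1)
    (bdd_mem subset_rfl I.measQ aestronglyMeasurable_const (M := 1) (by simp)) I hz
  have hi' : AEStronglyMeasurable (kz l z) (volume.restrict I.Q) := hi.1.congr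
    ((ae_restrict_iff' I.measQ).2 (Eventually.of_forall fun x hx => by simp [indicator_of_mem hx]))
  refine bdd_mem subset_rfl I.measQ hi' (M := 2 ^ (l + 1) * 1 ^ l * (1 - ‖z‖)⁻¹ ^ (l + 1)) fun x hx => ?_
  have hb := Dy.Q_bd hx
  refine (kz_norm_le l hz hb.1 hb.2.1.le).trans ?_
  have : 0 ≤ (1 - ‖z‖)⁻¹ := inv_nonneg.2 (by linarith)
  have h0 : 0 ≤ 1 - x.1 := by linarith [hb.2.1]
  have h1 : 1 - x.1 ≤ 1 := by linarith [hb.1]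
  gcongr

lemma lev_tendsto : Tendsto Dy.lev atTop atTop :=
  tendsto_atTop_finset_of_monotone (fun a b hab I hI => Dy.mem_lev.2 ((Dy.mem_lev.1 hI).trans_le hab))
    fun I => ⟨I.1 + 1, Dy.mem_lev.2 (Nat.lt_succ_self _)⟩

/-- evaluation -/
def evH (hp : 0 < p) (hp1 : p ≤ 1) (z : ℂ) (n : ℕ) : HX hp hp1 →+ ℂ where
  toFun := fun F => fn F z n
  map_zero' := rfl
  map_add' := fun _ _ => rfl

theorem TS_exists (hp : 0 < p) (hp1 : p ≤ 1) :
    ∃ (T : ((dyW p hp hp1).comap fstDy).F →L[ℂ] HX hp hp1)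
      (S : HX hp hp1 →L[ℂ] ((dyW p hp hp1).comap fstDy).F), ∀ F, T (S F) = F := by
  obtain ⟨m, hm⟩ := exists_nat_gt (2 / p)
  have hL : 2 ≤ ((m + 1 : ℕ) + 1) * p := by rw [div_lt_iff₀ hp] at hm; push_cast; nlinarith
  obtain ⟨b, hb, P2, P1, P3⟩ := exists_b
  have hbc : ∀ m, MemLp (fun x => (starRingEnd ℂ) (b m x)) 2 volume := fun m => (hb m).star
  have hinj : ∀ (G : Finset (Dy × (ℕ × ℕ))) (J : Dy) (n : ℕ), (∀ k ∈ G, k.1 = J ∧ k.2.2 = n) →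
      InjOn (fun k : Dy × (ℕ × ℕ) => k.2.1) G := fun G J n h k hk k' hk' he => by
    have h1 := h k hk; have h2 := h k' hk'
    exact Prod.ext (h1.1.trans h2.1.symm) (Prod.ext he (h1.2.trans h2.2.symm))
  obtain ⟨T, τ, hτ, hT⟩ := T_gen m hp hp1 hL fstDy (fun k => k.2.2)
    (fun k => k.1.Q.indicator fun x => al p k.1 * b k.2.1 x)
    (fun k => ((hb k.2.1).const_mul _).indicator k.1.measQ) (fun k x hx => indicator_of_notMem hx _)
    (K := 1) (by simp) (by
      intro G c J n h
      have e1 : bq (fun x => ∑ k ∈ G, c k * k.1.Q.indicator (fun x => al p k.1 * b k.2.1 x) x) J =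
          ∫⁻ x in J.Q, 2 ^ (2 * J.1 / p) * ‖∑ k ∈ G.image (fun k => k.2.1), c (J, (k, n)) * b k x‖ₑ ^ 2 := by
        unfold bq
        refine setLIntegral_congr_fun J.measQ fun x hx => ?_
        simp only
        rw [← al_sq, ← mul_pow, ← enorm_mul, mul_sum, sum_image (hinj G J n h)]
        congr 2
        refine sum_congr rfl fun k hk => ?_
        obtain ⟨h1, h2⟩ := h k hk
        have h3 : (J, (k.2.1, n)) = k := Prod.ext h1.symm (Prod.ext rfl h2.symm)
        rw [h3, h1, indicator_of_mem hx]; ring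
      rw [e1, lintegral_const_mul' _ _ (by simp), one_mul, ← sum_mul, mul_comm]
      refine mul_le_mul_left ((setLIntegral_le_lintegral _ _).trans ((P1 _ _).trans (le_of_eq ?_))) _
      rw [sum_image (hinj G J n h)]
      refine sum_congr rfl fun k hk => ?_
      obtain ⟨h1, h2⟩ := h k hk
      rw [show (J, (k.2.1, n)) = k from Prod.ext h1.symm (Prod.ext rfl h2.symm)])
  have einn : ∀ (J : Dy) (k : ℕ) (u : ℝ × ℝ → ℂ), ∫ x in J.Q, (al p J)⁻¹ * (starRingEnd ℂ) (b k x) * u x =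
      (al p J)⁻¹ * ∫ x, (starRingEnd ℂ) (b k x) * J.Q.indicator u x := fun J k u => by
    rw [← integral_const_mul, ← integral_indicator J.measQ]
    congr 1; ext1 x
    by_cases hx : x ∈ J.Q
    · simp only [indicator_of_mem hx]; ring
    · simp [indicator_of_notMem hx]
  obtain ⟨S, hS⟩ := S_gen (m + 1 + 1) hp hp1 fstDy (fun k => k.2.2)
    (fun k x => (al p k.1)⁻¹ * (starRingEnd ℂ) (b k.2.1 x))
    (fun k => (hbc k.2.1).const_mul _)
    (K := 1) (by simp) (by
      intro G J n h u hu
      have e1 : bq u J = ∫⁻ x, ‖J.Q.indicator u x‖ₑ ^ 2 := by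
        unfold bq
        rw [← lintegral_indicator J.measQ]
        congr 1; ext1 x
        by_cases hx : x ∈ J.Q
        · simp [indicator_of_mem hx]
        · simp [indicator_of_notMem hx]
      rw [e1, one_mul]
      refine le_trans (le_of_eq ?_) (P2 _ (hu.indicator J.measQ) (G.image fun k => k.2.1))
      rw [sum_image (hinj G J n h)]
      refine sum_congr rfl fun k hk => ?_
      rw [(h k hk).1, einn, enorm_mul, mul_pow, mul_right_comm, al_inv, one_mul])
  refine ⟨T, S, fun F => fn_inj fun z hz => ?_⟩
  apply lp.ext; ext1 n
  have h1 := (hT (S F)).map (evH hp hp1 z n) (ev_cont z n)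
  have ev : ∀ k, (evH hp hp1 z n ∘ fun k => ((dyW p hp hp1).comap Prod.fst).cd (S F) k • τ k) k =
      ((dyW p hp hp1).comap Prod.fst).cd (S F) k * fn (τ k) z n := fun _ => rfl
  have h2 : ∀ J : Dy, HasSum (fun k : ℕ × ℕ => (evH hp hp1 z n ∘ fun k => ((dyW p hp hp1).comap Prod.fst).cd (S F) k • τ k) (J, k))
      (TI (m + 1) J (rq (m + 1 + 1) (fun w => fn F w n) J) z) := fun J => by
    have h3 := P3 _ _ (rq_mem (m + 1 + 1) (co_hol (fn_hol F) n) J) (kz_mem (m + 1) J hz)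
    have e3 : ∀ s : ℝ × ℝ → ℂ, ∫ x, J.Q.indicator (kz (m + 1) z) x * s x = TI (m + 1) J s z := fun s => by
      unfold TI
      rw [← integral_indicator J.measQ]
      congr 1; ext1 x
      by_cases hx : x ∈ J.Q
      · simp [indicator_of_mem hx]
      · simp [indicator_of_notMem hx]
    simp_rw [e3] at h3
    have hi : Function.Injective fun k : ℕ => (k, n) := fun a b h => (Prod.ext_iff.1 h).1
    rw [← hi.hasSum_iff]
    · refine h3.congr_fun fun k => ?_
      rw [Function.comp_apply, ev, hτ _ _ hz, hS]
      simp only [if_true]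
      rw [TI_ind, TI_smul, einn]
      have : J.Q.indicator (rq (m + 1 + 1) (fun w => fn F w n) J) = rq (m + 1 + 1) (fun w => fn F w n) J := by
        unfold rq; rw [Set.indicator_indicator, Set.inter_self]
      rw [this, mul_mul_mul_comm, mul_comm (al p J)⁻¹, mul_assoc, mul_left_comm, mul_comm (al p J) _]
      have ha := al_ne p J
      field_simp
    · intro k hk
      rw [ev, hτ _ _ hz, if_neg, mul_zero]
      rintro rfl
      exact hk ⟨k.1, rfl⟩
  have h3 : Tendsto _ atTop _ := (h1.prod_fiberwise h2)
  have h4 := h3.comp lev_tendsto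
  refine tendsto_nhds_unique h4 ((repr_box (m + 1) (co_hol (fn_hol F) n) hz).congr fun N => ?_)
  exact sum_congr rfl fun J _ => (rq_TI _ _ _ _ _).symm

lemma tc_uniq {f : ℂ → ℂ} {c : ℕ → ℂ} (h : ∀ z, ‖z‖ < 1 → HasSum (fun n => c n * z ^ n) (f z)) (n : ℕ) :
    tc f n = c n := by
  have key : ∀ b : ℕ → ℂ, (∀ z, ‖z‖ < 1 → HasSum (fun n => b n * z ^ n) (f z)) →
      ∫ t in (0 : ℝ)..1, Ec (-t) ^ n * f (2⁻¹ * Ec t) = b n * 2⁻¹ ^ n := fun b hb => by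
    rw [← pars_one n (b := fun n => b n * 2⁻¹ ^ n) (hb 2⁻¹ (by norm_num)).summable.norm]
    congr 1; ext1 t
    rw [← (hb (2⁻¹ * Ec t) (by rw [norm_mul, Ec_norm]; norm_num)).tsum_eq]
    simp_rw [mul_pow, mul_assoc]
  have h1 := (key _ fun z hz => tc_hasSum (pow_hol h) hz).symm.trans (key c h)
  exact mul_right_cancel₀ (pow_ne_zero n (by norm_num)) h1

lemma Rop_TI (l : ℕ) (I : Dy) {s : ℝ × ℝ → ℂ} (hs : MemLp s 2 volume)
    (hs' : MemLp (fun x => s x / ((1 - x.1 ^ 2 : ℝ) : ℂ)) 2 volume) {z : ℂ} (hz : ‖z‖ < 1) :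
    Rop (l + 1) (TI l I s) z = (l + 1) * TI (l + 1) I (fun x => s x / ((1 - x.1 ^ 2 : ℝ) : ℂ)) z := by
  have h1 := Rop_hasSum (l + 1) (TI_hol l hs I) hz
  refine h1.unique (((mo_hasSum (l + 1) I.measQ (Q_sub I) (s_int hs' I) hz).mul_left _).congr_fun fun n => ?_)
  rw [tc_uniq (f := TI l I s) (fun z hz => mo_hasSum l I.measQ (Q_sub I) (s_int hs I) hz), ← mul_assoc]
  congr 1
  unfold mo
  rw [← integral_const_mul, ← integral_const_mul]
  refine setIntegral_congr_fun I.measQ fun x hx => ?_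
  have hb := Dy.Q_bd hx
  have h0 : (1 - x.1 ^ 2 : ℝ) ≠ 0 := by nlinarith [hb.1, hb.2.1]
  have hbt : (n + (l + 1) : ℝ) * bt l n = (l + 1) * bt (l + 1) n := by
    have := Nat.add_one_mul_choose_eq (n + l) l
    unfold bt
    rw [show n + (l + 1) = n + l + 1 by ring, mul_comm (l + 1 : ℝ)]
    exact_mod_cast this
  have hr : rw1 (l + 1) x.1 = rw1 l x.1 * (1 - x.1 ^ 2) := by unfold rw1; ring
  have h0' : ((1 - x.1 ^ 2 : ℝ) : ℂ) ≠ 0 := by exact_mod_cast h0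
  have hbt' : (n + (l + 1) : ℂ) * (bt l n : ℝ) = (l + 1) * (bt (l + 1) n : ℝ) := by exact_mod_cast hbt
  simp only
  rw [hr]
  simp only [Complex.ofReal_mul] at *
  field_simp
  push_cast at *
  linear_combination (rw1 l x.1 * x.1 ^ n * Ec (-x.2) ^ n * s x : ℂ) * hbt'

lemma re_near (N : ℕ) : ∃ η > 0, ∀ δ : ℂ, ‖δ‖ ≤ η → 1 / 2 ≤ ((1 + δ)⁻¹ ^ N).re := by
  have hc : ContinuousAt (fun δ : ℂ => ((1 + δ)⁻¹ ^ N).re) 0 := by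
    refine Complex.continuous_re.continuousAt.comp (ContinuousAt.pow (ContinuousAt.inv₀ (by fun_prop) (by simp)) _)
  have := hc.eventually (lt_mem_nhds (show (1 / 2 : ℝ) < _ by norm_num))
  obtain ⟨ε, h0, h⟩ := Metric.eventually_nhds_iff.1 this
  exact ⟨ε / 2, by linarith, fun δ hδ => (h (by simpa using by linarith)).le⟩

lemma bq_bd {s : ℝ × ℝ → ℂ} {J : Dy} {M : ℝ} (h : ∀ x ∈ J.Q, ‖s x‖ ≤ M / J.len) : bq s J ≤ ofReal (M ^ 2) := by
  have hl := J.len_pos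
  unfold bq
  calc ∫⁻ x in J.Q, ‖s x‖ₑ ^ 2 ≤ ∫⁻ x in J.Q, ofReal ((M / J.len) ^ 2) := by
        refine setLIntegral_mono' J.measQ fun x hx => ?_
        rw [← ofReal_norm, ← ofReal_pow (norm_nonneg _)]
        have := h x hx
        gcongr
    _ = ofReal (M ^ 2 / 2) := by
        rw [lintegral_const, Measure.restrict_apply_univ, Dy.volQ, ← ofReal_mul (by positivity)]
        congr 1; field_simp
    _ ≤ _ := ofReal_le_ofReal (by nlinarith [sq_nonneg M])

lemma den_low {N : ℕ} {η c : ℝ} (hη : ∀ δ : ℂ, ‖δ‖ ≤ η → 1 / 2 ≤ ((1 + δ)⁻¹ ^ N).re) (hc : 16 * c ≤ η)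
    {J : Dy} {x y : ℝ × ℝ} (hx : x ∈ J.Q) (hy : y ∈ J.Q) (h : |y.2 - x.2| ≤ c * J.len) :
    (2 * J.len)⁻¹ ^ N / 2 ≤ ((1 - (x.1 : ℂ) * Ec (-x.2) * circlePt y.1 y.2)⁻¹ ^ N).re := by
  have hl := J.len_pos
  obtain ⟨x0, x1, x2, x3, -⟩ := Dy.Q_bd hx
  obtain ⟨y0, y1, y2, y3, -⟩ := Dy.Q_bd hy
  have hxy : x.1 * y.1 ≤ x.1 := by nlinarith
  have hd0 : 0 < 1 - x.1 * y.1 := by linarith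
  have hxy0 := mul_nonneg x0 y0
  have e : (1 - (x.1 : ℂ) * Ec (-x.2) * circlePt y.1 y.2) = ((1 - x.1 * y.1 : ℝ) : ℂ) *
      (1 + ((x.1 * y.1 / (1 - x.1 * y.1) : ℝ) : ℂ) * (Ec 0 - Ec (y.2 - x.2))) := by
    have h0 : (1 - x.1 * y.1 : ℂ) ≠ 0 := by exact_mod_cast hd0.ne'
    rw [circlePt_eq, sub_eq_add_neg y.2, Ec_add, Ec_zero]; push_cast; field_simp; ring
  have hn : ‖((x.1 * y.1 / (1 - x.1 * y.1) : ℝ) : ℂ) * (Ec 0 - Ec (y.2 - x.2))‖ ≤ η := by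
    rw [norm_mul, Complex.norm_of_nonneg (by positivity)]
    have h1 : x.1 * y.1 / (1 - x.1 * y.1) ≤ 2 / J.len := by rw [div_le_div_iff₀ hd0 hl]; nlinarith
    have h2 := Ec_lip 0 (y.2 - x.2)
    rw [zero_sub, abs_neg] at h2
    have h3 : 2 * Real.pi * |y.2 - x.2| ≤ 8 * (c * J.len) := by
      have := Real.pi_le_four
      have := abs_nonneg (y.2 - x.2)
      nlinarith [pi_pos]
    calc _ ≤ 2 / J.len * (8 * (c * J.len)) := mul_le_mul h1 (h2.trans h3) (norm_nonneg _) (by positivity)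
      _ = 16 * c := by field_simp; ring
      _ ≤ η := hc
  rw [e, mul_inv (_ : ℂ), mul_pow (_ : ℂ), ← Complex.ofReal_inv, ← Complex.ofReal_pow, re_ofReal_mul, div_eq_mul_one_div]
  have : (2 * J.len)⁻¹ ≤ (1 - x.1 * y.1)⁻¹ := inv_anti₀ hd0 (by nlinarith)
  have h5 := hη _ hn
  gcongr

lemma box_exists (m : ℕ) : ∃ K : ℝ, ∀ J : Dy, ∃ s w : ℝ × ℝ → ℂ, MemLp s 2 volume ∧ MemLp w 2 volume ∧
    (∀ x ∉ J.Q, s x = 0) ∧ bq s J ≤ ofReal (K ^ 2) ∧ bq w J ≤ ofReal (K ^ 2) ∧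
    ∫ x in J.Q, w x * rq (m + 1 + 1) (TI (m + 1) J s) J x = 1 := by
  obtain ⟨η, hη0, hη⟩ := re_near (m + 1 + 1 + 1)
  obtain ⟨c, hc0, hc1, hcη⟩ : ∃ c : ℝ, 0 < c ∧ c ≤ 1 ∧ 16 * c ≤ η :=
    ⟨min 1 (η / 16), by positivity, min_le_left _ _, by have := min_le_right 1 (η / 16); linarith⟩
  obtain ⟨a, ha⟩ : ∃ a : ℝ, a = (m + 2) * c / (8 * 2 ^ (m + 3)) := ⟨_, rfl⟩
  have ha0 : 0 < a := by rw [ha]; positivity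
  refine ⟨max (2 ^ (m + 2)) (4 / (a * c)), fun J => ?_⟩
  have hl := J.len_pos
  have hl1 := J.len_le_one
  obtain ⟨E, hE⟩ : ∃ E : Set (ℝ × ℝ), E = Ico (1 - 3 / 4 * J.len) (1 - J.len / 2) ×ˢ Ico J.lf (J.lf + c * J.len) := ⟨_, rfl⟩
  have hEm : MeasurableSet E := by rw [hE]; exact measurableSet_Ico.prod measurableSet_Ico
  have hEQ : E ⊆ J.Q := by
    rw [hE]
    refine Set.prod_mono (Set.Ico_subset_Ico_left (by linarith)) (Set.Ico_subset_Ico_right (by nlinarith))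
  have hEv : volume E = ofReal (c * J.len ^ 2 / 4) := by
    rw [hE, Measure.volume_eq_prod, Measure.prod_prod, Real.volume_Ico, Real.volume_Ico,
      ← ofReal_mul (by linarith)]
    congr 1; ring
  have hEr : volume.real E = c * J.len ^ 2 / 4 := by rw [Measure.real, hEv, toReal_ofReal (by positivity)]
  obtain ⟨g, hg⟩ : ∃ g : ℝ × ℝ → ℝ, g = fun x => J.len ^ m / rw1 (m + 1) x.1 := ⟨_, rfl⟩
  have hgm : Measurable g := by rw [hg]; exact ((rw1_cont _).measurable.comp measurable_fst).const_div _
  have hE1 : ∀ x ∈ E, 1 / 4 ≤ x.1 ∧ J.len / 2 ≤ 1 - x.1 ^ 2 := fun x hx => by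
    have hb := Dy.Q_bd (hEQ hx)
    rw [hE] at hx
    have h1 : 1 / 4 ≤ x.1 := by linarith [hx.1.1]
    exact ⟨h1, by nlinarith⟩
  have hrw : ∀ x ∈ E, 2⁻¹ * (J.len / 2) ^ (m + 1) ≤ rw1 (m + 1) x.1 := fun x hx => by
    obtain ⟨h1, h2⟩ := hE1 x hx
    unfold rw1
    have : 2⁻¹ ≤ 2 * x.1 := by linarith
    gcongr
  have hgb : ∀ x ∈ E, ‖(g x : ℂ)‖ ≤ 2 ^ (m + 2) / J.len := fun x hx => by
    have h1 := hrw x hx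
    have h2 : 0 < 2⁻¹ * (J.len / 2) ^ (m + 1) := by positivity
    rw [norm_real, norm_eq_abs, hg]
    simp only
    rw [abs_of_nonneg (div_nonneg (by positivity) (h2.le.trans h1))]
    refine (div_le_div_of_nonneg_left (by positivity) h2 h1).trans (le_of_eq ?_)
    field_simp; rw [div_pow]; field_simp; ring
  have hs : MemLp (E.indicator fun x => (g x : ℂ)) 2 volume :=
    bdd_mem hEQ hEm (Complex.measurable_ofReal.comp hgm).aestronglyMeasurable hgb
  have hs' : MemLp (fun x => E.indicator (fun x => (g x : ℂ)) x / ((1 - x.1 ^ 2 : ℝ) : ℂ)) 2 volume := by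
    have e : (fun x => E.indicator (fun x => (g x : ℂ)) x / ((1 - x.1 ^ 2 : ℝ) : ℂ)) =
        E.indicator fun x => (g x : ℂ) / ((1 - x.1 ^ 2 : ℝ) : ℂ) := by
      ext1 x; by_cases hx : x ∈ E <;> simp [hx]
    rw [e]
    refine bdd_mem hEQ hEm (Measurable.aestronglyMeasurable ?_) (M := 2 ^ (m + 2) / J.len / (J.len / 2)) fun x hx => ?_
    · exact (Complex.measurable_ofReal.comp hgm).div (Complex.measurable_ofReal.comp (by fun_prop))
    · have h1 := hgb x hx
      have h2 := (hE1 x hx).2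
      rw [norm_div, norm_real (1 - x.1 ^ 2), norm_eq_abs, abs_of_nonneg (by linarith)]
      gcongr
  obtain ⟨h, hh⟩ : ∃ h : ℝ × ℝ → ℂ, h = fun x => Rop (m + 1 + 1) (TI (m + 1) J (E.indicator fun x => (g x : ℂ))) cp(x) := ⟨_, rfl⟩
  have hlow : ∀ y ∈ E, a / J.len ≤ ‖h y‖ := fun y hy => by
    have hz : ‖circlePt y.1 y.2‖ < 1 := by
      have hb := Dy.Q_bd (hEQ hy)
      rw [circlePt_norm, abs_of_nonneg hb.1]; exact hb.2.1
    refine le_trans ?_ (Complex.re_le_norm _)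
    rw [hh]; simp only
    rw [Rop_TI _ _ hs hs' hz, show ((m + 1 : ℕ) + 1 : ℂ) = ((m + 2 : ℝ) : ℂ) by push_cast; ring, re_ofReal_mul]
    unfold TI
    have hInt := kz_int (m + 1 + 1) hs' J hz
    have h1 : ∫ x in J.Q, E.indicator (fun _ => J.len ^ m * ((2 * J.len)⁻¹ ^ (m + 3) / 2)) x ≤
        ∫ x in J.Q, (kz (m + 1 + 1) (circlePt y.1 y.2) x * (E.indicator (fun x => (g x : ℂ)) x / ((1 - x.1 ^ 2 : ℝ) : ℂ))).re := by
      refine setIntegral_mono_on ?_ hInt.re J.measQ fun x hx => ?_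
      · exact (integrable_indicator_iff hEm).2 (integrableOn_const (by
          rw [Measure.restrict_apply hEm]; exact ne_top_of_le_ne_top (Q_fin J) (measure_mono Set.inter_subset_right)))
      · by_cases hxE : x ∈ E
        · simp only [indicator_of_mem hxE]
          have hd := den_low hη hcη hx (hEQ hy) (by
            rw [hE] at hxE hy
            rw [abs_le]; constructor <;> linarith [hxE.2.1, hxE.2.2, hy.2.1, hy.2.2])
          have e1 : kz (m + 1 + 1) (circlePt y.1 y.2) x * ((g x : ℂ) / ((1 - x.1 ^ 2 : ℝ) : ℂ)) =
              ((J.len ^ m : ℝ) : ℂ) * (1 - (x.1 : ℂ) * Ec (-x.2) * circlePt y.1 y.2)⁻¹ ^ (m + 1 + 1 + 1) := by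
            obtain ⟨h1, h2⟩ := hE1 x hxE
            have h3 : ((1 - x.1 ^ 2 : ℝ) : ℂ) ≠ 0 := by
              have : (1 - x.1 ^ 2 : ℝ) ≠ 0 := by linarith
              exact_mod_cast this
            have h4 : (x.1 : ℂ) ≠ 0 := by
              have : x.1 ≠ 0 := by linarith
              exact_mod_cast this
            rw [hg]; unfold kz rw1
            simp only [Complex.ofReal_mul, Complex.ofReal_div, Complex.ofReal_pow]
            have h6 : ((2 : ℝ) : ℂ) ≠ 0 := by norm_num
            generalize ((1 - x.1 ^ 2 : ℝ) : ℂ) = u at h3 ⊢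
            generalize ((1 - (x.1 : ℂ) * Ec (-x.2) * circlePt y.1 y.2)⁻¹) = v
            generalize ((2 : ℝ) : ℂ) = q at h6 ⊢
            field_simp; ring
          rw [e1, re_ofReal_mul]
          gcongr
        · simp [hxE]
    rw [setIntegral_indicator hEm, Set.inter_eq_right.2 hEQ, setIntegral_const, hEr] at h1
    have h2 : a / J.len = (m + 2) * (c * J.len ^ 2 / 4) • (J.len ^ m * ((2 * J.len)⁻¹ ^ (m + 3) / 2)) := by
      rw [ha, smul_eq_mul, inv_pow, mul_pow]; field_simp; ring
    rw [h2, mul_smul_comm, ← mul_smul_comm]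
    have h3 : (∫ x in J.Q, kz (m + 1 + 1) (circlePt y.1 y.2) x * (E.indicator (fun x => (g x : ℂ)) x / ((1 - x.1 ^ 2 : ℝ) : ℂ))).re =
      ∫ x in J.Q, (kz (m + 1 + 1) (circlePt y.1 y.2) x * (E.indicator (fun x => (g x : ℂ)) x / ((1 - x.1 ^ 2 : ℝ) : ℂ))).re := (integral_re hInt).symm
    rw [h3]
    gcongr
  have hpos : ∀ y ∈ E, h y ≠ 0 := fun y hy h0 => by
    have := hlow y hy
    rw [h0, norm_zero] at this
    exact absurd this (not_le.2 (by positivity))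
  have hwb : ∀ y ∈ E, ‖(h y * (c * J.len ^ 2 / 4 : ℝ))⁻¹‖ ≤ 4 / (a * c) / J.len := fun y hy => by
    rw [norm_inv, norm_mul, norm_real, norm_eq_abs, abs_of_pos (by positivity)]
    have h1 : a / J.len * (c * J.len ^ 2 / 4) ≤ ‖h y‖ * (c * J.len ^ 2 / 4) := by
      have := hlow y hy
      gcongr
    refine (inv_anti₀ (by positivity) h1).trans (le_of_eq ?_)
    field_simp
  have hhc : ContinuousOn h J.Q := by rw [hh]; exact rop_cont _ (TI_hol _ hs J) J
  have indb : ∀ (u : ℝ × ℝ → ℂ) (M M' : ℝ), 0 ≤ M → M ≤ M' → (∀ x ∈ E, ‖u x‖ ≤ M / J.len) → bq (E.indicator u) J ≤ ofReal (M' ^ 2) := fun u M M' h0 hM hu => by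
    refine bq_bd fun x _ => ?_
    by_cases hx : x ∈ E
    · rw [indicator_of_mem hx]; exact (hu x hx).trans (by gcongr)
    · rw [indicator_of_notMem hx, norm_zero]; exact div_nonneg (h0.trans hM) hl.le
  refine ⟨E.indicator fun x => (g x : ℂ), E.indicator fun y => (h y * (c * J.len ^ 2 / 4 : ℝ))⁻¹, hs,
    bdd_mem hEQ hEm (ContinuousOn.aestronglyMeasurable ?_ hEm) hwb,
    fun x hx => indicator_of_notMem (fun h' => hx (hEQ h')) _,
    indb _ _ _ (by positivity) (le_max_left _ _) hgb, indb _ _ _ (by positivity) (le_max_right _ _) hwb, ?_⟩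
  · refine ContinuousOn.inv₀ ((hhc.mono hEQ).mul continuousOn_const) fun y hy => mul_ne_zero (hpos y hy) ?_
    exact_mod_cast (show c * J.len ^ 2 / 4 ≠ 0 by positivity)
  · have e : ∫ x in J.Q, E.indicator (fun y => (h y * (c * J.len ^ 2 / 4 : ℝ))⁻¹) x * rq (m + 1 + 1) (TI (m + 1) J (E.indicator fun x => (g x : ℂ))) J x =
        ∫ x in J.Q, E.indicator (fun _ => ((c * J.len ^ 2 / 4 : ℝ) : ℂ)⁻¹) x := by
      refine setIntegral_congr_fun J.measQ fun x hx => ?_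
      by_cases hxE : x ∈ E
      · have h1 : rq (m + 1 + 1) (TI (m + 1) J (E.indicator fun x => (g x : ℂ))) J x = h x := by
          rw [hh]; exact indicator_of_mem hx _
        simp only [indicator_of_mem hxE, h1]
        rw [mul_inv, mul_right_comm, inv_mul_cancel₀ (hpos x hxE), one_mul]
      · simp [hxE]
    rw [e, setIntegral_indicator hEm, Set.inter_eq_right.2 hEQ, setIntegral_const, hEr, Complex.real_smul,
      mul_inv_cancel₀]
    exact_mod_cast (show c * J.len ^ 2 / 4 ≠ 0 by positivity)

lemma cd_ext {Ω K : Type*} [MeasurableSpace Ω] [Countable K] (W : WS Ω K) {c d : W.F} (h : ∀ k, W.cd c k = W.cd d k) : c = d :=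
  PN.val_inj (funext h)

theorem TS2_exists (hp : 0 < p) (hp1 : p ≤ 1) :
    ∃ (T : ((dyW p hp hp1).comap fstDy).F →L[ℂ] HX hp hp1)
      (S : HX hp hp1 →L[ℂ] ((dyW p hp hp1).comap fstDy).F), ∀ c, S (T c) = c := by
  obtain ⟨m, hm⟩ := exists_nat_gt (2 / p)
  have hL : 2 ≤ ((m + 1 : ℕ) + 1) * p := by rw [div_lt_iff₀ hp] at hm; push_cast; nlinarith
  obtain ⟨ν, hν⟩ := Countable.exists_injective_nat (Dy × (ℕ × ℕ))
  obtain ⟨K, hK⟩ := box_exists m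
  choose s w hs hw s0 sb wb hsw using hK
  have hG : ∀ (G : Finset (Dy × (ℕ × ℕ))) (J : Dy) (n : ℕ), (∀ k ∈ G, k.1 = J ∧ ν k = n) →
      G = ∅ ∨ ∃ k, G = {k} ∧ k.1 = J := fun G J n h => by
    rcases G.eq_empty_or_nonempty with h1 | ⟨k, hk⟩
    · exact Or.inl h1
    · refine Or.inr ⟨k, Finset.eq_singleton_iff_unique_mem.2 ⟨hk, fun j hj => hν ?_⟩, (h k hk).1⟩
      rw [(h j hj).2, (h k hk).2]
  obtain ⟨T, τ, hτ, hT⟩ := T_gen m hp hp1 hL fstDy ν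
    (fun k x => al p k.1 * s k.1 x) (fun k => (hs k.1).const_mul _) (fun k x hx => by rw [s0 k.1 x hx, mul_zero])
    (K := ofReal (K ^ 2)) (by simp) (by
      intro G c J n h
      rcases hG G J n h with rfl | ⟨k, rfl, rfl⟩
      · simp [bq]
      · simp only [sum_singleton]
        unfold bq at *
        simp_rw [enorm_mul, mul_pow, ← mul_assoc, al_sq]
        rw [lintegral_const_mul' _ _ (by finiteness), mul_comm]
        rw [mul_assoc]
        exact mul_le_mul_left (sb k.1) _)
  obtain ⟨S, hS⟩ := S_gen (m + 1 + 1) hp hp1 fstDy ν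
    (fun k x => (al p k.1)⁻¹ * w k.1 x) (fun k => (hw k.1).const_mul _)
    (K := ofReal (K ^ 2)) (by simp) (by
      intro G J n h u hu
      rcases hG G J n h with rfl | ⟨k, rfl, rfl⟩
      · simp
      · simp only [sum_singleton, mul_assoc]
        rw [integral_const_mul, enorm_mul, mul_pow, mul_right_comm, al_inv, one_mul]
        have h1 := lint_CS (volume.restrict k.1.Q) ((hw k.1).restrict k.1.Q).1.enorm (hu.restrict k.1.Q).1.enorm
        calc _ ≤ (∫⁻ x in k.1.Q, ‖w k.1 x‖ₑ * ‖u x‖ₑ) ^ 2 := by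
              gcongr
              refine (enorm_integral_le_lintegral_enorm _).trans (le_of_eq ?_)
              simp_rw [enorm_mul]
          _ ≤ _ := h1.trans (mul_le_mul_left (wb k.1) _))
  refine ⟨T, S, fun c => cd_ext _ fun k => ?_⟩
  have h1 := ((hT c).mapL S).mapL (((dyW p hp hp1).comap Prod.fst).cdL k)
  simp only [map_smul, WS.cdL_apply, smul_eq_mul] at h1
  have h2 := hasSum_single (f := fun j => ((dyW p hp hp1).comap Prod.fst).cd c j * ((dyW p hp hp1).comap Prod.fst).cd (S (τ j)) k) k (fun j hj => by
    rw [hS, rq_congr (g := fun _ => 0) _ (fun z hz => by rw [hτ _ _ hz, if_neg fun h => hj (hν h).symm])]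
    have : rq (m + 1 + 1) (fun _ => (0 : ℂ)) k.1 = 0 := by unfold rq Rop; simp; rfl
    simp [this])
  rw [h1.unique h2, hS, rq_congr (g := fun z => al p k.1 * TI (m + 1) k.1 (s k.1) z) _
    (fun z hz => by rw [hτ _ _ hz, if_pos rfl, TI_smul])]
  simp_rw [rq_smul]
  have ha := al_ne p k.1
  have e : ∀ x, (al p k.1)⁻¹ * w k.1 x * (al p k.1 * rq (m + 1 + 1) (fun z => TI (m + 1) k.1 (s k.1) z) k.1 x) =
      w k.1 x * rq (m + 1 + 1) (TI (m + 1) k.1 (s k.1)) k.1 x := fun x => by field_simp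
  simp_rw [e, hsw, mul_one]

/-- contractions of a `p`-normed space -/
def PN.map {M : Type*} [AddCommGroup M] [Module ℂ M] (n : PN M) (A : M →ₗ[ℂ] M) (h : ∀ x, n.N (A x) ≤ n.N x) :
    n.Sp →L[ℂ] n.Sp :=
  let A0 : n.Sp →ₗ[ℂ] n.Sp :=
    { toFun := fun x => n.mk' (A (n.val x)) ((h _).trans_lt (PN.val_lt x))
      map_add' := fun x y => PN.val_inj (map_add A _ _)
      map_smul' := fun c x => PN.val_inj (map_smul A _ _) }
  ⟨A0, AddMonoidHomClass.continuous_of_bound A0 1 fun x => by rw [one_mul]; exact toReal_mono (PN.val_lt x).ne (h _)⟩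

lemma PN.square {M : Type*} [AddCommGroup M] [Module ℂ M] (n : PN M) (A B : Bool → M →ₗ[ℂ] M)
    (hA : ∀ i x, n.N (A i x) ≤ n.N x) (hB : ∀ i x, n.N (B i x) ≤ n.N x)
    (h1 : ∀ i j x, A i (B j x) = if i = j then x else 0) (h2 : ∀ x, B true (A true x) + B false (A false x) = x) :
    Nonempty (n.Sp ≃L[ℂ] n.Sp × n.Sp) := by
  refine ⟨ContinuousLinearEquiv.equivOfInverse ((n.map (A true) (hA _)).prod (n.map (A false) (hA _)))
    ((n.map (B true) (hB _)).coprod (n.map (B false) (hB _))) (fun x => PN.val_inj (h2 _)) fun x => ?_⟩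
  refine Prod.ext (PN.val_inj ?_) (PN.val_inj ?_)
  · show A true (B true (n.val x.1) + B false (n.val x.2)) = n.val x.1
    rw [map_add, h1, h1]; simp
  · show A false (B true (n.val x.1) + B false (n.val x.2)) = n.val x.2
    rw [map_add, h1, h1]; simp

/-- splitting of the natural numbers -/
def ka (i : Bool) (n : ℕ) : ℕ := 2 * n + i.toNat
lemma ka_inj (i : Bool) : Function.Injective (ka i) := fun a b h => by simp only [ka] at h; omega
lemma ka_ne {i j : Bool} (h : i ≠ j) (a b : ℕ) : ka i a ≠ ka j b := by
  cases i <;> cases j <;> simp [ka] at * <;> omega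
lemma ka_sur (n : ℕ) : ∃ i k, ka i k = n := by
  rcases Nat.even_or_odd n with ⟨k, h⟩ | ⟨k, h⟩
  · exact ⟨false, k, by simp [ka]; omega⟩
  · exact ⟨true, k, by simp [ka]; omega⟩

/-- splitting of the index set -/
def kj (i : Bool) (k : Dy × (ℕ × ℕ)) : Dy × (ℕ × ℕ) := (k.1, (ka i k.2.1, k.2.2))

lemma kj_inj (i : Bool) : Function.Injective (kj i) := by
  rintro ⟨a, b, c⟩ ⟨a', b', c'⟩ h
  simp only [kj, Prod.mk.injEq] at h
  rw [h.1, ka_inj i h.2.1, h.2.2]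

lemma kj_ne {i j : Bool} (h : i ≠ j) (k : Dy × (ℕ × ℕ)) : ¬ ∃ k', kj j k' = kj i k := by
  rintro ⟨k', h'⟩
  simp only [kj, Prod.mk.injEq] at h'
  exact ka_ne h.symm _ _ h'.2.1

lemma F_square {Ω : Type*} [MeasurableSpace Ω] (B : WS Ω Dy) :
    Nonempty ((B.comap fstDy).F ≃L[ℂ]
      (B.comap fstDy).F × (B.comap fstDy).F) := by
  have hd : ∀ i j (x : Dy × (ℕ × ℕ) → ℂ) k, Function.extend (kj j) x 0 (kj i k) = if i = j then x k else 0 := fun i j x k => by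
    split_ifs with h
    · subst h; exact (kj_inj i).extend_apply x 0 k
    · exact Function.extend_apply' _ _ _ (kj_ne h k)
  refine PN.square _ (fun i => LinearMap.funLeft ℂ ℂ (kj i))
    (fun i => Function.ExtendByZero.linearMap ℂ (kj i)) (fun i x => ?_) (fun i x => ?_)
    (fun i j x => ?_) fun x => ?_
  · refine lintegral_mono fun θ => rpow_le_rpow ?_ (WS.hp2 _).le
    exact tsum_comp_le_tsum_of_injective (kj_inj i) fun k => ‖x k‖ₑ ^ 2 * B.g k.1 θ
  · refine lintegral_mono fun θ => rpow_le_rpow (le_of_eq ?_) (WS.hp2 _).le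
    show ∑' k : Dy × (ℕ × ℕ), ‖Function.extend (kj i) x 0 k‖ₑ ^ 2 * B.g k.1 θ = ∑' k : Dy × (ℕ × ℕ), ‖x k‖ₑ ^ 2 * B.g k.1 θ
    rw [← (kj_inj i).tsum_eq]
    · simp_rw [(kj_inj i).extend_apply]; rfl
    · intro k hk
      by_contra h
      exact hk (by simp [Function.extend_apply' _ _ _ h])
  · ext1 k
    refine (hd i j x k).trans ?_
    split_ifs <;> rfl
  · ext1 k
    show Function.extend (kj true) (fun k => x (kj true k)) 0 k + Function.extend (kj false) (fun k => x (kj false k)) 0 k = x k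
    obtain ⟨a, b, c⟩ := k
    obtain ⟨i, b', rfl⟩ := ka_sur b
    rw [show (a, (ka i b', c)) = kj i (a, (b', c)) from rfl, hd, hd]
    cases i <;> simp

/-- restriction of sequences -/
def rsL (i : Bool) : ELL2 →L[ℂ] ELL2 :=
  LinearMap.mkContinuous
    { toFun := fun v => ⟨fun n => v (ka i n), memℓp_gen ((lp.memℓp v).summable (by norm_num) |>.comp_injective (ka_inj i))⟩
      map_add' := fun _ _ => rfl
      map_smul' := fun _ _ => rfl } 1 fun v => by
    rw [one_mul, ← toReal_enorm, ← toReal_enorm]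
    refine toReal_mono (by simp) ((ENNReal.pow_le_pow_left_iff two_ne_zero).1 ?_)
    rw [ell_sq, ell_sq]
    exact tsum_comp_le_tsum_of_injective (ka_inj i) fun n => ‖v n‖ₑ ^ 2

lemma rsL_apply (i : Bool) (v : ELL2) (n : ℕ) : rsL i v n = v (ka i n) := rfl
lemma rsL_norm (i : Bool) : ‖rsL i‖ ≤ 1 := LinearMap.mkContinuous_norm_le _ zero_le_one _

lemma adj_apply (i : Bool) (v : ELL2) (n : ℕ) : (ContinuousLinearMap.adjoint (rsL i) v) n = inner ℂ (rsL i (ee n)) v := by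
  rw [← ContinuousLinearMap.adjoint_inner_right, ee, lp.inner_single_left]; simp

lemma adj_same (i : Bool) (v : ELL2) (n : ℕ) : (ContinuousLinearMap.adjoint (rsL i) v) (ka i n) = v n := by
  have : rsL i (ee (ka i n)) = ee n := by
    apply lp.ext; ext1 k
    rw [rsL_apply, ee_apply, ee_apply]; simp only [(ka_inj i).eq_iff]
  rw [adj_apply, this, ee, lp.inner_single_left]; simp

lemma adj_diff {i j : Bool} (h : i ≠ j) (v : ELL2) (n : ℕ) : (ContinuousLinearMap.adjoint (rsL j) v) (ka i n) = 0 := by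
  have : rsL j (ee (ka i n)) = 0 := by
    apply lp.ext; ext1 k
    rw [rsL_apply, ee_apply, if_neg (ka_ne h.symm _ _)]; rfl
  rw [adj_apply, this, inner_zero_left]

/-- composition with an operator on `ℓ₂` -/
def postL (a : ELL2 →L[ℂ] ELL2) : HD →ₗ[ℂ] HD where
  toFun F := ⟨fun z => a (F.1 z), a.differentiable.comp_differentiableOn F.2.1, fun z hz => by simp [F.2.2 z hz]⟩
  map_add' F G := Subtype.ext (funext fun z => map_add a _ _)
  map_smul' c F := Subtype.ext (funext fun z => map_smul a _ _)

lemma X_square (hp : 0 < p) (hp1 : p ≤ 1) : Nonempty (HX hp hp1 ≃L[ℂ] HX hp hp1 × HX hp hp1) := by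
  have key : ∀ a : ELL2 →L[ℂ] ELL2, ‖a‖ ≤ 1 → ∀ F : HD, (hpPN hp hp1).N (postL a F) ≤ (hpPN hp hp1).N F := fun a ha F => by
    refine iSup_mono fun r => lintegral_mono fun t => rpow_le_rpow ?_ hp.le
    have : ‖a (F.1 (circlePt r t))‖ ≤ ‖F.1 (circlePt r t)‖ := by simpa using a.le_of_opNorm_le ha (F.1 (circlePt r t))
    exact_mod_cast this
  refine PN.square _ (fun i => postL (rsL i)) (fun i => postL (ContinuousLinearMap.adjoint (rsL i)))
    (fun i => key _ (rsL_norm i)) (fun i => key _ (by rw [LinearIsometryEquiv.norm_map]; exact rsL_norm i))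
    (fun i j F => Subtype.ext (funext fun z => lp.ext (funext fun n => ?_)))
    fun F => Subtype.ext (funext fun z => lp.ext (funext fun n => ?_))
  · show (ContinuousLinearMap.adjoint (rsL j) (F.1 z)) (ka i n) = _
    split_ifs with h
    · subst h; exact adj_same i _ n
    · exact adj_diff h _ n
  · show (ContinuousLinearMap.adjoint (rsL true) (rsL true (F.1 z))) n + (ContinuousLinearMap.adjoint (rsL false) (rsL false (F.1 z))) n = F.1 z n
    obtain ⟨i, k, rfl⟩ := ka_sur n
    cases i
    · rw [adj_same, adj_diff (by simp), zero_add]; rfl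
    · rw [adj_same, adj_diff (by simp), add_zero]; rfl

theorem X_iso (hp : 0 < p) (hp1 : p ≤ 1) :
    Nonempty (HX hp hp1 ≃L[ℂ] ((dyW p hp hp1).comap fstDy).F) := by
  obtain ⟨T, S, h1⟩ := TS_exists hp hp1
  obtain ⟨T', S', h2⟩ := TS2_exists hp hp1
  obtain ⟨e1⟩ := F_square (dyW p hp hp1)
  obtain ⟨e2⟩ := X_square hp hp1
  have a := ContinuousLinearEquiv.equivOfRightInverse T S h1
  have b := ContinuousLinearEquiv.equivOfRightInverse S' T' h2
  have c := a.trans ((e2.prodCongr (.refl ℂ _)).trans ((ContinuousLinearEquiv.prodAssoc ℂ _ _ _).trans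
    ((ContinuousLinearEquiv.refl ℂ _).prodCongr a.symm)))
  have d := b.trans ((e1.prodCongr (.refl ℂ _)).trans ((ContinuousLinearEquiv.prodAssoc ℂ _ _ _).trans
    ((ContinuousLinearEquiv.refl ℂ _).prodCongr b.symm)))
  exact ⟨d.trans ((ContinuousLinearEquiv.prodComm ℂ _ _).trans c.symm)⟩

lemma clm_bound {p q : ℝ} {V W : Type*} [NormedAddCommGroup V] [Module ℂ V] [PNormed p V]
    [NormedAddCommGroup W] [Module ℂ W] [PNormed q W] (hpq : q = p) (T : V →L[ℂ] W) :
    ∃ C : ℝ≥0∞, C ≠ ∞ ∧ ∀ f, ‖T f‖ₑ ≤ C * ‖f‖ₑ := by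
  obtain ⟨δ, hδ, h⟩ := Metric.continuousAt_iff.1 (T.continuous.continuousAt (x := (0 : V))) 1 one_pos
  refine ⟨ofReal (2 / δ), by simp, fun f => ?_⟩
  rcases eq_or_ne f 0 with rfl | hf
  · simp
  have hf0 := norm_pos_iff.2 hf
  obtain ⟨c, -, hc⟩ := UBasis.exists_scal (pn_pos V) (s := δ / (2 * ‖f‖)) (by positivity)
  have h1 := @h (c • f) (by
    rw [dist_zero_right, pn_smul, hc]; field_simp; linarith)
  rw [map_smul, map_zero, dist_zero_right, pn_smul, hpq, hc] at h1
  rw [← ofReal_norm, ← ofReal_norm, ← ofReal_mul (by positivity)]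
  refine ofReal_le_ofReal ?_
  field_simp at h1 ⊢
  linarith

section
variable {hp : 0 < p} {hp1 : p ≤ 1}

lemma mem_iff {F : ℂ → ELL2} : memHpD p F ↔ Hol(F, 1) ∧ hpN p F < ∞ := by
  unfold memHpD hpN
  constructor
  · rintro ⟨hd, B, hB, h⟩
    exact ⟨hd, lt_of_le_of_lt (iSup_le fun r => h r.1 r.2.1 r.2.2) hB⟩
  · rintro ⟨hd, h⟩
    exact ⟨hd, _, h, fun r h0 h1 => le_iSup (fun r : 𝕀 => hpIntegral p F r.1) ⟨r, h0, h1⟩⟩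

lemma q_eq {F : ℂ → ELL2} (G : HX hp hp1) (h : ∀ z, ‖z‖ < 1 → F z = fn G z) : qHpD p F = ‖G‖ ^ (1 / p) := by
  have hn : hpN p F = ‖G‖ₑ := by rw [fn_enorm]; exact hpN_congr h
  have hf : ∀ r : 𝕀, hpIntegral p F r.1 ≠ ∞ := fun r =>
    ((le_iSup (fun r : 𝕀 => hpIntegral p F r.1) r).trans_lt (lt_of_eq_of_lt hn (by simp))).ne
  have hp' : 0 < 1 / p := by positivity
  unfold qHpD
  rw [← toReal_iSup fun r => rpow_ne_top_of_nonneg hp'.le (hf r)]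
  have := (orderIsoRpow (1 / p) hp').map_iSup fun r : 𝕀 => hpIntegral p F r.1
  simp only [orderIsoRpow_apply] at this
  rw [← this, ← toReal_rpow, ← toReal_enorm, ← hn]; rfl

lemma usum_iff {ι : Type*} {v : ι → ℂ → ELL2} {V : ι → HX hp hp1} {f : ℂ → ELL2} {f₁ : HX hp hp1}
    (hv : ∀ n z, ‖z‖ < 1 → v n z = fn (V n) z) (hf : ∀ z, ‖z‖ < 1 → f z = fn f₁ z) :
    UncondSum (qHpD p) v f ↔ HasSum V f₁ := by
  classical
  have hq : ∀ G : Finset ι, qHpD p ((∑ n ∈ G, v n) - f) = ‖(∑ n ∈ G, V n) - f₁‖ ^ (1 / p) := fun G => by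
    refine q_eq _ fun z hz => ?_
    rw [fn_sub, fn_sum, Pi.sub_apply, Pi.sub_apply, hf z hz, Finset.sum_apply, Finset.sum_apply]
    congr 1; exact sum_congr rfl fun n _ => hv n z hz
  unfold UncondSum
  simp_rw [hq]
  rw [HasSum, SummationFilter.unconditional_filter, Metric.tendsto_atTop]
  simp_rw [dist_eq_norm, one_div]
  constructor
  · intro h ε hε
    obtain ⟨F, hF⟩ := h (ε ^ p⁻¹) (by positivity)
    exact ⟨F, fun G hG => (Real.rpow_lt_rpow_iff (norm_nonneg _) hε.le (inv_pos.2 hp)).1 (hF G hG)⟩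
  · intro h ε hε
    obtain ⟨F, hF⟩ := h (ε ^ p) (by positivity)
    exact ⟨F, fun G hG => (Real.rpow_inv_lt_iff_of_pos (norm_nonneg _) hε.le hp).2 (hF G hG)⟩

lemma basis_of {ι : Type*} {X : ι → HX hp hp1} (h : UBasis X) :
    IsUncondBasis (memHpD p) (qHpD p) fun n => fn (X n) := by
  refine ⟨fun n => mem_iff.2 ⟨fn_hol _, by rw [← fn_enorm]; simp⟩, fun f hf => ?_⟩
  obtain ⟨h1, h2⟩ := mem_iff.1 hf
  have : ∀ a : ι → ℂ, UncondSum (qHpD p) (fun n => a n • fn (X n)) f ↔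
      HasSum (fun n => a n • X n) (mkX hp hp1 f h1 h2) := fun a =>
    usum_iff (fun n z _ => rfl) fun z hz => (fn_mkX f h1 h2 hz).symm
  simp_rw [this]
  exact h _

lemma of_basis (hp : 0 < p) (hp1 : p ≤ 1) {ι : Type*} {x : ι → ℂ → ELL2} (h : IsUncondBasis (memHpD p) (qHpD p) x) :
    ∃ X : ι → HX hp hp1, UBasis X ∧ ∀ n z, ‖z‖ < 1 → x n z = fn (X n) z := by
  have hm := fun n => mem_iff.1 (h.1 n)
  have hX : ∀ n z, ‖z‖ < 1 → x n z = fn (mkX hp hp1 (x n) (hm n).1 (hm n).2) z := fun n z hz =>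
    (fn_mkX _ _ _ hz).symm
  refine ⟨_, fun f => ?_, hX⟩
  have : ∀ a : ι → ℂ, UncondSum (qHpD p) (fun n => a n • x n) (fn f) ↔
      HasSum (fun n => a n • mkX hp hp1 (x n) (hm n).1 (hm n).2) f := fun a =>
    usum_iff (fun n z hz => by rw [fn_smul, Pi.smul_apply, Pi.smul_apply, hX n z hz]) fun z _ => rfl
  simp_rw [← this]
  exact h.2 _ (mem_iff.2 ⟨fn_hol _, by rw [← fn_enorm]; simp⟩)

lemma basis_exists (hp : 0 < p) (hp1 : p ≤ 1) : ∃ X : Dy × (ℕ × ℕ) → HX hp hp1, UBasis X ∧ ∀ n, ‖X n‖ = 1 := by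
  obtain ⟨Φ⟩ := X_iso hp hp1
  have hb := ((dyW p hp hp1).comap fstDy).ubasis_e.map Φ.symm
  choose c hc0 hc using fun n => UBasis.exists_scal hp (inv_pos.2 (norm_pos_iff.2 (hb.ne_zero n)))
  refine ⟨fun n => c n • Φ.symm (((dyW p hp hp1).comap fstDy).e n), fun f => ?_, fun n => ?_⟩
  rotate_left
  · rw [pn_smul]
    exact (congrArg (· * _) (hc n)).trans (inv_mul_cancel₀ (norm_pos_iff.2 (hb.ne_zero n)).ne')
  obtain ⟨a, ha, hu⟩ := hb f
  refine ⟨fun n => a n * (c n)⁻¹, ?_, fun a' ha' => ?_⟩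
  · refine ha.congr_fun fun n => ?_
    simp only [smul_smul]
    rw [inv_mul_cancel_right₀ (hc0 n)]
  · have := hu (fun n => a' n * c n) (by simpa only [smul_smul] using ha')
    ext1 n
    rw [← this, mul_inv_cancel_right₀ (hc0 n)]

lemma basis_std (hp : 0 < p) (hp1 : p < 1) {ι : Type} [Countable ι] {X : ι → HX hp hp1.le} (hX : UBasis X) (h1 : ∀ n, ‖X n‖ = 1) :
    ∃ h : Dy × (ℕ × ℕ) ≃ ι, ∃ C : ℝ≥0∞, C ≠ ∞ ∧ ∀ (c : Dy × (ℕ × ℕ) → ℂ) (G : Finset (Dy × (ℕ × ℕ))),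
      ‖∑ j ∈ G, c j • X (h j)‖ₑ ≤ C * (dyW p hp hp1.le).Pf Prod.fst c G ∧
      (dyW p hp hp1.le).Pf Prod.fst c G ≤ C * ‖∑ j ∈ G, c j • X (h j)‖ₑ := by
  classical
  obtain ⟨Φ⟩ := X_iso hp hp1.le
  obtain ⟨A, hA, hΦ⟩ := clm_bound rfl Φ.toContinuousLinearMap
  obtain ⟨B, hB, hΨ⟩ := clm_bound rfl Φ.symm.toContinuousLinearMap
  have e1 : ∀ n, ‖X n‖ₑ = 1 := fun n => by rw [← ofReal_norm, h1]; simp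
  have hΨ' : ∀ f, ‖f‖ₑ ≤ B * ‖Φ f‖ₑ := fun f => by simpa using hΨ (Φ f)
  obtain ⟨h, C, hC, H⟩ := WS.lemmaB (dyW p hp hp1.le) (dyW_emb p hp hp1) (fun n => Φ (X n)) (hX.map Φ)
    (c1 := B⁻¹) (C1 := A) (by simpa using hB) hA
    (fun n => by
      have := hΨ' (X n)
      rw [e1] at this
      have h0 : B ≠ 0 := fun h => by simp [h] at this
      simpa using (ENNReal.inv_mul_le_iff h0 hB).2 this)
    (fun n => by simpa [e1] using hΦ (X n))
  refine ⟨h, B * C + C * A, by finiteness, fun c G => ?_⟩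
  have h2 := H c G
  simp_rw [← map_smul, ← map_sum] at h2
  constructor
  · refine (hΨ' _).trans ((mul_le_mul_right h2.1 B).trans ?_)
    rw [← mul_assoc]; gcongr; exact le_self_add
  · refine h2.2.trans ((mul_le_mul_right (hΦ _) C).trans ?_)
    rw [← mul_assoc]; gcongr; exact le_add_self
end

lemma q_sum {hp : 0 < p} {hp1 : p ≤ 1} {ι κ : Type*} {y : κ → ℂ → ELL2} {Y : κ → HX hp hp1}
    (hY : ∀ n z, ‖z‖ < 1 → y n z = fn (Y n) z) (a : ι → ℂ) (π : ι → κ) (G : Finset ι) :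
    qHpD p (∑ n ∈ G, a n • y (π n)) = ‖∑ n ∈ G, a n • Y (π n)‖ ^ (1 / p) := by
  refine q_eq _ fun z hz => ?_
  rw [fn_sum, Finset.sum_apply, Finset.sum_apply]
  refine sum_congr rfl fun n _ => ?_
  rw [fn_smul, Pi.smul_apply, Pi.smul_apply, hY _ z hz]

lemma rpow_cmp {V W : Type*} [NormedAddCommGroup V] [NormedAddCommGroup W] {s : ℝ} (hs : 0 ≤ s) {D : ℝ≥0∞} (hD : D ≠ ∞)
    {f : V} {g : W} (h : ‖f‖ₑ ≤ D * ‖g‖ₑ) : ‖f‖ ^ s ≤ D.toReal ^ s * ‖g‖ ^ s := by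
  rw [← Real.mul_rpow toReal_nonneg (norm_nonneg _)]
  refine Real.rpow_le_rpow (norm_nonneg _) ?_ hs
  have := toReal_mono (by finiteness) h
  simpa using this

/-- For `0 < p < 1`, `H_p(𝔻, ℓ₂)` has a unique unconditional basis. -/
theorem HpD_ell2_unique_unconditional_basis (p : ℝ) (hp : 0 < p) (hp1 : p < 1) :
    (∃ (ι : Type) (_ : Countable ι) (x : ι → (ℂ → ELL2)),
      IsUncondBasis (memHpD p) (qHpD p) x ∧ Normalized (qHpD p) x) ∧
    (∀ (ι κ : Type), Countable ι → Countable κ →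
      ∀ (x : ι → (ℂ → ELL2)) (y : κ → (ℂ → ELL2)),
        IsUncondBasis (memHpD p) (qHpD p) x → Normalized (qHpD p) x →
        IsUncondBasis (memHpD p) (qHpD p) y → Normalized (qHpD p) y →
        PermutativelyEquivalent (qHpD p) (qHpD p) x y) := by
  constructor
  · obtain ⟨X, hX, h1⟩ := basis_exists hp hp1.le
    refine ⟨Dy × (ℕ × ℕ), inferInstance, _, basis_of hX, fun n => ?_⟩
    rw [q_eq (X n) fun _ _ => rfl, h1, Real.one_rpow]
  intro ι κ _ _ x y hx nx hy ny
  have nrm : ∀ {ι : Type} {x : ι → ℂ → ELL2} (_ : Normalized (qHpD p) x) (X : ι → HX hp hp1.le)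
      (_ : ∀ n z, ‖z‖ < 1 → x n z = fn (X n) z) (n : ι), ‖X n‖ = 1 := fun nx X h n => by
    have := nx n
    rw [q_eq (X n) (h n)] at this
    exact (Real.rpow_left_inj (norm_nonneg _) zero_le_one (one_div_pos.2 hp).ne').1 (this.trans (Real.one_rpow _).symm)
  obtain ⟨X, hX, hxX⟩ := of_basis hp hp1.le hx
  obtain ⟨Y, hY, hyY⟩ := of_basis hp hp1.le hy
  obtain ⟨h, C, hC, H⟩ := basis_std hp hp1 hX (nrm nx X hxX)
  obtain ⟨h', C', hC', H'⟩ := basis_std hp hp1 hY (nrm ny Y hyY)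
  have hD : C * C' + 1 ≠ ∞ := by finiteness
  have hD0 : 0 < (C * C' + 1).toReal := toReal_pos (by simp) hD
  have hs : 0 ≤ 1 / p := by positivity
  refine ⟨h.symm.trans h', (C * C' + 1).toReal ^ (1 / p), by positivity, fun a => ?_⟩
  rw [q_sum hyY, show qHpD p (∑ n ∈ a.support, a n • x n) = _ from q_sum hxX a id _]
  have e1 : ∑ n ∈ a.support, a n • X (id n) =
      ∑ j ∈ a.support.map h.symm.toEmbedding, a (h j) • X (h j) := by simp
  have e2 : ∑ n ∈ a.support, a n • Y (h.symm.trans h' n) =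
      ∑ j ∈ a.support.map h.symm.toEmbedding, a (h j) • Y (h' j) := by simp
  rw [e1, e2]
  have k1 := H (fun j => a (h j)) (a.support.map h.symm.toEmbedding)
  have k2 := H' (fun j => a (h j)) (a.support.map h.symm.toEmbedding)
  constructor
  · rw [inv_mul_le_iff₀ (by positivity)]
    refine rpow_cmp hs hD (k1.1.trans ((mul_le_mul_right k2.2 C).trans ?_))
    rw [← mul_assoc]; gcongr; exact le_self_add
  · refine rpow_cmp hs hD (k2.1.trans ((mul_le_mul_right k1.2 C').trans ?_))
    rw [← mul_assoc, mul_comm C']; gcongr; exact le_self_add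

end
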